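/- Let L be an algebraically closed field, let 1 ≤ k ≤ n, and let λ^1, …, λ^m be partitions contained in a k×(n−k) rectangle with Σ_j |λ^j| = k(n−k). Let N be the iterated Littlewood–Richardson number N = Σ c^{ν^{(2)}}_{λ^1,λ^2} · c^{ν^{(3)}}_{ν^{(2)},λ^3} ⋯ c^{ρ}_{ν^{(m−1)},λ^m}, the sum running over all sequences ν^{(2)}, …, ν^{(m−1)} of partitions contained in the k×(n−k) rectangle, where ρ = ((n−k), …, (n−k)) is the full k×(n−k) rectangle. Then there exist complete flags F^1_•, …, F^m_• of L^n such that the set { V : V a k-dimensional subspace of L^n with dim(V ∩ F^j_{n−k+i−λ^j_i}) ≥ i for all i = 1,…,k and j = 1,…,m } is finite and has exactly N elements. -/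

import Mathlib

/-!  All Schubert problems on Grassmannians are enumerative over algebraically
closed fields (of arbitrary characteristic). -/

open scoped Classical
open Module

/-- The cell `(i, j)` lies in the skew Young diagram `ν/λ`. -/
def InSkew (lam nu : ℕ → ℕ) (x : ℕ × ℕ) : Prop :=
  lam x.1 ≤ x.2 ∧ x.2 < nu x.1

/-- Reading order: rows top to bottom, each row right to left. -/
def ReadBefore (r c : ℕ) (x : ℕ × ℕ) : Prop :=
  x.1 < r ∨ (x.1 = r ∧ c ≤ x.2)

/-- `T` is a Littlewood–Richardson skew tableau of shape `ν/λ` and content `μ`. -/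
def IsLRSkewTableau (lam mu nu : ℕ → ℕ) (T : ℕ × ℕ → ℕ) : Prop :=
  (∀ x : ℕ × ℕ, 0 < T x ↔ InSkew lam nu x) ∧
  (∀ i j j', lam i ≤ j → j ≤ j' → j' < nu i → T (i, j) ≤ T (i, j')) ∧
  (∀ i i' j, i < i' → InSkew lam nu (i, j) → InSkew lam nu (i', j) →
    T (i, j) < T (i', j)) ∧
  (∀ m, 0 < m →
    Nat.card {x : ℕ × ℕ // InSkew lam nu x ∧ T x = m} = mu (m - 1)) ∧
  (∀ m, 0 < m → ∀ r c : ℕ,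
    Nat.card {x : ℕ × ℕ // ReadBefore r c x ∧ InSkew lam nu x ∧ T x = m + 1} ≤
      Nat.card {x : ℕ × ℕ // ReadBefore r c x ∧ InSkew lam nu x ∧ T x = m})

/-- `lam` is a partition contained in a `k × (n-k)` rectangle. -/
def IsRectPartition (n k : ℕ) (lam : ℕ → ℕ) : Prop :=
  Antitone lam ∧ (∀ i, lam i ≤ n - k) ∧ (∀ i, k ≤ i → lam i = 0)

/-- The full `k × (n-k)` rectangle `ρ = ((n-k), …, (n-k))`. -/
def rectFull (n k : ℕ) : ℕ → ℕ := fun i => if i < k then n - k else 0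

/-- The iterated Littlewood–Richardson number
`N = Σ c^{ν⁽²⁾}_{λ¹,λ²} · c^{ν⁽³⁾}_{ν⁽²⁾,λ³} ⋯ c^{ρ}_{ν⁽ᵐ⁻¹⁾,λᵐ}`,
the sum running over all sequences `ν⁽²⁾, …, ν⁽ᵐ⁻¹⁾` of partitions contained in
the `k × (n-k)` rectangle and `ρ` the full rectangle.  It is expressed as the
number of pairs `(c, T)` where `c` is the chain
`λ¹ = ν⁽¹⁾ ⊆ ν⁽²⁾ ⊆ … ⊆ ν⁽ᵐ⁾ = ρ` (recorded as `c (j-1) = ν⁽ʲ⁾`, constant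
beyond index `m-1`) and `T j` is a Littlewood–Richardson skew tableau of shape
`ν⁽ʲ⁺¹⁾/ν⁽ʲ⁾` and content `λ^{j+1}` for `1 ≤ j ≤ m-1` (with all unused values
of `T` pinned to the zero filling, so that `Nat.card` counts exactly the
iterated sum of Littlewood–Richardson coefficients). -/
noncomputable def iteratedLRNumber (n k m : ℕ) (lams : ℕ → ℕ → ℕ) : ℕ :=
  Nat.card { p : (ℕ → ℕ → ℕ) × (ℕ → ℕ × ℕ → ℕ) //
    p.1 0 = lams 0 ∧
    (∀ j, m - 1 ≤ j → p.1 j = rectFull n k) ∧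
    (∀ j, IsRectPartition n k (p.1 j)) ∧
    p.2 0 = (fun _ => 0) ∧
    (∀ j, m ≤ j → p.2 j = fun _ => 0) ∧
    (∀ j, 1 ≤ j → j ≤ m - 1 →
      (∀ i, p.1 (j - 1) i ≤ p.1 j i) ∧
      IsLRSkewTableau (p.1 (j - 1)) (lams j) (p.1 j) (p.2 j)) }

set_option linter.unusedSectionVars false

namespace SchubertEnum

section Rational

variable {K₀ Ω : Type*} [Field K₀] [Field Ω] [Algebra K₀ Ω] {ι κ : Type*} [Fintype ι] [Fintype κ]

/-- The transcendence degree over `K₀` of an intermediate field. -/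
noncomputable def tr (F : IntermediateField K₀ Ω) : ℕ∞ :=
  (AlgebraicIndependent.matroid K₀ Ω).eRk (F : Set Ω)

theorem coe_adjoin_subset_closure (s : Set Ω) :
    (IntermediateField.adjoin K₀ s : Set Ω) ⊆
      (AlgebraicIndependent.matroid K₀ Ω).closure s := by
  rw [AlgebraicIndependent.matroid_closure_eq]
  intro x hx
  rw [SetLike.mem_coe, Subalgebra.mem_algebraicClosure]
  have h1 : IsAlgebraic (IntermediateField.adjoin K₀ s) x :=
    isAlgebraic_algebraMap (A := Ω) (⟨x, hx⟩ : IntermediateField.adjoin K₀ s)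
  rw [IntermediateField.isAlgebraic_adjoin_iff] at h1
  exact h1

theorem tr_adjoin (s : Set Ω) : tr (IntermediateField.adjoin K₀ s) =
    (AlgebraicIndependent.matroid K₀ Ω).eRk s := by
  apply le_antisymm
  · rw [← Matroid.eRk_closure_eq _ s]
    exact Matroid.eRk_mono _ (coe_adjoin_subset_closure s)
  · exact Matroid.eRk_mono _ (IntermediateField.subset_adjoin K₀ s)

theorem tr_sup_le (F F' : IntermediateField K₀ Ω) :
    tr (F ⊓ F') + tr (F ⊔ F') ≤ tr F + tr F' := by
  have h : F ⊔ F' = IntermediateField.adjoin K₀ ((F : Set Ω) ∪ F') := by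
    rw [IntermediateField.adjoin_union]; simp
  rw [h, tr_adjoin]
  exact Matroid.eRk_inter_add_eRk_union_le _ _ _

theorem exists_adjoin_finset (F : IntermediateField K₀ Ω) (Z : Finset Ω) :
    ∃ F' ≥ F, ↑Z ⊆ (F' : Set Ω) ∧ tr F' ≤ tr F + Z.card := by
  refine ⟨IntermediateField.adjoin K₀ ((F : Set Ω) ∪ Z), ?_, ?_, ?_⟩
  · intro x hx
    exact IntermediateField.subset_adjoin K₀ _ (Or.inl hx)
  · intro x hx
    exact IntermediateField.subset_adjoin K₀ _ (Or.inr hx)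
  · rw [tr_adjoin]
    refine (Matroid.eRk_union_le_eRk_add_encard _ _ _).trans ?_
    simp [tr]

theorem exists_adjoin_range {α : Type*} [Fintype α] (F : IntermediateField K₀ Ω) (z : α → Ω) :
    ∃ F' ≥ F, (∀ a, z a ∈ F') ∧ tr F' ≤ tr F + Fintype.card α := by
  obtain ⟨F', h1, h2, h3⟩ := exists_adjoin_finset F (Finset.univ.image z)
  refine ⟨F', h1, fun a => h2 (by simp), h3.trans ?_⟩
  gcongr
  exact Finset.card_image_le

theorem card_le_tr {α : Type*} [Fintype α] {x : α → Ω} (hx : AlgebraicIndependent K₀ x)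
    {F : IntermediateField K₀ Ω} (h : ∀ a, x a ∈ F) : (Fintype.card α : ℕ∞) ≤ tr F := by
  have h1 : (AlgebraicIndependent.matroid K₀ Ω).Indep (Set.range x) := by
    rw [AlgebraicIndependent.matroid_indep_iff]
    exact hx.coe_range
  have h2 := h1.encard_le_eRk_of_subset (X := (F : Set Ω)) (by rintro _ ⟨a, rfl⟩; exact h a)
  have : (Set.range x).encard = Fintype.card α := by
    rw [← Set.image_univ, hx.injective.encard_image, Set.encard_univ, ENat.card_eq_coe_fintype_card]
  rwa [this] at h2

theorem tr_bot : tr (⊥ : IntermediateField K₀ Ω) = 0 := by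
  rw [← IntermediateField.adjoin_empty, tr_adjoin]; simp

/-- A subspace of `Ω^ι` is rational over a subfield `F`. -/
def IsRational (F : IntermediateField K₀ Ω) (U : Submodule Ω (ι → Ω)) : Prop :=
  ∀ θ : Ω →ₗ[F] Ω, ∀ x ∈ U, (fun i => θ (x i)) ∈ U

theorem IsRational.mono {F F' : IntermediateField K₀ Ω} (h : F ≤ F') {U : Submodule Ω (ι → Ω)}
    (hU : IsRational F U) : IsRational F' U := by
  intro θ x hx
  let θ' : Ω →ₗ[F] Ω :=
    { toFun := θ
      map_add' := θ.map_add
      map_smul' := fun c y => by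
        have := θ.map_smul (⟨c, h c.2⟩ : F') y
        simpa [IntermediateField.smul_def] using this }
  exact hU θ' x hx

theorem apply_mul_left {F : IntermediateField K₀ Ω} (θ : Ω →ₗ[F] Ω) {c : Ω} (hc : c ∈ F) (y : Ω) :
    θ (c * y) = c * θ y := by
  have := θ.map_smul (⟨c, hc⟩ : F) y
  simpa [IntermediateField.smul_def] using this

theorem apply_mul_right {F : IntermediateField K₀ Ω} (θ : Ω →ₗ[F] Ω) {c : Ω} (hc : c ∈ F)
    (y : Ω) : θ (y * c) = θ y * c := by
  rw [mul_comm, apply_mul_left θ hc, mul_comm]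

theorem isRational_top (F : IntermediateField K₀ Ω) :
    IsRational F (⊤ : Submodule Ω (ι → Ω)) := fun _ _ _ => trivial

theorem IsRational.inf {F : IntermediateField K₀ Ω} {U W : Submodule Ω (ι → Ω)}
    (hU : IsRational F U) (hW : IsRational F W) : IsRational F (U ⊓ W) :=
  fun θ x hx => ⟨hU θ x hx.1, hW θ x hx.2⟩

theorem IsRational.sup {F : IntermediateField K₀ Ω} {U W : Submodule Ω (ι → Ω)}
    (hU : IsRational F U) (hW : IsRational F W) : IsRational F (U ⊔ W) := by
  intro θ x hx
  obtain ⟨u, hu, w, hw, rfl⟩ := Submodule.mem_sup.1 hx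
  refine Submodule.mem_sup.2 ⟨_, hU θ u hu, _, hW θ w hw, ?_⟩
  ext i; simp

theorem isRational_span {F : IntermediateField K₀ Ω} {α : Type*} {b : α → ι → Ω}
    (hb : ∀ a i, b a i ∈ F) : IsRational F (Submodule.span Ω (Set.range b)) := by
  intro θ x hx
  induction hx using Submodule.span_induction with
  | mem y hy =>
    obtain ⟨a, rfl⟩ := hy
    have : (fun i => θ (b a i)) = θ 1 • b a := by
      ext i
      have := apply_mul_right θ (hb a i) 1
      simpa using this
    rw [this]
    exact Submodule.smul_mem _ _ (Submodule.subset_span ⟨a, rfl⟩)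
  | zero => 
    have : (fun i => θ ((0 : ι → Ω) i)) = 0 := by ext; simp
    rw [this]; exact zero_mem _
  | add y z _ _ h1 h2 =>
    have : (fun i => θ ((y + z) i)) = (fun i => θ (y i)) + fun i => θ (z i) := by ext; simp
    rw [this]; exact add_mem h1 h2
  | smul c y hy h1 =>
    clear h1
    induction hy using Submodule.span_induction generalizing c with
    | mem y hy =>
      obtain ⟨a, rfl⟩ := hy
      have : (fun i => θ ((c • b a) i)) = θ c • b a := by
        ext i
        simpa using apply_mul_right θ (hb a i) c
      rw [this]
      exact Submodule.smul_mem _ _ (Submodule.subset_span ⟨a, rfl⟩)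
    | zero => 
      have : (fun i => θ ((c • (0 : ι → Ω)) i)) = 0 := by ext; simp
      rw [this]; exact zero_mem _
    | add y z _ _ h1 h2 =>
      have : (fun i => θ ((c • (y + z)) i)) =
        (fun i => θ ((c • y) i)) + fun i => θ ((c • z) i) := by ext; simp [mul_add]
      rw [this]; exact add_mem (h1 c) (h2 c)
    | smul d y _ h1 =>
      rw [smul_smul]; exact h1 _

theorem apply_mulVec {F : IntermediateField K₀ Ω} {M : Matrix κ ι Ω} (hM : ∀ i j, M i j ∈ F)
    (θ : Ω →ₗ[F] Ω) (x : ι → Ω) :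
    (fun i => θ (M.mulVec x i)) = M.mulVec (fun j => θ (x j)) := by
  ext i
  simp only [Matrix.mulVec, dotProduct, map_sum]
  exact Finset.sum_congr rfl fun j _ => apply_mul_left θ (hM i j) _

theorem IsRational.map {F : IntermediateField K₀ Ω} {U : Submodule Ω (ι → Ω)}
    (hU : IsRational F U) {M : Matrix κ ι Ω} (hM : ∀ i j, M i j ∈ F) :
    IsRational F (U.map M.mulVecLin) := by
  rintro θ _ ⟨x, hx, rfl⟩
  exact ⟨_, hU θ x hx, by simp [← apply_mulVec hM]⟩

/-- Vectors vanishing on a set of coordinates. -/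
def vanish (Ω : Type*) [Field Ω] {ι : Type*} (P : Finset ι) : Submodule Ω (ι → Ω) where
  carrier := {x | ∀ i ∈ P, x i = 0}
  add_mem' := fun ha hb i hi => by simp [ha i hi, hb i hi]
  zero_mem' := fun i _ => rfl
  smul_mem' := fun c x hx i hi => by simp [hx i hi]

theorem mem_vanish {P : Finset ι} {x : ι → Ω} : x ∈ vanish Ω P ↔ ∀ i ∈ P, x i = 0 := Iff.rfl

theorem isRational_vanish (F : IntermediateField K₀ Ω) (P : Finset ι) :
    IsRational F (vanish Ω P) := by
  intro θ x hx i hi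
  simp [hx i hi]

/-- A set of pivots for `U` together with the reduced echelon basis. -/
structure IsEchelon (U : Submodule Ω (ι → Ω)) (P : Finset ι) (b : ι → ι → Ω) : Prop where
  mem : ∀ p ∈ P, b p ∈ U
  delta : ∀ p ∈ P, ∀ q ∈ P, b p q = if p = q then 1 else 0
  disj : ∀ x ∈ U, (∀ i ∈ P, x i = 0) → x = 0

theorem exists_isEchelon (U : Submodule Ω (ι → Ω)) (Q : Finset ι)
    (hQ : ∀ x ∈ U, (∀ i ∈ Q, x i = 0) → x = 0) : ∃ P ⊆ Q, ∃ b, IsEchelon U P b := by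
  obtain ⟨P, hPQ, hP⟩ : ∃ P ≤ Q, Minimal (fun P : Finset ι => ∀ x ∈ U, (∀ i ∈ P, x i = 0) → x = 0) P :=
    exists_minimal_le_of_wellFoundedLT _ Q hQ
  have hb : ∀ p, ∃ y : ι → Ω, p ∈ P → y ∈ U ∧ ∀ q ∈ P, y q = if p = q then 1 else 0 := by
    intro p
    by_cases hp : p ∈ P
    · have h1 : ¬ ∀ x ∈ U, (∀ i ∈ P.erase p, x i = 0) → x = 0 := by
        intro h
        have := hP.2 h (Finset.erase_subset _ _) hp
        simp at this
      push Not at h1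
      obtain ⟨x, hx, hx0, hne⟩ := h1
      have hxp : x p ≠ 0 := by
        intro h
        apply hne
        apply hP.1 x hx
        intro i hi
        by_cases hip : i = p
        · rw [hip, h]
        · exact hx0 i (Finset.mem_erase.2 ⟨hip, hi⟩)
      refine ⟨(x p)⁻¹ • x, fun _ => ⟨U.smul_mem _ hx, fun q hq => ?_⟩⟩
      by_cases hpq : p = q
      · subst hpq; simp [hxp]
      · simp [hpq, hx0 q (Finset.mem_erase.2 ⟨fun h => hpq h.symm, hq⟩)]
    · exact ⟨0, fun h => absurd h hp⟩
  choose b hb using hb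
  exact ⟨P, hPQ, b, fun p hp => (hb p hp).1, fun p hp q hq => (hb p hp).2 q hq, hP.1⟩

namespace IsEchelon

variable {U : Submodule Ω (ι → Ω)} {P : Finset ι} {b : ι → ι → Ω}

theorem sum_eq (h : IsEchelon U P b) {x : ι → Ω} (hx : x ∈ U) : ∑ p ∈ P, x p • b p = x := by
  have h1 : x - ∑ p ∈ P, x p • b p ∈ U :=
    U.sub_mem hx (U.sum_mem fun p hp => U.smul_mem _ (h.mem p hp))
  have h2 := h.disj _ h1 fun q hq => by
    simp only [Pi.sub_apply, Finset.sum_apply, Pi.smul_apply, smul_eq_mul]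
    rw [Finset.sum_eq_single q]
    · simp [h.delta q hq q hq]
    · intro p hp hpq; simp [h.delta p hp q hq, hpq]
    · intro h'; exact absurd hq h'
  exact (sub_eq_zero.1 h2).symm

theorem span_eq (h : IsEchelon U P b) :
    Submodule.span Ω (Set.range fun p : P => b p) = U := by
  apply le_antisymm
  · rw [Submodule.span_le]
    rintro _ ⟨p, rfl⟩
    exact h.mem _ p.2
  · intro x hx
    rw [← h.sum_eq hx]
    exact Submodule.sum_mem _ fun p hp => Submodule.smul_mem _ _
      (Submodule.subset_span ⟨⟨p, hp⟩, rfl⟩)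

theorem finrank_eq (h : IsEchelon U P b) : finrank Ω U = P.card := by
  have hli : LinearIndependent Ω (fun p : P => b p) := by
    rw [Fintype.linearIndependent_iff]
    intro g hg q
    have := congrFun hg q
    simp only [Finset.sum_apply, Pi.smul_apply, smul_eq_mul, Pi.zero_apply] at this
    rw [Finset.sum_eq_single q] at this
    · simpa [h.delta q q.2 q q.2] using this
    · intro p _ hpq
      simp [h.delta p p.2 q q.2, Subtype.coe_injective.ne hpq]
    · simp
  rw [← h.span_eq, finrank_span_eq_card hli]; simp

theorem mem_field (h : IsEchelon U P b) {F : IntermediateField K₀ Ω} (hU : IsRational F U) :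
    ∀ p ∈ P, ∀ i, b p i ∈ F := by
  intro p hp i
  by_contra hi
  have key : ∀ θ : Ω →ₗ[F] Ω, θ 1 = 1 → θ (b p i) = b p i := by
    intro θ h1
    have hm := hU θ _ (h.mem p hp)
    have h2 := h.disj _ (U.sub_mem hm (h.mem p hp)) fun q hq => by
      simp only [Pi.sub_apply, h.delta p hp q hq]
      split_ifs <;> simp [h1]
    have := congrFun h2 i
    simpa [sub_eq_zero] using this
  have h1 : b p i ∉ Submodule.span F {(1 : Ω)} := by
    rw [Submodule.mem_span_singleton]
    rintro ⟨a, ha⟩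
    apply hi
    rw [← ha, IntermediateField.smul_def]
    simp
  obtain ⟨g, hg, hg1⟩ := Submodule.exists_le_ker_of_notMem h1
  have h2 : g 1 = 0 := hg1 (Submodule.mem_span_singleton_self _)
  have := key (LinearMap.id + (Algebra.linearMap F Ω).comp g) (by simp [h2])
  simp at this
  exact hg this

end IsEchelon

/-- `F'` is obtained from `F` by adjoining elements of total transcendence degree at most `c`. -/
def Cost (F F' : IntermediateField K₀ Ω) (c : ℕ) : Prop :=
  F ≤ F' ∧ tr F' ≤ tr F + c

theorem Cost.refl (F : IntermediateField K₀ Ω) : Cost F F 0 := ⟨le_rfl, by simp⟩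

theorem Cost.trans {F F' F'' : IntermediateField K₀ Ω} {c d : ℕ} (h : Cost F F' c)
    (h' : Cost F' F'' d) : Cost F F'' (c + d) :=
  ⟨h.1.trans h'.1, h'.2.trans (by
    refine (add_le_add_left h.2 _).trans ?_
    rw [add_assoc]; push_cast; rfl)⟩

theorem Cost.mono {F F' : IntermediateField K₀ Ω} {c d : ℕ} (h : Cost F F' c) (hcd : c ≤ d) :
    Cost F F' d :=
  ⟨h.1, h.2.trans (by gcongr)⟩

theorem exists_cost_range {α : Type*} [Fintype α] (F : IntermediateField K₀ Ω) (z : α → Ω) :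
    ∃ F', Cost F F' (Fintype.card α) ∧ ∀ a, z a ∈ F' := by
  obtain ⟨F', h1, h2, h3⟩ := exists_adjoin_range F z
  exact ⟨F', ⟨h1, h3⟩, h2⟩

theorem exists_echelon (U : Submodule Ω (ι → Ω)) : ∃ P b, IsEchelon U P b := by
  obtain ⟨P, -, b, h⟩ := exists_isEchelon U Finset.univ fun x _ h => funext fun i => h i (by simp)
  exact ⟨P, b, h⟩

/-- Entries of a vector of a rational subspace. -/
theorem exists_cost_mem {F : IntermediateField K₀ Ω} {U : Submodule Ω (ι → Ω)}
    (hU : IsRational F U) {x : ι → Ω} (hx : x ∈ U) :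
    ∃ F', Cost F F' (finrank Ω U) ∧ ∀ i, x i ∈ F' := by
  obtain ⟨P, b, h⟩ := exists_echelon U
  obtain ⟨F', hF, hz⟩ := exists_cost_range F (fun p : P => x p)
  refine ⟨F', by simpa [h.finrank_eq] using hF, fun i => ?_⟩
  have h1 := congrFun (h.sum_eq hx) i
  rw [← h1]
  simp only [Finset.sum_apply, Pi.smul_apply, smul_eq_mul]
  exact sum_mem fun p hp => mul_mem (hz ⟨p, hp⟩) (hF.1 (h.mem_field hU p hp i))

theorem exists_cost_sub {F : IntermediateField K₀ Ω} {U U' : Submodule Ω (ι → Ω)}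
    (hU : IsRational F U) (hle : U' ≤ U) :
    ∃ F', Cost F F' (finrank Ω U' * (finrank Ω U - finrank Ω U')) ∧ IsRational F' U' := by
  obtain ⟨P, b, h⟩ := exists_echelon U
  obtain ⟨P', hP', b', h'⟩ := exists_isEchelon U' P fun x hx => h.disj x (hle hx)
  obtain ⟨F', hF, hz⟩ := exists_cost_range F (fun a : P' × (P \ P' : Finset ι) => b' a.1 a.2)
  refine ⟨F', ?_, ?_⟩
  · rw [h.finrank_eq, h'.finrank_eq, ← Finset.card_sdiff_of_subset hP']
    rwa [Fintype.card_prod, Fintype.card_coe, Fintype.card_coe] at hF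
  · rw [← h'.span_eq]
    refine isRational_span fun p i => ?_
    have h1 := congrFun (h.sum_eq (hle (h'.mem p p.2))) i
    rw [← h1]
    simp only [Finset.sum_apply, Pi.smul_apply, smul_eq_mul]
    refine sum_mem fun q hq => mul_mem ?_ (hF.1 (h.mem_field hU q hq i))
    by_cases hq' : q ∈ P'
    · rw [h'.delta p p.2 q hq']
      split_ifs
      · exact one_mem _
      · exact zero_mem _
    · exact hz (p, ⟨q, Finset.mem_sdiff.2 ⟨hq, hq'⟩⟩)

theorem IsEchelon.exists_decomp {U : Submodule Ω (ι → Ω)} {P : Finset ι} {b : ι → ι → Ω}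
    (h : IsEchelon U P b) (x : ι → Ω) : ∃ u ∈ U, x - u ∈ vanish Ω P := by
  refine ⟨∑ p ∈ P, x p • b p, U.sum_mem fun p hp => U.smul_mem _ (h.mem p hp), fun q hq => ?_⟩
  simp only [Pi.sub_apply, Finset.sum_apply, Pi.smul_apply, smul_eq_mul]
  rw [Finset.sum_eq_single q]
  · simp [h.delta q hq q hq]
  · intro p hp hpq; simp [h.delta p hp q hq, hpq]
  · intro h'; exact absurd hq h'

theorem IsEchelon.sup_inf {U W : Submodule Ω (ι → Ω)} {P : Finset ι} {b : ι → ι → Ω}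
    (h : IsEchelon U P b) (hle : U ≤ W) : U ⊔ (W ⊓ vanish Ω P) = W := by
  apply le_antisymm (sup_le hle inf_le_left)
  intro x hx
  obtain ⟨u, hu, hv⟩ := h.exists_decomp x
  exact Submodule.mem_sup.2 ⟨u, hu, x - u, ⟨W.sub_mem hx (hle hu), hv⟩, by simp⟩

theorem IsEchelon.finrank_inf {U W : Submodule Ω (ι → Ω)} {P : Finset ι} {b : ι → ι → Ω}
    (h : IsEchelon U P b) (hle : U ≤ W) :
    finrank Ω U + finrank Ω ↥(W ⊓ vanish Ω P) = finrank Ω W := by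
  have h1 : U ⊓ (W ⊓ vanish Ω P) = ⊥ := by
    rw [eq_bot_iff]
    rintro x ⟨hx, -, hv⟩
    exact h.disj x hx hv
  have := Submodule.finrank_sup_add_finrank_inf_eq U (W ⊓ vanish Ω P)
  rw [h.sup_inf hle, h1, finrank_bot] at this
  omega

/-- Cost of an intermediate subspace. -/
theorem exists_cost_between {F : IntermediateField K₀ Ω} {U₀ U U' : Submodule Ω (ι → Ω)}
    (hU₀ : IsRational F U₀) (hU : IsRational F U) (hle₀ : U₀ ≤ U') (hle : U' ≤ U) :
    ∃ F', Cost F F' ((finrank Ω U' - finrank Ω U₀) * (finrank Ω U - finrank Ω U')) ∧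
      IsRational F' U' := by
  obtain ⟨P, b, h⟩ := exists_echelon U₀
  obtain ⟨F', hF, hr⟩ := exists_cost_sub (hU.inf (isRational_vanish F P))
    (inf_le_inf_right (vanish Ω P) hle)
  refine ⟨F', ?_, ?_⟩
  · have h1 := h.finrank_inf hle₀
    have h2 := h.finrank_inf (hle₀.trans hle)
    have e1 : finrank Ω U' - finrank Ω U₀ = finrank Ω ↥(U' ⊓ vanish Ω P) := by omega
    have e2 : finrank Ω U - finrank Ω U' =
      finrank Ω ↥(U ⊓ vanish Ω P) - finrank Ω ↥(U' ⊓ vanish Ω P) := by omega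
    rw [e1, e2]; exact hF
  · rw [← h.sup_inf hle₀]
    exact (hU₀.mono hF.1).sup hr

/-- Cost of a nonzero vector up to scaling. -/
theorem exists_cost_line {F : IntermediateField K₀ Ω} {U : Submodule Ω (ι → Ω)}
    (hU : IsRational F U) {x : ι → Ω} (hx : x ∈ U) (hx0 : x ≠ 0) :
    ∃ F', Cost F F' (finrank Ω U - 1) ∧ ∃ c : Ω, c ≠ 0 ∧ ∀ i, c * x i ∈ F' := by
  obtain ⟨F', hF, hr⟩ := exists_cost_sub hU (U' := Submodule.span Ω {x})
    ((Submodule.span_singleton_le_iff_mem _ _).2 hx)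
  rw [finrank_span_singleton hx0, one_mul] at hF
  refine ⟨F', hF, ?_⟩
  obtain ⟨P, b, h⟩ := exists_echelon (Submodule.span Ω {x})
  have h1 := h.finrank_eq
  rw [finrank_span_singleton hx0] at h1
  obtain ⟨p, rfl⟩ := Finset.card_eq_one.1 h1.symm
  obtain ⟨c, hc⟩ := Submodule.mem_span_singleton.1 (h.mem p (by simp))
  refine ⟨c, ?_, fun i => ?_⟩
  · rintro rfl
    have := h.delta p (by simp) p (by simp)
    rw [← hc] at this
    simp at this
  · have := h.mem_field hr p (by simp) i
    rwa [← hc] at this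

/-- The orthogonal complement with respect to the dot product. -/
def perp (U : Submodule Ω (ι → Ω)) : Submodule Ω (ι → Ω) where
  carrier := {f | ∀ x ∈ U, f ⬝ᵥ x = 0}
  add_mem' := fun ha hb x hx => by rw [add_dotProduct, ha x hx, hb x hx, add_zero]
  zero_mem' := fun x _ => by simp
  smul_mem' := fun c f hf x hx => by rw [smul_dotProduct, hf x hx, smul_zero]

theorem mem_perp {U : Submodule Ω (ι → Ω)} {f : ι → Ω} : f ∈ perp U ↔ ∀ x ∈ U, f ⬝ᵥ x = 0 :=
  Iff.rfl

theorem finrank_perp (U : Submodule Ω (ι → Ω)) :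
    finrank Ω (perp U) = Fintype.card ι - finrank Ω U := by
  have e : perp U = U.dualAnnihilator.comap (dotProductEquiv Ω ι).toLinearMap := by
    ext f
    simp [mem_perp, Submodule.mem_dualAnnihilator, dotProductEquiv]
  rw [e, Submodule.comap_equiv_eq_map_symm, LinearEquiv.finrank_map_eq]
  have := Subspace.finrank_add_finrank_dualAnnihilator_eq U
  rw [Module.finrank_fintype_fun_eq_card] at this
  omega

theorem IsRational.perp {F : IntermediateField K₀ Ω} {U : Submodule Ω (ι → Ω)}
    (hU : IsRational F U) : IsRational F (perp U) := by
  obtain ⟨P, b, h⟩ := exists_echelon U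
  intro θ f hf x hx
  rw [← h.sum_eq hx, dotProduct_sum]
  refine Finset.sum_eq_zero fun p hp => ?_
  rw [dotProduct_smul]
  have : (fun i => θ (f i)) ⬝ᵥ b p = θ (f ⬝ᵥ b p) := by
    simp only [dotProduct, map_sum]
    exact Finset.sum_congr rfl fun j _ => (apply_mul_right θ (h.mem_field hU p hp j) _).symm
  rw [this, hf _ (h.mem p hp)]; simp

theorem exists_cost_perp {F : IntermediateField K₀ Ω} {U : Submodule Ω (ι → Ω)}
    (hU : IsRational F U) {f : ι → Ω} (hf : ∀ x ∈ U, f ⬝ᵥ x = 0) :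
    ∃ F', Cost F F' (Fintype.card ι - finrank Ω U) ∧ ∀ i, f i ∈ F' := by
  rw [← finrank_perp]
  exact exists_cost_mem hU.perp hf

end Rational

section Flags

variable {Ω : Type*} [Field Ω] {n : ℕ}

/-- The `i`-th step of the flag cut out by the rows of `f`. -/
def fl (f : Fin n → Fin n → Ω) (i : ℕ) : Submodule Ω (Fin n → Ω) where
  carrier := {x | ∀ l : Fin n, i ≤ l → f l ⬝ᵥ x = 0}
  add_mem' := fun ha hb l hl => by rw [dotProduct_add, ha l hl, hb l hl, add_zero]
  zero_mem' := fun l _ => by simp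
  smul_mem' := fun c x hx l hl => by rw [dotProduct_smul, hx l hl, smul_zero]

theorem mem_fl {f : Fin n → Fin n → Ω} {i : ℕ} {x : Fin n → Ω} :
    x ∈ fl f i ↔ ∀ l : Fin n, i ≤ l → f l ⬝ᵥ x = 0 := Iff.rfl

theorem fl_mono (f : Fin n → Fin n → Ω) : Monotone (fl f) :=
  fun _ _ hij _ hx l hl => hx l (hij.trans hl)

theorem fl_of_le (f : Fin n → Fin n → Ω) {i : ℕ} (hi : n ≤ i) : fl f i = ⊤ := by
  rw [eq_top_iff]
  intro x _ l hl
  omega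

theorem fl_zero {f : Fin n → Fin n → Ω} (hf : (Matrix.of f).det ≠ 0) : fl f 0 = ⊥ := by
  rw [eq_bot_iff]
  intro x hx
  exact Matrix.eq_zero_of_mulVec_eq_zero hf (funext fun l => hx l (Nat.zero_le _))

theorem fl_succ (f : Fin n → Fin n → Ω) (i : Fin n) (x : Fin n → Ω) :
    x ∈ fl f i ↔ x ∈ fl f (i + 1) ∧ f i ⬝ᵥ x = 0 := by
  constructor
  · exact fun h => ⟨fl_mono f (Nat.le_succ _) h, h i le_rfl⟩
  · rintro ⟨h, h'⟩ l hl
    rcases hl.eq_or_lt with e | hl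
    · rwa [← Fin.ext e]
    · exact h l hl

theorem finrank_inf_ker_add_one {E : Type*} [AddCommGroup E] [Module Ω E] [FiniteDimensional Ω E]
    (U : Submodule Ω E) (φ : E →ₗ[Ω] Ω) :
    finrank Ω U ≤ finrank Ω ↥(U ⊓ LinearMap.ker φ) + 1 := by
  have h := LinearMap.finrank_range_add_finrank_ker (φ.comp U.subtype)
  have h1 : finrank Ω (LinearMap.range (φ.comp U.subtype)) ≤ 1 := by
    simpa using Submodule.finrank_le (LinearMap.range (φ.comp U.subtype))
  have h2 : finrank Ω (LinearMap.ker (φ.comp U.subtype)) =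
      finrank Ω ↥(U ⊓ LinearMap.ker φ) := by
    rw [LinearMap.ker_comp, ← Submodule.map_comap_subtype, Submodule.finrank_map_subtype_eq]
  omega

theorem finrank_fl_succ_le (f : Fin n → Fin n → Ω) (V : Submodule Ω (Fin n → Ω)) (i : ℕ) :
    finrank Ω ↥(V ⊓ fl f (i + 1)) ≤ finrank Ω ↥(V ⊓ fl f i) + 1 := by
  by_cases hi : i < n
  · have h := finrank_inf_ker_add_one (V ⊓ fl f (i + 1)) (dotProductEquiv Ω (Fin n) (f ⟨i, hi⟩))
    have e : V ⊓ fl f (i + 1) ⊓ LinearMap.ker (dotProductEquiv Ω (Fin n) (f ⟨i, hi⟩)) =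
        V ⊓ fl f i := by
      ext x
      have := fl_succ f ⟨i, hi⟩ x
      simp only [Submodule.mem_inf, LinearMap.mem_ker, dotProductEquiv_apply_apply] at this ⊢
      tauto
    rwa [e] at h
  · rw [fl_of_le f (by omega : n ≤ i + 1), fl_of_le f (by omega : n ≤ i)]
    omega

theorem finrank_inf_fl_mono (f : Fin n → Fin n → Ω) (V : Submodule Ω (Fin n → Ω)) :
    Monotone fun i => finrank Ω ↥(V ⊓ fl f i) := 
  fun _ _ h => Submodule.finrank_mono (inf_le_inf_left V (fl_mono f h))

theorem finrank_fl {f : Fin n → Fin n → Ω} (hf : (Matrix.of f).det ≠ 0) {i : ℕ} (hi : i ≤ n) :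
    finrank Ω (fl f i) = i := by
  have hup : ∀ i, finrank Ω (fl f i) ≤ i := by
    intro i
    induction i with
    | zero => rw [fl_zero hf]; simp
    | succ i ih =>
      have := finrank_fl_succ_le f ⊤ i
      rw [top_inf_eq, top_inf_eq] at this
      omega
  have hlo : ∀ d, finrank Ω (fl f (i + d)) ≤ finrank Ω (fl f i) + d := by
    intro d
    induction d with
    | zero => simp
    | succ d ih =>
      have := finrank_fl_succ_le f ⊤ (i + d)
      rw [top_inf_eq, top_inf_eq] at this
      rw [← add_assoc]
      omega
  have h1 := hlo (n - i)
  rw [fl_of_le f (by omega), finrank_top, Module.finrank_fin_fun] at h1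
  have := hup i
  omega

theorem telescope_choose {v : ℕ → ℕ} (h0 : v 0 = 0) (hm : ∀ i, v i ≤ v (i + 1))
    (h1 : ∀ i, v (i + 1) ≤ v i + 1) (N : ℕ) :
    ∑ i ∈ Finset.range N, v i * (v (i + 1) - v i) = (v N).choose 2 := by
  induction N with
  | zero => simp [h0]
  | succ N ih =>
    rw [Finset.sum_range_succ, ih]
    have a := hm N
    have b := h1 N
    rcases (by omega : v (N + 1) = v N ∨ v (N + 1) = v N + 1) with e | e
    · rw [e]; simp
    · rw [e, Nat.choose_succ_succ]; simp [add_comm]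

end Flags

section Generic

variable {K₀ Ω : Type*} [Field K₀] [Field Ω] [Algebra K₀ Ω] {n : ℕ} {J W : Type*}

/-- The entries of the flag matrices and of the linear forms are algebraically independent. -/
def IsGeneric (K₀ : Type*) [Field K₀] [Algebra K₀ Ω] (f : J → Fin n → Fin n → Ω)
    (w : W → Fin n → Ω) : Prop :=
  AlgebraicIndependent K₀ (Sum.elim (fun p : J × Fin n × Fin n => f p.1 p.2.1 p.2.2)
    (fun p : W × Fin n => w p.1 p.2))

theorem IsGeneric.card_le [Fintype J] [Fintype W] {f : J → Fin n → Fin n → Ω} {w : W → Fin n → Ω}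
    (h : IsGeneric K₀ f w) {F : IntermediateField K₀ Ω} (hf : ∀ j i l, f j i l ∈ F)
    (hw : ∀ a l, w a l ∈ F) {c : ℕ} (hc : Cost ⊥ F c) :
    Fintype.card J * (n * n) + Fintype.card W * n ≤ c := by
  have h1 := card_le_tr h (F := F) (by rintro (p | p); exacts [hf _ _ _, hw _ _])
  have h2 := h1.trans hc.2
  rw [tr_bot, zero_add] at h2
  have h3 : Fintype.card ((J × Fin n × Fin n) ⊕ (W × Fin n)) ≤ c := by exact_mod_cast h2
  simpa using h3

theorem IsGeneric.det_ne_zero {f : J → Fin n → Fin n → Ω} {w : W → Fin n → Ω}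
    (h : IsGeneric K₀ f w) (j : J) : (Matrix.of (f j)).det ≠ 0 := by
  have h1 : AlgebraicIndependent K₀ (fun p : Fin n × Fin n => f j p.1 p.2) := by
    have hi : Function.Injective
        (fun p : Fin n × Fin n => (Sum.inl (j, p) : (J × Fin n × Fin n) ⊕ (W × Fin n))) :=
      fun p q hpq => (Prod.mk.inj (Sum.inl.inj hpq)).2
    exact (AlgebraicIndependent.comp h _ hi :)
  intro h0
  have h2 : MvPolynomial.aeval (fun p : Fin n × Fin n => f j p.1 p.2)
      (Matrix.mvPolynomialX (Fin n) (Fin n) K₀).det = 0 := by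
    rw [← AlgHom.coe_toRingHom, RingHom.map_det, ← h0]
    congr 1
    ext a b
    simp [Matrix.mvPolynomialX]
  exact Matrix.det_mvPolynomialX_ne_zero (Fin n) K₀
    ((injective_iff_map_eq_zero _).1 h1 _ h2)

theorem exists_cost_forall {α : Type*} [Fintype α] {F₀ : IntermediateField K₀ Ω} {c : α → ℕ}
    {P : α → IntermediateField K₀ Ω → Prop} (mono : ∀ a F F', F ≤ F' → P a F → P a F')
    (h : ∀ a F, F₀ ≤ F → ∃ F', Cost F F' (c a) ∧ P a F') :
    ∃ F', Cost F₀ F' (∑ a, c a) ∧ ∀ a, P a F' := by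
  suffices H : ∀ s : Finset α, ∃ F', Cost F₀ F' (∑ a ∈ s, c a) ∧ ∀ a ∈ s, P a F' by
    obtain ⟨F', h1, h2⟩ := H Finset.univ
    exact ⟨F', h1, fun a => h2 a (Finset.mem_univ a)⟩
  intro s
  induction s using Finset.induction_on with
  | empty => exact ⟨F₀, by simpa using Cost.refl F₀, by simp⟩
  | insert a s ha ih =>
    obtain ⟨F', h1, h2⟩ := ih
    obtain ⟨F'', h3, h4⟩ := h a F' h1.1
    refine ⟨F'', ?_, ?_⟩
    · rw [Finset.sum_insert ha, add_comm]
      exact h1.trans h3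
    · intro b hb
      rcases Finset.mem_insert.1 hb with rfl | hb
      · exact h4
      · exact mono _ _ _ h3.1 (h2 b hb)

theorem exists_cost_chain {ι : Type*} [Fintype ι] {F₀ : IntermediateField K₀ Ω}
    {U : ℕ → Submodule Ω (ι → Ω)} (N : ℕ) (hm : ∀ i < N, U i ≤ U (i + 1))
    (hU : IsRational F₀ (U N)) :
    ∃ F', Cost F₀ F' (∑ i ∈ Finset.range N,
      finrank Ω (U i) * (finrank Ω (U (i + 1)) - finrank Ω (U i))) ∧
      ∀ i ≤ N, IsRational F' (U i) := by
  induction N generalizing F₀ with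
  | zero => exact ⟨F₀, by simpa using Cost.refl F₀, fun i hi => by simpa [Nat.le_zero.1 hi] using hU⟩
  | succ N ih =>
    obtain ⟨F₁, h1, h2⟩ := exists_cost_sub hU (hm N (Nat.lt_succ_self N))
    obtain ⟨F', h3, h4⟩ := ih (fun i hi => hm i (by omega)) h2
    refine ⟨F', ?_, ?_⟩
    · rw [Finset.sum_range_succ, add_comm]
      exact h1.trans h3
    · intro i hi
      rcases hi.eq_or_lt with rfl | hi
      · exact hU.mono (h1.1.trans h3.1)
      · exact h4 i (by omega)

/-- Cost of all steps of an induced flag and of the flag itself. -/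
theorem exists_cost_flag {F₀ : IntermediateField K₀ Ω} {V : Submodule Ω (Fin n → Ω)}
    (hV : IsRational F₀ V) (f : Fin n → Fin n → Ω) :
    ∃ F', Cost F₀ F' (∑ i ∈ Finset.range n, (finrank Ω ↥(V ⊓ fl f i) *
        (finrank Ω ↥(V ⊓ fl f (i + 1)) - finrank Ω ↥(V ⊓ fl f i)) +
          (n - finrank Ω ↥(V ⊓ fl f i)))) ∧
      (∀ i, IsRational F' (V ⊓ fl f i)) ∧ ∀ i l, f i l ∈ F' := by
  obtain ⟨F₁, h1, h2⟩ := exists_cost_chain (F₀ := F₀) (U := fun i => V ⊓ fl f i) n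
    (fun i _ => inf_le_inf_left V (fl_mono f (Nat.le_succ i))) (by simpa [fl_of_le] using hV)
  obtain ⟨F₂, h3, h4⟩ := exists_cost_forall (F₀ := F₁)
    (c := fun i : Fin n => n - finrank Ω ↥(V ⊓ fl f i)) (P := fun i F => ∀ l, f i l ∈ F)
    (fun a F F' h h' l => h (h' l)) (fun i F hF => by
      simpa using exists_cost_perp ((h2 i i.2.le).mono hF) (f := f i) (fun x hx => hx.2 i le_rfl))
  refine ⟨F₂, ?_, ?_, h4⟩
  · rw [Finset.sum_add_distrib, Finset.sum_range fun i => n - finrank Ω ↥(V ⊓ fl f i)]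
    exact h1.trans h3
  · intro i
    rcases le_total i n with hi | hi
    · exact (h2 i hi).mono h3.1
    · rw [fl_of_le f hi, inf_top_eq]
      exact hV.mono (h1.1.trans h3.1)

/-- The dimension count for a Schubert problem with a marked line. -/
theorem IsGeneric.codim_le [Fintype J] [Fintype W] {f : J → Fin n → Fin n → Ω}
    {w : W → Fin n → Ω} (h : IsGeneric K₀ f w) {V : Submodule Ω (Fin n → Ω)} {k : ℕ}
    (hV : finrank Ω V = k) {o : J} {b : ℕ} {x : Fin n → Ω} (hx0 : x ≠ 0) (hx : x ∈ V ⊓ fl (f o) b)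
    (hw : ∀ a, w a ⬝ᵥ x = 0) :
    Fintype.card W + ∑ j, ∑ i ∈ Finset.range n, finrank Ω ↥(V ⊓ fl (f j) i) ≤
      k * (n - k) + (finrank Ω ↥(V ⊓ fl (f o) b) - 1) + Fintype.card J * k.choose 2 := by
  obtain ⟨F₁, h1, hr1⟩ := exists_cost_sub (isRational_top (⊥ : IntermediateField K₀ Ω))
    (le_top (a := V))
  obtain ⟨F₂, h2, hr2⟩ := exists_cost_forall (F₀ := F₁)
    (c := fun j : J => ∑ i ∈ Finset.range n, (finrank Ω ↥(V ⊓ fl (f j) i) *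
        (finrank Ω ↥(V ⊓ fl (f j) (i + 1)) - finrank Ω ↥(V ⊓ fl (f j) i)) +
          (n - finrank Ω ↥(V ⊓ fl (f j) i))))
    (P := fun j F => (∀ i, IsRational F (V ⊓ fl (f j) i)) ∧ ∀ i l, f j i l ∈ F)
    (fun a F F' h h' => ⟨fun i => (h'.1 i).mono h, fun i l => h (h'.2 i l)⟩)
    (fun j F hF => exists_cost_flag (hr1.mono hF) (f j))
  obtain ⟨F₃, h3, c, hc0, hc⟩ := exists_cost_line ((hr2 o).1 b) hx hx0
  have hl : IsRational F₃ (Submodule.span Ω (Set.range fun _ : Unit => c • x)) :=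
    isRational_span fun _ i => hc i
  have hcx : c • x ≠ 0 := smul_ne_zero hc0 hx0
  obtain ⟨F₄, h4, hr4⟩ := exists_cost_forall (F₀ := F₃)
    (c := fun _ : W => n - 1) (P := fun a F => ∀ l, w a l ∈ F)
    (fun a F F' h h' l => h (h' l)) (fun a F hF => by
      have := exists_cost_perp (hl.mono hF) (f := w a) (fun y hy => by
        rw [Set.range_const] at hy
        obtain ⟨d, rfl⟩ := Submodule.mem_span_singleton.1 hy
        simp [hw a])
      rwa [Set.range_const, finrank_span_singleton hcx, Fintype.card_fin] at this)
  have key := h.card_le (fun j i l => h4.1 (h3.1 ((hr2 j).2 i l))) hr4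
    (((h1.trans h2).trans h3).trans h4)
  have hn : 0 < n := by
    rcases Nat.eq_zero_or_pos n with rfl | hn
    · exact absurd (Subsingleton.elim x 0) hx0
    · exact hn
  rw [finrank_top, Module.finrank_fin_fun, hV] at key
  have hj : ∀ j, ∑ i ∈ Finset.range n, (finrank Ω ↥(V ⊓ fl (f j) i) *
        (finrank Ω ↥(V ⊓ fl (f j) (i + 1)) - finrank Ω ↥(V ⊓ fl (f j) i)) +
          (n - finrank Ω ↥(V ⊓ fl (f j) i))) + ∑ i ∈ Finset.range n, finrank Ω ↥(V ⊓ fl (f j) i)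
        = k.choose 2 + n * n := by
    intro j
    rw [Finset.sum_add_distrib, telescope_choose (v := fun i => finrank Ω ↥(V ⊓ fl (f j) i))
      (by simp [fl_zero (h.det_ne_zero j)])
      (fun i => finrank_inf_fl_mono (f j) V (Nat.le_succ i)) (finrank_fl_succ_le (f j) V) n,
      add_assoc, ← Finset.sum_add_distrib]
    rw [fl_of_le _ le_rfl, inf_top_eq, hV]
    congr 1
    rw [Finset.sum_congr rfl (g := fun _ => n)]
    · simp
    · intro i _
      have := Submodule.finrank_le (V ⊓ fl (f j) i)
      rw [Module.finrank_fin_fun] at this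
      omega
  have hj' := Finset.sum_congr (s₁ := Finset.univ) rfl fun j _ => hj j
  rw [Finset.sum_add_distrib] at hj'
  simp only [Finset.sum_const, Finset.card_univ, smul_eq_mul] at hj' key
  have e : Fintype.card W * n = Fintype.card W * (n - 1) + Fintype.card W := by
    rw [← Nat.mul_succ]; congr 1; omega
  rw [mul_add] at hj'
  omega

end Generic

section Adapted

variable {Ω : Type*} [Field Ω] {E : Type*} [AddCommGroup E] [Module Ω E] [FiniteDimensional Ω E]

theorem exists_complement_family (B R : Submodule Ω E) :
    ∃ y : ℕ → E, (∀ a, y a ∈ R) ∧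
      B ⊔ Submodule.span Ω (y '' Set.Ico (finrank Ω B) (finrank Ω ↥(B ⊔ R))) = B ⊔ R := by
  obtain ⟨C', hC⟩ := Submodule.exists_isCompl (B.comap R.subtype)
  set C := C'.map R.subtype with hCdef
  have hCR : C ≤ R := Submodule.map_subtype_le _ _
  have hsup : B ⊔ C = B ⊔ R := by
    apply le_antisymm (sup_le_sup_left hCR B)
    refine sup_le le_sup_left fun x hx => ?_
    have h1 : (⟨x, hx⟩ : R) ∈ B.comap R.subtype ⊔ C' := by rw [hC.sup_eq_top]; trivial
    obtain ⟨u, hu, v, hv, huv⟩ := Submodule.mem_sup.1 h1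
    exact Submodule.mem_sup.2 ⟨u, hu, v, ⟨v, hv, rfl⟩, congrArg Subtype.val huv⟩
  have hinf : B ⊓ C = ⊥ := by
    rw [eq_bot_iff]
    rintro _ ⟨hx, ⟨c, hc, rfl⟩⟩
    have : c ∈ B.comap R.subtype ⊓ C' := ⟨hx, hc⟩
    rw [hC.inf_eq_bot] at this
    simpa using this
  have hdim := Submodule.finrank_sup_add_finrank_inf_eq B C
  rw [hinf, finrank_bot, hsup] at hdim
  let bas := finBasis Ω C
  refine ⟨fun a => if h : a - finrank Ω B < finrank Ω C then (bas ⟨_, h⟩ : E) else 0,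
    fun a => ?_, ?_⟩
  · dsimp only
    split_ifs with h
    · exact hCR (bas ⟨_, h⟩).2
    · exact zero_mem _
  · rw [← hsup]
    congr 1
    have e1 := congrArg (Submodule.map C.subtype) bas.span_eq
    rw [Submodule.map_span, Submodule.map_top, Submodule.range_subtype] at e1
    refine Eq.trans ?_ e1
    congr 1
    ext x
    simp only [Set.mem_image, Set.mem_Ico, Set.mem_range, exists_exists_eq_and]
    constructor
    · rintro ⟨a, ⟨h1, h2⟩, rfl⟩
      rw [hsup] at h2
      have h3 : a - finrank Ω B < finrank Ω C := by omega
      exact ⟨⟨_, h3⟩, by simp [h3]⟩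
    · rintro ⟨i, rfl⟩
      refine ⟨finrank Ω B + i, ⟨by omega, by rw [hsup]; omega⟩, ?_⟩
      have h3 : finrank Ω B + i - finrank Ω B < finrank Ω C := by have := i.2; omega
      rw [dif_pos h3]
      congr 2
      ext; simp

theorem exists_adapted_family (B : Submodule Ω E) (R : ℕ → Submodule Ω E) (h0 : R 0 ≤ B)
    (hR : Monotone R) :
    ∃ y : ℕ → E, ∀ t, B ⊔ Submodule.span Ω (y '' Set.Ico (finrank Ω B) (finrank Ω ↥(B ⊔ R t))) =
      B ⊔ R t ∧ ∀ a < finrank Ω ↥(B ⊔ R t), finrank Ω B ≤ a → y a ∈ R t := by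
  have hT : Monotone fun t => B ⊔ R t := fun _ _ h => sup_le_sup_left (hR h) B
  have hd : Monotone fun t => finrank Ω ↥(B ⊔ R t) := fun _ _ h => Submodule.finrank_mono (hT h)
  have e0 : B ⊔ R 0 = B := sup_eq_left.2 h0
  choose z hzR hz using fun t => exists_complement_family (B ⊔ R t) (R (t + 1))
  have hsup : ∀ t, B ⊔ R t ⊔ R (t + 1) = B ⊔ R (t + 1) := fun t => by
    rw [sup_assoc, sup_eq_right.2 (hR (Nat.le_succ t))]
  let y : ℕ → E := fun a => if h : ∃ t, a < finrank Ω ↥(B ⊔ R (t + 1)) then z (Nat.find h) a else 0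
  have hy : ∀ t a, finrank Ω ↥(B ⊔ R t) ≤ a → a < finrank Ω ↥(B ⊔ R (t + 1)) → y a = z t a := by
    intro t a h1 h2
    have h : ∃ t, a < finrank Ω ↥(B ⊔ R (t + 1)) := ⟨t, h2⟩
    have : Nat.find h = t := by
      rw [Nat.find_eq_iff]
      refine ⟨h2, fun m hm => ?_⟩
      have := hd (show m + 1 ≤ t by omega)
      dsimp only at this
      omega
    simp only [y, dif_pos h, this]
  refine ⟨y, fun t => ?_⟩
  induction t with
  | zero => 
    rw [e0]
    refine ⟨by simp, fun a h1 h2 => by omega⟩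
  | succ t ih =>
    have hle := hd (Nat.le_succ t)
    have hle0 := hd (Nat.zero_le t)
    dsimp only at hle hle0
    rw [e0] at hle0
    constructor
    · rw [← Set.Ico_union_Ico_eq_Ico hle0 hle, Set.image_union, Submodule.span_union, ← sup_assoc,
        ih.1]
      have h1 := hz t
      rw [hsup] at h1
      refine Eq.trans ?_ h1
      congr 2
      exact Set.image_congr fun a (ha : a ∈ Set.Ico _ _) => hy t a ha.1 ha.2
    · intro a h1 h2
      by_cases h3 : a < finrank Ω ↥(B ⊔ R t)
      · exact hR (Nat.le_succ t) (ih.2 a h3 h2)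
      · rw [hy t a (by omega) h1]
        exact hzR t a

/-- A basis adapted to `S ≤ K` and to a filtration of `K` together with the induced filtration of
`S`. -/
theorem exists_adapted_basis {S K : Submodule Ω E} (hSK : S ≤ K) (Kc : ℕ → Submodule Ω E)
    (hK : Monotone Kc) {N : ℕ} (h0 : Kc 0 = ⊥) (hN : ∀ i, N ≤ i → Kc i = K) :
    ∃ y : ℕ → E, Submodule.span Ω (y '' Set.Iio (finrank Ω E)) = ⊤ ∧
      (∀ a < finrank Ω S, y a ∈ S) ∧ (∀ a < finrank Ω K, y a ∈ K) ∧
      (∀ i, ∀ a < finrank Ω ↥(Kc i ⊓ S), y a ∈ Kc i ⊓ S) ∧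
      ∀ i a, finrank Ω S ≤ a → a < finrank Ω S + (finrank Ω (Kc i) - finrank Ω ↥(Kc i ⊓ S)) →
        y a ∈ Kc i := by
  obtain ⟨y₁, hy₁⟩ := exists_adapted_family (⊥ : Submodule Ω E) (fun i => Kc i ⊓ S)
    (by simp [h0]) fun _ _ h => inf_le_inf_right S (hK h)
  obtain ⟨y₂, hy₂⟩ := exists_adapted_family S Kc (by simp [h0]) hK
  obtain ⟨y₃, -, hy₃⟩ := exists_complement_family K ⊤
  replace hy₁ : ∀ t, Submodule.span Ω (y₁ '' Set.Ico 0 (finrank Ω ↥(Kc t ⊓ S))) = Kc t ⊓ S ∧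
      ∀ a < finrank Ω ↥(Kc t ⊓ S), y₁ a ∈ Kc t ⊓ S := by
    intro t
    have h := hy₁ t
    rw [bot_sup_eq, bot_sup_eq, finrank_bot] at h
    exact ⟨h.1, fun a ha => h.2 a ha (Nat.zero_le a)⟩
  rw [sup_top_eq, finrank_top] at hy₃
  have hdS : finrank Ω S ≤ finrank Ω K := Submodule.finrank_mono hSK
  have hdK : finrank Ω K ≤ finrank Ω E := Submodule.finrank_le K
  have hNS := hy₁ N
  rw [hN N le_rfl, inf_eq_right.2 hSK] at hNS
  have hNK := hy₂ N
  rw [hN N le_rfl, sup_eq_right.2 hSK] at hNK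
  have hdi : ∀ i, finrank Ω ↥(S ⊔ Kc i) =
      finrank Ω S + (finrank Ω (Kc i) - finrank Ω ↥(Kc i ⊓ S)) := by
    intro i
    have h1 := Submodule.finrank_sup_add_finrank_inf_eq S (Kc i)
    have h2 : finrank Ω ↥(Kc i ⊓ S) ≤ finrank Ω (Kc i) := Submodule.finrank_mono inf_le_left
    rw [inf_comm] at h1
    omega
  have hKi : ∀ i, Kc i ≤ K := fun i => by
    rw [← hN (max i N) (le_max_right _ _)]; exact hK (le_max_left _ _)
  refine ⟨fun a => if a < finrank Ω S then y₁ a else if a < finrank Ω K then y₂ a else y₃ a,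
    ?_, ?_, ?_, ?_, ?_⟩
  · rw [show Set.Iio (finrank Ω E) = Set.Ico 0 (finrank Ω S) ∪ (Set.Ico (finrank Ω S) (finrank Ω K)
      ∪ Set.Ico (finrank Ω K) (finrank Ω E)) by ext; simp; omega, Set.image_union, Set.image_union,
      Submodule.span_union, Submodule.span_union, Set.image_congr (g := y₁),
      Set.image_congr (s := Set.Ico (finrank Ω S) (finrank Ω K)) (g := y₂),
      Set.image_congr (s := Set.Ico (finrank Ω K) (finrank Ω E)) (g := y₃),
      hNS.1, ← sup_assoc, hNK.1, hy₃]
    · rintro a ⟨h1, h2⟩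
      rw [if_neg (by omega), if_neg (by omega)]
    · rintro a ⟨h1, h2⟩
      rw [if_neg (by omega), if_pos (by omega)]
    · rintro a ⟨h1, h2⟩
      rw [if_pos h2]
  · intro a ha
    simp only [ha, if_true]
    exact hNS.2 a ha
  · intro a ha
    dsimp only
    split_ifs with h
    · exact hSK (hNS.2 a h)
    · exact hNK.2 a ha (by omega)
  · intro i a ha
    have : finrank Ω ↥(Kc i ⊓ S) ≤ finrank Ω S := Submodule.finrank_mono inf_le_right
    dsimp only
    rw [if_pos (by omega)]
    exact (hy₁ i).2 a ha
  · intro i a h1 h2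
    rw [← hdi] at h2
    have : finrank Ω ↥(S ⊔ Kc i) ≤ finrank Ω K := Submodule.finrank_mono (sup_le hSK (hKi i))
    dsimp only
    rw [if_neg (by omega), if_pos (by omega)]
    exact (hy₂ i).2 a h2 h1

end Adapted

section ConfigCount

variable {K₀ Ω : Type*} [Field K₀] [Field Ω] [Algebra K₀ Ω] {n : ℕ} {J : Type*} [Fintype J]

theorem exists_cost_system {U : Submodule Ω (Fin n → Ω)} {Uc : J → ℕ → Submodule Ω (Fin n → Ω)}
    (hm : ∀ j, Monotone (Uc j)) (hn : ∀ j, Uc j n = U) (f : J → Fin n → Fin n → Ω)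
    (hf : ∀ j, ∀ i : Fin n, ∀ x ∈ Uc j i, f j i ⬝ᵥ x = 0) :
    ∃ F : IntermediateField K₀ Ω, Cost ⊥ F (finrank Ω U * (n - finrank Ω U) +
      ∑ j, ∑ i ∈ Finset.range n, (finrank Ω (Uc j i) *
        (finrank Ω (Uc j (i + 1)) - finrank Ω (Uc j i)) + (n - finrank Ω (Uc j i)))) ∧
      IsRational F U ∧ (∀ j, ∀ i ≤ n, IsRational F (Uc j i)) ∧ ∀ j i l, f j i l ∈ F := by
  obtain ⟨F₁, h1, hr1⟩ := exists_cost_sub (isRational_top (⊥ : IntermediateField K₀ Ω))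
    (le_top (a := U))
  rw [finrank_top, Module.finrank_fin_fun] at h1
  obtain ⟨F₂, h2, hr2⟩ := exists_cost_forall (F₀ := F₁)
    (c := fun j : J => ∑ i ∈ Finset.range n, (finrank Ω (Uc j i) *
        (finrank Ω (Uc j (i + 1)) - finrank Ω (Uc j i)) + (n - finrank Ω (Uc j i))))
    (P := fun j F => (∀ i ≤ n, IsRational F (Uc j i)) ∧ ∀ i l, f j i l ∈ F)
    (fun a F F' h h' => ⟨fun i hi => (h'.1 i hi).mono h, fun i l => h (h'.2 i l)⟩)
    (fun j F hF => by
      obtain ⟨F₁, h1, h2⟩ := exists_cost_chain (F₀ := F) (U := Uc j) n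
        (fun i _ => hm j (Nat.le_succ i)) (by rw [hn]; exact hr1.mono hF)
      obtain ⟨F₂, h3, h4⟩ := exists_cost_forall (F₀ := F₁)
        (c := fun i : Fin n => n - finrank Ω (Uc j i)) (P := fun i F => ∀ l, f j i l ∈ F)
        (fun a F F' h h' l => h (h' l)) (fun i F hF => by
          simpa using exists_cost_perp ((h2 i i.2.le).mono hF) (hf j i))
      refine ⟨F₂, ?_, fun i hi => (h2 i hi).mono h3.1, h4⟩
      rw [Finset.sum_add_distrib, Finset.sum_range fun i => n - finrank Ω (Uc j i)]
      exact h1.trans h3)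
  exact ⟨F₂, h1.trans h2, hr1.mono h2.1, fun j => (hr2 j).1, fun j => (hr2 j).2⟩

theorem finrank_vanish (T : Finset (Fin n)) : finrank Ω (vanish Ω Tᶜ) = T.card := by
  have h : IsEchelon (vanish Ω Tᶜ) T (fun p => Pi.single p 1) :=
    ⟨fun p hp i hi => by
      rw [Pi.single_eq_of_ne]
      rintro rfl
      exact Finset.mem_compl.1 hi hp, fun p hp q hq => by
        rw [Pi.single_apply]; simp [eq_comm], fun x hx h0 => funext fun i => by
        by_cases hi : i ∈ T
        · exact h0 i hi
        · exact hx i (Finset.mem_compl.2 hi)⟩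
  exact h.finrank_eq

theorem finrank_comap_mulVecLin {g : Matrix (Fin n) (Fin n) Ω} (hg : g.det ≠ 0)
    (U : Submodule Ω (Fin n → Ω)) : finrank Ω (U.comap g.mulVecLin) = finrank Ω U := by
  have hu : IsUnit g.det := isUnit_iff_ne_zero.2 hg
  have e : U.comap g.mulVecLin = U.map (g⁻¹).mulVecLin := by
    ext x
    constructor
    · intro hx
      exact ⟨_, hx, by simp [Matrix.nonsing_inv_mul _ hu]⟩
    · rintro ⟨y, hy, rfl⟩
      simpa [Matrix.mul_nonsing_inv _ hu] using hy
  rw [e]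
  apply LinearEquiv.finrank_eq
  symm
  apply Submodule.equivMapOfInjective
  intro x y hxy
  have := congrArg g.mulVec hxy
  simpa [Matrix.mul_nonsing_inv _ hu] using this

theorem inv_mem_field {F : IntermediateField K₀ Ω} {M : Matrix (Fin n) (Fin n) Ω}
    (hM : ∀ i j, M i j ∈ F) (hd : M.det ≠ 0) : ∀ i j, M⁻¹ i j ∈ F := by
  let M₀ : Matrix (Fin n) (Fin n) F := Matrix.of fun i j => ⟨M i j, hM i j⟩
  have h0 : (algebraMap F Ω).mapMatrix M₀ = M := by ext; rfl
  have h1 : M₀.det ≠ 0 := by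
    intro h
    apply hd
    rw [← h0, ← RingHom.map_det, h, map_zero]
  have h2 : M * (algebraMap F Ω).mapMatrix M₀⁻¹ = 1 := by
    rw [← h0, ← map_mul, Matrix.mul_nonsing_inv _ (isUnit_iff_ne_zero.2 h1), map_one]
  rw [Matrix.inv_eq_right_inv h2]
  exact fun i j => (M₀⁻¹ i j).2

theorem mul_mem_field {F : IntermediateField K₀ Ω} {M N : Matrix (Fin n) (Fin n) Ω}
    (hM : ∀ i j, M i j ∈ F) (hN : ∀ i j, N i j ∈ F) : ∀ i j, (M * N) i j ∈ F := fun i j => by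
  rw [Matrix.mul_apply]
  exact sum_mem fun l _ => mul_mem (hM i l) (hN l j)

theorem inv_mulVec_single_mem {g : Matrix (Fin n) (Fin n) Ω} (hg : g.det ≠ 0) {T : Finset (Fin n)}
    {a : Fin n} (ha : a ∈ T) :
    (fun i => g⁻¹ i a) ∈ (vanish Ω Tᶜ).comap g.mulVecLin := by
  have hu : IsUnit g.det := isUnit_iff_ne_zero.2 hg
  have : (fun i => g⁻¹ i a) = g⁻¹.mulVec (Pi.single a 1) := by ext; simp
  rw [this]
  intro i hi
  simp only [Matrix.mulVecLin_apply, Matrix.mulVec_mulVec, Matrix.mul_nonsing_inv _ hu,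
    Matrix.one_mulVec]
  rw [Pi.single_eq_of_ne]
  rintro rfl
  exact Finset.mem_compl.1 hi ha

/-- Cost of recovering the columns of the inverse of a matrix. -/
theorem exists_cost_inv {g : Matrix (Fin n) (Fin n) Ω} (hg : g.det ≠ 0)
    {F₀ : IntermediateField K₀ Ω} (T : Fin n → Finset (Fin n)) (hT : ∀ a, a ∈ T a)
    (hr : ∀ a, IsRational F₀ ((vanish Ω (T a)ᶜ).comap g.mulVecLin)) :
    ∃ F', Cost F₀ F' (∑ a, (T a).card) ∧ ∀ i j, g i j ∈ F' := by
  obtain ⟨F', h1, h2⟩ := exists_cost_forall (F₀ := F₀) (c := fun a => (T a).card)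
    (P := fun a F => ∀ i, g⁻¹ i a ∈ F) (fun a F F' h h' l => h (h' l)) (fun a F hF => by
      have := exists_cost_mem ((hr a).mono hF) (inv_mulVec_single_mem hg (hT a))
      rwa [finrank_comap_mulVecLin hg, finrank_vanish] at this)
  refine ⟨F', h1, ?_⟩
  have hu : IsUnit g.det := isUnit_iff_ne_zero.2 hg
  have h3 := inv_mem_field (M := g⁻¹) (fun i a => h2 a i)
    (by rw [Matrix.det_nonsing_inv]; simpa using hg)
  rwa [Matrix.nonsing_inv_nonsing_inv _ hu] at h3

end ConfigCount

section Patterns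

/-- The index of the step of the chain `s` at which `a` is passed. -/
noncomputable def blk (s : ℕ → ℕ) (a : ℕ) : ℕ := sInf {i | a < s (i + 1)}

theorem blk_eq {s : ℕ → ℕ} (hs : Monotone s) {i a : ℕ} (h1 : s i ≤ a) (h2 : a < s (i + 1)) :
    blk s a = i := by
  apply le_antisymm
  · exact Nat.sInf_le h2
  · by_contra! h
    have h3 : a < s (blk s a + 1) := Nat.sInf_mem (s := {i | a < s (i + 1)}) ⟨i, h2⟩
    have := hs (show blk s a + 1 ≤ i from h)
    omega

theorem blk_spec {s : ℕ → ℕ} (h0 : s 0 = 0) {n a : ℕ} (h : a < s n) :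
    s (blk s a) ≤ a ∧ a < s (blk s a + 1) ∧ blk s a < n := by
  have hn : n ≠ 0 := by rintro rfl; omega
  have hmem : n - 1 ∈ {i | a < s (i + 1)} := by
    simpa [Nat.sub_add_cancel (Nat.one_le_iff_ne_zero.2 hn)] using h
  have h3 : a < s (blk s a + 1) := Nat.sInf_mem ⟨_, hmem⟩
  have h4 : blk s a ≤ n - 1 := Nat.sInf_le hmem
  refine ⟨?_, h3, by omega⟩
  by_contra! h5
  rcases Nat.eq_zero_or_pos (blk s a) with h6 | h6
  · rw [h6, h0] at h5; omega
  · have : blk s a ≤ blk s a - 1 := Nat.sInf_le (by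
      simpa [Nat.sub_add_cancel h6] using h5)
    omega

theorem sum_range_blk {s : ℕ → ℕ} (hs : Monotone s) (h0 : s 0 = 0) (G : ℕ → ℕ) (n : ℕ) :
    ∑ a ∈ Finset.range (s n), G (blk s a) = ∑ i ∈ Finset.range n, (s (i + 1) - s i) * G i := by
  induction n with
  | zero => simp [h0]
  | succ n ih =>
    rw [Finset.sum_range_succ, ← ih, ← Finset.sum_range_add_sum_Ico _ (hs n.le_succ)]
    congr 1
    rw [Finset.sum_congr rfl fun a ha => by
      rw [blk_eq hs (Finset.mem_Ico.1 ha).1 (Finset.mem_Ico.1 ha).2]]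
    simp

theorem card_filter_fin_lt (n t : ℕ) (h : t ≤ n) :
    (Finset.univ.filter fun a : Fin n => (a : ℕ) < t).card = t := by
  rw [Fin.card_filter_val_lt]; simpa using h

/-- Numerical data of a pair of nested chains. -/
structure IsChainData (n d q : ℕ) (s e : ℕ → ℕ) : Prop where
  ms : Monotone s
  me : Monotone e
  s0 : s 0 = 0
  e0 : e 0 = 0
  sn : s n = d
  en : e n = q
  le : d + q ≤ n

variable {n : ℕ}

/-- Positions allowed to be nonzero in column `b` of a matrix preserving two coordinate subspaces. -/
def patP (n d q : ℕ) (b : Fin n) : Finset (Fin n) :=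
  if (b : ℕ) < d then Finset.univ.filter fun a => (a : ℕ) < d
  else if (b : ℕ) < d + q then Finset.univ.filter fun a => (a : ℕ) < d + q
  else Finset.univ

/-- The coordinate pattern of the `i`-th member of the larger chain. -/
def patC (n d : ℕ) (s e : ℕ → ℕ) (i : ℕ) : Finset (Fin n) :=
  Finset.univ.filter fun a => (a : ℕ) < s i ∨ (d ≤ a ∧ (a : ℕ) < d + e i)

/-- For each basis vector, the coordinate pattern of the smallest chain member containing it. -/
noncomputable def patG (n d q : ℕ) (s e : ℕ → ℕ) (b : Fin n) : Finset (Fin n) :=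
  if (b : ℕ) < d then Finset.univ.filter fun a => (a : ℕ) < s (blk s b + 1)
  else if (b : ℕ) < d + q then patC n d s e (blk e (b - d) + 1)
  else Finset.univ

theorem card_patC {d q : ℕ} {s e : ℕ → ℕ} (h : IsChainData n d q s e) {i : ℕ} (hi : i ≤ n) :
    (patC n d s e i).card = s i + e i := by
  have h1 := h.ms hi
  have h2 := h.me hi
  have h3 := h.le
  rw [h.sn] at h1
  rw [h.en] at h2
  have : patC n d s e i = (Finset.univ.filter fun a : Fin n => (a : ℕ) < s i) ∪
      ((Finset.univ.filter fun a : Fin n => (a : ℕ) < d + e i) \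
        (Finset.univ.filter fun a : Fin n => (a : ℕ) < d)) := by
    ext a; simp [patC]; omega
  rw [this, Finset.card_union_of_disjoint, Finset.card_sdiff_of_subset, card_filter_fin_lt,
    card_filter_fin_lt, card_filter_fin_lt]
  · omega
  · omega
  · omega
  · omega
  · intro a; simp; omega
  · rw [Finset.disjoint_left]; intro a; simp; omega

theorem sum_fin_three {d q : ℕ} (hle : d + q ≤ n) (f : Fin n → ℕ) (A B : ℕ → ℕ) (C : ℕ)
    (hA : ∀ a : Fin n, (a : ℕ) < d → f a = A a)
    (hB : ∀ a : Fin n, d ≤ (a : ℕ) → (a : ℕ) < d + q → f a = B (a - d))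
    (hC : ∀ a : Fin n, d + q ≤ (a : ℕ) → f a = C) :
    ∑ a, f a = ∑ a ∈ Finset.range d, A a + ∑ a ∈ Finset.range q, B a + (n - (d + q)) * C := by
  obtain ⟨r, rfl⟩ := Nat.exists_eq_add_of_le hle
  obtain ⟨g, hg⟩ : ∃ g : ℕ → ℕ, ∀ a, g a = if a < d then A a else
      if a < d + q then B (a - d) else C := ⟨_, fun _ => rfl⟩
  have : ∀ a : Fin (d + q + r), f a = g a := by
    intro a
    rw [hg]
    split_ifs with h1 h2
    · exact hA a h1
    · exact hB a (by omega) h2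
    · exact hC a (by omega)
  rw [Finset.sum_congr rfl fun a _ => this a, Fin.sum_univ_eq_sum_range g (d + q + r),
    Finset.sum_range_add, Finset.sum_range_add]
  congr 1
  · congr 1
    · exact Finset.sum_congr rfl fun a ha => by simp [hg, Finset.mem_range.1 ha]
    · exact Finset.sum_congr rfl fun a ha => by simp [hg, Finset.mem_range.1 ha]
  · rw [Finset.sum_congr rfl fun x _ => show g (d + q + x) = C by
      rw [hg, if_neg (by omega), if_neg (by omega)]]
    simp

theorem sum_card_patP {d q : ℕ} (hle : d + q ≤ n) :
    ∑ b, (patP n d q b).card = d * d + q * (d + q) + (n - (d + q)) * n := by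
  rw [sum_fin_three hle _ (fun _ => d) (fun _ => d + q) n]
  · simp
  · intro a h; rw [patP, if_pos h, card_filter_fin_lt _ _ (by omega)]
  · intro a h h'; rw [patP, if_neg (by omega), if_pos h', card_filter_fin_lt _ _ hle]
  · intro a h; rw [patP, if_neg (by omega), if_neg (by omega)]; simp

theorem sum_card_patG {d q : ℕ} {s e : ℕ → ℕ} (h : IsChainData n d q s e) :
    ∑ b, (patG n d q s e b).card = ∑ i ∈ Finset.range n, (s (i + 1) - s i) * s (i + 1) +
      ∑ i ∈ Finset.range n, (e (i + 1) - e i) * (s (i + 1) + e (i + 1)) + (n - (d + q)) * n := by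
  rw [sum_fin_three h.le _ (fun a => s (blk s a + 1))
    (fun a => s (blk e a + 1) + e (blk e a + 1)) n]
  · have h1 := sum_range_blk h.ms h.s0 (fun i => s (i + 1)) n
    have h2 := sum_range_blk h.me h.e0 (fun i => s (i + 1) + e (i + 1)) n
    rw [h.sn] at h1
    rw [h.en] at h2
    rw [h1, h2]
  · intro a ha
    rw [patG, if_pos ha, card_filter_fin_lt]
    have := (blk_spec h.s0 (n := n) (by rw [h.sn]; exact ha)).2.2
    have := h.ms (show blk s a + 1 ≤ n from this)
    rw [h.sn] at this
    have := h.le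
    omega
  · intro a h1 h2
    rw [patG, if_neg (by omega), if_pos h2, card_patC h]
    exact (blk_spec h.e0 (n := n) (a := a - d) (by rw [h.en]; omega)).2.2
  · intro a h'; rw [patG, if_neg (by omega), if_neg (by omega)]; simp

theorem chain_identity {d q : ℕ} {s e : ℕ → ℕ} (h : IsChainData n d q s e) :
    ∑ i ∈ Finset.range n, (s i * (s (i + 1) - s i) + (n - s i)) +
      ∑ i ∈ Finset.range n, ((s i + e i) * (s (i + 1) + e (i + 1) - (s i + e i)) +
        (n - (s i + e i))) +
      ∑ b, (patG n d q s e b).card + ∑ i ∈ Finset.range n, s i =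
    ∑ b, (patP n d q b).card + n * n + ∑ i ∈ Finset.range n, (n - (s i + e i)) +
      ∑ i ∈ Finset.range n, s i * (s (i + 1) + e (i + 1) - (s i + e i)) := by
  rw [sum_card_patG h, sum_card_patP h.le]
  have key : ∀ N ≤ n, ∑ i ∈ Finset.range N, (s i * (s (i + 1) - s i) + (n - s i)) +
      ∑ i ∈ Finset.range N, ((s i + e i) * (s (i + 1) + e (i + 1) - (s i + e i)) +
        (n - (s i + e i))) +
      (∑ i ∈ Finset.range N, (s (i + 1) - s i) * s (i + 1) +
      ∑ i ∈ Finset.range N, (e (i + 1) - e i) * (s (i + 1) + e (i + 1)))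
         + ∑ i ∈ Finset.range N, s i =
    s N * s N + e N * (s N + e N) + n * N + ∑ i ∈ Finset.range N, (n - (s i + e i)) +
      ∑ i ∈ Finset.range N, s i * (s (i + 1) + e (i + 1) - (s i + e i)) := by
    intro N hN
    induction N with
    | zero => simp [h.s0, h.e0]
    | succ N ih =>
      have ih := ih (by omega)
      simp only [Finset.sum_range_succ]
      obtain ⟨a, ha⟩ := Nat.exists_eq_add_of_le (h.ms N.le_succ)
      obtain ⟨b, hb⟩ := Nat.exists_eq_add_of_le (h.me N.le_succ)
      have h1 : s N ≤ n := by
        have := h.ms (show N ≤ n by omega)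
        have := h.le; rw [h.sn] at *; omega
      obtain ⟨c, hc⟩ := Nat.exists_eq_add_of_le h1
      simp only [Nat.succ_eq_add_one] at ha hb
      rw [ha, hb]
      have e1 : s N + a + (e N + b) - (s N + e N) = a + b := by omega
      have e2 : n - s N = c := by omega
      rw [e1, e2]
      simp only [Nat.add_sub_cancel_left]
      generalize n - (s N + e N) = z
      nlinarith
  have := key n le_rfl
  rw [h.sn, h.en] at this
  linarith

end Patterns

section ConfigCount

variable {K₀ Ω : Type*} [Field K₀] [Field Ω] [Algebra K₀ Ω] {n : ℕ} {J : Type*} [Fintype J]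
  {d q : ℕ} {s e : J → ℕ → ℕ}

theorem comap_vanish_eq {p : Matrix (Fin n) (Fin n) Ω} (hp : p.det ≠ 0) {T : Finset (Fin n)}
    (h : ∀ b ∈ T, ∀ a, a ∉ T → p a b = 0) :
    (vanish Ω Tᶜ).comap p.mulVecLin = vanish Ω Tᶜ := by
  symm
  apply Submodule.eq_of_le_of_finrank_eq
  · intro x hx a ha
    change ∑ b, p a b * x b = 0
    refine Finset.sum_eq_zero fun b _ => ?_
    by_cases hb : b ∈ T
    · rw [h b hb a (Finset.mem_compl.1 ha), zero_mul]
    · rw [hx b (Finset.mem_compl.2 hb), mul_zero]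
  · rw [finrank_comap_mulVecLin hp]

theorem comap_mul (p Y : Matrix (Fin n) (Fin n) Ω) (U : Submodule Ω (Fin n → Ω)) :
    U.comap (p * Y).mulVecLin = (U.comap p.mulVecLin).comap Y.mulVecLin := by
  rw [Matrix.mulVecLin_mul]; rfl

/-- Index type for the free entries of a configuration matrix factorization. -/
abbrev ActIndex (n : ℕ) (J : Type*) (d q : ℕ) (s e : J → ℕ → ℕ) : Type _ :=
  (Fin n × Fin n) ⊕ (Σ _ : J, Σ b : Fin n, ↥(patP n d q b)) ⊕
    (Σ j : J, Σ i : Fin n, ↥(patC n d (s j) (e j) i)ᶜ)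

/-- The free entries of a configuration. -/
def actVal (Y : Matrix (Fin n) (Fin n) Ω) (p c : J → Matrix (Fin n) (Fin n) Ω) :
    ActIndex n J d q s e → Ω :=
  Sum.elim (fun x => Y x.1 x.2) (Sum.elim (fun x => p x.1 x.2.2 x.2.1) (fun x => c x.1 x.2.1 x.2.2))

theorem config_count (h : ∀ j, IsChainData n d q (s j) (e j)) (hle : d + q ≤ n)
    {Y : Matrix (Fin n) (Fin n) Ω} {p c : J → Matrix (Fin n) (Fin n) Ω}
    (hY : Y.det ≠ 0) (hp : ∀ j, (p j).det ≠ 0)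
    (hp0 : ∀ j b, ∀ a ∉ patP n d q b, p j a b = 0)
    (hc0 : ∀ j (i : Fin n), ∀ a ∈ patC n d (s j) (e j) i, c j i a = 0)
    (hf : AlgebraicIndependent K₀ fun x : J × Fin n × Fin n => (c x.1 * (p x.1 * Y)) x.2.1 x.2.2)
    (hact : AlgebraicIndependent K₀ (actVal (d := d) (q := q) (s := s) (e := e) Y p c)) :
    ∑ j, ∑ i ∈ Finset.range n, s j i ≤ d * (n - (d + q)) + ∑ j, ∑ i ∈ Finset.range n,
      s j i * (s j (i + 1) + e j (i + 1) - (s j i + e j i)) := by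
  have hg : ∀ j, (p j * Y).det ≠ 0 := fun j => by
    rw [Matrix.det_mul]; exact mul_ne_zero (hp j) hY
  let Td : Finset (Fin n) := Finset.univ.filter fun a => (a : ℕ) < d
  let Tk : Finset (Fin n) := Finset.univ.filter fun a => (a : ℕ) < d + q
  have hTd : Td.card = d := card_filter_fin_lt _ _ (by omega)
  have hTk : Tk.card = d + q := card_filter_fin_lt _ _ hle
  let TS : J → ℕ → Finset (Fin n) := fun j i => Finset.univ.filter fun a => (a : ℕ) < s j i
  have hsd : ∀ j, ∀ i ≤ n, s j i ≤ d := fun j i hi => (h j).sn ▸ (h j).ms hi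
  have hTS : ∀ j, ∀ i ≤ n, (TS j i).card = s j i := fun j i hi =>
    card_filter_fin_lt _ _ (by have := hsd j i hi; omega)
  let S := (vanish Ω Tdᶜ).comap Y.mulVecLin
  let K := (vanish Ω Tkᶜ).comap Y.mulVecLin
  let Sc : J → ℕ → Submodule Ω (Fin n → Ω) := fun j i =>
    (vanish Ω (TS j i)ᶜ).comap (p j * Y).mulVecLin
  let Kc : J → ℕ → Submodule Ω (Fin n → Ω) := fun j i =>
    (vanish Ω (patC n d (s j) (e j) i)ᶜ).comap (p j * Y).mulVecLin
  have vm : ∀ {T T' : Finset (Fin n)}, T ⊆ T' → vanish Ω Tᶜ ≤ vanish Ω T'ᶜ :=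
    fun hTT x hx a ha => hx a (Finset.compl_subset_compl.2 hTT ha)
  have hSm : ∀ j, Monotone (Sc j) := fun j i i' hi => Submodule.comap_mono (vm fun a ha => by
    have := (h j).ms hi
    simp only [TS, Finset.mem_filter] at ha ⊢
    exact ⟨ha.1, by omega⟩)
  have hKm : ∀ j, Monotone (Kc j) := fun j i i' hi => Submodule.comap_mono (vm fun a ha => by
    have := (h j).ms hi
    have := (h j).me hi
    simp only [patC, Finset.mem_filter] at ha ⊢
    exact ⟨ha.1, by omega⟩)
  have hSn : ∀ j, Sc j n = S := fun j => by
    have e1 : TS j n = Td := by simp only [TS, Td, (h j).sn]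
    simp only [Sc, S, e1, comap_mul]
    rw [comap_vanish_eq (hp j)]
    intro b hb a ha
    refine hp0 j b a ?_
    rw [patP, if_pos (by simpa [Td] using hb)]
    exact ha
  have hKn : ∀ j, Kc j n = K := fun j => by
    have e1 : patC n d (s j) (e j) n = Tk := by
      simp only [patC, Tk, (h j).sn, (h j).en]
      ext a
      simp
      omega
    simp only [Kc, K, e1, comap_mul]
    rw [comap_vanish_eq (hp j)]
    intro b hb a ha
    refine hp0 j b a ?_
    have hb : (b : ℕ) < d + q := by simpa [Tk] using hb
    have ha : ¬ (a : ℕ) < d + q := by simpa [Tk] using ha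
    rw [patP]
    split_ifs
    · simp; omega
    · simpa using ha
  have hfK : ∀ j, ∀ i : Fin n, ∀ x ∈ Kc j i, (c j * (p j * Y)) i ⬝ᵥ x = 0 := by
    intro j i x hx
    have e1 : (c j * (p j * Y)) i ⬝ᵥ x = (c j).mulVec ((p j * Y).mulVec x) i := by
      rw [Matrix.mulVec_mulVec]; rfl
    rw [e1]
    change ∑ a, c j i a * (p j * Y).mulVec x a = 0
    refine Finset.sum_eq_zero fun a _ => ?_
    by_cases ha : a ∈ patC n d (s j) (e j) i
    · rw [hc0 j i a ha, zero_mul]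
    · rw [show (p j * Y).mulVec x a = 0 from hx a (Finset.mem_compl.2 ha), mul_zero]
  have hSK : ∀ j i, Sc j i ≤ Kc j i := fun j i => Submodule.comap_mono (vm fun a ha => by
    simp only [TS, patC, Finset.mem_filter] at ha ⊢
    exact ⟨ha.1, Or.inl ha.2⟩)
  have rS : finrank Ω S = d := by rw [finrank_comap_mulVecLin hY, finrank_vanish, hTd]
  have rK : finrank Ω K = d + q := by rw [finrank_comap_mulVecLin hY, finrank_vanish, hTk]
  have rSc : ∀ j, ∀ i ≤ n, finrank Ω (Sc j i) = s j i := fun j i hi => by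
    rw [finrank_comap_mulVecLin (hg j), finrank_vanish, hTS j i hi]
  have rKc : ∀ j, ∀ i ≤ n, finrank Ω (Kc j i) = s j i + e j i := fun j i hi => by
    rw [finrank_comap_mulVecLin (hg j), finrank_vanish, card_patC (h j) hi]
  obtain ⟨FS, hFS, hrS, hrSc, hfFS⟩ := exists_cost_system (K₀ := K₀) hSm hSn
    (fun j => c j * (p j * Y)) (fun j i x hx => hfK j i x (hSK j i hx))
  obtain ⟨FK, hFK, hrK, hrKc, hfFK⟩ := exists_cost_system (K₀ := K₀) hKm hKn
    (fun j => c j * (p j * Y)) hfK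
  have t0 : (Fintype.card (J × Fin n × Fin n) : ℕ∞) ≤ tr (FS ⊓ FK) :=
    card_le_tr hf fun x => ⟨hfFS _ _ _, hfFK _ _ _⟩
  have t1 := tr_sup_le FS FK
  obtain ⟨F₂, hF₂, hYF⟩ := exists_cost_inv (F₀ := FS ⊔ FK) hY (patP n d q) (fun a => by
    rw [patP]; split_ifs <;> simp <;> omega) (fun a => by
    rw [patP]
    split_ifs
    · exact hrS.mono le_sup_left
    · exact hrK.mono le_sup_right
    · rw [Finset.compl_univ]
      have : (vanish Ω (∅ : Finset (Fin n))).comap Y.mulVecLin = ⊤ := by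
        ext x; simp [mem_vanish]
      rw [this]; exact isRational_top _)
  obtain ⟨F₃, hF₃, hgF⟩ := exists_cost_forall (F₀ := F₂)
    (c := fun j : J => ∑ b, (patG n d q (s j) (e j) b).card)
    (P := fun j F => ∀ i l, (p j * Y) i l ∈ F) (fun j F F' h h' i l => h (h' i l))
    (fun j F hF => by
      have hFF : FS ⊔ FK ≤ F := hF₂.1.trans hF
      refine exists_cost_inv (hg j) _ (fun a => ?_) (fun a => ?_)
      · rw [patG]
        split_ifs with h1 h2
        · simpa using (blk_spec (h j).s0 (n := n) (a := a) (by rw [(h j).sn]; exact h1)).2.1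
        · have := (blk_spec (h j).e0 (n := n) (a := a - d) (by rw [(h j).en]; omega)).2.1
          simp only [patC, Finset.mem_filter]
          exact ⟨Finset.mem_univ _, by omega⟩
        · simp
      · rw [patG]
        split_ifs with h1 h2
        · exact (hrSc j _ (blk_spec (h j).s0 (n := n) (a := a)
            (by rw [(h j).sn]; exact h1)).2.2).mono (le_sup_left.trans hFF)
        · exact (hrKc j _ (blk_spec (h j).e0 (n := n) (a := a - d)
            (by rw [(h j).en]; omega)).2.2).mono (le_sup_right.trans hFF)
        · rw [Finset.compl_univ]
          have : (vanish Ω (∅ : Finset (Fin n))).comap (p j * Y).mulVecLin = ⊤ := by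
            ext x; simp [mem_vanish]
          rw [this]; exact isRational_top _)
  have hYF₃ : ∀ i l, Y i l ∈ F₃ := fun i l => hF₃.1 (hYF i l)
  have uY : IsUnit Y.det := isUnit_iff_ne_zero.2 hY
  have hpF : ∀ j i l, p j i l ∈ F₃ := fun j i l => by
    have := mul_mem_field (hgF j) (inv_mem_field hYF₃ hY) i l
    rwa [Matrix.mul_assoc, Matrix.mul_nonsing_inv _ uY, Matrix.mul_one] at this
  have hcF : ∀ j i l, c j i l ∈ F₃ := fun j i l => by
    have := mul_mem_field (fun i l => hF₃.1 (hF₂.1 ((le_sup_left : FS ≤ FS ⊔ FK) (hfFS j i l))))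
      (inv_mem_field (hgF j) (hg j)) i l
    rwa [Matrix.mul_assoc, Matrix.mul_nonsing_inv _ (isUnit_iff_ne_zero.2 (hg j)),
      Matrix.mul_one] at this
  have t2 := card_le_tr hact (F := F₃) (by
    rintro (x | x | x)
    · exact hYF₃ _ _
    · exact hpF _ _ _
    · exact hcF _ _ _)
  have t3 := hF₃.2.trans (add_le_add_left hF₂.2 _)
  have tS := hFS.2
  have tK := hFK.2
  rw [tr_bot, zero_add] at tS tK
  have T := add_le_add t0 t2 |>.trans ((add_le_add_right t3 _).trans
    (show _ ≤ ((_ : ℕ) : ℕ∞) + ((_ : ℕ) : ℕ∞) + (((_ : ℕ) : ℕ∞) + ((_ : ℕ) : ℕ∞)) by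
      rw [add_assoc, ← add_assoc (tr (FS ⊓ FK))]
      exact add_le_add (t1.trans (add_le_add tS tK)) le_rfl))
  norm_cast at T
  have q1 : ∀ j, ∑ i ∈ Finset.range n, (finrank Ω (Sc j i) *
      (finrank Ω (Sc j (i + 1)) - finrank Ω (Sc j i)) + (n - finrank Ω (Sc j i))) =
      ∑ i ∈ Finset.range n, (s j i * (s j (i + 1) - s j i) + (n - s j i)) := fun j =>
    Finset.sum_congr rfl fun i hi => by
      have := Finset.mem_range.1 hi
      rw [rSc j i (by omega), rSc j (i + 1) (by omega)]
  have q2 : ∀ j, ∑ i ∈ Finset.range n, (finrank Ω (Kc j i) *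
      (finrank Ω (Kc j (i + 1)) - finrank Ω (Kc j i)) + (n - finrank Ω (Kc j i))) =
      ∑ i ∈ Finset.range n, ((s j i + e j i) * (s j (i + 1) + e j (i + 1) - (s j i + e j i)) +
        (n - (s j i + e j i))) := fun j =>
    Finset.sum_congr rfl fun i hi => by
      have := Finset.mem_range.1 hi
      rw [rKc j i (by omega), rKc j (i + 1) (by omega)]
  have q3 : Fintype.card (ActIndex n J d q s e) = n * n +
      (∑ _ : J, ∑ b, (patP n d q b).card +
        ∑ j, ∑ i ∈ Finset.range n, (n - (s j i + e j i))) := by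
    have : ∀ j, ∑ i ∈ Finset.range n, (n - (s j i + e j i)) =
        ∑ i : Fin n, ((patC n d (s j) (e j) i)ᶜ).card := fun j => by
      rw [← Fin.sum_univ_eq_sum_range fun i => n - (s j i + e j i)]
      refine Finset.sum_congr rfl fun i _ => ?_
      rw [Finset.card_compl, card_patC (h j) i.2.le, Fintype.card_fin]
    simp only [ActIndex, Fintype.card_sum, Fintype.card_prod, Fintype.card_fin,
      Fintype.card_sigma, Fintype.card_coe, this]
  have q4 : ∑ j : J, (∑ i ∈ Finset.range n, (s j i * (s j (i + 1) - s j i) + (n - s j i)) +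
      ∑ i ∈ Finset.range n, ((s j i + e j i) * (s j (i + 1) + e j (i + 1) - (s j i + e j i)) +
        (n - (s j i + e j i))) +
      ∑ b, (patG n d q (s j) (e j) b).card + ∑ i ∈ Finset.range n, s j i) = _ :=
    Finset.sum_congr rfl fun j _ => chain_identity (h j)
  rw [q3] at T
  rw [rS, rK, sum_card_patP hle, Finset.sum_congr rfl fun j _ => q1 j,
    Finset.sum_congr rfl fun j _ => q2 j] at T
  rw [sum_card_patP hle] at q4
  simp only [Finset.sum_add_distrib, Fintype.card_prod, Fintype.card_fin, Finset.sum_const,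
    Finset.card_univ, smul_eq_mul] at T q4 ⊢
  obtain ⟨r, hr⟩ := Nat.exists_eq_add_of_le hle
  have r1 : n - (d + q) = r := by omega
  have r2 : n - d = q + r := by omega
  rw [r1] at T q4 ⊢
  rw [r2] at T
  have hn' : n * n + d * r = d * (q + r) + (d + q) * r + (d * d + q * (d + q) + r * n) := by
    rw [hr]; ring
  linarith

end ConfigCount

section ChainBound

variable {K₀ Ω : Type*} [Field K₀] [Field Ω] [Algebra K₀ Ω] {n : ℕ} {J : Type*} [Fintype J]

theorem det_ne_zero_of_span {y : ℕ → Fin n → Ω} (h : Submodule.span Ω (y '' Set.Iio n) = ⊤) :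
    (Matrix.of fun i a : Fin n => y a i).det ≠ 0 := by
  rw [← isUnit_iff_ne_zero, ← Matrix.isUnit_iff_isUnit_det, ← Matrix.mulVec_surjective_iff_isUnit]
  have h1 : LinearMap.range (Matrix.of fun i a : Fin n => y a i).mulVecLin = ⊤ := by
    rw [Matrix.range_mulVecLin, eq_top_iff, ← h, Submodule.span_le]
    rintro _ ⟨a, ha, rfl⟩
    exact Submodule.subset_span ⟨⟨a, ha⟩, rfl⟩
  exact LinearMap.range_eq_top.1 h1

theorem comap_inv_vanish_eq {y : ℕ → Fin n → Ω}
    (hd : (Matrix.of fun i a : Fin n => y a i).det ≠ 0) {S : Submodule Ω (Fin n → Ω)}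
    (hS : ∀ a < finrank Ω S, y a ∈ S) :
    (vanish Ω (Finset.univ.filter fun a : Fin n => (a : ℕ) < finrank Ω S)ᶜ).comap
      (Matrix.of fun i a : Fin n => y a i)⁻¹.mulVecLin = S := by
  set B := Matrix.of fun i a : Fin n => y a i with hB
  have hu : IsUnit B.det := isUnit_iff_ne_zero.2 hd
  have hi : (B⁻¹).det ≠ 0 := by rw [Matrix.det_nonsing_inv]; simpa using hd
  apply Submodule.eq_of_le_of_finrank_eq
  · intro x hx
    have e : x = B.mulVec (B⁻¹.mulVec x) := by
      rw [Matrix.mulVec_mulVec, Matrix.mul_nonsing_inv _ hu, Matrix.one_mulVec]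
    have e2 : B.mulVec (B⁻¹.mulVec x) = ∑ a, (B⁻¹.mulVec x) a • y a := by
      ext i
      simp [Matrix.mulVec, dotProduct, hB, mul_comm]
    rw [e, e2]
    refine Submodule.sum_mem _ fun a _ => ?_
    by_cases ha : (a : ℕ) < finrank Ω S
    · exact Submodule.smul_mem _ _ (hS a ha)
    · rw [show (B⁻¹.mulVec x) a = 0 from hx a (by simpa using ha), zero_smul]
      exact Submodule.zero_mem _
  · rw [finrank_comap_mulVecLin hi, finrank_vanish, card_filter_fin_lt]
    simpa using Submodule.finrank_le S

variable {S K : Submodule Ω (Fin n → Ω)} {Kc : J → ℕ → Submodule Ω (Fin n → Ω)}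

theorem isChainData_finrank (hSK : S ≤ K) {Kc : ℕ → Submodule Ω (Fin n → Ω)} (hm : Monotone Kc)
    (h0 : Kc 0 = ⊥) (hn : Kc n = K) : IsChainData n (finrank Ω S) (finrank Ω K - finrank Ω S)
      (fun i => finrank Ω ↥(Kc i ⊓ S)) (fun i => finrank Ω (Kc i) - finrank Ω ↥(Kc i ⊓ S)) where
  ms i i' h := Submodule.finrank_mono (inf_le_inf_right _ (hm h))
  me i i' h := by
    have h1 := Submodule.finrank_sup_add_finrank_inf_eq (Kc i) S
    have h2 := Submodule.finrank_sup_add_finrank_inf_eq (Kc i') S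
    have h3 := Submodule.finrank_mono (sup_le_sup_right (hm h) S)
    dsimp only
    omega
  s0 := by rw [h0, bot_inf_eq, finrank_bot]
  e0 := by rw [h0, finrank_bot, Nat.zero_sub]
  sn := by rw [hn, inf_eq_right.2 hSK]
  en := by rw [hn, inf_eq_right.2 hSK]
  le := by
    have := Submodule.finrank_mono hSK
    have := Submodule.finrank_le K
    rw [Module.finrank_fin_fun] at this
    omega

theorem chain_bound {f : J → Fin n → Fin n → Ω}
    (hf : AlgebraicIndependent K₀ fun x : J × Fin n × Fin n => f x.1 x.2.1 x.2.2)
    (hSK : S ≤ K) (hm : ∀ j, Monotone (Kc j)) (h0 : ∀ j, Kc j 0 = ⊥)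
    (hn : ∀ j, ∀ i ≥ n, Kc j i = K) (hfl : ∀ j i, Kc j i ≤ fl (f j) i) :
    ∑ j, ∑ i ∈ Finset.range n, finrank Ω ↥(Kc j i ⊓ S) ≤
      finrank Ω S * (n - finrank Ω K) + ∑ j, ∑ i ∈ Finset.range n, finrank Ω ↥(Kc j i ⊓ S) *
        (finrank Ω (Kc j (i + 1)) - finrank Ω (Kc j i)) := by
  have hSK' := Submodule.finrank_mono hSK
  have hKn : finrank Ω K ≤ n := by simpa using Submodule.finrank_le K
  set d := finrank Ω S with hd
  set q := finrank Ω K - d with hq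
  have hdq : d + q = finrank Ω K := by omega
  let s : J → ℕ → ℕ := fun j i => finrank Ω ↥(Kc j i ⊓ S)
  let e : J → ℕ → ℕ := fun j i => finrank Ω (Kc j i) - finrank Ω ↥(Kc j i ⊓ S)
  have hse : ∀ j i, s j i + e j i = finrank Ω (Kc j i) := fun j i => by
    have := Submodule.finrank_mono (inf_le_left : Kc j i ⊓ S ≤ Kc j i)
    simp only [s, e]; omega
  have hcd : ∀ j, IsChainData n d q (s j) (e j) := fun j =>
    isChainData_finrank hSK (hm j) (h0 j) (hn j n le_rfl)
  obtain ⟨y, hy, hyS, hyK, -, -⟩ := exists_adapted_basis hSK (fun i => if i = 0 then ⊥ else K)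
    (fun i i' h => by dsimp only; split_ifs <;> simp_all) (by simp) (N := 1) (fun i hi => by
      simp [show i ≠ 0 by omega])
  choose z hz hzS hzK hzs hze using fun j => exists_adapted_basis hSK (Kc j) (hm j) (h0 j) (hn j)
  rw [Module.finrank_fin_fun] at hy
  simp only [Module.finrank_fin_fun] at hz
  have dy := det_ne_zero_of_span hy
  have dz := fun j => det_ne_zero_of_span (hz j)
  set B := Matrix.of fun i a : Fin n => y a i with hB
  let Z : J → Matrix (Fin n) (Fin n) Ω := fun j => Matrix.of fun i a : Fin n => z j a i
  have uB : IsUnit B.det := isUnit_iff_ne_zero.2 dy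
  have uZ : ∀ j, IsUnit (Z j).det := fun j => isUnit_iff_ne_zero.2 (dz j)
  let Ys := B⁻¹
  let ps : J → Matrix (Fin n) (Fin n) Ω := fun j => (Z j)⁻¹ * B
  let cs : J → Matrix (Fin n) (Fin n) Ω := fun j => Matrix.of (f j) * Z j
  have hps : ∀ j b, ∀ a ∉ patP n d q b, ps j a b = 0 := by
    intro j b a ha
    have e1 : ps j a b = ((Z j)⁻¹.mulVec (y b)) a := by
      simp [ps, Matrix.mul_apply, Matrix.mulVec, dotProduct, hB]
    rw [e1]
    rw [patP] at ha
    split_ifs at ha with h1 h2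
    · have h3 := hyS b h1
      rw [← comap_inv_vanish_eq (dz j) (hzS j)] at h3
      exact h3 a (by simpa using ha)
    · have h3 := hyK b (by omega)
      rw [← comap_inv_vanish_eq (dz j) (hzK j)] at h3
      exact h3 a (by simpa [hdq] using ha)
    · simp at ha
  have hcs : ∀ j (i : Fin n), ∀ a ∈ patC n d (s j) (e j) i, cs j i a = 0 := by
    intro j i a ha
    have h1 : z j a ∈ Kc j i := by
      simp only [patC, Finset.mem_filter, Finset.mem_univ, true_and] at ha
      rcases ha with ha | ⟨h1, h2⟩
      · exact (hzs j i a ha).1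
      · exact hze j i a h1 h2
    have h2 := mem_fl.1 (hfl j i h1) i le_rfl
    simpa [cs, Z, Matrix.mul_apply, dotProduct] using h2
  let R := MvPolynomial (ActIndex n J d q s e) K₀
  let YX : Matrix (Fin n) (Fin n) R := Matrix.of fun i l => MvPolynomial.X (Sum.inl (i, l))
  let pX : J → Matrix (Fin n) (Fin n) R := fun j => Matrix.of fun a b =>
    if h : a ∈ patP n d q b then MvPolynomial.X (Sum.inr (Sum.inl ⟨j, b, a, h⟩)) else 0
  let cX : J → Matrix (Fin n) (Fin n) R := fun j => Matrix.of fun i a =>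
    if h : a ∈ (patC n d (s j) (e j) i)ᶜ then MvPolynomial.X (Sum.inr (Sum.inr ⟨j, i, a, h⟩)) else 0
  let φ : R →ₐ[K₀] Ω := MvPolynomial.aeval (actVal Ys ps cs)
  have hX : ∀ x, φ (MvPolynomial.X x) = actVal Ys ps cs x := fun x => MvPolynomial.aeval_X _ _
  have φY : φ.toRingHom.mapMatrix YX = Ys := by
    ext i l; exact hX _
  have φp : ∀ j, φ.toRingHom.mapMatrix (pX j) = ps j := fun j => by
    ext a b
    by_cases h : a ∈ patP n d q b
    · exact (congrArg φ (dif_pos h)).trans (hX _)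
    · exact (congrArg φ (dif_neg h)).trans ((map_zero φ).trans (hps j b a h).symm)
  have φc : ∀ j, φ.toRingHom.mapMatrix (cX j) = cs j := fun j => by
    ext i a
    by_cases h : a ∈ (patC n d (s j) (e j) i)ᶜ
    · exact (congrArg φ (dif_pos h)).trans (hX _)
    · exact (congrArg φ (dif_neg h)).trans
        ((map_zero φ).trans (hcs j i a (by simpa using h)).symm)
  let Ω₂ := FractionRing R
  let ι : R →ₐ[K₀] Ω₂ := IsScalarTower.toAlgHom K₀ R Ω₂
  have hι : Function.Injective ι := IsFractionRing.injective R Ω₂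
  have hdet : ∀ M : Matrix (Fin n) (Fin n) R, (φ.toRingHom.mapMatrix M).det ≠ 0 →
      (ι.toRingHom.mapMatrix M).det ≠ 0 := fun M hM h => by
    rw [← RingHom.map_det] at h hM
    apply hM
    have : M.det = 0 := hι (by rw [map_zero]; exact h)
    rw [this, map_zero]
  have key := config_count (K₀ := K₀) (Ω := Ω₂) hcd (by omega) (Y := ι.toRingHom.mapMatrix YX)
    (p := fun j => ι.toRingHom.mapMatrix (pX j)) (c := fun j => ι.toRingHom.mapMatrix (cX j))
    (hdet _ (by rw [φY, Matrix.det_nonsing_inv]; simpa using dy))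
    (fun j => hdet _ (by
      rw [φp, Matrix.det_mul, Matrix.det_nonsing_inv]
      exact mul_ne_zero (by simpa using dz j) dy))
    (fun j b a ha => by exact (congrArg ι (dif_neg ha)).trans (map_zero ι)) (fun j i a ha => by exact (congrArg ι (dif_neg (by simpa using ha))).trans (map_zero ι)) ?_ ?_
  · simp only [hse, hdq] at key
    exact key
  · have : (fun x : J × Fin n × Fin n => (ι.toRingHom.mapMatrix (cX x.1) *
        (ι.toRingHom.mapMatrix (pX x.1) * ι.toRingHom.mapMatrix YX)) x.2.1 x.2.2) =
        ι ∘ fun x : J × Fin n × Fin n => (cX x.1 * (pX x.1 * YX)) x.2.1 x.2.2 := by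
      funext x
      rw [← map_mul, ← map_mul]
      rfl
    rw [this]
    refine AlgebraicIndependent.map' (AlgebraicIndependent.of_comp φ ?_) hι
    convert hf using 1
    funext x
    have : φ ((cX x.1 * (pX x.1 * YX)) x.2.1 x.2.2) =
        (φ.toRingHom.mapMatrix (cX x.1 * (pX x.1 * YX))) x.2.1 x.2.2 := rfl
    simp only [Function.comp_apply]
    rw [this, map_mul, map_mul, φY, φp, φc]
    simp only [cs, ps, Ys]
    rw [Matrix.mul_assoc (Z x.1)⁻¹, Matrix.mul_nonsing_inv _ uB, Matrix.mul_one, Matrix.mul_assoc,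
      Matrix.mul_nonsing_inv _ (uZ _), Matrix.mul_one]
    rfl
  · have : actVal (d := d) (q := q) (s := s) (e := e) (ι.toRingHom.mapMatrix YX)
        (fun j => ι.toRingHom.mapMatrix (pX j)) (fun j => ι.toRingHom.mapMatrix (cX j)) =
        ι ∘ MvPolynomial.X := by
      funext x
      rcases x with x | ⟨j, b, a, h⟩ | ⟨j, i, a, h⟩
      · rfl
      · exact congrArg ι (dif_pos h)
      · exact congrArg ι (dif_pos h)
    rw [this]
    exact (MvPolynomial.algebraicIndependent_X _ _).map' hι

end ChainBound

section Tangent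

variable {K₀ Ω : Type*} [Field K₀] [Field Ω] [Algebra K₀ Ω]

theorem exists_cost_map {ι : Type*} [Fintype ι] {F : IntermediateField K₀ Ω}
    {V S : Submodule Ω (ι → Ω)} (hS : IsRational F S) (hSV : S ≤ V)
    (Φ : (ι → Ω) →ₗ[Ω] (ι → Ω)) (hΦ : ∀ x ∈ S, Φ x ∈ V) (hx : ∃ x ∈ V, Φ x ∉ V) :
    ∃ F' : IntermediateField K₀ Ω, ∃ c : Ω, ∃ M : Matrix ι ι Ω,
      Cost F F' ((finrank Ω V - finrank Ω S) * (Fintype.card ι - finrank Ω V) - 1) ∧ c ≠ 0 ∧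
      (∀ i l, M i l ∈ F') ∧ ∀ x ∈ V, c • Φ x - M.mulVec x ∈ V := by
  obtain ⟨PS, e, he⟩ := exists_echelon S
  obtain ⟨PV, w, hw⟩ := exists_echelon V
  obtain ⟨P1, b, hb⟩ := exists_echelon (V ⊓ vanish Ω PS)
  have hc1 : P1.card = finrank Ω V - finrank Ω S := by
    rw [← hb.finrank_eq]; have := he.finrank_inf hSV; omega
  have hcV : PVᶜ.card = Fintype.card ι - finrank Ω V := by
    rw [Finset.card_compl, hw.finrank_eq]
  choose u hu hy using fun a => hw.exists_decomp (Φ (b a))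
  let C : Matrix ι ι Ω := Matrix.of fun a m => (if a = m then 1 else 0) - if m ∈ PS then e m a else 0
  have hC : ∀ a m, C a m ∈ F := fun a m => by
    refine sub_mem ?_ ?_
    · split_ifs
      exacts [one_mem _, zero_mem _]
    · split_ifs with h
      exacts [he.mem_field hS m h a, zero_mem _]
  have hCx : ∀ x, C.mulVec x = x - ∑ p ∈ PS, x p • e p := fun x => by
    ext a
    simp only [Matrix.mulVec, dotProduct, C, sub_mul, Finset.sum_sub_distrib, Matrix.of_apply,
      ite_mul, one_mul, zero_mul, Finset.sum_ite_eq, Finset.mem_univ, if_true, Pi.sub_apply,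
      Finset.sum_apply, Pi.smul_apply, smul_eq_mul, Finset.sum_ite_mem, Finset.univ_inter]
    simp [mul_comm]
  have hsum : ∀ x ∈ V, x - ∑ a ∈ P1, (C.mulVec x) a • b a ∈ S := by
    intro x hx
    have h2 : ∑ p ∈ PS, x p • e p ∈ S := S.sum_mem fun p hp => S.smul_mem _ (he.mem p hp)
    have h1 : C.mulVec x ∈ V ⊓ vanish Ω PS := by
      rw [hCx]
      refine ⟨V.sub_mem hx (hSV h2), fun q hq => ?_⟩
      simp only [Pi.sub_apply, Finset.sum_apply, Pi.smul_apply, smul_eq_mul]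
      rw [Finset.sum_eq_single q]
      · simp [he.delta q hq q hq]
      · intro p hp hpq; simp [he.delta p hp q hq, hpq]
      · intro h'; exact absurd hq h'
    rw [hb.sum_eq h1, hCx]
    simpa using h2
  have hM : ∀ c : Ω, ∀ x ∈ V, c • Φ x - (Matrix.of fun l m => ∑ a ∈ P1, c * (Φ (b a) - u a) l *
      C a m).mulVec x ∈ V := by
    intro c x hx
    have e1 : (Matrix.of fun l m => ∑ a ∈ P1, c * (Φ (b a) - u a) l * C a m).mulVec x =
        c • ∑ a ∈ P1, (C.mulVec x) a • (Φ (b a) - u a) := by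
      ext l
      simp only [Matrix.mulVec, dotProduct, Matrix.of_apply, Pi.smul_apply, Finset.sum_apply,
        smul_eq_mul, Finset.sum_mul, Finset.mul_sum]
      rw [Finset.sum_comm]
      refine Finset.sum_congr rfl fun a _ => Finset.sum_congr rfl fun m _ => ?_
      ring
    have e2 : Φ x = Φ (x - ∑ a ∈ P1, (C.mulVec x) a • b a) +
        ∑ a ∈ P1, (C.mulVec x) a • Φ (b a) := by
      rw [map_sub, map_sum]; simp
    have e3 : c • Φ x - c • ∑ a ∈ P1, (C.mulVec x) a • (Φ (b a) - u a) =
        c • (Φ (x - ∑ a ∈ P1, (C.mulVec x) a • b a) + ∑ a ∈ P1, (C.mulVec x) a • u a) := by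
      rw [← smul_sub, e2]
      simp only [smul_sub, Finset.sum_sub_distrib]
      rw [smul_add, smul_add]
      abel
    rw [e1, e3]
    exact V.smul_mem _ (V.add_mem (hΦ _ (hsum x hx)) (V.sum_mem fun a _ => V.smul_mem _ (hu a)))
  let z : P1 × (PVᶜ : Finset ι) → Ω := fun x => (Φ (b x.1) - u x.1) x.2
  have hz : z ≠ 0 := by
    rintro hz
    obtain ⟨x, hx, hxV⟩ := hx
    apply hxV
    have := hM 1 x hx
    have e0 : (Matrix.of fun l m => ∑ a ∈ P1, 1 * (Φ (b a) - u a) l * C a m) = 0 := by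
      ext l m
      refine Finset.sum_eq_zero fun a ha => ?_
      have : (Φ (b a) - u a) l = 0 := by
        by_cases hl : l ∈ PV
        · exact hy a l hl
        · exact congrFun hz (⟨a, ha⟩, ⟨l, Finset.mem_compl.2 hl⟩)
      rw [this]; simp
    rw [e0] at this
    simpa using this
  obtain ⟨F', hF', c, hc, hcz⟩ := exists_cost_line (isRational_top F) (Submodule.mem_top (x := z)) hz
  rw [finrank_top, Module.finrank_fintype_fun_eq_card, Fintype.card_prod, Fintype.card_coe,
    Fintype.card_coe, hc1, hcV] at hF'
  refine ⟨F', c, _, hF', hc, fun l m => ?_, hM c⟩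
  refine sum_mem fun a ha => mul_mem ?_ (hF'.1 (hC a m))
  by_cases hl : l ∈ PV
  · rw [show (Φ (b a) - u a) l = 0 from hy a l hl, mul_zero]
    exact zero_mem _
  · exact hcz (⟨a, ha⟩, ⟨l, Finset.mem_compl.2 hl⟩)

theorem finrank_map_add_finrank_inf_ker {A : Type*} [AddCommGroup A] [Module Ω A]
    [FiniteDimensional Ω A] (U : Submodule Ω A) (Φ : A →ₗ[Ω] A) :
    finrank Ω ↥(U.map Φ) + finrank Ω ↥(U ⊓ LinearMap.ker Φ) = finrank Ω U := by
  have h2 := (Φ.domRestrict U).finrank_range_add_finrank_ker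
  rw [LinearMap.range_domRestrict] at h2
  rw [← h2]
  congr 1
  rw [LinearMap.ker_domRestrict, ← Submodule.finrank_map_subtype_eq, Submodule.map_comap_subtype]

theorem finrank_sup_map {A : Type*} [AddCommGroup A] [Module Ω A] [FiniteDimensional Ω A]
    (V U : Submodule Ω A) (Φ : A →ₗ[Ω] A) :
    finrank Ω ↥(V ⊔ U.map Φ) + finrank Ω ↥(U ⊓ V.comap Φ) = finrank Ω V + finrank Ω U := by
  have h1 := Submodule.finrank_sup_add_finrank_inf_eq V (U.map Φ)
  have h2 := finrank_map_add_finrank_inf_ker U Φ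
  have h3 := finrank_map_add_finrank_inf_ker (U ⊓ V.comap Φ) Φ
  have h4 : V ⊓ U.map Φ = (U ⊓ V.comap Φ).map Φ := by
    ext y
    constructor
    · rintro ⟨hy, x, hx, rfl⟩
      exact ⟨x, ⟨hx, hy⟩, rfl⟩
    · rintro ⟨x, hx, rfl⟩
      exact ⟨hx.2, x, hx.1, rfl⟩
  have h5 : U ⊓ V.comap Φ ⊓ LinearMap.ker Φ = U ⊓ LinearMap.ker Φ := by
    ext x
    simp only [Submodule.mem_inf, Submodule.mem_comap, LinearMap.mem_ker]
    constructor
    · tauto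
    · rintro ⟨h, h'⟩
      exact ⟨⟨h, by rw [h']; exact V.zero_mem⟩, h'⟩
  rw [h4] at h1
  rw [h5] at h3
  omega

variable {n : ℕ} {J : Type*} [Fintype J]

theorem tangent_eq_zero {f : J → Fin n → Fin n → Ω}
    (hf : AlgebraicIndependent K₀ fun x : J × Fin n × Fin n => f x.1 x.2.1 x.2.2)
    {V : Submodule Ω (Fin n → Ω)} (hbal : ∑ j, ∑ i ∈ Finset.range n, finrank Ω ↥(V ⊓ fl (f j) i) =
      finrank Ω V * (n - finrank Ω V) + Fintype.card J * (finrank Ω V).choose 2)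
    (hdet : ∀ j, (Matrix.of (f j)).det ≠ 0)
    (Φ : (Fin n → Ω) →ₗ[Ω] (Fin n → Ω)) (hΦ : ∀ j i, ∀ x ∈ V ⊓ fl (f j) i, Φ x ∈ fl (f j) i ⊔ V) :
    ∀ x ∈ V, Φ x ∈ V := by
  by_contra! hcon
  set k := finrank Ω V with hk
  let S := V ⊓ V.comap Φ
  have hSV : S ≤ V := inf_le_left
  let Vc : J → ℕ → Submodule Ω (Fin n → Ω) := fun j i => V ⊓ fl (f j) i
  let Wc : J → ℕ → Submodule Ω (Fin n → Ω) := fun j i => V ⊔ (Vc j i).map Φ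
  let Kc : J → ℕ → Submodule Ω (Fin n → Ω) := fun j i => fl (f j) i ⊓ Wc j i
  let K := V ⊔ V.map Φ
  have hVm : ∀ j, Monotone (Vc j) := fun j i i' h => inf_le_inf_left _ (fl_mono _ h)
  have hWm : ∀ j, Monotone (Wc j) := fun j i i' h => sup_le_sup_left (Submodule.map_mono (hVm j h)) _
  have hKm : ∀ j, Monotone (Kc j) := fun j i i' h => inf_le_inf (fl_mono _ h) (hWm j h)
  have hVn : ∀ j, ∀ i ≥ n, Vc j i = V := fun j i hi => by simp only [Vc]; rw [fl_of_le _ hi, inf_top_eq]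
  have hKn : ∀ j, ∀ i ≥ n, Kc j i = K := fun j i hi => by
    simp only [Kc, Wc, hVn j i hi]; rw [fl_of_le _ hi, top_inf_eq]
  have hK0 : ∀ j, Kc j 0 = ⊥ := fun j => by simp only [Kc]; rw [fl_zero (hdet j), bot_inf_eq]
  have hV0 : ∀ j, Vc j 0 = ⊥ := fun j => by simp only [Vc]; rw [fl_zero (hdet j), inf_bot_eq]
  have hKV : ∀ j i, Kc j i ⊓ V = Vc j i := fun j i => by
    apply le_antisymm
    · exact fun x hx => ⟨hx.2, hx.1.1⟩
    · exact fun x hx => ⟨⟨hx.2, (le_sup_left : V ≤ Wc j i) hx.1⟩, hx.1⟩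
  have hKS : ∀ j i, Kc j i ⊓ S = Vc j i ⊓ S := fun j i => by
    rw [← hKV, inf_assoc (Kc j i), inf_eq_right.2 hSV]
  have hVS : ∀ j i, Vc j i ⊓ S = Vc j i ⊓ V.comap Φ := fun j i => by
    apply le_antisymm
    · exact fun x hx => ⟨hx.1, hx.2.2⟩
    · exact fun x hx => ⟨hx.1, hx.1.1, hx.2⟩
  have dW : ∀ j i, finrank Ω (Wc j i) + finrank Ω ↥(Vc j i ⊓ S) = k + finrank Ω (Vc j i) :=
    fun j i => by rw [hVS]; exact finrank_sup_map _ _ _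
  have hWF : ∀ j i i', i ≤ i' → Wc j i ≤ V ⊔ (fl (f j) i' ⊓ Wc j i) := fun j i i' hi => by
    apply sup_le le_sup_left
    rintro _ ⟨x, hx, rfl⟩
    obtain ⟨y, hy, z, hz, hyz⟩ := Submodule.mem_sup.1 (hΦ j i x hx)
    rw [← hyz, add_comm]
    refine Submodule.add_mem_sup hz ⟨fl_mono _ hi hy, ?_⟩
    rw [eq_sub_of_add_eq hyz]
    exact (Wc j i).sub_mem ((le_sup_right : _ ≤ Wc j i) ⟨x, hx, rfl⟩) ((le_sup_left : V ≤ Wc j i) hz)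
  have dK : ∀ j i i', i ≤ i' → finrank Ω ↥(fl (f j) i' ⊓ Wc j i) + finrank Ω ↥(Vc j i ⊓ S) =
      finrank Ω (Vc j i') + finrank Ω (Vc j i) := fun j i i' hi => by
    have h1 := Submodule.finrank_sup_add_finrank_inf_eq V (fl (f j) i' ⊓ Wc j i)
    have h2 : V ⊔ (fl (f j) i' ⊓ Wc j i) = Wc j i :=
      le_antisymm (sup_le le_sup_left inf_le_right) (hWF j i i' hi)
    have h3 : V ⊓ (fl (f j) i' ⊓ Wc j i) = Vc j i' := by
      rw [inf_left_comm, inf_eq_left.2 (le_sup_left : V ≤ Wc j i), inf_comm]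
    rw [h2, h3] at h1
    have := dW j i
    omega
  have dKK : finrank Ω K + finrank Ω S = k + k := finrank_sup_map _ _ _
  have kn : k ≤ n := by simpa using Submodule.finrank_le V
  have dk : finrank Ω S < k := by
    apply Submodule.finrank_lt_finrank_of_lt
    refine lt_of_le_of_ne hSV fun h => ?_
    obtain ⟨x, hx, hxV⟩ := hcon
    rw [← h] at hx
    exact hxV hx.2
  have II := chain_bound (K₀ := K₀) hf (S := S) (K := K) (Kc := Kc) (hSV.trans le_sup_left) hKm hK0
    hKn (fun j i => inf_le_left)
  obtain ⟨F₁, c1, rV⟩ := exists_cost_sub (isRational_top (⊥ : IntermediateField K₀ Ω))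
    (le_top (a := V))
  obtain ⟨F₂, c2, rS⟩ := exists_cost_sub rV hSV
  obtain ⟨F₃, c, M, c3, hc, hM, hcM⟩ := exists_cost_map rS hSV Φ
    (fun x hx => hx.2) hcon
  have hWM : ∀ j i, Wc j i = V ⊔ (Vc j i).map M.mulVecLin := by
    intro j i
    apply le_antisymm
    · apply sup_le le_sup_left
      rintro _ ⟨x, hx, rfl⟩
      have e : Φ x = c⁻¹ • (c • Φ x - M.mulVec x) + c⁻¹ • M.mulVec x := by
        rw [smul_sub, sub_add_cancel, smul_smul, inv_mul_cancel₀ hc, one_smul]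
      rw [e]
      exact Submodule.add_mem_sup (V.smul_mem _ (hcM x hx.1))
        (Submodule.smul_mem _ _ ⟨x, hx, rfl⟩)
    · apply sup_le le_sup_left
      rintro _ ⟨x, hx, rfl⟩
      have e : M.mulVecLin x = - (c • Φ x - M.mulVec x) + c • Φ x := by
        simp
      rw [e]
      exact Submodule.add_mem_sup (V.neg_mem (hcM x hx.1)) (Submodule.smul_mem _ _ ⟨x, hx, rfl⟩)
  have hKW : ∀ j i, Kc j (i + 1) ⊓ Wc j i = fl (f j) (i + 1) ⊓ Wc j i := fun j i => by
    simp only [Kc]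
    rw [inf_assoc, inf_eq_right.2 (hWm j i.le_succ)]
  have vm : ∀ j i, finrank Ω (Vc j i) ≤ finrank Ω (Vc j (i + 1)) := fun j i =>
    Submodule.finrank_mono (hVm j i.le_succ)
  have sm : ∀ j i, finrank Ω ↥(Vc j i ⊓ S) ≤ finrank Ω ↥(Vc j (i + 1) ⊓ S) := fun j i =>
    Submodule.finrank_mono (inf_le_inf_right _ (hVm j i.le_succ))
  have sv : ∀ j i, finrank Ω ↥(Vc j i ⊓ S) ≤ finrank Ω (Vc j i) := fun j i =>
    Submodule.finrank_mono inf_le_left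
  have step : ∀ j, ∀ N ≤ n, ∀ F, F₃ ≤ F → IsRational F (Vc j N) → IsRational F (Kc j N) →
      ∃ F', Cost F F' (∑ i ∈ Finset.range N,
        (finrank Ω ↥(Vc j i ⊓ S) * (finrank Ω ↥(Vc j (i + 1) ⊓ S) - finrank Ω ↥(Vc j i ⊓ S)) +
        2 * ((finrank Ω (Vc j i) - finrank Ω ↥(Vc j i ⊓ S)) *
          (finrank Ω (Vc j (i + 1)) - finrank Ω (Vc j i))) + (n - finrank Ω (Kc j i)))) ∧
        ∀ i : Fin n, (i : ℕ) < N → ∀ l, f j i l ∈ F' := by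
    intro j N
    induction N with
    | zero => exact fun _ F _ _ _ => ⟨F, by simpa using Cost.refl F, fun i hi => by omega⟩
    | succ N ih =>
      intro hN F hF rVN rKN
      obtain ⟨G₁, g1, r1⟩ := exists_cost_sub
        (rVN.inf (rS.mono (c3.1.trans hF))) (inf_le_inf_right S (hVm j N.le_succ))
      obtain ⟨G₂, g2, r2⟩ := exists_cost_between r1 (rVN.mono g1.1)
        (inf_le_left : Vc j N ⊓ S ≤ Vc j N) (hVm j N.le_succ)
      have hG₂ : F₃ ≤ G₂ := hF.trans (g1.1.trans g2.1)
      have rW : IsRational G₂ (Wc j N) := by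
        rw [hWM]
        exact (rV.mono (c2.1.trans (c3.1.trans hG₂))).sup (r2.map fun i l => hG₂ (hM i l))
      obtain ⟨G₃, g3, r3⟩ := exists_cost_between r2 ((rKN.mono (g1.1.trans g2.1)).inf rW)
        (hKV j N ▸ inf_le_left : Vc j N ≤ Kc j N) (le_inf (hKm j N.le_succ) inf_le_right)
      obtain ⟨G₄, g4, r4⟩ := exists_cost_perp r3 (f := f j ⟨N, hN⟩)
        (fun x hx => mem_fl.1 hx.1 _ le_rfl)
      have h34 := g3.1.trans g4.1
      obtain ⟨F', g5, r5⟩ := ih (by omega) G₄ (hG₂.trans h34) (r2.mono h34) (r3.mono g4.1)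
      refine ⟨F', ((((g1.trans g2).trans g3).trans g4).trans g5).mono (le_of_eq ?_), ?_⟩
      · rw [Finset.sum_range_succ, hKW, Fintype.card_fin]
        have a1 := dK j N (N + 1) N.le_succ
        have a2 : finrank Ω (Kc j N) + finrank Ω ↥(Vc j N ⊓ S) = _ := dK j N N le_rfl
        have a3 := vm j N
        have a4 := sv j N
        have e1 : finrank Ω (Kc j N) - finrank Ω (Vc j N) =
          finrank Ω (Vc j N) - finrank Ω ↥(Vc j N ⊓ S) := by omega
        have e2 : finrank Ω ↥(fl (f j) (N + 1) ⊓ Wc j N) - finrank Ω (Kc j N) =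
          finrank Ω (Vc j (N + 1)) - finrank Ω (Vc j N) := by omega
        rw [e1, e2]
        ring
      · intro i hi l
        rcases Nat.lt_succ_iff_lt_or_eq.1 hi with h | h
        · exact r5 i h l
        · have : i = ⟨N, hN⟩ := Fin.ext h
          rw [this]
          exact g5.1 (r4 l)
  obtain ⟨F₄, c4, r4⟩ := exists_cost_forall (F₀ := F₃) (P := fun j F => ∀ i l, f j i l ∈ F)
    (fun a F F' h h' i l => h (h' i l)) (fun j F hF => by
      have rVF := rV.mono (c2.1.trans (c3.1.trans hF))
      obtain ⟨F', h1, h2⟩ := step j n le_rfl F hF (by rwa [hVn j n le_rfl])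
        (by
          have := hWM j n
          simp only [Wc, hVn j n le_rfl] at this
          rw [hKn j n le_rfl]
          show IsRational F (V ⊔ V.map Φ)
          rw [this]
          exact rVF.sup (rVF.map fun i l => hF (hM i l)))
      exact ⟨F', h1, fun i => h2 i i.2⟩)
  have T := (card_le_tr hf fun x => r4 _ _ _).trans (((c1.trans c2).trans c3).trans c4).2
  rw [tr_bot, zero_add] at T
  norm_cast at T
  rw [finrank_top, Module.finrank_fin_fun] at T
  have hkn : k < n := by
    by_contra! h
    obtain ⟨x, hx, hxV⟩ := hcon
    have hV : V = ⊤ := Submodule.eq_top_of_finrank_eq (by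
      rw [Module.finrank_fin_fun]
      have := Submodule.finrank_le V
      rw [Module.finrank_fin_fun] at this
      omega)
    exact hxV (by rw [hV]; exact Submodule.mem_top)
  have id1 : ∀ j, ∑ i ∈ Finset.range n,
        (finrank Ω ↥(Vc j i ⊓ S) * (finrank Ω ↥(Vc j (i + 1) ⊓ S) - finrank Ω ↥(Vc j i ⊓ S)) +
        2 * ((finrank Ω (Vc j i) - finrank Ω ↥(Vc j i ⊓ S)) *
          (finrank Ω (Vc j (i + 1)) - finrank Ω (Vc j i))) + (n - finrank Ω (Kc j i))) +
      ∑ i ∈ Finset.range n, finrank Ω ↥(Kc j i ⊓ S) *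
        (finrank Ω (Kc j (i + 1)) - finrank Ω (Kc j i)) +
      2 * ∑ i ∈ Finset.range n, finrank Ω (Vc j i) =
      2 * k.choose 2 + n * n + ∑ i ∈ Finset.range n, finrank Ω ↥(Kc j i ⊓ S) := by
    intro j
    have tc := telescope_choose (v := fun i => finrank Ω (Vc j i))
      (show finrank Ω (Vc j 0) = 0 by rw [hV0]; exact finrank_bot _ _) (vm j)
      (fun i => finrank_fl_succ_le (f j) V i) n
    beta_reduce at tc
    rw [hVn j n le_rfl] at tc
    have e : n * n = ∑ i ∈ Finset.range n, n := by simp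
    rw [hk, ← tc, e, Finset.mul_sum, Finset.mul_sum, ← Finset.sum_add_distrib,
      ← Finset.sum_add_distrib, ← Finset.sum_add_distrib, ← Finset.sum_add_distrib]
    refine Finset.sum_congr rfl fun i _ => ?_
    rw [hKS]
    have a1 : finrank Ω (Kc j i) + finrank Ω ↥(Vc j i ⊓ S) = _ := dK j i i le_rfl
    have a2 : finrank Ω (Kc j (i + 1)) + finrank Ω ↥(Vc j (i + 1) ⊓ S) = _ :=
      dK j (i + 1) (i + 1) le_rfl
    have a3 := vm j i
    have a4 := sv j i
    have a5 := sm j i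
    have a6 : finrank Ω (Kc j i) ≤ finrank Ω (Kc j (i + 1)) :=
      Submodule.finrank_mono (hKm j i.le_succ)
    have a7 : finrank Ω (Kc j i) ≤ n := by simpa using Submodule.finrank_le (Kc j i)
    generalize finrank Ω (Kc j i) = κ at *
    generalize finrank Ω (Kc j (i + 1)) = κ' at *
    generalize finrank Ω (Vc j i) = v at *
    generalize finrank Ω (Vc j (i + 1)) = v' at *
    generalize finrank Ω ↥(Vc j i ⊓ S) = s at *
    generalize finrank Ω ↥(Vc j (i + 1) ⊓ S) = s' at *
    zify [a3, a4, a5, a6, a7]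
    have b1 : (κ : ℤ) = 2 * v - s := by push_cast [← @Nat.cast_inj ℤ] at a1; linarith
    have b2 : (κ' : ℤ) = 2 * v' - s' := by push_cast [← @Nat.cast_inj ℤ] at a2; linarith
    rw [b1, b2]
    ring
  have id2 := Finset.sum_congr (rfl : (Finset.univ : Finset J) = _) fun j _ => id1 j
  simp only [Finset.sum_add_distrib, ← Finset.mul_sum, Fintype.card_prod, Fintype.card_fin,
    Finset.sum_const, Finset.card_univ, smul_eq_mul] at id2 T II hbal
  change ∑ j, ∑ i ∈ Finset.range n, finrank Ω (Vc j i) = _ at hbal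
  rw [hbal] at id2
  obtain ⟨μ, hμ⟩ := Nat.exists_eq_add_of_lt dk
  obtain ⟨r, hr⟩ : ∃ r, n = k + (μ + 1) + r := by
    have : finrank Ω K ≤ n := by simpa using Submodule.finrank_le K
    exact ⟨n - (k + (μ + 1)), by omega⟩
  have q1 : n - k = μ + 1 + r := by omega
  have q2 : n - finrank Ω K = r := by omega
  have q3 : k - finrank Ω S = μ + 1 := by omega
  rw [← hk, q1, q3] at T
  rw [q1] at id2
  rw [q2] at II
  have q4 : (μ + 1) * (μ + 1 + r) = (μ + 1) * (μ + 1 + r) - 1 + 1 :=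
    (Nat.sub_add_cancel (Nat.mul_pos (by omega) (by omega))).symm
  have q5 : k * (μ + 1 + r) = finrank Ω S * (μ + 1) + finrank Ω S * r + (μ + 1) * (μ + 1 + r) := by
    rw [show k = finrank Ω S + μ + 1 from hμ]; ring
  linarith

end Tangent

section Problems

variable {Ω : Type*} [Field Ω] {n : ℕ} {J W : Type*}

/-- The solutions `V` of the Schubert problem `dim (V ∩ F_{s_q}) > q` for all flags. -/
def SchubertSet (k : ℕ) (f : J → Fin n → Fin n → Ω) (s : J → ℕ → ℕ) :
    Set (Submodule Ω (Fin n → Ω)) :=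
  {V | finrank Ω V = k ∧ ∀ j, ∀ q < k, q + 1 ≤ finrank Ω ↥(V ⊓ fl (f j) (s j q))}

/-- The solutions `(ℓ, V)` where additionally `ℓ` is a line in `V ∩ F_b` killed by the `w a`. -/
def MarkedSet (k : ℕ) (f : J → Fin n → Fin n → Ω) (s : J → ℕ → ℕ) (w : W → Fin n → Ω) (o : J)
    (b : ℕ) : Set (Submodule Ω (Fin n → Ω) × Submodule Ω (Fin n → Ω)) :=
  {x | x.2 ∈ SchubertSet k f s ∧ finrank Ω x.1 = 1 ∧ x.1 ≤ x.2 ⊓ fl (f o) b ∧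
    ∀ a, ∀ z ∈ x.1, w a ⬝ᵥ z = 0}

/-- Infinitesimal rigidity of a solution of a marked problem. -/
def Nondeg (k : ℕ) (f : J → Fin n → Fin n → Ω) (s : J → ℕ → ℕ) (w : W → Fin n → Ω) (o : J)
    (b : ℕ) (x : Submodule Ω (Fin n → Ω) × Submodule Ω (Fin n → Ω)) : Prop :=
  ∀ Φ : (Fin n → Ω) →ₗ[Ω] (Fin n → Ω),
    (∀ j, ∀ q < k, ∀ z ∈ x.2 ⊓ fl (f j) (s j q), Φ z ∈ fl (f j) (s j q) ⊔ x.2) →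
    ∀ u ∈ x.1, u ≠ 0 → ∀ y ∈ fl (f o) b, y - Φ u ∈ x.2 → (∀ a, w a ⬝ᵥ y = 0) →
      (∀ z ∈ x.2, Φ z ∈ x.2) ∧ y ∈ x.1

end Problems

section Reduction

variable {K : Type*} [Field K] (O : ValuationSubring K) {ι : Type*} [Fintype ι]

theorem exists_scale {α : Type*} [Finite α] (g : α → K) (hg : g ≠ 0) :
    ∃ c : K, c ≠ 0 ∧ ∃ g' : α → O, (∀ i, g i = c * g' i) ∧ ∃ i, g' i = 1 := by
  obtain ⟨i₁, h₁⟩ := Function.ne_iff.1 hg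
  have : Nonempty α := ⟨i₁⟩
  obtain ⟨i₀, h₀⟩ := Finite.exists_max fun i => O.valuation (g i)
  have hc : g i₀ ≠ 0 := by
    intro h
    have := h₀ i₁
    rw [h, map_zero, le_zero_iff, map_eq_zero] at this
    exact h₁ this
  refine ⟨g i₀, hc, fun i => ⟨g i / g i₀, ?_⟩, fun i => by field_simp, i₀, Subtype.ext (div_self hc)⟩
  rw [← O.valuation_le_one_iff, map_div₀]
  exact div_le_one_of_le₀ (h₀ i) zero_le

/-- The reduction of a subspace modulo the maximal ideal of a valuation ring. -/
def red (U : Submodule K (ι → K)) :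
    Submodule (IsLocalRing.ResidueField O) (ι → IsLocalRing.ResidueField O) where
  carrier := {z | ∃ x : ι → O, (fun i => (x i : K)) ∈ U ∧ (fun i => IsLocalRing.residue O (x i)) = z}
  add_mem' := by
    rintro _ _ ⟨x, hx, rfl⟩ ⟨y, hy, rfl⟩
    exact ⟨x + y, by simpa using! U.add_mem hx hy, by funext i; simp⟩
  zero_mem' := ⟨0, U.zero_mem, by funext i; simp⟩
  smul_mem' := by
    rintro c _ ⟨x, hx, rfl⟩
    obtain ⟨c, rfl⟩ := IsLocalRing.residue_surjective c
    exact ⟨c • x, by simpa using! U.smul_mem (c : K) hx, by funext i; simp⟩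

variable {O}

theorem red_mono {U U' : Submodule K (ι → K)} (h : U ≤ U') : red O U ≤ red O U' := by
  rintro _ ⟨x, hx, rfl⟩
  exact ⟨x, h hx, rfl⟩

theorem red_bot : red O (⊥ : Submodule K (ι → K)) = ⊥ := by
  rw [eq_bot_iff]
  rintro _ ⟨x, hx, rfl⟩
  rw [Submodule.mem_bot] at hx ⊢
  funext i
  have : x i = 0 := Subtype.ext (congrFun hx i)
  simp [this]

theorem finrank_inf_ker_proj {F : Type*} [Field F] {U : Submodule F (ι → F)} {x : ι → F}
    (hx : x ∈ U) {m : ι} (hm : x m ≠ 0) :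
    finrank F U = finrank F ↥(U ⊓ LinearMap.ker (LinearMap.proj m : (ι → F) →ₗ[F] F)) + 1 := by
  have h1 := finrank_inf_ker_add_one U (LinearMap.proj m : (ι → F) →ₗ[F] F)
  have h2 : U ⊓ LinearMap.ker (LinearMap.proj m : (ι → F) →ₗ[F] F) < U :=
    lt_of_le_of_ne inf_le_left fun h => hm (h.ge hx).2
  have := Submodule.finrank_lt_finrank_of_lt h2
  omega

theorem finrank_red (U : Submodule K (ι → K)) :
    finrank (IsLocalRing.ResidueField O) (red O U) = finrank K U := by
  induction h : finrank K U generalizing U with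
  | zero =>
    rw [Submodule.finrank_eq_zero] at h
    rw [h, red_bot]; exact finrank_bot _ _
  | succ d ih =>
    obtain ⟨x, hx, hx0⟩ := Submodule.exists_mem_ne_zero_of_ne_bot
      (show U ≠ ⊥ by rintro rfl; rw [finrank_bot] at h; omega)
    obtain ⟨c, hc, y, hy, m, hm⟩ := exists_scale O x hx0
    have hyU : (fun i => (y i : K)) ∈ U := by
      have : (fun i => (y i : K)) = c⁻¹ • x := by
        funext i; simp [hy, hc]
      rw [this]; exact U.smul_mem _ hx
    have h1 := finrank_inf_ker_proj hyU (m := m) (by simp [hm])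
    have h2 : red O U ⊓ LinearMap.ker (LinearMap.proj m) =
        red O (U ⊓ LinearMap.ker (LinearMap.proj m : (ι → K) →ₗ[K] K)) := by
      ext z
      constructor
      · rintro ⟨⟨x, hx, rfl⟩, hz⟩
        have hz : IsLocalRing.residue O (x m) = 0 := hz
        refine ⟨x - x m • y, ⟨?_, ?_⟩, by funext i; simp [hz]⟩
        · have : (fun i => ((x - x m • y) i : K)) =
            (fun i => (x i : K)) - (x m : K) • fun i => (y i : K) := by
            funext i; simp
          rw [this]
          exact U.sub_mem hx (U.smul_mem _ hyU)
        · simp [hm]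
      · rintro ⟨x, ⟨hx, hx'⟩, rfl⟩
        refine ⟨⟨x, hx, rfl⟩, ?_⟩
        have hx' : (x m : K) = 0 := hx'
        have : x m = 0 := Subtype.ext hx'
        simp [this]
    have h3 := finrank_inf_ker_proj (U := red O U) (m := m) ⟨y, hyU, rfl⟩ (by simp [hm])
    rw [h] at h1
    rw [h3, h2, ih _ (Nat.succ.inj h1).symm]

theorem eq_zero_of_red {V : Submodule K (ι → K)} {P : Finset ι}
    (h : ∀ z ∈ red O V, (∀ i ∈ P, z i = 0) → z = 0) {x : ι → K} (hx : x ∈ V)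
    (hP : ∀ i ∈ P, x i = 0) : x = 0 := by
  by_contra hx0
  obtain ⟨c, hc, y, hy, m, hm⟩ := exists_scale O x hx0
  have hyV : (fun i => (y i : K)) ∈ V := by
    have : (fun i => (y i : K)) = c⁻¹ • x := by
      funext i; simp [hy, hc]
    rw [this]; exact V.smul_mem _ hx
  have := h _ ⟨y, hyV, rfl⟩ (fun i hi => by
    have h1 := hy i
    rw [hP i hi, eq_comm, mul_eq_zero, or_iff_right hc] at h1
    have : y i = 0 := Subtype.ext h1
    simp [this])
  have := congrFun this m
  simp [hm] at this

theorem exists_integral_echelon {V : Submodule K (ι → K)} {P : Finset ι}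
    {b₀ : ι → ι → IsLocalRing.ResidueField O} (h : IsEchelon (red O V) P b₀) :
    ∃ b : ι → ι → O, IsEchelon V P (fun p i => (b p i : K)) ∧
      ∀ p ∈ P, (fun i => IsLocalRing.residue O (b p i)) = b₀ p := by
  obtain ⟨P', hP', b, hb⟩ := exists_isEchelon V P fun x hx => eq_zero_of_red h.disj hx
  obtain rfl : P' = P := Finset.eq_of_subset_of_card_le hP' (by
    rw [← hb.finrank_eq, ← finrank_red (O := O), h.finrank_eq])
  have key : ∀ p ∈ P', ∀ i, b p i ∈ O := by
    intro p hp
    have hbp : b p ≠ 0 := fun h0 => by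
      have := hb.delta p hp p hp
      simp [h0] at this
    obtain ⟨c, hc, y, hy, m, hm⟩ := exists_scale O (b p) hbp
    by_cases hcO : c ∈ O
    · intro i
      rw [hy]; exact O.mul_mem _ _ hcO (y i).2
    exfalso
    have hci := (O.mem_or_inv_mem c).resolve_left hcO
    have hyV : (fun i => (y i : K)) ∈ V := by
      have : (fun i => (y i : K)) = c⁻¹ • b p := by
        funext i; simp [hy, hc]
      rw [this]; exact V.smul_mem _ (hb.mem p hp)
    have hres : IsLocalRing.residue O ⟨c⁻¹, hci⟩ = 0 := by
      rw [IsLocalRing.residue_eq_zero_iff, IsLocalRing.mem_maximalIdeal, mem_nonunits_iff]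
      intro hu
      obtain ⟨d, hd⟩ := hu.exists_right_inv
      have hd' : c⁻¹ * (d : K) = 1 := congrArg Subtype.val hd
      have : c = d := by field_simp at hd'; exact hd'.symm
      exact hcO (this ▸ d.2)
    have := h.disj _ ⟨y, hyV, rfl⟩ (fun i hi => by
      have h1 : (y i : K) = c⁻¹ * if p = i then 1 else 0 := by
        rw [← hb.delta p hp i hi, hy]; field_simp
      have h2 : y i = ⟨c⁻¹, hci⟩ * if p = i then 1 else 0 := Subtype.ext (by
        rw [h1]; split_ifs <;> simp)
      show IsLocalRing.residue O (y i) = 0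
      rw [h2, map_mul, hres, zero_mul])
    have := congrFun this m
    simp [hm] at this
  refine ⟨fun p i => if h : p ∈ P' then ⟨b p i, key p h i⟩ else 0, ?_, ?_⟩
  · have e : ∀ p ∈ P', (fun i => ((if h : p ∈ P' then (⟨b p i, key p h i⟩ : O) else 0 : O) : K)) =
        b p := fun p hp => by
      funext i; simp [hp]
    refine ⟨fun p hp => by rw [e p hp]; exact hb.mem p hp, fun p hp q hq => ?_, hb.disj⟩
    rw [congrFun (e p hp) q]; exact hb.delta p hp q hq
  · intro p hp
    rw [← sub_eq_zero]
    refine h.disj _ (Submodule.sub_mem _ ⟨fun i => ⟨b p i, key p hp i⟩, hb.mem p hp, ?_⟩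
      (h.mem p hp)) fun i hi => ?_
    · funext i; simp [hp]
    · have h1 := h.delta p hp i hi
      have h2 := hb.delta p hp i hi
      have h3 : (⟨b p i, key p hp i⟩ : O) = if p = i then 1 else 0 := Subtype.ext (by
        rw [show ((⟨b p i, key p hp i⟩ : O) : K) = b p i from rfl, h2]; split_ifs <;> simp)
      simp only [Pi.sub_apply, dif_pos hp, h1, h3]
      split_ifs <;> simp

theorem red_fl {n : ℕ} {f : Fin n → Fin n → O} (hf : IsUnit (Matrix.of f).det) (i : ℕ) :
    red O (fl (fun l m => (f l m : K)) i) = fl (fun l m => IsLocalRing.residue O (f l m)) i := by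
  rcases le_total n i with hi | hi
  · rw [fl_of_le _ hi, fl_of_le _ hi, eq_top_iff]
    intro z _
    choose x hx using fun i => IsLocalRing.residue_surjective (R := O) (z i)
    exact ⟨x, Submodule.mem_top, funext hx⟩
  have h1 : (Matrix.of fun l m => (f l m : K)).det ≠ 0 := by
    have : (Matrix.of fun l m => (f l m : K)) = (Matrix.of f).map O.subtype := rfl
    rw [this, ← RingHom.mapMatrix_apply, ← RingHom.map_det]
    exact (hf.map O.subtype).ne_zero
  have h2 : (Matrix.of fun l m => IsLocalRing.residue O (f l m)).det ≠ 0 := by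
    have : (Matrix.of fun l m => IsLocalRing.residue O (f l m)) =
      (Matrix.of f).map (IsLocalRing.residue O) := rfl
    rw [this, ← RingHom.mapMatrix_apply, ← RingHom.map_det]
    exact (hf.map (IsLocalRing.residue O)).ne_zero
  refine Submodule.eq_of_le_of_finrank_eq ?_ (by rw [finrank_red, finrank_fl h1 hi, finrank_fl h2 hi])
  rintro _ ⟨x, hx, rfl⟩ l hl
  have h3 : f l ⬝ᵥ x = 0 := Subtype.ext (by simpa [dotProduct] using hx l hl)
  simpa [dotProduct] using congrArg (IsLocalRing.residue O) h3

theorem red_sup {V F : Submodule K (ι → K)}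
    (h : finrank (IsLocalRing.ResidueField O) ↥(red O V ⊓ red O F) = finrank K ↥(V ⊓ F)) :
    red O (F ⊔ V) = red O F ⊔ red O V := by
  refine (Submodule.eq_of_le_of_finrank_eq (sup_le (red_mono le_sup_left) (red_mono le_sup_right))
    ?_).symm
  have h1 := Submodule.finrank_sup_add_finrank_inf_eq F V
  have h2 := Submodule.finrank_sup_add_finrank_inf_eq (red O F) (red O V)
  rw [inf_comm] at h1 h2
  simp only [finrank_red] at h2 ⊢
  omega

variable {n : ℕ} {J W : Type*}

theorem Nondeg.rigid {k b₀ : ℕ} {f : J → Fin n → Fin n → O} {s : J → ℕ → ℕ} {w : W → Fin n → O}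
    {o : J} (hf : ∀ j, IsUnit (Matrix.of (f j)).det) {V : Submodule K (Fin n → K)}
    {ℓ : Submodule (IsLocalRing.ResidueField O) (Fin n → IsLocalRing.ResidueField O)}
    (hnd : Nondeg k (fun j l m => IsLocalRing.residue O (f j l m)) s
      (fun a m => IsLocalRing.residue O (w a m)) o b₀ (ℓ, red O V))
    (hdim : ∀ j, ∀ q < k, finrank (IsLocalRing.ResidueField O)
        ↥(red O V ⊓ fl (fun l m => IsLocalRing.residue O (f j l m)) (s j q)) =
      finrank K ↥(V ⊓ fl (fun l m => (f j l m : K)) (s j q)))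
    (hℓ : finrank (IsLocalRing.ResidueField O) ℓ = 1) {P : Finset (Fin n)}
    {b : Fin n → Fin n → O} (hb : IsEchelon V P fun p i => (b p i : K))
    (hb' : ∀ z ∈ red O V, (∀ i ∈ P, z i = 0) → z = 0)
    {u : Fin n → O} (hu : (fun i => IsLocalRing.residue O (u i)) ∈ ℓ) {m₀ : Fin n}
    (hm₀ : u m₀ = 1) {d : Fin n → Fin n → K} (hd : ∀ p, ∀ i ∈ P, d p i = 0)
    (hd' : ∀ p ∉ P, d p = 0)
    (hΦ : ∀ j, ∀ q < k, ∀ z ∈ red O V ⊓ fl (fun l m => IsLocalRing.residue O (f j l m)) (s j q),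
      ∃ ζ : Fin n → O, (fun i => IsLocalRing.residue O (ζ i)) = z ∧
        ∑ p ∈ P, (ζ p : K) • d p ∈ fl (fun l m => (f j l m : K)) (s j q) ⊔ V)
    {y : Fin n → K} (hy : y ∈ fl (fun l m => (f o l m : K)) b₀)
    (hyw : ∀ a, (fun m => (w a m : K)) ⬝ᵥ y = 0) (hym : y m₀ = 0) {e : Fin n → Fin n → O}
    (he : ∀ p i, IsLocalRing.residue O (e p i) = 0)
    (hyV : y - ∑ p ∈ P, (u p : K) • d p - ∑ p ∈ P, y p • (fun i => (e p i : K)) ∈ V) :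
    d = 0 ∧ y = 0 := by
  by_contra hcon
  have hg : (Sum.elim (fun p : Fin n × Fin n => d p.1 p.2) y) ≠ 0 := by
    intro h
    exact hcon ⟨funext fun p => funext fun i => congrFun h (Sum.inl (p, i)),
      funext fun i => congrFun h (Sum.inr i)⟩
  obtain ⟨c, hc, g, hgc, hone⟩ := exists_scale O _ hg
  let D : Fin n → Fin n → O := fun p i => g (Sum.inl (p, i))
  let Y : Fin n → O := fun i => g (Sum.inr i)
  have hD : ∀ p, d p = c • fun i => (D p i : K) := fun p => funext fun i => hgc (Sum.inl (p, i))
  have hY : y = c • fun i => (Y i : K) := funext fun i => hgc (Sum.inr i)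
  have hone' : (∃ p i, D p i = 1) ∨ ∃ i, Y i = 1 := by
    obtain ⟨(⟨p, i⟩ | i), h⟩ := hone
    exacts [Or.inl ⟨p, i, h⟩, Or.inr ⟨i, h⟩]
  have div : ∀ {U : Submodule K (Fin n → K)} {x : Fin n → K}, c • x ∈ U → x ∈ U :=
    fun {U x} h => by simpa [smul_smul, inv_mul_cancel₀ hc] using U.smul_mem c⁻¹ h
  let res := IsLocalRing.residue O
  let Φ : (Fin n → IsLocalRing.ResidueField O) →ₗ[IsLocalRing.ResidueField O]
      (Fin n → IsLocalRing.ResidueField O) :=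
    ∑ p ∈ P, (LinearMap.proj p).smulRight fun i => res (D p i)
  have hΦa : ∀ z, Φ z = ∑ p ∈ P, z p • fun i => res (D p i) := fun z => by
    simp [Φ]
  have h := hnd Φ ?_ _ hu (fun h0 => by
    have := congrFun h0 m₀
    simp [hm₀] at this) (fun i => res (Y i)) ?_ ?_ ?_
  · have hD0 : ∀ p i, res (D p i) = 0 := by
      intro p i
      by_cases hp : p ∈ P
      · have h1 : (fun i => res (D p i)) ∈ red O V := by
          have := h.1 (fun i => res (b p i)) ⟨b p, hb.mem p hp, rfl⟩
          rw [hΦa, Finset.sum_eq_single_of_mem p hp] at this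
          · have h2 := hb.delta p hp p hp
            rw [if_pos rfl] at h2
            have h3 : b p p = 1 := Subtype.ext h2
            simpa [h3] using! this
          · intro q hq hqp
            have h2 := hb.delta p hp q hq
            rw [if_neg hqp.symm] at h2
            have h3 : b p q = 0 := Subtype.ext h2
            simp [h3]
        refine congrFun (hb' _ h1 fun i hi => ?_) i
        have h2 := hgc (Sum.inl (p, i))
        rw [Sum.elim_inl, hd p i hi, eq_comm, mul_eq_zero, or_iff_right hc] at h2
        have h3 : D p i = 0 := Subtype.ext h2
        simp [h3]
      · have h2 := hgc (Sum.inl (p, i))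
        rw [Sum.elim_inl, hd' p hp, Pi.zero_apply, eq_comm, mul_eq_zero, or_iff_right hc] at h2
        have h3 : D p i = 0 := Subtype.ext h2
        simp [h3]
    have hY0 : ∀ i, res (Y i) = 0 := by
      have hne : (⟨_, hu⟩ : ℓ) ≠ 0 := fun h0 => by
        have := congrFun (congrArg Subtype.val h0) m₀
        simp [hm₀] at this
      obtain ⟨a, ha⟩ := (finrank_eq_one_iff_of_nonzero' _ hne).1 hℓ ⟨_, h.2⟩
      have ha' : ∀ i, a * res (u i) = res (Y i) := fun i => congrFun (congrArg Subtype.val ha) i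
      have h2 := hgc (Sum.inr m₀)
      rw [Sum.elim_inr, hym, eq_comm, mul_eq_zero, or_iff_right hc] at h2
      have h3 : Y m₀ = 0 := Subtype.ext h2
      have h4 := ha' m₀
      rw [hm₀, h3, map_one, map_zero, mul_one] at h4
      intro i
      rw [← ha', h4, zero_mul]
    rcases hone' with ⟨p, i, h1⟩ | ⟨i, h1⟩
    · have := hD0 p i; simp [res, h1] at this
    · have := hY0 i; simp [res, h1] at this
  · intro j q hq z hz
    obtain ⟨ζ, rfl, hζ⟩ := hΦ j q hq z hz
    rw [← red_fl (hf j), ← red_sup (by rw [red_fl (hf j)]; exact hdim j q hq), hΦa]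
    refine ⟨∑ p ∈ P, ζ p • D p, div (?_ : c • _ ∈ _), ?_⟩
    · convert hζ using 1
      funext i
      simp [hD, Finset.mul_sum, mul_left_comm]
    · funext i
      simp [res]
  · rw [← red_fl (hf o)]
    exact ⟨Y, div (hY ▸ hy), rfl⟩
  · refine ⟨Y - ∑ p ∈ P, u p • D p - ∑ p ∈ P, Y p • e p, div (?_ : c • _ ∈ _), ?_⟩
    · convert hyV using 1
      funext i
      simp [hD, hY, Finset.mul_sum, mul_left_comm, mul_sub, mul_assoc]
    · rw [hΦa]
      funext i
      simp [res, he]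
  · intro a
    have h1 : w a ⬝ᵥ Y = 0 := by
      refine Subtype.ext (mul_left_cancel₀ hc ?_)
      have := hyw a
      rw [hY, dotProduct_smul, smul_eq_mul] at this
      simpa [dotProduct] using this
    simpa [dotProduct, res] using congrArg res h1

section Solutions

variable {k b₀ : ℕ} {f : J → Fin n → Fin n → O} {s : J → ℕ → ℕ} {w : W → Fin n → O} {o : J}

theorem red_mem_markedSet (hf : ∀ j, IsUnit (Matrix.of (f j)).det)
    {x : Submodule K (Fin n → K) × Submodule K (Fin n → K)}
    (hx : x ∈ MarkedSet k (fun j l m => (f j l m : K)) s (fun a m => (w a m : K)) o b₀) :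
    (red O x.1, red O x.2) ∈ MarkedSet k (fun j l m => IsLocalRing.residue O (f j l m)) s
      (fun a m => IsLocalRing.residue O (w a m)) o b₀ := by
  obtain ⟨⟨h1, h2⟩, h3, h4, h5⟩ := hx
  refine ⟨⟨(finrank_red _).trans h1, fun j q hq => (h2 j q hq).trans ?_⟩, (finrank_red _).trans h3,
    ?_, ?_⟩
  · rw [← finrank_red (O := O), ← red_fl (hf j)]
    exact Submodule.finrank_mono (le_inf (red_mono inf_le_left) (red_mono inf_le_right))
  · rw [← red_fl (hf o)]
    exact le_inf (red_mono (h4.trans inf_le_left)) (red_mono (h4.trans inf_le_right))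
  · rintro a _ ⟨z, hz, rfl⟩
    have : w a ⬝ᵥ z = 0 := Subtype.ext (by simpa [dotProduct] using h5 a _ hz)
    simpa [dotProduct] using congrArg (IsLocalRing.residue O) this

theorem finrank_inf_fl_of_red (hf : ∀ j, IsUnit (Matrix.of (f j)).det)
    (hex : ∀ x ∈ MarkedSet k (fun j l m => IsLocalRing.residue O (f j l m)) s
      (fun a m => IsLocalRing.residue O (w a m)) o b₀, ∀ j, ∀ q < k,
        finrank (IsLocalRing.ResidueField O)
          ↥(x.2 ⊓ fl (fun l m => IsLocalRing.residue O (f j l m)) (s j q)) = q + 1)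
    {x : Submodule K (Fin n → K) × Submodule K (Fin n → K)}
    (hx : x ∈ MarkedSet k (fun j l m => (f j l m : K)) s (fun a m => (w a m : K)) o b₀)
    (j : J) {q : ℕ} (hq : q < k) :
    finrank K ↥(x.2 ⊓ fl (fun l m => (f j l m : K)) (s j q)) = q + 1 ∧
    red O (x.2 ⊓ fl (fun l m => (f j l m : K)) (s j q)) =
      red O x.2 ⊓ fl (fun l m => IsLocalRing.residue O (f j l m)) (s j q) := by
  have h1 := hex _ (red_mem_markedSet hf hx) j q hq
  have h2 : q + 1 ≤ finrank K ↥(x.2 ⊓ fl (fun l m => (f j l m : K)) (s j q)) := hx.1.2 j q hq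
  have h3 : red O (x.2 ⊓ fl (fun l m => (f j l m : K)) (s j q)) ≤
      red O x.2 ⊓ fl (fun l m => IsLocalRing.residue O (f j l m)) (s j q) := by
    rw [← red_fl (hf j)]
    exact le_inf (red_mono inf_le_left) (red_mono inf_le_right)
  have h4 := Submodule.finrank_mono h3
  rw [finrank_red] at h4
  replace h4 := h4.trans_eq h1
  have h5 : finrank K ↥(x.2 ⊓ fl (fun l m => (f j l m : K)) (s j q)) = q + 1 := by omega
  exact ⟨h5, Submodule.eq_of_le_of_finrank_eq h3 (by rw [finrank_red, h5, h1])⟩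

theorem nondeg_of_red (hf : ∀ j, IsUnit (Matrix.of (f j)).det)
    (hex : ∀ x ∈ MarkedSet k (fun j l m => IsLocalRing.residue O (f j l m)) s
      (fun a m => IsLocalRing.residue O (w a m)) o b₀, ∀ j, ∀ q < k,
        finrank (IsLocalRing.ResidueField O)
          ↥(x.2 ⊓ fl (fun l m => IsLocalRing.residue O (f j l m)) (s j q)) = q + 1)
    (hnd : ∀ x ∈ MarkedSet k (fun j l m => IsLocalRing.residue O (f j l m)) s
      (fun a m => IsLocalRing.residue O (w a m)) o b₀,
        Nondeg k (fun j l m => IsLocalRing.residue O (f j l m)) s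
          (fun a m => IsLocalRing.residue O (w a m)) o b₀ x)
    {x : Submodule K (Fin n → K) × Submodule K (Fin n → K)}
    (hx : x ∈ MarkedSet k (fun j l m => (f j l m : K)) s (fun a m => (w a m : K)) o b₀) :
    Nondeg k (fun j l m => (f j l m : K)) s (fun a m => (w a m : K)) o b₀ x := by
  intro Φ hΦ u hu hu0 y hy hyu hyw
  have hr := red_mem_markedSet hf hx
  have hD := fun j q hq => finrank_inf_fl_of_red hf hex hx j (q := q) hq
  obtain ⟨P, b₁, hb₁⟩ := exists_echelon (red O x.2)
  obtain ⟨b, hb, -⟩ := exists_integral_echelon hb₁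
  obtain ⟨c, hc, u', hu', m₀, hm₀⟩ := exists_scale O u hu0
  have hus : u = c • fun i => (u' i : K) := funext hu'
  have hu'ℓ : (fun i => (u' i : K)) ∈ x.1 := by
    have : (fun i => (u' i : K)) = c⁻¹ • u := by rw [hus, smul_smul, inv_mul_cancel₀ hc, one_smul]
    rw [this]; exact x.1.smul_mem _ hu
  have hℓV : x.1 ≤ x.2 := hx.2.2.1.trans inf_le_left
  let d : Fin n → Fin n → K := fun p => if p ∈ P then
    Φ (fun i => (b p i : K)) - ∑ i ∈ P, Φ (fun i => (b p i : K)) i • (fun m => (b i m : K)) else 0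
  have hd : ∀ v ∈ x.2, Φ v - ∑ p ∈ P, v p • d p ∈ x.2 := by
    intro v hv
    have h1 : Φ v = ∑ p ∈ P, v p • Φ (fun i => (b p i : K)) := by
      conv_lhs => rw [← hb.sum_eq hv]
      simp
    rw [h1, ← Finset.sum_sub_distrib]
    refine Submodule.sum_mem _ fun p hp => ?_
    rw [← smul_sub]
    refine Submodule.smul_mem _ _ ?_
    simp only [d, if_pos hp, sub_sub_cancel]
    exact Submodule.sum_mem _ fun i hi => Submodule.smul_mem _ _ (hb.mem i hi)
  set y' : Fin n → K := c⁻¹ • y - (c⁻¹ • y) m₀ • (fun i => (u' i : K)) with hy'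
  obtain ⟨e1, e2⟩ : d = 0 ∧ y' = 0 := by
    refine (hnd _ hr).rigid (b := b) (m₀ := m₀) (u := u') (d := d) (e := 0) (y := y') hf
      (fun j q hq => (hex _ hr j q hq).trans (hD j q hq).1.symm) hr.2.1 hb hb₁.disj ⟨u', hu'ℓ, rfl⟩
      hm₀ ?_ (fun p hp => if_neg hp) ?_ ?_ ?_ ?_ (by simp) ?_
    · intro p i hi
      by_cases hp : p ∈ P
      · simp only [d, if_pos hp, Pi.sub_apply, Finset.sum_apply, Pi.smul_apply, smul_eq_mul]
        rw [Finset.sum_eq_single_of_mem i hi]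
        · rw [hb.delta i hi i hi, if_pos rfl]; ring
        · intro q hq hqi
          rw [hb.delta q hq i hi, if_neg hqi, mul_zero]
      · simp [d, hp]
    · intro j q hq z hz
      rw [← (hD j q hq).2] at hz
      obtain ⟨ζ, hζ, rfl⟩ := hz
      refine ⟨ζ, rfl, ?_⟩
      have h1 := hΦ j q hq _ hζ
      have h2 := Submodule.mem_sup_right (S := fl (fun l m => (f j l m : K)) (s j q)) (hd _ hζ.1)
      simpa using Submodule.sub_mem _ h1 h2
    · exact Submodule.sub_mem _ (Submodule.smul_mem _ _ hy)
        (Submodule.smul_mem _ _ ((hx.2.2.1.trans inf_le_right) hu'ℓ))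
    · intro a
      rw [dotProduct_sub, dotProduct_smul, dotProduct_smul, hyw a, hx.2.2.2 a _ hu'ℓ]
      simp
    · simp [hy', hm₀]
    · have h1 : y' - ∑ p ∈ P, (u' p : K) • d p = c⁻¹ • (y - Φ u) -
          (c⁻¹ • y) m₀ • (fun i => (u' i : K)) +
          (Φ (fun i => (u' i : K)) - ∑ p ∈ P, (u' p : K) • d p) := by
        rw [hus, map_smul, smul_sub, smul_smul, inv_mul_cancel₀ hc, one_smul, hy']
        abel
      have : y' - ∑ p ∈ P, (u' p : K) • d p ∈ x.2 := by
        rw [h1]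
        exact Submodule.add_mem _ (Submodule.sub_mem _ (Submodule.smul_mem _ _ hyu)
          (Submodule.smul_mem _ _ (hℓV hu'ℓ))) (hd _ (hℓV hu'ℓ))
      convert this using 1
      rw [sub_eq_self]
      exact Finset.sum_eq_zero fun p _ => by funext i; simp
  refine ⟨fun z hz => by simpa [e1] using hd z hz, ?_⟩
  have : y = c • ((c⁻¹ • y) m₀ • (fun i => (u' i : K))) := by
    rw [← sub_eq_zero.1 (hy'.symm.trans e2), smul_smul, mul_inv_cancel₀ hc, one_smul]
  rw [this]
  exact x.1.smul_mem _ (x.1.smul_mem _ hu'ℓ)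

theorem red_injOn (hf : ∀ j, IsUnit (Matrix.of (f j)).det)
    (hex : ∀ x ∈ MarkedSet k (fun j l m => IsLocalRing.residue O (f j l m)) s
      (fun a m => IsLocalRing.residue O (w a m)) o b₀, ∀ j, ∀ q < k,
        finrank (IsLocalRing.ResidueField O)
          ↥(x.2 ⊓ fl (fun l m => IsLocalRing.residue O (f j l m)) (s j q)) = q + 1)
    (hnd : ∀ x ∈ MarkedSet k (fun j l m => IsLocalRing.residue O (f j l m)) s
      (fun a m => IsLocalRing.residue O (w a m)) o b₀,
        Nondeg k (fun j l m => IsLocalRing.residue O (f j l m)) s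
          (fun a m => IsLocalRing.residue O (w a m)) o b₀ x) :
    Set.InjOn (fun x : Submodule K (Fin n → K) × Submodule K (Fin n → K) => (red O x.1, red O x.2))
      (MarkedSet k (fun j l m => (f j l m : K)) s (fun a m => (w a m : K)) o b₀) := by
  rintro ⟨ℓ, V⟩ hx ⟨ℓ', V'⟩ hx' heq
  obtain ⟨q1, q2⟩ : red O ℓ = red O ℓ' ∧ red O V = red O V' := Prod.mk.inj heq
  have hr := red_mem_markedSet hf hx
  have hD := fun j q hq => finrank_inf_fl_of_red hf hex hx j (q := q) hq
  have hD' := fun j q hq => finrank_inf_fl_of_red hf hex hx' j (q := q) hq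
  dsimp only at hr hD hD'
  obtain ⟨P, b₁, hb₁⟩ := exists_echelon (red O V)
  obtain ⟨b, hb, hbr⟩ := exists_integral_echelon hb₁
  obtain ⟨b', hb', hbr'⟩ := exists_integral_echelon (V := V') (q2 ▸ hb₁)
  obtain ⟨P₀, u₁, hu₁⟩ := exists_echelon (red O ℓ)
  obtain ⟨u, hu, hur⟩ := exists_integral_echelon hu₁
  obtain ⟨u', hu', hur'⟩ := exists_integral_echelon (V := ℓ') (q1 ▸ hu₁)
  obtain ⟨m₀, rfl⟩ : ∃ m₀, P₀ = {m₀} := Finset.card_eq_one.1 (by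
    rw [← hu₁.finrank_eq]; exact hr.2.1)
  have hm := Finset.mem_singleton_self m₀
  have hum : u m₀ m₀ = 1 := Subtype.ext (by simpa using hu.delta m₀ hm m₀ hm)
  have hum' : u' m₀ m₀ = 1 := Subtype.ext (by simpa using hu'.delta m₀ hm m₀ hm)
  have uV' := hb'.sum_eq ((hx'.2.2.1.trans inf_le_left) (hu'.mem m₀ hm))
  have comb : ∀ c : Fin n → K, ∑ p ∈ P, c p • (fun i => (b p i : K)) ∈ V := fun c =>
    Submodule.sum_mem _ fun p hp => Submodule.smul_mem _ _ (hb.mem p hp)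
  have key : (fun p => if p ∈ P then (fun i => (b' p i : K)) - (fun i => (b p i : K)) else 0) =
      (0 : Fin n → Fin n → K) ∧ (fun i => (u' m₀ i : K)) - (fun i => (u m₀ i : K)) = 0 := by
    refine (hnd _ hr).rigid (b := b) (m₀ := m₀) (u := u m₀)
      (d := fun p => if p ∈ P then (fun i => (b' p i : K)) - (fun i => (b p i : K)) else 0)
      (e := fun p => if p ∈ P then b' p - b p else 0)
      (y := (fun i => (u' m₀ i : K)) - fun i => (u m₀ i : K)) hf
      (fun j q hq => (hex _ hr j q hq).trans (hD j q hq).1.symm) hr.2.1 hb hb₁.disj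
      ⟨u m₀, hu.mem m₀ hm, rfl⟩ hum ?_ (fun p hp => if_neg hp) ?_ ?_ ?_ ?_ ?_ ?_
    · intro p i hi
      by_cases hp : p ∈ P
      · simpa [hp, sub_eq_zero] using (hb'.delta p hp i hi).trans (hb.delta p hp i hi).symm
      · simp [hp]
    · intro j q hq z hz
      rw [q2, ← (hD' j q hq).2] at hz
      obtain ⟨ζ, hζ, rfl⟩ := hz
      refine ⟨ζ, rfl, ?_⟩
      have h1 := hb'.sum_eq hζ.1
      have h2 : ∑ p ∈ P, (ζ p : K) • (if p ∈ P then (fun i => (b' p i : K)) - (fun i => (b p i : K))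
          else 0) = (fun i => (ζ i : K)) - ∑ p ∈ P, (ζ p : K) • (fun i => (b p i : K)) := by
        rw [← h1, ← Finset.sum_sub_distrib]
        refine Finset.sum_congr rfl fun p hp => ?_
        rw [if_pos hp, smul_sub]
      rw [h2]
      exact Submodule.sub_mem _ (Submodule.mem_sup_left hζ.2) (Submodule.mem_sup_right (comb _))
    · exact Submodule.sub_mem _ ((hx'.2.2.1.trans inf_le_right) (hu'.mem m₀ hm))
        ((hx.2.2.1.trans inf_le_right) (hu.mem m₀ hm))
    · intro a
      rw [dotProduct_sub, hx'.2.2.2 a _ (hu'.mem m₀ hm), hx.2.2.2 a _ (hu.mem m₀ hm), sub_zero]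
    · simp [hum, hum']
    · intro p i
      by_cases hp : p ∈ P
      · have := congrFun ((hbr' p hp).trans (hbr p hp).symm) i
        simpa [hp, sub_eq_zero] using this
      · simp [hp]
    · have : (fun i => (u' m₀ i : K)) - (fun i => (u m₀ i : K)) -
          ∑ p ∈ P, (u m₀ p : K) • (if p ∈ P then (fun i => (b' p i : K)) - (fun i => (b p i : K))
            else 0) -
          ∑ p ∈ P, ((fun i => (u' m₀ i : K)) - (fun i => (u m₀ i : K))) p •
            (fun i => (((if p ∈ P then b' p - b p else 0) i : O) : K)) =
          ∑ p ∈ P, (u' m₀ p : K) • (fun i => (b p i : K)) - fun i => (u m₀ i : K) := by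
        have h2 : ∑ p ∈ P, (u m₀ p : K) • (if p ∈ P then
            (fun i => (b' p i : K)) - (fun i => (b p i : K)) else 0) +
          ∑ p ∈ P, ((fun i => (u' m₀ i : K)) - (fun i => (u m₀ i : K))) p •
            (fun i => (((if p ∈ P then b' p - b p else 0) i : O) : K)) =
          (fun i => (u' m₀ i : K)) - ∑ p ∈ P, (u' m₀ p : K) • (fun i => (b p i : K)) := by
          rw [← Finset.sum_add_distrib]
          conv_rhs => rw [← uV', ← Finset.sum_sub_distrib]
          refine Finset.sum_congr rfl fun p hp => ?_
          funext i
          simp only [hp, if_true, Pi.add_apply, Pi.smul_apply, Pi.sub_apply, smul_eq_mul]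
          push_cast
          ring
        rw [sub_sub, h2]
        abel
      rw [this]
      exact Submodule.sub_mem _ (comb _) ((hx.2.2.1.trans inf_le_left) (hu.mem m₀ hm))
  obtain ⟨e1, e2⟩ := key
  have hbb : ∀ p ∈ P, b' p = b p := fun p hp => funext fun i => Subtype.ext (by
    have := congrFun (congrFun e1 p) i
    simpa [hp, sub_eq_zero] using this)
  have huu : u' m₀ = u m₀ := funext fun i => Subtype.ext (by
    have := congrFun e2 i
    simpa [sub_eq_zero] using this)
  have hV : V = V' := by
    rw [← hb.span_eq, ← hb'.span_eq]
    congr 2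
    funext p
    simp only [hbb p p.2]
  have hℓ : ℓ = ℓ' := by
    rw [← hu.span_eq, ← hu'.span_eq]
    congr 2
    funext p
    rw [Finset.mem_singleton.1 p.2, huu]
  rw [hV, hℓ]

end Solutions

end Reduction

section Newton

variable {κ : Type*} [Field κ] {X : Type*} [Fintype X]

/-- A function on power series tuples with vanishing constant coefficients having constant
coefficient `c` and linear part `D`. -/
def IsTaylor (g : (X → PowerSeries κ) → PowerSeries κ) (c : κ) (D : (X → κ) →ₗ[κ] κ) : Prop :=
  ∀ x, (∀ i, PowerSeries.X ∣ x i) → PowerSeries.constantCoeff (g x) = c ∧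
    ∀ m, 1 ≤ m → ∀ δ, (∀ i, (PowerSeries.X : PowerSeries κ) ^ m ∣ δ i) →
      PowerSeries.X ^ (m + 1) ∣
        g (x + δ) - g x - ∑ i, PowerSeries.C (D (Pi.single i 1)) * δ i

theorem IsTaylor.const (a : PowerSeries κ) :
    IsTaylor (fun _ : X → PowerSeries κ => a) (PowerSeries.constantCoeff a) 0 :=
  fun x hx => ⟨rfl, fun m hm δ hδ => by simp⟩

theorem IsTaylor.var (i : X) :
    IsTaylor (fun x : X → PowerSeries κ => x i) 0 (LinearMap.proj i) := by
  refine fun x hx => ⟨PowerSeries.X_dvd_iff.1 (hx i), fun m hm δ hδ => ?_⟩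
  rw [Finset.sum_eq_single i]
  · simp
  · intro b _ hb
    simp [hb.symm]
  · simp

theorem IsTaylor.add {g g' : (X → PowerSeries κ) → PowerSeries κ} {c c' : κ}
    {D D' : (X → κ) →ₗ[κ] κ} (h : IsTaylor g c D) (h' : IsTaylor g' c' D') :
    IsTaylor (fun x => g x + g' x) (c + c') (D + D') := by
  refine fun x hx => ⟨by simp [(h x hx).1, (h' x hx).1], fun m hm δ hδ => ?_⟩
  convert dvd_add ((h x hx).2 m hm δ hδ) ((h' x hx).2 m hm δ hδ) using 1
  simp only [LinearMap.add_apply, map_add, add_mul, Finset.sum_add_distrib]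
  ring

theorem IsTaylor.mul {g g' : (X → PowerSeries κ) → PowerSeries κ} {c c' : κ}
    {D D' : (X → κ) →ₗ[κ] κ} (h : IsTaylor g c D) (h' : IsTaylor g' c' D') :
    IsTaylor (fun x => g x * g' x) (c * c') (c • D' + c' • D) := by
  refine fun x hx => ⟨by simp [(h x hx).1, (h' x hx).1], fun m hm δ hδ => ?_⟩
  obtain ⟨e, he⟩ := (h x hx).2 m hm δ hδ
  obtain ⟨e', he'⟩ := (h' x hx).2 m hm δ hδ
  have hd : ∀ D : (X → κ) →ₗ[κ] κ,
      PowerSeries.X ^ m ∣ ∑ i, PowerSeries.C (D (Pi.single i 1)) * δ i :=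
    fun D => Finset.dvd_sum fun i _ => (hδ i).mul_left _
  obtain ⟨d, hd1⟩ := hd D
  obtain ⟨d', hd1'⟩ := hd D'
  have hc : PowerSeries.X ∣ g x - PowerSeries.C c := by
    rw [PowerSeries.X_dvd_iff]; simp [(h x hx).1]
  have hc' : PowerSeries.X ∣ g' x - PowerSeries.C c' := by
    rw [PowerSeries.X_dvd_iff]; simp [(h' x hx).1]
  obtain ⟨t, ht⟩ := hc
  obtain ⟨t', ht'⟩ := hc'
  have hs : ∑ i, PowerSeries.C ((c • D' + c' • D) (Pi.single i 1)) * δ i =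
      PowerSeries.C c * (PowerSeries.X ^ m * d') + PowerSeries.C c' * (PowerSeries.X ^ m * d) := by
    rw [← hd1, ← hd1', Finset.mul_sum, Finset.mul_sum, ← Finset.sum_add_distrib]
    refine Finset.sum_congr rfl fun i _ => ?_
    simp only [LinearMap.add_apply, LinearMap.smul_apply, smul_eq_mul, map_add, map_mul]
    ring
  have e1 : g (x + δ) = g x + PowerSeries.X ^ m * d + PowerSeries.X ^ (m + 1) * e := by
    rw [← he, hd1]; ring
  have e2 : g' (x + δ) = g' x + PowerSeries.X ^ m * d' + PowerSeries.X ^ (m + 1) * e' := by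
    rw [← he', hd1']; ring
  obtain ⟨m, rfl⟩ := Nat.exists_eq_add_of_le' hm
  rw [hs]
  dsimp only
  rw [e1, e2]
  refine ⟨t * d' + t' * d + g x * e' + g' x * e + PowerSeries.X ^ m * (d + PowerSeries.X * e) *
    (d' + PowerSeries.X * e'), ?_⟩
  linear_combination (PowerSeries.X ^ (m + 1) * d') * ht + (PowerSeries.X ^ (m + 1) * d) * ht'

theorem IsTaylor.sum {α : Type*} {A : Finset α} {g : α → (X → PowerSeries κ) → PowerSeries κ}
    {c : α → κ} {D : α → (X → κ) →ₗ[κ] κ} (h : ∀ a ∈ A, IsTaylor (g a) (c a) (D a)) :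
    IsTaylor (fun x => ∑ a ∈ A, g a x) (∑ a ∈ A, c a) (∑ a ∈ A, D a) := by
  induction A using Finset.induction_on with
  | empty => simpa using IsTaylor.const (0 : PowerSeries κ)
  | insert a A ha ih =>
    simp only [Finset.sum_insert ha]
    exact (h a (Finset.mem_insert_self _ _)).add
      (ih fun b hb => h b (Finset.mem_insert_of_mem hb))

theorem exists_zero_of_isTaylor {E : Type*} [Fintype E]
    {g : E → (X → PowerSeries κ) → PowerSeries κ} {D : E → (X → κ) →ₗ[κ] κ}
    (hg : ∀ e, IsTaylor (g e) 0 (D e)) (hcard : Fintype.card X = Fintype.card E)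
    (hinj : ∀ δ, (∀ e, D e δ = 0) → δ = 0) :
    ∃ x, (∀ i, PowerSeries.X ∣ x i) ∧ ∀ e, g e x = 0 := by
  obtain ⟨A, hA⟩ : ∃ A : E → X → κ, ∀ e e', D e (A e') = if e = e' then 1 else 0 := by
    let L : (X → κ) →ₗ[κ] (E → κ) := LinearMap.pi D
    have hL : Function.Surjective L := by
      refine (LinearMap.injective_iff_surjective_of_finrank_eq_finrank (by simp [hcard])).1 ?_
      rw [← LinearMap.ker_eq_bot, LinearMap.ker_eq_bot']
      exact fun δ hδ => hinj δ fun e => congrFun hδ e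
    choose A hA using hL
    exact ⟨fun e => A (Pi.single e 1), fun e e' => by
      have := congrFun (hA (Pi.single e' 1)) e
      rw [Pi.single_apply] at this
      exact this⟩
  have hDA : ∀ e (p : E → PowerSeries κ),
      ∑ i, PowerSeries.C (D e (Pi.single i 1)) * ∑ e', PowerSeries.C (A e' i) * p e' = p e := by
    intro e p
    have h1 : ∀ e', ∑ i, D e (Pi.single i 1) * A e' i = if e = e' then 1 else 0 := by
      intro e'
      rw [← hA]
      conv_rhs => rw [pi_eq_sum_univ' (A e')]
      rw [map_sum]
      exact Finset.sum_congr rfl fun i _ => by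
        rw [map_smul, smul_eq_mul, mul_comm]
    calc _ = ∑ e', PowerSeries.C (∑ i, D e (Pi.single i 1) * A e' i) * p e' := by
          simp only [Finset.mul_sum]
          rw [Finset.sum_comm]
          refine Finset.sum_congr rfl fun e' _ => ?_
          rw [map_sum, Finset.sum_mul]
          simp [mul_assoc]
      _ = p e := by simp [h1]
  let F : (X → PowerSeries κ) → (X → PowerSeries κ) :=
    fun x i => -∑ e', PowerSeries.C (A e' i) * g e' x
  let y : ℕ → X → PowerSeries κ := fun m => Nat.rec 0 (fun _ x => x + F x) m
  have hy : ∀ m, (∀ i, PowerSeries.X ∣ y m i) ∧ ∀ e, PowerSeries.X ^ (m + 1) ∣ g e (y m) := by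
    intro m
    induction m with
    | zero =>
      have h0 : ∀ i, (PowerSeries.X : PowerSeries κ) ∣ y 0 i := fun i => dvd_zero _
      refine ⟨h0, fun e => ?_⟩
      rw [zero_add, pow_one, PowerSeries.X_dvd_iff, (hg e _ h0).1]
    | succ m ih =>
      have hF : ∀ i, PowerSeries.X ^ (m + 1) ∣ F (y m) i := fun i =>
        (Finset.dvd_sum fun e _ => (ih.2 e).mul_left _).neg_right
      refine ⟨fun i => dvd_add (ih.1 i) (dvd_trans (dvd_pow_self _ (by omega)) (hF i)),
        fun e => ?_⟩
      have := (hg e _ ih.1).2 (m + 1) (by omega) _ hF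
      simp only [F, mul_neg, Finset.sum_neg_distrib, hDA] at this
      simpa [y, F] using this
  have hstep : ∀ m i, PowerSeries.X ^ (m + 1) ∣ y (m + 1) i - y m i := fun m i => by
    have : y (m + 1) i - y m i = F (y m) i := by simp [y]
    rw [this]
    exact (Finset.dvd_sum fun e _ => ((hy m).2 e).mul_left _).neg_right
  have hstab : ∀ m d i, PowerSeries.X ^ (m + 1) ∣ y (m + d) i - y m i := by
    intro m d i
    induction d with
    | zero => simp
    | succ d ih =>
      have := dvd_add (dvd_trans (pow_dvd_pow _ (by omega)) (hstep (m + d) i)) ih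
      rw [sub_add_sub_cancel] at this
      exact this
  let x : X → PowerSeries κ := fun i => PowerSeries.mk fun j => PowerSeries.coeff j (y j i)
  have hx : ∀ m i, PowerSeries.X ^ (m + 1) ∣ x i - y m i := by
    intro m i
    rw [PowerSeries.X_pow_dvd_iff]
    intro j hj
    obtain ⟨d, rfl⟩ := Nat.exists_eq_add_of_le (Nat.lt_succ_iff.1 hj)
    have := PowerSeries.X_pow_dvd_iff.1 (hstab j d i) j (Nat.lt_succ_self j)
    rw [map_sub, sub_eq_zero] at this
    simp [x, this]
  refine ⟨x, fun i => ?_, fun e => ?_⟩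
  · have := dvd_add (hx 0 i) (show (PowerSeries.X : PowerSeries κ) ^ (0 + 1) ∣ y 0 i from dvd_zero _)
    simpa using this
  · ext j
    have h1 := (hg e _ (hy j).1).2 (j + 1) (by omega) (x - y j) (hx j)
    have h2 := dvd_add (dvd_add (dvd_trans (pow_dvd_pow _ (Nat.le_succ (j + 1))) h1) ((hy j).2 e))
      (Finset.dvd_sum (s := Finset.univ)
        (f := fun i => PowerSeries.C (D e (Pi.single i 1)) * (x - y j) i)
        fun i _ => (hx j i).mul_left _)
    have h3 := PowerSeries.X_pow_dvd_iff.1 h2 j (Nat.lt_succ_self j)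
    have h4 : y j + (x - y j) = x := by simp
    rw [h4, sub_right_comm, sub_add_cancel, sub_add_cancel] at h3
    simpa using h3

end Newton

section Lift

variable {κ K : Type*} [Field κ] [Field K] {φ : PowerSeries κ →+* K} {ι : Type*} [Fintype ι]

/-- `U'` is a subspace over `K` whose power series points specialize exactly to `U`. -/
def Lifts (φ : PowerSeries κ →+* K) (U : Submodule κ (ι → κ)) (U' : Submodule K (ι → K)) : Prop :=
  ∀ z, z ∈ U ↔ ∃ z' : ι → PowerSeries κ, (fun i => φ (z' i)) ∈ U' ∧
    (fun i => PowerSeries.constantCoeff (z' i)) = z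

theorem lifts_span (hφ : Function.Injective φ) {A : Type*} [Fintype A]
    {y : A → ι → PowerSeries κ}
    (hy : LinearIndependent κ fun a i => PowerSeries.constantCoeff (y a i)) :
    Lifts φ (Submodule.span κ (Set.range fun a i => PowerSeries.constantCoeff (y a i)))
      (Submodule.span K (Set.range fun a i => φ (y a i))) ∧
    LinearIndependent K fun a i => φ (y a i) := by
  obtain ⟨L, hL⟩ := (Fintype.linearCombination κ
    fun a i => PowerSeries.constantCoeff (y a i)).exists_leftInverse_of_injective
    (LinearMap.ker_eq_bot'.2 fun g hg => funext (Fintype.linearIndependent_iff.1 hy g hg))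
  let M : Matrix A A (PowerSeries κ) :=
    Matrix.of fun a b => ∑ i, PowerSeries.C (L (Pi.single i 1) a) * y b i
  have hM1 : M.map PowerSeries.constantCoeff = 1 := by
    ext a b
    have h1 := congrFun (LinearMap.congr_fun hL (Pi.single b 1)) a
    rw [LinearMap.comp_apply, Fintype.linearCombination_apply_single, one_smul] at h1
    rw [pi_eq_sum_univ' (fun i => PowerSeries.constantCoeff (y b i)), map_sum,
      Finset.sum_apply] at h1
    rw [Matrix.one_apply, Matrix.map_apply]
    simp only [M, Matrix.of_apply, map_sum, map_mul, PowerSeries.constantCoeff_C]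
    rw [LinearMap.id_apply, Pi.single_apply] at h1
    rw [← h1]
    refine Finset.sum_congr rfl fun i _ => ?_
    rw [map_smul, Pi.smul_apply, smul_eq_mul, mul_comm]
  have hM : IsUnit M.det := by
    rw [PowerSeries.isUnit_iff_constantCoeff, RingHom.map_det, RingHom.mapMatrix_apply, hM1,
      Matrix.det_one]
    exact isUnit_one
  have key : ∀ (g : A → K) (z : ι → PowerSeries κ), (∑ a, g a • fun i => φ (y a i)) =
      (fun i => φ (z i)) →
      ∀ a, g a = φ ((M⁻¹.mulVec fun a => ∑ i, PowerSeries.C (L (Pi.single i 1) a) * z i) a) := by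
    intro g z hgz
    have h1 : (M.map φ).mulVec g =
        fun a => φ (∑ i, PowerSeries.C (L (Pi.single i 1) a) * z i) := by
      funext a
      simp only [Matrix.mulVec, dotProduct, Matrix.map_apply, M, Matrix.of_apply, map_sum, map_mul, Finset.sum_mul]
      rw [Finset.sum_comm]
      refine Finset.sum_congr rfl fun i _ => ?_
      rw [← congrFun hgz i, Finset.sum_apply, Finset.mul_sum]
      exact Finset.sum_congr rfl fun b _ => by simp [mul_assoc, mul_comm]
    have h2 : (M⁻¹.map φ).mulVec ((M.map φ).mulVec g) = g := by
      rw [Matrix.mulVec_mulVec, ← Matrix.map_mul, Matrix.nonsing_inv_mul _ hM]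
      simp
    intro a
    rw [← congrFun h2 a, h1]
    simp [Matrix.mulVec, dotProduct]
  refine ⟨fun z => ⟨fun hz => ?_, ?_⟩, ?_⟩
  · obtain ⟨g, rfl⟩ := (Submodule.mem_span_range_iff_exists_fun κ).1 hz
    refine ⟨fun i => ∑ a, PowerSeries.C (g a) * y a i, ?_, by funext i; simp⟩
    rw [Submodule.mem_span_range_iff_exists_fun]
    exact ⟨fun a => φ (PowerSeries.C (g a)), by funext i; simp⟩
  · rintro ⟨z', hz', rfl⟩
    obtain ⟨g, hg⟩ := (Submodule.mem_span_range_iff_exists_fun K).1 hz'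
    have h1 := key g z' hg
    rw [Submodule.mem_span_range_iff_exists_fun]
    refine ⟨fun a => PowerSeries.constantCoeff
      ((M⁻¹.mulVec fun a => ∑ i, PowerSeries.C (L (Pi.single i 1) a) * z' i) a), ?_⟩
    funext i
    have h2 : z' i = ∑ a, (M⁻¹.mulVec fun a => ∑ i, PowerSeries.C (L (Pi.single i 1) a) * z' i) a *
        y a i := by
      apply hφ
      rw [← congrFun hg i]
      simp only [Finset.sum_apply, Pi.smul_apply, smul_eq_mul, map_sum φ, map_mul φ, ← h1]
    conv_rhs => rw [h2]
    simp
  · rw [Fintype.linearIndependent_iff]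
    intro g hg a
    have := key g 0 (by rw [hg]; funext i; simp) a
    rw [this]
    have h0 : (fun a => ∑ i, PowerSeries.C (L (Pi.single i 1) a) * (0 : ι → PowerSeries κ) i) = 0 := by
      funext a; simp
    rw [h0, Matrix.mulVec_zero]; simp

end Lift


section Adapted

variable {κ : Type*} [Field κ] {n k : ℕ}

theorem exists_adapted_fin {V : Submodule κ (Fin n → κ)} (hV : finrank κ V = k)
    {f : Fin n → Fin n → κ} (hf : (Matrix.of f).det ≠ 0) {s : ℕ → ℕ}
    (hex : ∀ q < k, finrank κ ↥(V ⊓ fl f (s q)) = q + 1) :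
    ∃ b : Fin k → Fin n → κ, LinearIndependent κ b ∧ Submodule.span κ (Set.range b) = V ∧
      ∀ q : Fin k, Submodule.span κ (b '' Set.Iic q) = V ⊓ fl f (s q) := by
  obtain ⟨y, hy⟩ := exists_adapted_family (⊥ : Submodule κ (Fin n → κ)) (fun t => V ⊓ fl f t)
    (by simp [fl_zero hf]) fun _ _ h => inf_le_inf_left _ (fl_mono f h)
  replace hy : ∀ t, Submodule.span κ (y '' Set.Ico 0 (finrank κ ↥(V ⊓ fl f t))) = V ⊓ fl f t := by
    intro t
    have := (hy t).1
    rwa [bot_sup_eq, bot_sup_eq, finrank_bot] at this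
  have himg : ∀ t ≤ k, (fun q : Fin k => y q) '' {q | (q : ℕ) < t} = y '' Set.Ico 0 t := by
    intro t ht
    ext z
    constructor
    · rintro ⟨q, hq, rfl⟩; exact ⟨q, ⟨Nat.zero_le _, hq⟩, rfl⟩
    · rintro ⟨a, ⟨_, ha⟩, rfl⟩; exact ⟨⟨a, by omega⟩, ha, rfl⟩
  have hspan : Submodule.span κ (Set.range fun q : Fin k => y q) = V := by
    have := hy n
    rw [fl_of_le f le_rfl, inf_top_eq, hV, ← himg k le_rfl] at this
    rw [← this, ← Set.image_univ]
    congr 1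
    congr 1
    ext q; simp
  refine ⟨fun q => y q, ?_, hspan, fun q => ?_⟩
  · rw [linearIndependent_iff_card_eq_finrank_span, Set.finrank, hspan, hV, Fintype.card_fin]
  · have := hy (s q)
    rw [hex q q.2, ← himg _ (by omega)] at this
    rw [← this]
    congr 1
    congr 1
    ext p
    simp only [Set.mem_Iic, Set.mem_ofPred_eq, Fin.le_def]
    omega

theorem card_pairs (k : ℕ) : Fintype.card {x : Fin k × Fin k // x.1 < x.2} = k.choose 2 := by
  rw [Nat.choose_two_right, ← Finset.sum_range_id, Finset.sum_range, Fintype.card_subtype,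
    Finset.card_filter, Fintype.sum_prod_type_right]
  refine Finset.sum_congr rfl fun p _ => ?_
  rw [← Finset.card_filter]
  exact card_filter_fin_lt k p p.2.le

end Adapted

section Variables

variable {κ : Type*} [Field κ] {X : Type*} [Fintype X]

/-- The value at `x` of an optional variable, absent variables being zero. -/
def ov {S : Type*} [Zero S] (i : Option X) (x : X → S) : S := i.elim 0 x

/-- Version of `IsTaylor` with the linear part given as a function. -/
def HasTaylor (g : (X → PowerSeries κ) → PowerSeries κ) (c : κ) (d : (X → κ) → κ) : Prop :=
  ∃ D, IsTaylor g c D ∧ ∀ δ, D δ = d δ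

theorem HasTaylor.const (a : PowerSeries κ) :
    HasTaylor (fun _ : X → PowerSeries κ => a) (PowerSeries.constantCoeff a) fun _ => 0 :=
  ⟨_, IsTaylor.const a, fun _ => rfl⟩

theorem HasTaylor.var (i : Option X) :
    HasTaylor (fun x : X → PowerSeries κ => ov i x) 0 (fun δ => ov i δ) := by
  cases i with
  | none => exact ⟨0, by simpa [ov] using IsTaylor.const (0 : PowerSeries κ), fun _ => rfl⟩
  | some i => exact ⟨_, IsTaylor.var i, fun _ => rfl⟩

variable {g g' : (X → PowerSeries κ) → PowerSeries κ} {c c' : κ} {d d' : (X → κ) → κ}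

theorem HasTaylor.congr (h : HasTaylor g c d) (hc : c = c') (hd : ∀ δ, d δ = d' δ) :
    HasTaylor g c' d' := by
  obtain ⟨D, h1, h2⟩ := h
  exact ⟨D, hc ▸ h1, fun δ => (h2 δ).trans (hd δ)⟩

theorem HasTaylor.add (h : HasTaylor g c d) (h' : HasTaylor g' c' d') :
    HasTaylor (fun x => g x + g' x) (c + c') fun δ => d δ + d' δ := by
  obtain ⟨D, h1, h2⟩ := h
  obtain ⟨D', h1', h2'⟩ := h'
  exact ⟨_, h1.add h1', fun δ => by simp [h2, h2']⟩

theorem HasTaylor.mul (h : HasTaylor g c d) (h' : HasTaylor g' c' d') :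
    HasTaylor (fun x => g x * g' x) (c * c') fun δ => c * d' δ + c' * d δ := by
  obtain ⟨D, h1, h2⟩ := h
  obtain ⟨D', h1', h2'⟩ := h'
  exact ⟨_, h1.mul h1', fun δ => by simp [h2, h2']⟩

theorem HasTaylor.sum {α : Type*} [Fintype α] {g : α → (X → PowerSeries κ) → PowerSeries κ}
    {c : α → κ} {d : α → (X → κ) → κ} (h : ∀ a, HasTaylor (g a) (c a) (d a)) :
    HasTaylor (fun x => ∑ a, g a x) (∑ a, c a) fun δ => ∑ a, d a δ := by
  choose D h1 h2 using h
  exact ⟨_, IsTaylor.sum fun a _ => h1 a, fun δ => by simp [h2]⟩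

end Variables

section LiftParam

variable {κ : Type*} [Field κ] {n k : ℕ}

/-- The deformation of a vector along `1 + Y`. -/
noncomputable def defo (Y : Fin n → Fin n → PowerSeries κ) (z : Fin n → κ) (m : Fin n) :
    PowerSeries κ :=
  PowerSeries.C (z m) + ∑ p, PowerSeries.C (z p) * Y p m

/-- The deformation of the `q`-th vector of a basis. -/
noncomputable def defoBasis (Y : Fin n → Fin n → PowerSeries κ) (U : Fin k → Fin k → PowerSeries κ)
    (b : Fin k → Fin n → κ) (q : Fin k) (m : Fin n) : PowerSeries κ :=
  defo Y (b q) m + ∑ p, U q p * defo Y (b p) m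

variable {J W : Type*} [Fintype J] [Fintype W]

theorem exists_lift_param {r : ℕ} (hr : r < k) {f : J → Fin n → Fin n → κ} {s : J → ℕ → ℕ}
    (hs : ∀ j p q, p ≤ q → q < k → s j p ≤ s j q) (o : J) (wt : W → Fin n → PowerSeries κ)
    (hcount : ∑ j, ∑ q ∈ Finset.range k, (n - s j q) + Fintype.card W =
      k * (n - k) + Fintype.card J * k.choose 2 + r)
    {V : Submodule κ (Fin n → κ)} (hV : finrank κ V = k) {b : J → Fin k → Fin n → κ}
    (hb : ∀ j, LinearIndependent κ (b j))
    (hbF : ∀ j (q : Fin k), Submodule.span κ (b j '' Set.Iic q) = V ⊓ fl (f j) (s j q))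
    {cb : Fin k → κ} (hcb : ∀ q : Fin k, r < q → cb q = 0) (hcb0 : cb ≠ 0)
    (hw : ∀ a, (fun m => PowerSeries.constantCoeff (wt a m)) ⬝ᵥ ∑ q, cb q • b o q = 0)
    (hnd : Nondeg k f s (fun a m => PowerSeries.constantCoeff (wt a m)) o (s o r)
      (Submodule.span κ {∑ q, cb q • b o q}, V)) :
    ∃ (Y : Fin n → Fin n → PowerSeries κ) (U : J → Fin k → Fin k → PowerSeries κ)
      (c : Fin k → PowerSeries κ), (∀ p m, PowerSeries.constantCoeff (Y p m) = 0) ∧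
      (∀ j q p, PowerSeries.constantCoeff (U j q p) = 0) ∧
      (∀ q, PowerSeries.constantCoeff (c q) = 0) ∧ (∀ q : Fin k, r < q → c q = 0) ∧
      (∀ j (q : Fin k) (l : Fin n), s j q ≤ l →
        ∑ m, PowerSeries.C (f j l m) * defoBasis Y (U j) (b j) q m = 0) ∧
      ∀ a, ∑ m, wt a m * ∑ q, (PowerSeries.C (cb q) + c q) * defoBasis Y (U o) (b o) q m = 0 := by
  obtain ⟨q₀, hq₀⟩ := Function.ne_iff.1 hcb0
  have hq₀r : (q₀ : ℕ) ≤ r := by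
    by_contra h
    exact hq₀ (hcb _ (by omega))
  obtain ⟨P, B, hB⟩ := exists_echelon V
  have hP : P.card = k := hB.finrank_eq.symm.trans hV
  let X := {x : Fin n × Fin n // x.1 ∈ P ∧ x.2 ∉ P} ⊕
    (J × {x : Fin k × Fin k // x.1 < x.2}) ⊕ {q : Fin k // (q : ℕ) ≤ r ∧ q ≠ q₀}
  let E := (Σ j : J, {x : Fin k × Fin n // s j x.1 ≤ x.2}) ⊕ W
  let Yi : Fin n → Fin n → Option X := fun p m =>
    if h : p ∈ P ∧ m ∉ P then some (Sum.inl ⟨(p, m), h⟩) else none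
  let Ui : J → Fin k → Fin k → Option X := fun j q p =>
    if h : q < p then some (Sum.inr (Sum.inl (j, ⟨(q, p), h⟩))) else none
  let Ci : Fin k → Option X := fun q =>
    if h : (q : ℕ) ≤ r ∧ q ≠ q₀ then some (Sum.inr (Sum.inr ⟨q, h⟩)) else none
  let Bv : J → Fin k → Fin n → (X → PowerSeries κ) → PowerSeries κ := fun j q m x =>
    defoBasis (fun p m => ov (Yi p m) x) (fun q p => ov (Ui j q p) x) (b j) q m
  let Φ : (X → κ) → (Fin n → κ) →ₗ[κ] (Fin n → κ) := fun δ =>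
    (Matrix.of fun p m => ov (Yi p m) δ).vecMulLinear
  have hΦ : ∀ δ z m, Φ δ z m = ∑ p, z p * ov (Yi p m) δ := fun δ z m => rfl
  let dB : J → Fin k → (X → κ) → Fin n → κ := fun j q δ =>
    Φ δ (b j q) + ∑ p, ov (Ui j q p) δ • b j p
  have hdefo : ∀ z m, HasTaylor (fun x : X → PowerSeries κ => defo (fun p m => ov (Yi p m) x) z m)
      (z m) fun δ => Φ δ z m := by
    intro z m
    refine ((HasTaylor.const _).add (HasTaylor.sum fun p =>
      (HasTaylor.const _).mul (HasTaylor.var (Yi p m)))).congr ?_ fun δ => ?_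
    · simp
    · simp [hΦ]
  have hBv : ∀ j q m, HasTaylor (Bv j q m) (b j q m) fun δ => dB j q δ m := by
    intro j q m
    refine ((hdefo _ m).add (HasTaylor.sum fun p =>
      (HasTaylor.var (Ui j q p)).mul (hdefo (b j p) m))).congr ?_ fun δ => ?_
    · simp
    · simp [dB, mul_comm]
  let u : Fin n → κ := ∑ q, cb q • b o q
  let dV : (X → κ) → Fin n → κ := fun δ => ∑ q, (cb q • dB o q δ + ov (Ci q) δ • b o q)
  have hVv : ∀ m, HasTaylor (fun x => ∑ q, (PowerSeries.C (cb q) + ov (Ci q) x) * Bv o q m x) (u m)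
      fun δ => dV δ m := by
    intro m
    refine (HasTaylor.sum fun q => ((HasTaylor.const (PowerSeries.C (cb q))).add
      (HasTaylor.var (Ci q))).mul (hBv o q m)).congr ?_ fun δ => ?_
    · simp [u]
    · simp [dV, mul_comm]
  let g : E → (X → PowerSeries κ) → PowerSeries κ := Sum.elim
    (fun e x => ∑ m, PowerSeries.C (f e.1 e.2.1.2 m) * Bv e.1 e.2.1.1 m x)
    fun a x => ∑ m, wt a m * ∑ q, (PowerSeries.C (cb q) + ov (Ci q) x) * Bv o q m x
  let dg : E → (X → κ) → κ := Sum.elim (fun e δ => f e.1 e.2.1.2 ⬝ᵥ dB e.1 e.2.1.1 δ)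
    fun a δ => (fun m => PowerSeries.constantCoeff (wt a m)) ⬝ᵥ dV δ
  have hbmem : ∀ j (q p : Fin k), p ≤ q → b j p ∈ V ⊓ fl (f j) (s j q) := fun j q p hp => by
    rw [← hbF]; exact Submodule.subset_span ⟨p, hp, rfl⟩
  have hg : ∀ e, HasTaylor (g e) 0 (dg e) := by
    rintro (⟨j, ⟨⟨q, l⟩, hl⟩⟩ | a)
    · refine (HasTaylor.sum fun m => (HasTaylor.const (PowerSeries.C (f j l m))).mul
        (hBv j q m)).congr ?_ fun δ => ?_
      · simpa [dotProduct] using (hbmem j q q le_rfl).2 l hl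
      · simp [dg, dotProduct]
    · refine (HasTaylor.sum fun m => (HasTaylor.const (wt a m)).mul (hVv m)).congr ?_ fun δ => ?_
      · simpa [dotProduct, u] using hw a
      · simp [dg, dotProduct]
  choose D hD hDg using hg
  have hcard : Fintype.card X = Fintype.card E := by
    have h1 : Fintype.card {x : Fin n × Fin n // x.1 ∈ P ∧ x.2 ∉ P} = k * (n - k) := by
      rw [Fintype.card_subtype]
      have : (Finset.univ.filter fun x : Fin n × Fin n => x.1 ∈ P ∧ x.2 ∉ P) = P ×ˢ Pᶜ := by
        ext; simp
      rw [this, Finset.card_product, Finset.card_compl, hP, Fintype.card_fin]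
    have h2 : Fintype.card {q : Fin k // (q : ℕ) ≤ r ∧ q ≠ q₀} = r := by
      rw [Fintype.card_subtype]
      have : (Finset.univ.filter fun q : Fin k => (q : ℕ) ≤ r ∧ q ≠ q₀) =
          (Finset.univ.filter fun q : Fin k => (q : ℕ) < r + 1).erase q₀ := by
        ext q
        simp only [Finset.mem_filter, Finset.mem_univ, true_and, Finset.mem_erase]
        omega
      rw [this, Finset.card_erase_of_mem (by simp; omega), card_filter_fin_lt k _ (by omega)]
      omega
    have h3 : ∀ j, Fintype.card {x : Fin k × Fin n // s j x.1 ≤ x.2} =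
        ∑ q ∈ Finset.range k, (n - s j q) := by
      intro j
      rw [Fintype.card_subtype, Finset.card_filter, Fintype.sum_prod_type, Finset.sum_range]
      refine Finset.sum_congr rfl fun q _ => ?_
      rw [← Finset.card_filter]
      have h := Finset.card_filter_add_card_filter_not (s := (Finset.univ : Finset (Fin n)))
        (fun l : Fin n => (l : ℕ) < s j q)
      simp only [not_lt, Finset.card_univ, Fintype.card_fin] at h
      rw [Fin.card_filter_val_lt] at h
      simp only
      omega
    simp only [X, E, Fintype.card_sum, Fintype.card_prod, Fintype.card_sigma, h1, h2, h3,
      card_pairs]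
    omega
  obtain ⟨x, hx, hx0⟩ := exists_zero_of_isTaylor hD hcard (by
    intro δ hδ
    have hδg : ∀ e, dg e δ = 0 := fun e => (hDg e δ).symm.trans (hδ e)
    have hdB : ∀ j (q : Fin k), dB j q δ ∈ fl (f j) (s j q) := fun j q l hl =>
      hδg (Sum.inl ⟨j, ⟨⟨q, l⟩, hl⟩⟩)
    have hbV' : ∀ j q, b j q ∈ V := fun j q => (hbmem j q q le_rfl).1
    have hUV : ∀ j q, ∑ p, ov (Ui j q p) δ • b j p ∈ V := fun j q =>
      Submodule.sum_mem _ fun p _ => V.smul_mem _ (hbV' j p)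
    have hΦF : ∀ j, ∀ q < k, ∀ z ∈ V ⊓ fl (f j) (s j q), Φ δ z ∈ fl (f j) (s j q) ⊔ V := by
      intro j q hq z hz
      rw [← hbF j ⟨q, hq⟩] at hz
      have : Submodule.span κ (b j '' Set.Iic ⟨q, hq⟩) ≤
          (fl (f j) (s j q) ⊔ V).comap (Φ δ) := by
        rw [Submodule.span_le]
        rintro _ ⟨p, hp, rfl⟩
        have e : Φ δ (b j p) = dB j p δ - ∑ p', ov (Ui j p p') δ • b j p' := by simp [dB]
        rw [SetLike.mem_coe, Submodule.mem_comap, e]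
        exact Submodule.sub_mem _ (le_sup_left (a := fl (f j) (s j q))
          (fl_mono _ (hs j p q hp hq) (hdB j p))) (le_sup_right (a := fl (f j) (s j q)) (hUV j p))
      exact this hz
    have hCi : ∀ q : Fin k, r < q → Ci q = none := fun q hq => dif_neg (by omega)
    have hu0 : u ≠ 0 := fun h => hq₀ (Fintype.linearIndependent_iff.1 (hb o) cb h q₀)
    have hy1 : dV δ ∈ fl (f o) (s o r) := by
      refine Submodule.sum_mem _ fun q _ => ?_
      rcases lt_or_ge r (q : ℕ) with h | h
      · simp [hcb q h, hCi q h, ov]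
      · exact Submodule.add_mem _ (Submodule.smul_mem _ _ (fl_mono _ (hs o q r h hr) (hdB o q)))
          (Submodule.smul_mem _ _ (hbmem o ⟨r, hr⟩ q h).2)
    have hy2 : dV δ - Φ δ u ∈ V := by
      have : dV δ - Φ δ u =
          ∑ q, (cb q • ∑ p, ov (Ui o q p) δ • b o p + ov (Ci q) δ • b o q) := by
        simp only [dV, u, map_sum, map_smul, ← Finset.sum_sub_distrib, dB]
        refine Finset.sum_congr rfl fun q _ => ?_
        rw [smul_add]; abel
      rw [this]
      exact Submodule.sum_mem _ fun q _ => V.add_mem (V.smul_mem _ (hUV o q))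
        (V.smul_mem _ (hbV' o q))
    obtain ⟨hn1, hn2⟩ := hnd (Φ δ) hΦF u (Submodule.mem_span_singleton_self _) hu0 (dV δ) hy1 hy2
      fun a => hδg (Sum.inr a)
    have hΦ0 : ∀ z ∈ V, Φ δ z = 0 := fun z hz => hB.disj _ (hn1 z hz) fun m hm => by
      rw [hΦ]
      refine Finset.sum_eq_zero fun p _ => ?_
      have : Yi p m = none := dif_neg fun h => h.2 hm
      simp [this, ov]
    have hY0 : ∀ p m, ov (Yi p m) δ = 0 := by
      intro p m
      by_cases hp : p ∈ P
      · have h1 := congrFun (hΦ0 _ (hB.mem p hp)) m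
        rw [hΦ, Finset.sum_eq_single p] at h1
        · simpa [hB.delta p hp p hp] using h1
        · intro p' _ hp'
          by_cases hp'' : p' ∈ P
          · simp [hB.delta p hp p' hp'', hp'.symm]
          · have : Yi p' m = none := dif_neg fun h => hp'' h.1
            simp [this, ov]
        · simp
      · have : Yi p m = none := dif_neg fun h => hp h.1
        simp [this, ov]
    have hU0 : ∀ j q p, ov (Ui j q p) δ = 0 := by
      intro j q p
      have h1 : ∑ p, ov (Ui j q p) δ • b j p ∈ Submodule.span κ (b j '' Set.Iic q) := by
        rw [hbF]
        refine ⟨hUV j q, ?_⟩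
        have := hdB j q
        simpa [dB, hΦ0 _ (hbV' j q)] using this
      have hUi : ∀ p, ¬ q < p → ov (Ui j q p) δ = 0 := fun p hp => by
        have : Ui j q p = none := dif_neg hp
        simp [this, ov]
      have h2 : ∑ p, ov (Ui j q p) δ • b j p ∈ Submodule.span κ (b j '' Set.Ioi q) := by
        refine Submodule.sum_mem _ fun p _ => ?_
        by_cases hp : q < p
        · exact Submodule.smul_mem _ _ (Submodule.subset_span ⟨p, hp, rfl⟩)
        · simp [hUi p hp]
      exact Fintype.linearIndependent_iff.1 (hb j) _ (Submodule.disjoint_def.1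
        ((hb j).disjoint_span_image (Set.Iic_disjoint_Ioi le_rfl)) _ h1 h2) p
    have hC0 : ∀ q, ov (Ci q) δ = 0 := by
      have e : dV δ = ∑ q, ov (Ci q) δ • b o q := by
        refine Finset.sum_congr rfl fun q _ => ?_
        simp [dB, hΦ0 _ (hbV' o q), hU0]
      obtain ⟨t, ht⟩ := Submodule.mem_span_singleton.1 hn2
      have h1 : ∀ q, t * cb q - ov (Ci q) δ = 0 := Fintype.linearIndependent_iff.1 (hb o) _ (by
        simp only [sub_smul, mul_smul, Finset.sum_sub_distrib]
        rw [← Finset.smul_sum, ht, e, sub_self])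
      have h2 := h1 q₀
      have h3 : Ci q₀ = none := dif_neg fun h => h.2 rfl
      have h4 : t = 0 := by
        rw [h3] at h2
        simpa [ov, show cb q₀ ≠ 0 from hq₀] using h2
      intro q
      simpa [h4] using h1 q
    funext i
    rcases i with ⟨⟨p, m⟩, h⟩ | ⟨⟨j, ⟨q, p⟩, h⟩⟩ | ⟨q, h⟩
    · have := hY0 p m
      simpa [Yi, h, ov] using this
    · have := hU0 j q p
      simp only [] at h
      simpa [Ui, h, ov] using this
    · have := hC0 q
      simpa [Ci, h, ov] using this)
  have hov : ∀ i, PowerSeries.constantCoeff (ov i x) = 0 := by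
    rintro (_ | i)
    · simp [ov]
    · exact PowerSeries.X_dvd_iff.1 (hx i)
  exact ⟨fun p m => ov (Yi p m) x, fun j q p => ov (Ui j q p) x, fun q => ov (Ci q) x,
    fun p m => hov _, fun j q p => hov _, fun q => hov _,
    fun q hq => by
      have : Ci q = none := dif_neg (by omega)
      simp [this, ov],
    fun j (q : Fin k) l hl => hx0 (Sum.inl ⟨j, ⟨⟨q, l⟩, hl⟩⟩), fun a => hx0 (Sum.inr a)⟩

end LiftParam

section LiftSolution

variable {κ K : Type*} [Field κ] [Field K] {n k : ℕ} {J W : Type*} [Fintype J] [Fintype W]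

theorem exists_lift {φ : PowerSeries κ →+* K} (hφ : Function.Injective φ) {r : ℕ} (hr : r < k)
    {f : J → Fin n → Fin n → κ} (hf : ∀ j, (Matrix.of (f j)).det ≠ 0) {s : J → ℕ → ℕ}
    (hs : ∀ j p q, p ≤ q → q < k → s j p ≤ s j q) (o : J) (wt : W → Fin n → PowerSeries κ)
    (hcount : ∑ j, ∑ q ∈ Finset.range k, (n - s j q) + Fintype.card W =
      k * (n - k) + Fintype.card J * k.choose 2 + r)
    {x : Submodule κ (Fin n → κ) × Submodule κ (Fin n → κ)}
    (hx : x ∈ MarkedSet k f s (fun a m => PowerSeries.constantCoeff (wt a m)) o (s o r))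
    (hex : ∀ j, ∀ q < k, finrank κ ↥(x.2 ⊓ fl (f j) (s j q)) = q + 1)
    (hnd : Nondeg k f s (fun a m => PowerSeries.constantCoeff (wt a m)) o (s o r) x) :
    ∃ x' ∈ MarkedSet k (fun j l m => φ (PowerSeries.C (f j l m))) s (fun a m => φ (wt a m)) o
      (s o r), Lifts φ x.1 x'.1 ∧ Lifts φ x.2 x'.2 := by
  obtain ⟨ℓ, V⟩ := x
  obtain ⟨⟨hV, -⟩, hℓ, hℓV, hℓw⟩ := hx
  simp only at hV hℓ hℓV hℓw hex
  choose b hb hbV hbF using fun j => exists_adapted_fin hV (hf j) (hex j)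
  obtain ⟨u, hu0, hu⟩ := finrank_eq_one_iff'.1 hℓ
  have hℓu : ℓ = Submodule.span κ {(u : Fin n → κ)} := by
    apply le_antisymm
    · intro z hz
      obtain ⟨c, hc⟩ := hu ⟨z, hz⟩
      exact Submodule.mem_span_singleton.2 ⟨c, congrArg Subtype.val hc⟩
    · rw [Submodule.span_singleton_le_iff_mem]; exact u.2
  obtain ⟨cb, hcb, hcbu⟩ := (Finsupp.mem_span_image_iff_linearCombination κ).1
    ((hbF o ⟨r, hr⟩).ge (hℓV u.2))
  rw [Finsupp.mem_supported'] at hcb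
  rw [Finsupp.linearCombination_apply, Finsupp.sum_fintype _ _ (fun q => zero_smul κ (b o q))] at hcbu
  have hcb' : ∀ q : Fin k, r < q → cb q = 0 := fun q hq => hcb q (by
    rw [Set.mem_Iic, Fin.le_def]; simpa using hq)
  have hu0' : (u : Fin n → κ) ≠ 0 := fun h => hu0 (Subtype.ext h)
  obtain ⟨Y, U, c, hY, hU, hc, hcr, hBF, hBw⟩ := exists_lift_param hr hs o wt hcount hV hb hbF
    (cb := cb) hcb' (by
      intro h
      rw [h] at hcbu
      exact hu0' (by rw [← hcbu]; simp))
    (fun a => by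
      have := hℓw a u u.2
      rw [← hcbu] at this
      exact this) (by
      rw [hcbu, ← hℓu]; exact hnd)
  have hdefo : ∀ z m, PowerSeries.constantCoeff (defo Y z m) = z m := fun z m => by
    simp [defo, hY]
  have hdB : ∀ j q m, PowerSeries.constantCoeff (defoBasis Y (U j) (b j) q m) = b j q m :=
    fun j q m => by simp [defoBasis, hU, hdefo]
  let v : Unit → Fin n → PowerSeries κ :=
    fun _ m => ∑ q, (PowerSeries.C (cb q) + c q) * defoBasis Y (U o) (b o) q m
  have hv : (fun i m => PowerSeries.constantCoeff (v i m)) = fun _ => (u : Fin n → κ) := by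
    funext i m
    rw [← hcbu]
    simp [v, hc, hdB]
  have hV' := lifts_span hφ (y := fun q m => defo Y (b o q) m) (by simpa only [hdefo] using hb o)
  have hℓ' := lifts_span hφ (y := v) (by
    rw [hv]; exact LinearIndependent.of_subsingleton () hu0')
  simp only [hdefo] at hV'
  rw [hv] at hℓ'
  rw [hbV] at hV'
  rw [Set.range_const, ← hℓu] at hℓ'
  set V' := Submodule.span K (Set.range fun q m => φ (defo Y (b o q) m)) with hV'def
  have hmem : ∀ z ∈ V, (fun m => φ (defo Y z m)) ∈ V' := by
    intro z hz
    rw [← hbV o, Submodule.mem_span_range_iff_exists_fun] at hz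
    obtain ⟨g, rfl⟩ := hz
    have : (fun m => φ (defo Y (∑ q, g q • b o q) m)) =
        ∑ q, φ (PowerSeries.C (g q)) • fun m => φ (defo Y (b o q) m) := by
      funext m
      simp only [Finset.sum_apply, Pi.smul_apply, smul_eq_mul, ← map_mul, ← map_sum]
      congr 1
      simp only [defo, Finset.sum_apply, Pi.smul_apply, smul_eq_mul, map_sum, map_mul,
        Finset.sum_mul, mul_add, Finset.mul_sum, Finset.sum_add_distrib, mul_assoc]
      rw [Finset.sum_comm]
    rw [this]
    exact Submodule.sum_mem _ fun q _ => Submodule.smul_mem _ _ (Submodule.subset_span ⟨q, rfl⟩)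
  have hbV' : ∀ j q, b j q ∈ V := fun j q => by
    rw [← hbV j]; exact Submodule.subset_span ⟨q, rfl⟩
  have hBV : ∀ j q, (fun m => φ (defoBasis Y (U j) (b j) q m)) ∈ V' := by
    intro j q
    have : (fun m => φ (defoBasis Y (U j) (b j) q m)) = (fun m => φ (defo Y (b j q) m)) +
        ∑ p, φ (U j q p) • fun m => φ (defo Y (b j p) m) := by
      funext m; simp [defoBasis]
    rw [this]
    exact V'.add_mem (hmem _ (hbV' j q))
      (Submodule.sum_mem _ fun p _ => V'.smul_mem _ (hmem _ (hbV' j p)))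
  have hBF' : ∀ j (q : Fin k), (fun m => φ (defoBasis Y (U j) (b j) q m)) ∈
      fl (fun l m => φ (PowerSeries.C (f j l m))) (s j q) := by
    intro j q l hl
    have := congrArg φ (hBF j q l hl)
    simpa [dotProduct] using this
  have hv' : (fun m => φ (v () m)) = ∑ q, φ (PowerSeries.C (cb q) + c q) •
      fun m => φ (defoBasis Y (U o) (b o) q m) := by
    funext m; simp [v]
  refine ⟨(Submodule.span K (Set.range fun a m => φ (v a m)), V'), ⟨⟨?_, fun j q hq => ?_⟩, ?_, ?_, fun a z hz => ?_⟩, hℓ'.1, hV'.1⟩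
  · simpa using finrank_span_eq_card hV'.2
  · have h1 := (lifts_span hφ (y := fun q m => defoBasis Y (U j) (b j) q m)
      (by simpa only [hdB] using hb j)).2
    have h2 := h1.comp (Fin.castLE (show q + 1 ≤ k by omega)) (Fin.castLE_injective _)
    have h3 := finrank_span_eq_card h2
    rw [Fintype.card_fin] at h3
    rw [← h3]
    apply Submodule.finrank_mono
    rw [Submodule.span_le]
    rintro _ ⟨p, rfl⟩
    exact ⟨hBV j _, fl_mono _ (hs j p q (by omega) hq) (hBF' j (Fin.castLE (show q + 1 ≤ k by omega) p))⟩
  · simpa using finrank_span_eq_card hℓ'.2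
  · simp only [Submodule.span_le]
    rintro _ ⟨⟨⟩, rfl⟩
    simp only [hv']
    refine Submodule.sum_mem _ fun q _ => ?_
    rcases lt_or_ge r (q : ℕ) with h | h
    · rw [hcb' q h, hcr q h]; simp
    · exact Submodule.smul_mem _ _ ⟨hBV o q, fl_mono _ (hs o q r h hr) (hBF' o q)⟩
  · simp only [Set.range_unique, Submodule.mem_span_singleton] at hz
    obtain ⟨t, rfl⟩ := hz
    have := congrArg φ (hBw a)
    rw [dotProduct_smul]
    have h2 : (fun m => φ (wt a m)) ⬝ᵥ (fun m => φ (v default m)) = 0 := by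
      simpa only [dotProduct, map_sum, map_mul, map_zero, v] using this
    rw [h2, smul_zero]

end LiftSolution

section Isomorphism

variable {K₀ Ω Ω' : Type} [Field K₀] [Countable K₀] [Field Ω] [Algebra K₀ Ω] [IsAlgClosed Ω]
  [Field Ω'] [Algebra K₀ Ω'] [IsAlgClosed Ω']

theorem exists_basis_extension (hΩ : Cardinal.mk Ω = Cardinal.continuum) {A : Type} [Finite A]
    {x : A → Ω} (hx : AlgebraicIndependent K₀ x) :
    ∃ v : A ⊕ ℝ → Ω, IsTranscendenceBasis K₀ v ∧ ∀ a, v (Sum.inl a) = x a := by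
  obtain ⟨t, ht, hb⟩ := exists_isTranscendenceBasis_superset (AlgebraicIndependent.coe_range hx)
  have hc := IsAlgClosed.cardinal_eq_cardinal_transcendence_basis_of_aleph0_lt _ hb
    Cardinal.mk_le_aleph0 (hΩ ▸ Cardinal.aleph0_lt_continuum)
  rw [Cardinal.lift_id, Cardinal.lift_id, hΩ] at hc
  have hd := Cardinal.mk_sdiff_add_mk ht
  have hfin : Cardinal.mk (Set.range x) < Cardinal.aleph0 := Cardinal.mk_lt_aleph0
  have hd' : Cardinal.mk ↥(t \ Set.range x) = Cardinal.mk ℝ := by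
    rw [Cardinal.mk_real, hc]
    rw [← hc] at hd ⊢
    by_contra hne
    have h1 : Cardinal.mk ↥(t \ Set.range x) < Cardinal.continuum :=
      lt_of_le_of_ne (hd ▸ self_le_add_right _ _) hne
    exact absurd hd (Cardinal.add_lt_of_lt Cardinal.aleph0_le_continuum h1
      (hfin.trans Cardinal.aleph0_lt_continuum)).ne
  obtain ⟨e⟩ := Cardinal.eq.1 hd'
  let e' : A ⊕ ℝ ≃ t := (Equiv.sumCongr (Equiv.ofInjective x (AlgebraicIndependent.injective hx)) e.symm).trans
    ((Equiv.Set.sumDiffSubset ht))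
  refine ⟨fun i => (e' i : Ω), ?_, fun a => ?_⟩
  · exact (hb.comp_equiv e' :)
  · simp [e']

theorem exists_ringEquiv (hΩ : Cardinal.mk Ω = Cardinal.continuum)
    (hΩ' : Cardinal.mk Ω' = Cardinal.continuum) {A : Type} [Finite A] {x : A → Ω} {x' : A → Ω'}
    (hx : AlgebraicIndependent K₀ x) (hx' : AlgebraicIndependent K₀ x') :
    ∃ σ : Ω ≃+* Ω', ∀ a, σ (x a) = x' a := by
  obtain ⟨v, hv, hvx⟩ := exists_basis_extension hΩ hx
  obtain ⟨w, hw, hwx⟩ := exists_basis_extension hΩ' hx'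
  let _ := IsAlgClosed.isAlgClosure_of_transcendence_basis v hv
  let _ := IsAlgClosed.isAlgClosure_of_transcendence_basis w hw
  let e : Algebra.adjoin K₀ (Set.range v) ≃+* Algebra.adjoin K₀ (Set.range w) :=
    hv.1.aevalEquiv.symm.toRingEquiv.trans hw.1.aevalEquiv.toRingEquiv
  refine ⟨IsAlgClosure.equivOfEquiv Ω Ω' e, fun a => ?_⟩
  have h1 : x a = algebraMap (Algebra.adjoin K₀ (Set.range v)) Ω
      (hv.1.aevalEquiv (MvPolynomial.X (Sum.inl a))) := by
    rw [hv.1.algebraMap_aevalEquiv, MvPolynomial.aeval_X, hvx]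
  rw [h1, IsAlgClosure.equivOfEquiv_algebraMap]
  have h2 : e (hv.1.aevalEquiv (MvPolynomial.X (Sum.inl a))) =
      hw.1.aevalEquiv (MvPolynomial.X (Sum.inl a)) := by
    simp [e]
  rw [h2, hw.1.algebraMap_aevalEquiv, MvPolynomial.aeval_X, hwx]

theorem exists_algebraicIndependent (hΩ : Cardinal.mk Ω = Cardinal.continuum) (A : Type) [Finite A] :
    ∃ x : A → Ω, AlgebraicIndependent K₀ x := by
  obtain ⟨v, hv, -⟩ := exists_basis_extension (K₀ := K₀) hΩ (x := (Empty.elim : Empty → Ω))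
    (algebraicIndependent_empty_type_iff.2 (FaithfulSMul.algebraMap_injective K₀ Ω))
  obtain ⟨m, ⟨e⟩⟩ := Finite.exists_equiv_fin A
  refine ⟨fun a => v (Sum.inr ((e a : ℕ) : ℝ)), hv.1.comp _ fun a b h => ?_⟩
  have := Sum.inr.inj h
  exact e.injective (Fin.ext (by exact_mod_cast this))

end Isomorphism

section Push

variable {Ω Ω' : Type*} [Field Ω] [Field Ω'] {ι : Type*} [Fintype ι]

/-- The image of a subspace under a field isomorphism. -/
def push (σ : Ω ≃+* Ω') (U : Submodule Ω (ι → Ω)) : Submodule Ω' (ι → Ω') where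
  carrier := {z | (fun i => σ.symm (z i)) ∈ U}
  add_mem' := fun ha hb => by simpa using! U.add_mem ha hb
  zero_mem' := by
    have h : (fun i => σ.symm ((0 : ι → Ω') i)) = 0 := by funext i; simp
    simpa only [Set.mem_ofPred_eq, h] using! U.zero_mem
  smul_mem' := fun c _ hx => by simpa using! U.smul_mem (σ.symm c) hx

theorem mem_push {σ : Ω ≃+* Ω'} {U : Submodule Ω (ι → Ω)} {z : ι → Ω'} :
    z ∈ push σ U ↔ (fun i => σ.symm (z i)) ∈ U := Iff.rfl

theorem comp_mem_push {σ : Ω ≃+* Ω'} {U : Submodule Ω (ι → Ω)} {z : ι → Ω} :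
    (fun i => σ (z i)) ∈ push σ U ↔ z ∈ U := by
  simp [mem_push]

theorem push_symm_push (σ : Ω ≃+* Ω') (U : Submodule Ω (ι → Ω)) : push σ.symm (push σ U) = U := by
  ext z; simp [mem_push]

theorem push_inf (σ : Ω ≃+* Ω') (U U' : Submodule Ω (ι → Ω)) :
    push σ (U ⊓ U') = push σ U ⊓ push σ U' := rfl

theorem push_mono (σ : Ω ≃+* Ω') {U U' : Submodule Ω (ι → Ω)} (h : U ≤ U') :
    push σ U ≤ push σ U' := fun _ hx => h hx

theorem push_le_iff (σ : Ω ≃+* Ω') {U U' : Submodule Ω (ι → Ω)} :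
    push σ U ≤ push σ U' ↔ U ≤ U' :=
  ⟨fun h _ hz => comp_mem_push.1 (h (comp_mem_push.2 hz)), push_mono σ⟩

theorem finrank_push (σ : Ω ≃+* Ω') (U : Submodule Ω (ι → Ω)) :
    finrank Ω' (push σ U) = finrank Ω U := by
  symm
  let e : U ≃+ push σ U :=
    { toFun := fun z => ⟨fun i => σ (z.1 i), comp_mem_push.2 z.2⟩
      invFun := fun z => ⟨fun i => σ.symm (z.1 i), z.2⟩
      left_inv := fun z => by ext; simp
      right_inv := fun z => by ext; simp
      map_add' := fun z z' => by ext; simp }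
  have := lift_rank_eq_of_equiv_equiv σ e σ.bijective fun c z => by ext; simp [e]
  simpa [finrank] using congrArg Cardinal.toNat this

variable {n k : ℕ} {J W : Type*} {f : J → Fin n → Fin n → Ω} {s : J → ℕ → ℕ} {w : W → Fin n → Ω}
  {o : J} {b : ℕ} (σ : Ω ≃+* Ω')

theorem map_dotProduct_symm (σ : Ω ≃+* Ω') (x : ι → Ω) (y : ι → Ω') :
    (fun i => σ (x i)) ⬝ᵥ y = σ (x ⬝ᵥ fun i => σ.symm (y i)) := by
  simp [dotProduct]

theorem push_fl (f : Fin n → Fin n → Ω) (i : ℕ) :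
    push σ (fl f i) = fl (fun l m => σ (f l m)) i := by
  ext z
  simp only [mem_push, mem_fl, map_dotProduct_symm, map_eq_zero_iff σ σ.injective]

theorem push_mem_schubertSet {V : Submodule Ω (Fin n → Ω)} :
    push σ V ∈ SchubertSet k (fun j l m => σ (f j l m)) s ↔ V ∈ SchubertSet k f s := by
  simp only [SchubertSet, Set.mem_ofPred_eq, finrank_push]
  refine and_congr_right fun _ => forall_congr' fun j => forall_congr' fun q => ?_
  rw [← push_fl σ (f j), ← push_inf, finrank_push]

theorem push_mem_markedSet {x : Submodule Ω (Fin n → Ω) × Submodule Ω (Fin n → Ω)} :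
    (push σ x.1, push σ x.2) ∈ MarkedSet k (fun j l m => σ (f j l m)) s (fun a m => σ (w a m)) o b ↔
      x ∈ MarkedSet k f s w o b := by
  simp only [MarkedSet, Set.mem_ofPred_eq, push_mem_schubertSet, finrank_push, ← push_fl σ,
    ← push_inf, push_le_iff, map_dotProduct_symm, map_eq_zero_iff σ σ.injective]
  refine and_congr_right fun _ => and_congr_right fun _ => and_congr_right fun _ =>
    forall_congr' fun a => ⟨fun h z hz => ?_, fun h z hz => h _ hz⟩
  simpa using h _ (comp_mem_push.2 hz)

theorem encard_push_schubertSet :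
    (SchubertSet k (fun j l m => σ (f j l m)) s).encard = (SchubertSet k f s).encard := by
  symm
  refine Set.encard_congr ⟨fun V => ⟨push σ V.1, (push_mem_schubertSet σ).2 V.2⟩,
    fun V => ⟨push σ.symm V.1, ?_⟩, fun V => ?_, fun V => ?_⟩
  · have h : V.1 = push σ (push σ.symm V.1) := (push_symm_push σ.symm V.1).symm
    exact (push_mem_schubertSet σ).1 (h ▸ V.2)
  · exact Subtype.ext (push_symm_push σ V.1)
  · exact Subtype.ext (push_symm_push σ.symm V.1)

theorem encard_push_markedSet :
    (MarkedSet k (fun j l m => σ (f j l m)) s (fun a m => σ (w a m)) o b).encard =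
      (MarkedSet k f s w o b).encard := by
  symm
  refine Set.encard_congr ⟨fun x => ⟨(push σ x.1.1, push σ x.1.2), (push_mem_markedSet σ).2 x.2⟩,
    fun x => ⟨(push σ.symm x.1.1, push σ.symm x.1.2), ?_⟩, fun x => ?_, fun x => ?_⟩
  · have h : x.1 = (push σ (push σ.symm x.1.1), push σ (push σ.symm x.1.2)) :=
      Prod.ext (push_symm_push σ.symm _).symm (push_symm_push σ.symm _).symm
    exact (push_mem_markedSet (x := (push σ.symm x.1.1, push σ.symm x.1.2)) σ).1 (h ▸ x.2)
  · exact Subtype.ext (Prod.ext (push_symm_push σ _) (push_symm_push σ _))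
  · exact Subtype.ext (Prod.ext (push_symm_push σ.symm _) (push_symm_push σ.symm _))

theorem nondeg_push {x : Submodule Ω (Fin n → Ω) × Submodule Ω (Fin n → Ω)}
    (h : Nondeg k f s w o b x) :
    Nondeg k (fun j l m => σ (f j l m)) s (fun a m => σ (w a m)) o b
      (push σ x.1, push σ x.2) := by
  intro Φ hΦ u hu hu0 y hy hyu hyw
  let Ψ : (Fin n → Ω) →ₗ[Ω] (Fin n → Ω) :=
    { toFun := fun z m => σ.symm (Φ (fun i => σ (z i)) m)
      map_add' := fun z z' => by
        funext m
        have : (fun i => σ ((z + z') i)) = (fun i => σ (z i)) + fun i => σ (z' i) := by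
          funext i; simp
        rw [this, map_add, Pi.add_apply, map_add, Pi.add_apply]
      map_smul' := fun c z => by
        funext m
        have : (fun i => σ ((c • z) i)) = σ c • fun i => σ (z i) := by
          funext i; simp
        rw [this, map_smul]
        simp }
  have hΨ : ∀ z, Ψ (fun i => σ.symm (z i)) = fun m => σ.symm (Φ z m) := fun z => by
    funext m; simp [Ψ]
  have hsup : ∀ (U U' : Submodule Ω (Fin n → Ω)) z, z ∈ push σ U ⊔ push σ U' →
      (fun i => σ.symm (z i)) ∈ U ⊔ U' := by
    intro U U' z hz
    have : push σ U ⊔ push σ U' ≤ push σ (U ⊔ U') :=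
      sup_le (push_mono σ le_sup_left) (push_mono σ le_sup_right)
    exact this hz
  obtain ⟨h1, h2⟩ := h Ψ (fun j q hq z hz => by
      have := hΦ j q hq (fun i => σ (z i)) (by
        rw [← push_fl σ, ← push_inf]; exact comp_mem_push.2 hz)
      rw [← push_fl σ] at this
      exact hsup _ _ _ this) (fun i => σ.symm (u i)) hu (fun h0 => hu0 (by
        funext i
        simpa using congrFun h0 i)) (fun i => σ.symm (y i))
      (by rw [← push_fl σ] at hy; exact hy)
      (by
        rw [hΨ]
        convert hyu using 1
        rw [mem_push]
        congr! 1
        funext i; simp)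
      (fun a => by
        have := hyw a
        rwa [map_dotProduct_symm, map_eq_zero_iff σ σ.injective] at this)
  refine ⟨fun z hz => ?_, h2⟩
  have := h1 _ hz
  rw [hΨ] at this
  exact this

end Push

section Counting

/-- The number of conditions `s_q ≤ i`. -/
noncomputable def cnt (k : ℕ) (s : ℕ → ℕ) (i : ℕ) : ℕ := ((Finset.range k).filter (s · ≤ i)).card

theorem sum_cnt (n k : ℕ) (s : ℕ → ℕ) :
    ∑ i ∈ Finset.range n, cnt k s i = ∑ q ∈ Finset.range k, (n - s q) := by
  simp only [cnt, Finset.card_filter]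
  rw [Finset.sum_comm]
  refine Finset.sum_congr rfl fun q _ => ?_
  rw [← Finset.card_filter, ← Nat.card_Ico]
  congr 1
  ext i
  simp only [Finset.mem_filter, Finset.mem_range, Finset.mem_Ico]
  omega

/-- Admissible index sequences: `1 ≤ s_0 < s_1 < ⋯ < s_{k-1} ≤ n`. -/
structure Adm (n k : ℕ) {J : Type*} (s : J → ℕ → ℕ) : Prop where
  pos : ∀ j, ∀ q < k, 1 ≤ s j q
  lt : ∀ j p q, p < q → q < k → s j p < s j q
  le : ∀ j, ∀ q < k, s j q ≤ n

variable {n k : ℕ} {J : Type*} {s : J → ℕ → ℕ}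

theorem Adm.mono (hs : Adm n k s) (j : J) (p q : ℕ) (hpq : p ≤ q) (hq : q < k) :
    s j p ≤ s j q := by
  rcases hpq.eq_or_lt with rfl | h
  · exact le_rfl
  · exact (hs.lt j p q h hq).le

theorem Adm.cnt_eq (hs : Adm n k s) (j : J) {r i : ℕ} (hr : r ≤ k)
    (h1 : ∀ q < r, s j q ≤ i) (h2 : r < k → i < s j r) : cnt k (s j) i = r := by
  rw [cnt, show (Finset.range k).filter (s j · ≤ i) = Finset.range r from ?_, Finset.card_range]
  ext q
  simp only [Finset.mem_filter, Finset.mem_range]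
  refine ⟨fun h => ?_, fun h => ⟨by omega, h1 q h⟩⟩
  by_contra hq
  have := hs.mono j r q (by omega) h.1
  have := h2 (by omega)
  omega

theorem Adm.cnt_at (hs : Adm n k s) (j : J) {r : ℕ} (hr : r < k) : cnt k (s j) (s j r) = r + 1 :=
  hs.cnt_eq j hr (fun q hq => hs.mono j q r (by omega) hr)
    (fun h => hs.lt j _ _ (by omega) h)

theorem Adm.cnt_pred (hs : Adm n k s) (j : J) {r : ℕ} (hr : r < k) :
    cnt k (s j) (s j r - 1) = r :=
  hs.cnt_eq j hr.le (fun q hq => by have := hs.lt j q r hq hr; omega)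
    (fun h => by have := hs.pos j r h; omega)

theorem Adm.cnt_of_le (hs : Adm n k s) (j : J) {i : ℕ} (hi : n ≤ i) : cnt k (s j) i = k :=
  hs.cnt_eq j le_rfl (fun q hq => (hs.le j q hq).trans hi) (fun h => absurd h (lt_irrefl _))

variable {Ω : Type*} [Field Ω] {f : J → Fin n → Fin n → Ω} {V : Submodule Ω (Fin n → Ω)}

theorem cnt_le (hV : V ∈ SchubertSet k f s) (j : J) (i : ℕ) :
    cnt k (s j) i ≤ finrank Ω ↥(V ⊓ fl (f j) i) := by
  rw [cnt]
  rcases ((Finset.range k).filter (s j · ≤ i)).eq_empty_or_nonempty with h | h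
  · simp [h]
  · have hm := Finset.max'_mem _ h
    set q := ((Finset.range k).filter (s j · ≤ i)).max' h
    simp only [Finset.mem_filter, Finset.mem_range] at hm
    calc _ ≤ (Finset.range (q + 1)).card := Finset.card_le_card fun p hp => by
            have := Finset.le_max' _ p hp
            simp only [Finset.mem_range]; omega
      _ = q + 1 := Finset.card_range _
      _ ≤ _ := hV.2 j q hm.1
      _ ≤ _ := finrank_inf_fl_mono _ _ hm.2

theorem finrank_eq_of_le (hV : finrank Ω V = k) (j : J) {i : ℕ} (hi : n ≤ i) :
    finrank Ω ↥(V ⊓ fl (f j) i) = k := by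
  rw [fl_of_le _ hi, inf_top_eq, hV]

theorem one_le_finrank_of_mem {U : Submodule Ω (Fin n → Ω)} {z : Fin n → Ω} (hz : z ∈ U)
    (h0 : z ≠ 0) : 1 ≤ finrank Ω U :=
  Submodule.one_le_finrank_iff.2 fun h => h0 (by simpa [h] using hz)

variable {K₀ W : Type*} [Field K₀] [Algebra K₀ Ω] [Fintype J] [Fintype W] {w : W → Fin n → Ω}

theorem eq_cnt_of_isGeneric (hg : IsGeneric K₀ f w) (hs : Adm n k s) (hV : V ∈ SchubertSet k f s)
    {z : Fin n → Ω} (hz0 : z ≠ 0) {o : J} {b : ℕ} (hz : z ∈ V ⊓ fl (f o) b)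
    (hw : ∀ a, w a ⬝ᵥ z = 0) {ρ : ℕ}
    (hcount : ∑ j, ∑ q ∈ Finset.range k, (n - s j q) + Fintype.card W + 1 =
      k * (n - k) + Fintype.card J * k.choose 2 + ρ)
    (hρ : cnt k (s o) b ≤ ρ) {j : J} {i : ℕ} (hne : (j, i) ≠ (o, b)) :
    finrank Ω ↥(V ⊓ fl (f j) i) = cnt k (s j) i := by
  rcases lt_or_ge i n with hi | hi
  swap
  · rw [finrank_eq_of_le hV.1 j hi, hs.cnt_of_le j hi]
  have h1 := hg.codim_le hV.1 hz0 hz hw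
  have h2 := one_le_finrank_of_mem hz hz0
  have hob := cnt_le hV o b
  by_contra hlt
  have hlt := lt_of_le_of_ne (cnt_le hV j i) (Ne.symm hlt)
  have h3 : ∑ p ∈ Finset.univ ×ˢ Finset.range n, (cnt k (s p.1) p.2 +
      (if p = (o, b) then finrank Ω ↥(V ⊓ fl (f o) b) - cnt k (s o) b else 0) +
      (if p = (j, i) then 1 else 0)) ≤
      ∑ p ∈ Finset.univ ×ˢ Finset.range n, finrank Ω ↥(V ⊓ fl (f p.1) p.2) := by
    refine Finset.sum_le_sum fun p _ => ?_
    have hp := cnt_le hV p.1 p.2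
    split_ifs with ha hb hb
    · exact absurd (hb.symm.trans ha) hne
    · subst ha; dsimp only at hp ⊢; omega
    · subst hb; dsimp only at hp ⊢; omega
    · omega
  rw [Finset.sum_add_distrib, Finset.sum_add_distrib, Finset.sum_ite_eq', Finset.sum_ite_eq',
    Finset.sum_product, Finset.sum_product, 
    if_pos (show (j, i) ∈ Finset.univ ×ˢ Finset.range n by simpa using hi)] at h3
  simp only [sum_cnt, Finset.mem_product, Finset.mem_univ, Finset.mem_range, true_and] at h3
  split_ifs at h3 with hb
  · omega
  · have hb' := finrank_eq_of_le (f := f) hV.1 o (not_lt.1 hb)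
    have := hs.cnt_of_le o (not_lt.1 hb)
    omega

theorem exists_mem_of_finrank_one {U : Submodule Ω (Fin n → Ω)} (h : finrank Ω U = 1) :
    ∃ z ∈ U, z ≠ 0 ∧ U = Submodule.span Ω {z} := by
  have hne : U ≠ ⊥ := by rintro rfl; simp at h
  obtain ⟨z, hz, hz0⟩ := Submodule.exists_mem_ne_zero_of_ne_bot hne
  refine ⟨z, hz, hz0, (Submodule.eq_of_le_of_finrank_eq ?_ ?_).symm⟩
  · rwa [Submodule.span_singleton_le_iff_mem]
  · rw [finrank_span_singleton hz0, h]

theorem finrank_eq_cnt (hg : IsGeneric K₀ f w) (hs : Adm n k s) {o : J} {r : ℕ} (hr : r < k)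
    (hcount : ∑ j, ∑ q ∈ Finset.range k, (n - s j q) + Fintype.card W =
      k * (n - k) + Fintype.card J * k.choose 2 + r)
    {x : Submodule Ω (Fin n → Ω) × Submodule Ω (Fin n → Ω)}
    (hx : x ∈ MarkedSet k f s w o (s o r)) (j : J) (i : ℕ) :
    finrank Ω ↥(x.2 ⊓ fl (f j) i) = cnt k (s j) i := by
  obtain ⟨hV, h1, hle, hw⟩ := hx
  obtain ⟨z, hz, hz0, -⟩ := exists_mem_of_finrank_one h1
  have key : ∀ {j : J} {i : ℕ}, (j, i) ≠ (o, s o r) →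
      finrank Ω ↥(x.2 ⊓ fl (f j) i) = cnt k (s j) i := fun hne =>
    eq_cnt_of_isGeneric hg hs hV hz0 (hle hz) (fun a => hw a z hz) (ρ := r + 1)
      (by omega) (hs.cnt_at o hr).le hne
  by_cases hji : (j, i) = (o, s o r)
  · obtain ⟨rfl, rfl⟩ := Prod.mk.inj hji
    refine le_antisymm ?_ (cnt_le hV _ _)
    have hp := hs.pos j r hr
    have h2 := finrank_fl_succ_le (f j) x.2 (s j r - 1)
    have hne : (j, s j r - 1) ≠ (j, s j r) := fun h => by
      have := (Prod.mk.inj h).2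
      omega
    rw [key hne, Nat.sub_add_cancel hp, hs.cnt_pred j hr] at h2
    rwa [hs.cnt_at j hr]
  · exact key hji

theorem finrank_eq_succ (hg : IsGeneric K₀ f w) (hs : Adm n k s) {o : J} {r : ℕ} (hr : r < k)
    (hcount : ∑ j, ∑ q ∈ Finset.range k, (n - s j q) + Fintype.card W =
      k * (n - k) + Fintype.card J * k.choose 2 + r)
    {x : Submodule Ω (Fin n → Ω) × Submodule Ω (Fin n → Ω)}
    (hx : x ∈ MarkedSet k f s w o (s o r)) (j : J) (q : ℕ) (hq : q < k) :
    finrank Ω ↥(x.2 ⊓ fl (f j) (s j q)) = q + 1 := by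
  rw [finrank_eq_cnt hg hs hr hcount hx, hs.cnt_at j hq]

/-- A nonzero subspace has a first nonzero intersection with a flag, of dimension one. -/
theorem exists_finrank_eq_one {g : Fin n → Fin n → Ω} (hdet : (Matrix.of g).det ≠ 0)
    {V : Submodule Ω (Fin n → Ω)} (hV : V ≠ ⊥) : ∃ b, finrank Ω ↥(V ⊓ fl g b) = 1 := by
  have hex : ∃ b, V ⊓ fl g b ≠ ⊥ := ⟨n, by rwa [fl_of_le _ le_rfl, inf_top_eq]⟩
  have h1 := Nat.find_spec hex
  rcases hb : Nat.find hex with _ | b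
  · rw [hb, fl_zero hdet, inf_bot_eq] at h1
    exact absurd rfl h1
  · have h2 := Nat.find_min hex (m := b) (by omega)
    rw [not_not] at h2
    have h3 := finrank_fl_succ_le g V b
    rw [h2, finrank_bot] at h3
    rw [hb] at h1
    exact ⟨b + 1, le_antisymm h3 (Submodule.one_le_finrank_iff.2 h1)⟩

theorem sum_le_of_mem_schubertSet (hg : IsGeneric K₀ f w) (hk : 0 < k) (o : J)
    (hV : V ∈ SchubertSet k f s) :
    ∑ j, ∑ q ∈ Finset.range k, (n - s j q) ≤ k * (n - k) + Fintype.card J * k.choose 2 := by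
  have hg' : IsGeneric K₀ f (Empty.elim : Empty → Fin n → Ω) := by
    unfold IsGeneric at hg ⊢
    convert! AlgebraicIndependent.comp hg
      (Sum.map id (fun x : Empty × Fin n => x.1.elim)) (by
        rintro (a | a) (b | b) h
        · simpa using h
        · exact b.1.elim
        · exact a.1.elim
        · exact a.1.elim) using 1
    funext x
    rcases x with x | x
    · rfl
    · exact x.1.elim
  obtain ⟨b, hb⟩ := exists_finrank_eq_one (hg.det_ne_zero o) (V := V) (by
    rintro rfl
    have := hV.1
    simp at this
    omega)
  obtain ⟨z, hz, hz0, -⟩ := exists_mem_of_finrank_one hb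
  have h1 := hg'.codim_le hV.1 hz0 hz (fun a => a.elim)
  have h2 : ∑ j, ∑ i ∈ Finset.range n, cnt k (s j) i ≤
      ∑ j, ∑ i ∈ Finset.range n, finrank Ω ↥(V ⊓ fl (f j) i) :=
    Finset.sum_le_sum fun j _ => Finset.sum_le_sum fun i _ => cnt_le hV j i
  simp only [sum_cnt] at h2
  simp only [Fintype.card_empty] at h1
  omega

end Counting

section Special

variable {K₀ Ω : Type*} [Field K₀] [Field Ω] [Algebra K₀ Ω] {n k : ℕ} {J W : Type*} [Fintype J]
  [Fintype W] {s : J → ℕ → ℕ} {f : J → Fin n → Fin n → Ω} {w : W → Fin n → Ω} {o : J} {r a : ℕ}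

/-- Lowering the `r`-th index of the `o`-th condition to `a`. -/
noncomputable def upd (s : J → ℕ → ℕ) (o : J) (r a : ℕ) : J → ℕ → ℕ :=
  Function.update s o (Function.update (s o) r a)

theorem upd_self : upd s o r a o r = a := by simp [upd]

theorem upd_of_ne {j : J} {q : ℕ} (h : (j, q) ≠ (o, r)) : upd s o r a j q = s j q := by
  by_cases hj : j = o
  · subst hj
    have hq : q ≠ r := fun hq => h (by rw [hq])
    simp [upd, hq]
  · simp [upd, hj]

theorem mem_schubertSet_upd (hr : r < k) (ha : a ≤ s o r) {V : Submodule Ω (Fin n → Ω)} :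
    V ∈ SchubertSet k f (upd s o r a) ↔
      V ∈ SchubertSet k f s ∧ r + 1 ≤ finrank Ω ↥(V ⊓ fl (f o) a) := by
  constructor
  · rintro ⟨h1, h2⟩
    have h3 := h2 o r hr
    rw [upd_self] at h3
    refine ⟨⟨h1, fun j q hq => ?_⟩, h3⟩
    by_cases h : (j, q) = (o, r)
    · obtain ⟨rfl, rfl⟩ := Prod.mk.inj h
      exact h3.trans (finrank_inf_fl_mono _ _ ha)
    · have h4 := h2 j q hq
      rwa [upd_of_ne h] at h4
  · rintro ⟨⟨h1, h2⟩, h3⟩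
    refine ⟨h1, fun j q hq => ?_⟩
    by_cases h : (j, q) = (o, r)
    · obtain ⟨rfl, rfl⟩ := Prod.mk.inj h
      rwa [upd_self]
    · rw [upd_of_ne h]
      exact h2 j q hq

theorem mem_markedSet_upd (hr : r < k) (ha : a ≤ s o r) {b : ℕ}
    {x : Submodule Ω (Fin n → Ω) × Submodule Ω (Fin n → Ω)} :
    x ∈ MarkedSet k f (upd s o r a) w o b ↔
      x ∈ MarkedSet k f s w o b ∧ r + 1 ≤ finrank Ω ↥(x.2 ⊓ fl (f o) a) := by
  simp only [MarkedSet, Set.mem_ofPred_eq, mem_schubertSet_upd hr ha]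
  tauto

theorem mem_markedSet_option (hsa : s o r = a + 1) (han : a < n)
    {x : Submodule Ω (Fin n → Ω) × Submodule Ω (Fin n → Ω)} :
    x ∈ MarkedSet k f s (fun i : Option W => i.elim (f o ⟨a, han⟩) w) o (s o r) ↔
      x ∈ MarkedSet k f s w o a := by
  have key : ∀ z, z ∈ fl (f o) a ↔ z ∈ fl (f o) (a + 1) ∧ f o ⟨a, han⟩ ⬝ᵥ z = 0 :=
    fun z => fl_succ (f o) ⟨a, han⟩ z
  simp only [MarkedSet, Set.mem_ofPred_eq, hsa, Option.forall, Option.elim_none, Option.elim_some,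
    le_inf_iff]
  refine and_congr_right fun _ => and_congr_right fun _ => ⟨fun h => ?_, fun h => ?_⟩
  · exact ⟨⟨h.1.1, fun z hz => (key z).2 ⟨h.1.2 hz, h.2.1 z hz⟩⟩, h.2.2⟩
  · exact ⟨⟨h.1.1, fun z hz => ((key z).1 (h.1.2 hz)).1⟩, fun z hz => ((key z).1 (h.1.2 hz)).2, h.2⟩

variable (hg : IsGeneric K₀ f w) (hs : Adm n k s) (hr : r < k) (hsa : s o r = a + 1) (han : a < n)
  (hcount : ∑ j, ∑ q ∈ Finset.range k, (n - s j q) + (Fintype.card W + 1) =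
      k * (n - k) + Fintype.card J * k.choose 2 + r)
  {x : Submodule Ω (Fin n → Ω) × Submodule Ω (Fin n → Ω)}
  (hx : x ∈ MarkedSet k f s w o a)

include hg hs hr hsa hcount hx

theorem special_eq_cnt {j : J} {i : ℕ} (hne : (j, i) ≠ (o, a)) :
    finrank Ω ↥(x.2 ⊓ fl (f j) i) = cnt k (s j) i := by
  obtain ⟨hV, h1, hle, hw⟩ := hx
  obtain ⟨z, hz, hz0, -⟩ := exists_mem_of_finrank_one h1
  refine eq_cnt_of_isGeneric hg hs hV hz0 (hle hz) (fun i => hw i z hz) (ρ := r) (by omega) ?_ hne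
  have := hs.cnt_pred o hr
  rw [hsa] at this
  exact this.le

theorem special_le : finrank Ω ↥(x.2 ⊓ fl (f o) a) ≤ r + 1 := by
  refine (finrank_inf_fl_mono _ _ (Nat.le_succ a)).trans ?_
  show finrank Ω ↥(x.2 ⊓ fl (f o) (a + 1)) ≤ r + 1
  rw [special_eq_cnt hg hs hr hsa hcount hx (j := o) (i := a + 1) (by simp), ← hs.cnt_at o hr, hsa]

theorem special_ge : r ≤ finrank Ω ↥(x.2 ⊓ fl (f o) a) := by
  have := hs.cnt_pred o hr
  rw [hsa] at this
  exact this.symm.le.trans (cnt_le hx.1 o a)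

theorem special_le_pred (ha : 0 < a) :
    finrank Ω ↥(x.2 ⊓ fl (f o) a) ≤ cnt k (s o) (a - 1) + 1 := by
  have h := finrank_fl_succ_le (f o) x.2 (a - 1)
  rwa [Nat.sub_add_cancel ha, special_eq_cnt hg hs hr hsa hcount hx (j := o) (i := a - 1)
    (by simp; omega)] at h

theorem special_finrank_eq (j : J) (q : ℕ) (hq : q < k) :
    finrank Ω ↥(x.2 ⊓ fl (f j) (s j q)) = q + 1 := by
  by_cases h : (j, s j q) = (o, a)
  · obtain ⟨rfl, rfl⟩ := Prod.mk.inj h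
    refine le_antisymm ?_ (hx.1.2 j q hq)
    have h1 := special_le_pred hg hs hr hsa hcount hx (hs.pos j q hq)
    rwa [hs.cnt_pred j hq] at h1
  · rw [special_eq_cnt hg hs hr hsa hcount hx h, hs.cnt_at j hq]

theorem special_disjoint (hr0 : 0 < r) (h : x ∈ MarkedSet k f s w o (s o (r - 1))) :
    finrank Ω ↥(x.2 ⊓ fl (f o) a) = r := by
  rw [finrank_eq_cnt hg hs (r := r - 1) (by omega) (by omega) h]
  have := hs.cnt_pred o hr
  rwa [hsa] at this

theorem special_inf_eq (hr0 : 0 < r) (h : finrank Ω ↥(x.2 ⊓ fl (f o) a) = r) :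
    x.2 ⊓ fl (f o) (s o (r - 1)) = x.2 ⊓ fl (f o) a := by
  have hlt := hs.lt o (r - 1) r (by omega) hr
  refine Submodule.eq_of_le_of_finrank_le (inf_le_inf_left _ (fl_mono _ (by omega))) ?_
  rw [h]
  have := hx.1.2 o (r - 1) (by omega)
  omega

theorem special_mem (hr0 : 0 < r) (h : finrank Ω ↥(x.2 ⊓ fl (f o) a) = r) :
    x ∈ MarkedSet k f s w o (s o (r - 1)) :=
  ⟨hx.1, hx.2.1, by rw [special_inf_eq hg hs hr hsa hcount hx hr0 h]; exact hx.2.2.1, hx.2.2.2⟩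

theorem special_lt (hr0 : 0 < r) (h : finrank Ω ↥(x.2 ⊓ fl (f o) a) = r + 1) :
    s o (r - 1) < a := by
  have hlt := hs.lt o (r - 1) r (by omega) hr
  by_contra hle
  have h1 := special_finrank_eq hg hs hr hsa hcount hx o (r - 1) (by omega)
  rw [show s o (r - 1) = a by omega] at h1
  omega

include han

theorem special_nondeg_of_eq (hr0 : 0 < r) (h : finrank Ω ↥(x.2 ⊓ fl (f o) a) = r)
    (hnd : Nondeg k f s w o (s o (r - 1)) x) :
    Nondeg k f s (fun i : Option W => i.elim (f o ⟨a, han⟩) w) o (s o r) x := by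
  intro Φ hΦ u hu hu0 y hy hyu hyw
  have hE := special_inf_eq hg hs hr hsa hcount hx hr0 h
  have hya : y ∈ fl (f o) a := (fl_succ (f o) ⟨a, han⟩ y).2 ⟨hsa ▸ hy, hyw none⟩
  have hlt := hs.lt o (r - 1) r (by omega) hr
  refine hnd Φ hΦ u hu hu0 y ?_ hyu fun i => hyw (some i)
  have hu' : u ∈ x.2 ⊓ fl (f o) (s o (r - 1)) := hE ▸ hx.2.2.1 hu
  obtain ⟨g, hg', v, hv, hgv⟩ := Submodule.mem_sup.1 (hΦ o (r - 1) (by omega) u hu')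
  have hyg : y - g ∈ x.2 ⊓ fl (f o) a := by
    refine ⟨?_, Submodule.sub_mem _ hya (fl_mono _ (by omega) hg')⟩
    rw [show y - g = (y - Φ u) + v by rw [← hgv]; abel]
    exact Submodule.add_mem _ hyu hv
  rw [← hE] at hyg
  simpa using Submodule.add_mem _ hyg.2 hg'

theorem special_nondeg_of_eq_succ (h : finrank Ω ↥(x.2 ⊓ fl (f o) a) = r + 1)
    (hnd : Nondeg k f (upd s o r a) w o a x) :
    Nondeg k f s (fun i : Option W => i.elim (f o ⟨a, han⟩) w) o (s o r) x := by
  intro Φ hΦ u hu hu0 y hy hyu hyw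
  have hya : y ∈ fl (f o) a := (fl_succ (f o) ⟨a, han⟩ y).2 ⟨hsa ▸ hy, hyw none⟩
  refine hnd Φ (fun j q hq z hz => ?_) u hu hu0 y hya hyu fun i => hyw (some i)
  by_cases hjq : (j, q) = (o, r)
  swap
  · rw [upd_of_ne hjq] at hz ⊢
    exact hΦ j q hq z hz
  obtain ⟨rfl, rfl⟩ := Prod.mk.inj hjq
  rw [upd_self] at hz ⊢
  have hΦu : Φ u ∈ fl (f j) a ⊔ x.2 := by
    rw [show Φ u = y + -(y - Φ u) by abel]
    exact Submodule.add_mem_sup hya (Submodule.neg_mem _ hyu)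
  obtain ⟨A, hA, hAΦ, hu'⟩ : ∃ A : Submodule Ω (Fin n → Ω), finrank Ω A = q ∧
      A ≤ x.2 ⊓ fl (f j) a ∧ (∀ z ∈ A, Φ z ∈ fl (f j) a ⊔ x.2) ∧ u ∉ A := by
    rcases Nat.eq_zero_or_pos q with rfl | hr0
    · exact ⟨⊥, by simp, bot_le, by simp, by simpa using hu0⟩
    · have hlt := special_lt hg hs hr hsa hcount hx hr0 h
      refine ⟨x.2 ⊓ fl (f j) (s j (q - 1)), ?_, inf_le_inf_left _ (fl_mono _ hlt.le),
        fun z hz => (sup_le_sup_right (fl_mono _ hlt.le) x.2 :) (hΦ j (q - 1) (by omega) z hz), fun hu' => ?_⟩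
      · rw [special_finrank_eq hg hs hr hsa hcount hx j (q - 1) (by omega)]; omega
      · have hm : x ∈ MarkedSet k f s w j (s j (q - 1)) := by
          refine ⟨hx.1, hx.2.1, ?_, hx.2.2.2⟩
          obtain ⟨z, -, -, hzs⟩ := exists_mem_of_finrank_one hx.2.1
          have hsp : x.1 = Submodule.span Ω {u} := by
            refine (Submodule.eq_of_le_of_finrank_eq ?_ ?_).symm
            · rwa [Submodule.span_singleton_le_iff_mem]
            · rw [finrank_span_singleton hu0, hx.2.1]
          rw [hsp, Submodule.span_singleton_le_iff_mem]
          exact hu'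
        have := special_disjoint hg hs hr hsa hcount hx hr0 hm
        omega
  have hlt : A < A ⊔ Submodule.span Ω {u} := by
    refine lt_of_le_of_ne le_sup_left fun hEq => hu'.2 ?_
    rw [hEq]
    exact Submodule.mem_sup_right (Submodule.mem_span_singleton_self u)
  have hsup : A ⊔ Submodule.span Ω {u} = x.2 ⊓ fl (f j) a := by
    refine Submodule.eq_of_le_of_finrank_le (sup_le hAΦ ?_) ?_
    · rw [Submodule.span_singleton_le_iff_mem]
      exact hx.2.2.1 hu
    · have := Submodule.finrank_lt_finrank_of_lt hlt
      omega
  rw [← hsup] at hz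
  obtain ⟨z1, hz1, z2, hz2, rfl⟩ := Submodule.mem_sup.1 hz
  obtain ⟨c, rfl⟩ := Submodule.mem_span_singleton.1 hz2
  rw [map_add, map_smul]
  exact Submodule.add_mem _ (hu'.1 z1 hz1) (Submodule.smul_mem _ c hΦu)

omit hx

theorem special_encard : (MarkedSet k f s w o a).encard =
    (if 0 < r then (MarkedSet k f s w o (s o (r - 1))).encard else 0) +
      (MarkedSet k f (upd s o r a) w o a).encard := by
  have h1 : MarkedSet k f s w o a = (if 0 < r then MarkedSet k f s w o (s o (r - 1)) else ∅) ∪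
      MarkedSet k f (upd s o r a) w o a := by
    ext x
    rw [Set.mem_union, mem_markedSet_upd hr (by omega)]
    refine ⟨fun hx => ?_, ?_⟩
    · have h1 := special_ge hg hs hr hsa hcount hx
      rcases h1.eq_or_lt with h2 | h2
      · have hr0 : 0 < r := by
          rw [h2]
          obtain ⟨z, hz, hz0, -⟩ := exists_mem_of_finrank_one hx.2.1
          exact one_le_finrank_of_mem (hx.2.2.1 hz) hz0
        rw [if_pos hr0]
        exact Or.inl (special_mem hg hs hr hsa hcount hx hr0 h2.symm)
      · exact Or.inr ⟨hx, h2⟩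
    · rintro (hx | hx)
      · split_ifs at hx with hr0
        · have := hs.lt o (r - 1) r (by omega) hr
          exact ⟨hx.1, hx.2.1, hx.2.2.1.trans (inf_le_inf_left _ (fl_mono _ (by omega))), hx.2.2.2⟩
        · exact hx.elim
      · exact hx.1
  rw [h1, Set.encard_union_eq]
  · split_ifs <;> simp
  · rw [Set.disjoint_left]
    intro x hx hx2
    split_ifs at hx with hr0
    · obtain ⟨hxa, h2⟩ := (mem_markedSet_upd hr (by omega)).1 hx2
      have := special_disjoint hg hs hr hsa hcount hxa hr0 hx
      omega
    · exact hx.elim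

end Special

section ResidueField

variable {K : Type*} [Field K]

theorem isAlgClosed_residueField [IsAlgClosed K] (O : ValuationSubring K) :
    IsAlgClosed (IsLocalRing.ResidueField O) := by
  refine IsAlgClosed.of_exists_root _ fun p hp hirr => ?_
  obtain ⟨P, hP, hdeg, hmon⟩ := Polynomial.lifts_and_natDegree_eq_and_monic
    (f := IsLocalRing.residue O) (p := p) (by
      rw [Polynomial.mem_lifts]
      exact Polynomial.map_surjective _ IsLocalRing.residue_surjective p) hp
  have hd : (P.map (algebraMap O K)).degree ≠ 0 := by
    rw [hmon.degree_map]
    intro h0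
    have := Polynomial.natDegree_eq_of_degree_eq_some h0
    rw [hdeg] at this
    exact hirr.natDegree_pos.ne' this
  obtain ⟨z, hz⟩ := IsAlgClosed.exists_root _ hd
  obtain ⟨y, rfl⟩ := IsIntegrallyClosed.isIntegral_iff.1
    (show IsIntegral O z from ⟨P, hmon, by rwa [Polynomial.IsRoot, Polynomial.eval_map] at hz⟩)
  refine ⟨IsLocalRing.residue O y, ?_⟩
  rw [Polynomial.IsRoot, Polynomial.eval_map_algebraMap, Polynomial.aeval_algebraMap_apply,
    map_eq_zero_iff _ (FaithfulSMul.algebraMap_injective O K), Polynomial.coe_aeval_eq_eval] at hz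
  rw [← hP, Polynomial.eval_map_apply, hz, map_zero]

end ResidueField

section Generic

variable {K₀ Ω Ω' : Type*} [Field K₀] [Field Ω] [Algebra K₀ Ω] [Field Ω'] [Algebra K₀ Ω'] {n : ℕ}
  {J J' W W' : Type*} {f : J → Fin n → Fin n → Ω} {w : W → Fin n → Ω}

theorem IsGeneric.map (h : IsGeneric K₀ f w) (g : Ω →+* Ω')
    (hg : ∀ c, g (algebraMap K₀ Ω c) = algebraMap K₀ Ω' c) :
    IsGeneric K₀ (fun j l m => g (f j l m)) (fun a m => g (w a m)) := by
  let g' : Ω →ₐ[K₀] Ω' := { g with commutes' := hg }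
  unfold IsGeneric at h ⊢
  convert! AlgebraicIndependent.map' (f := g') h g.injective using 1
  funext x
  rcases x with x | x <;> rfl

theorem IsGeneric.comp (h : IsGeneric K₀ f w) {e : J' → J} (he : Function.Injective e)
    {e' : W' → W} (he' : Function.Injective e') :
    IsGeneric K₀ (fun j => f (e j)) (fun a => w (e' a)) := by
  unfold IsGeneric at h ⊢
  convert! AlgebraicIndependent.comp h
    (Sum.map (Prod.map e id) (Prod.map e' id)) (Function.Injective.sumMap
      (he.prodMap Function.injective_id) (he'.prodMap Function.injective_id)) using 1
  funext x
  rcases x with x | x <;> rfl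

theorem IsGeneric.of_algebraicIndependent {x : (J × Fin n × Fin n) ⊕ (W × Fin n) → Ω}
    (h : AlgebraicIndependent K₀ x) :
    IsGeneric K₀ (fun j l m => x (Sum.inl (j, l, m))) (fun a m => x (Sum.inr (a, m))) := by
  unfold IsGeneric
  convert! h using 1
  funext x
  rcases x with x | x <;> rfl

end Generic

section Good

variable (K₀ : Type) [Field K₀] [Countable K₀] {n : ℕ} (k : ℕ) {J : Type} [Fintype J]

/-- Every generic instance of the marked problem has `N` solutions, all of them rigid. -/
def Good (s : J → ℕ → ℕ) (W : Type) (o : J) (b n : ℕ) (N : ℕ∞) : Prop :=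
  ∀ (Ω : Type) [Field Ω] [Algebra K₀ Ω] [IsAlgClosed Ω], Cardinal.mk Ω = Cardinal.continuum →
    ∀ (f : J → Fin n → Fin n → Ω) (w : W → Fin n → Ω), IsGeneric K₀ f w →
      (MarkedSet k f s w o b).encard = N ∧
        ∀ x ∈ MarkedSet k f s w o b, Nondeg k f s w o b x

variable {K₀ k} {s : J → ℕ → ℕ} {W : Type} [Fintype W] {o : J} {b : ℕ} {N : ℕ∞}

theorem good_of_instance {Ω : Type} [Field Ω] [Algebra K₀ Ω] [IsAlgClosed Ω]
    (hΩ : Cardinal.mk Ω = Cardinal.continuum) {f : J → Fin n → Fin n → Ω} {w : W → Fin n → Ω}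
    (hg : IsGeneric K₀ f w) (hN : (MarkedSet k f s w o b).encard = N)
    (hnd : ∀ x ∈ MarkedSet k f s w o b, Nondeg k f s w o b x) : Good K₀ k s W o b n N := by
  intro Ω' _ _ _ hΩ' f' w' hg'
  obtain ⟨σ, hσ⟩ := exists_ringEquiv hΩ hΩ' hg hg'
  have hf : (fun j l m => σ (f j l m)) = f' := by
    funext j l m; exact hσ (Sum.inl (j, l, m))
  have hw : (fun a m => σ (w a m)) = w' := by
    funext a m; exact hσ (Sum.inr (a, m))
  rw [← hf, ← hw, encard_push_markedSet, hN]
  refine ⟨rfl, fun x hx => ?_⟩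
  obtain ⟨y, hy⟩ : ∃ y : Submodule Ω (Fin n → Ω) × Submodule Ω (Fin n → Ω),
      (push σ y.1, push σ y.2) = x :=
    ⟨(push σ.symm x.1, push σ.symm x.2),
      Prod.ext (push_symm_push σ.symm _) (push_symm_push σ.symm _)⟩
  have h := nondeg_push σ (hnd y ((push_mem_markedSet (x := y) σ).1 (by rw [hy]; exact hx)))
  rwa [hy] at h

theorem Good.reindex {W' : Type} (h : Good K₀ k s W o b n N) (e : W ≃ W') :
    Good K₀ k s W' o b n N := by
  intro Ω _ _ _ hΩ f w hg
  obtain ⟨h1, h2⟩ := h Ω hΩ f (fun a => w (e a)) (hg.comp (e := id) Function.injective_id e.injective)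
  have hM : MarkedSet k f s (fun a => w (e a)) o b = MarkedSet k f s w o b := by
    ext x
    simp only [MarkedSet, Set.mem_ofPred_eq, e.forall_congr_left, Equiv.apply_symm_apply]
  rw [hM] at h1 h2
  refine ⟨h1, fun x hx Φ hΦ u hu hu0 y hy hyu hw => h2 x hx Φ hΦ u hu hu0 y hy hyu fun a => hw _⟩

variable {Ω : Type} [Field Ω] [Algebra K₀ Ω] [IsAlgClosed Ω] {f : J → Fin n → Fin n → Ω}
  {w : W → Fin n → Ω} {r a : ℕ} {N₁ N₂ : ℕ∞}

theorem special_of_good (hΩ : Cardinal.mk Ω = Cardinal.continuum)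
    (hg : IsGeneric K₀ f w) (hs : Adm n k s) (hr : r < k) (hsa : s o r = a + 1) (han : a < n)
    (hcount : ∑ j, ∑ q ∈ Finset.range k, (n - s j q) + (Fintype.card W + 1) =
      k * (n - k) + Fintype.card J * k.choose 2 + r)
    (hA : 0 < r → Good K₀ k s W o (s o (r - 1)) n N₁) (hA0 : r = 0 → N₁ = 0)
    (hB : Good K₀ k (upd s o r a) W o a n N₂) :
    (MarkedSet k f s (fun i : Option W => i.elim (f o ⟨a, han⟩) w) o (s o r)).encard = N₁ + N₂ ∧
      ∀ x ∈ MarkedSet k f s (fun i : Option W => i.elim (f o ⟨a, han⟩) w) o (s o r),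
        (∀ j, ∀ q < k, finrank Ω ↥(x.2 ⊓ fl (f j) (s j q)) = q + 1) ∧
        Nondeg k f s (fun i : Option W => i.elim (f o ⟨a, han⟩) w) o (s o r) x := by
  have hM : MarkedSet k f s (fun i : Option W => i.elim (f o ⟨a, han⟩) w) o (s o r) =
      MarkedSet k f s w o a := Set.ext fun x => mem_markedSet_option hsa han
  rw [hM, special_encard hg hs hr hsa han hcount, (hB Ω hΩ f w hg).1]
  constructor
  · split_ifs with h0
    · rw [(hA h0 Ω hΩ f w hg).1]
    · rw [hA0 (by omega)]
  · intro x hx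
    refine ⟨special_finrank_eq hg hs hr hsa hcount hx, ?_⟩
    rcases (special_ge hg hs hr hsa hcount hx).eq_or_lt with h2 | h2
    · have hr0 : 0 < r := by
        rw [h2]
        obtain ⟨z, hz, hz0, -⟩ := exists_mem_of_finrank_one hx.2.1
        exact one_le_finrank_of_mem (hx.2.2.1 hz) hz0
      exact special_nondeg_of_eq hg hs hr hsa han hcount hx hr0 h2.symm
        ((hA hr0 Ω hΩ f w hg).2 x (special_mem hg hs hr hsa hcount hx hr0 h2.symm))
    · refine special_nondeg_of_eq_succ hg hs hr hsa han hcount hx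
        (le_antisymm (special_le hg hs hr hsa hcount hx) h2) ((hB Ω hΩ f w hg).2 x ?_)
      exact (mem_markedSet_upd hr (by omega)).2 ⟨hx, h2⟩

theorem lifts_injective {κ K ι : Type*} [Field κ] [Field K] [Fintype ι] {φ : PowerSeries κ →+* K}
    {U₁ U₂ : Submodule κ (ι → κ)} {U' : Submodule K (ι → K)} (h₁ : Lifts φ U₁ U')
    (h₂ : Lifts φ U₂ U') : U₁ = U₂ :=
  Submodule.ext fun z => (h₁ z).trans (h₂ z).symm

end Good

section Degeneration

variable {K₀ : Type} [Field K₀] [Countable K₀] {n k : ℕ} {J : Type} [Fintype J]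
  {s : J → ℕ → ℕ} {W : Type} [Fintype W] {o : J} {r a : ℕ} {N₁ N₂ : ℕ∞}

/-- The family specializing the vector `u` to the vector `v`. -/
noncomputable def specialize {κ : Type*} [Field κ] (u v : Fin n → κ) (w : W → Fin n → κ) :
    Option W → Fin n → PowerSeries κ :=
  fun i m => i.elim (PowerSeries.C (v m) + PowerSeries.X * PowerSeries.C (u m - v m))
    fun i => PowerSeries.C (w i m)

theorem constantCoeff_specialize {κ : Type*} [Field κ] (u v : Fin n → κ) (w : W → Fin n → κ)
    (i : Option W) (m : Fin n) :
    PowerSeries.constantCoeff (specialize u v w i m) = i.elim v w m := by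
  rcases i with _ | i <;> simp [specialize]

theorem isGeneric_specialize {κ K : Type*} [Field κ] [Field K] [Algebra K₀ κ] [Algebra K₀ K]
    {φ : PowerSeries κ →+* K} (hφ : Function.Injective φ)
    (hcomp : ∀ c, φ (PowerSeries.C (algebraMap K₀ κ c)) = algebraMap K₀ K c)
    {f : J → Fin n → Fin n → κ} {w : Option W → Fin n → κ} (hg : IsGeneric K₀ f w) (v : Fin n → κ) :
    IsGeneric K₀ (fun j l m => φ (PowerSeries.C (f j l m)))
      (fun i m => φ (specialize (w none) v (fun i => w (some i)) i m)) := by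
  let x : (J × Fin n × Fin n) ⊕ (Option W × Fin n) → Polynomial κ :=
    Sum.elim (fun p => Polynomial.C (f p.1 p.2.1 p.2.2)) fun p => p.1.elim
      (Polynomial.C (v p.2) + Polynomial.X * Polynomial.C (w none p.2 - v p.2))
      fun i => Polynomial.C (w (some i) p.2)
  have hx : AlgebraicIndependent K₀ x := by
    refine AlgebraicIndependent.of_comp ((Polynomial.aeval (1 : κ)).restrictScalars K₀) ?_
    unfold IsGeneric at hg
    convert! hg using 1
    funext p
    rcases p with p | ⟨_ | i, m⟩ <;> simp [x]
  let g : Polynomial κ →ₐ[K₀] K :=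
    { φ.comp Polynomial.coeToPowerSeries.ringHom with
      commutes' := fun c => by
        rw [← hcomp]
        simp [Polynomial.algebraMap_apply] }
  have hginj : Function.Injective g := fun p q h => Polynomial.coe_injective κ (hφ h)
  have h := AlgebraicIndependent.map' (f := g) hx hginj
  unfold IsGeneric
  convert! h using 1
  funext p
  rcases p with p | ⟨_ | i, m⟩
  · simp [g, x]
  · simp only [Sum.elim_inr, Function.comp_apply, x, g, specialize, Option.elim_none, AlgHom.coe_mk]
    show _ = φ ((Polynomial.C (v m) + Polynomial.X * Polynomial.C (w none m - v m) :
      Polynomial κ) : PowerSeries κ)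
    rw [Polynomial.coe_add, Polynomial.coe_mul, Polynomial.coe_C, Polynomial.coe_X,
      Polynomial.coe_C]
  · simp [g, x, specialize]

theorem good_option_of_field {κ K : Type} [Field κ] [Algebra K₀ κ] [IsAlgClosed κ]
    (hκ : Cardinal.mk κ = Cardinal.continuum) [Field K] [IsAlgClosed K]
    (hK : Cardinal.mk K = Cardinal.continuum) {φ : PowerSeries κ →+* K} (hφ : Function.Injective φ)
    (hs : Adm n k s) (hr : r < k) (hsa : s o r = a + 1) (han : a < n)
    (hcount : ∑ j, ∑ q ∈ Finset.range k, (n - s j q) + (Fintype.card W + 1) =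
      k * (n - k) + Fintype.card J * k.choose 2 + r)
    (hA : 0 < r → Good K₀ k s W o (s o (r - 1)) n N₁) (hA0 : r = 0 → N₁ = 0)
    (hB : Good K₀ k (upd s o r a) W o a n N₂) :
    Good K₀ k s (Option W) o (s o r) n (N₁ + N₂) := by
  obtain ⟨X, hX⟩ := exists_algebraicIndependent (K₀ := K₀) hκ
    ((J × Fin n × Fin n) ⊕ (Option W × Fin n))
  have hgu := IsGeneric.of_algebraicIndependent hX
  set f : J → Fin n → Fin n → κ := fun j l m => X (Sum.inl (j, l, m)) with hf
  set wu : Option W → Fin n → κ := fun i m => X (Sum.inr (i, m)) with hwu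
  set w : W → Fin n → κ := fun i => wu (some i) with hw
  set wt := specialize (wu none) (f o ⟨a, han⟩) w with hwt
  have hg : IsGeneric K₀ f w := hgu.comp (e := id) Function.injective_id (Option.some_injective W)
  let _ : Algebra K₀ K := (φ.comp (PowerSeries.C.comp (algebraMap K₀ κ))).toAlgebra
  have hgK : IsGeneric K₀ (fun j l m => φ (PowerSeries.C (f j l m))) (fun i m => φ (wt i m)) :=
    isGeneric_specialize hφ (fun c => rfl) hgu _
  have hcc : (fun i m => PowerSeries.constantCoeff (wt i m)) =
      fun i : Option W => i.elim (f o ⟨a, han⟩) w := by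
    funext i m
    exact constantCoeff_specialize _ _ _ i m
  -- solutions of the special problem lift
  obtain ⟨hc, hS⟩ := special_of_good hκ hg hs hr hsa han hcount hA hA0 hB
  have hlow : N₁ + N₂ ≤ (MarkedSet k (fun j l m => φ (PowerSeries.C (f j l m))) s
      (fun i m => φ (wt i m)) o (s o r)).encard := by
    rw [← hc]
    have hlift : ∀ x : MarkedSet k f s (fun i : Option W => i.elim (f o ⟨a, han⟩) w) o (s o r),
        ∃ x' : MarkedSet k (fun j l m => φ (PowerSeries.C (f j l m))) s (fun i m => φ (wt i m)) o
          (s o r), Lifts φ x.1.1 x'.1.1 ∧ Lifts φ x.1.2 x'.1.2 := by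
      rintro ⟨x, hx⟩
      obtain ⟨hex, hnd⟩ := hS x hx
      rw [← hcc] at hx hnd
      obtain ⟨x', h1, h2⟩ := exists_lift hφ hr (fun j => hg.det_ne_zero j)
        (fun j p q hpq hq => hs.mono j p q hpq hq) o wt (by
          rw [Fintype.card_option]; exact hcount) hx hex hnd
      exact ⟨⟨x', h1⟩, h2⟩
    choose F hF using hlift
    refine Function.Embedding.encard_le ⟨F, fun x y hxy => ?_⟩
    have h1 := hF x
    have h2 := hF y
    rw [hxy] at h1
    exact Subtype.ext (Prod.ext (lifts_injective h1.1 h2.1) (lifts_injective h1.2 h2.2))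
  -- solutions of the general problem specialize
  obtain ⟨O, hO, hloc⟩ := IsLocalRing.exists_factor_valuationRing φ
  set φ' := φ.codRestrict O.toSubring hO with hφ'
  let ρ : PowerSeries κ →+* IsLocalRing.ResidueField O := (IsLocalRing.residue O).comp φ'
  have hρX : ρ PowerSeries.X = 0 := by
    refine (IsLocalRing.residue_eq_zero_iff _).2 ((IsLocalRing.mem_maximalIdeal _).2 fun hu => ?_)
    have := isUnit_of_map_unit φ' _ hu
    rw [PowerSeries.isUnit_iff_constantCoeff, PowerSeries.constantCoeff_X] at this
    exact not_isUnit_zero this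
  let g : κ →+* IsLocalRing.ResidueField O := ρ.comp PowerSeries.C
  let _ : Algebra K₀ (IsLocalRing.ResidueField O) := (g.comp (algebraMap K₀ κ)).toAlgebra
  have hgκ : IsGeneric K₀ (fun j l m => g (f j l m)) (fun i m => g (w i m)) := hg.map g fun c => rfl
  have := isAlgClosed_residueField O
  have hκ' : Cardinal.mk (IsLocalRing.ResidueField O) = Cardinal.continuum := by
    refine le_antisymm ?_ (hκ ▸ Cardinal.mk_le_of_injective g.injective)
    rw [← hK]
    exact (Cardinal.mk_le_of_surjective IsLocalRing.residue_surjective).trans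
      (Cardinal.mk_le_of_injective Subtype.val_injective)
  obtain ⟨hc', hS'⟩ := special_of_good hκ' hgκ hs hr hsa han hcount hA hA0 hB
  have hw' : (fun i : Option W => i.elim (fun m => g (f o ⟨a, han⟩ m)) fun i m => g (w i m)) =
      fun i m => IsLocalRing.residue O (φ' (wt i m)) := by
    funext i m
    change _ = ρ (wt i m)
    rcases i with _ | i
    · simp [wt, specialize, hρX, g]
    · rfl
  have hdet : ∀ j, IsUnit (Matrix.of fun l m => φ' (PowerSeries.C (f j l m))).det := by
    intro j
    have h1 : (Matrix.of fun l m => φ' (PowerSeries.C (f j l m))) =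
        (φ'.comp PowerSeries.C).mapMatrix (Matrix.of (f j)) := rfl
    rw [h1, ← RingHom.map_det]
    exact (hg.det_ne_zero j).isUnit.map _
  rw [hw'] at hc' hS'
  have hexO : ∀ x ∈ MarkedSet k (fun j l m => IsLocalRing.residue O (φ' (PowerSeries.C (f j l m)))) s
      (fun i m => IsLocalRing.residue O (φ' (wt i m))) o (s o r), ∀ j, ∀ q < k,
        finrank (IsLocalRing.ResidueField O) ↥(x.2 ⊓ fl (fun l m =>
          IsLocalRing.residue O (φ' (PowerSeries.C (f j l m)))) (s j q)) = q + 1 :=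
    fun x hx => (hS' x hx).1
  have hndO : ∀ x ∈ MarkedSet k (fun j l m => IsLocalRing.residue O (φ' (PowerSeries.C (f j l m)))) s
      (fun i m => IsLocalRing.residue O (φ' (wt i m))) o (s o r),
        Nondeg k (fun j l m => IsLocalRing.residue O (φ' (PowerSeries.C (f j l m)))) s
      (fun i m => IsLocalRing.residue O (φ' (wt i m))) o (s o r) x :=
    fun x hx => (hS' x hx).2
  have hinj := red_injOn (O := O) (f := fun j l m => φ' (PowerSeries.C (f j l m)))
    (w := fun i m => φ' (wt i m)) hdet hexO hndO
  have hup : (MarkedSet k (fun j l m => φ (PowerSeries.C (f j l m))) s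
      (fun i m => φ (wt i m)) o (s o r)).encard ≤ N₁ + N₂ := by
    rw [← hc']
    exact Set.encard_le_encard_of_injOn (fun x hx => red_mem_markedSet (O := O)
      (f := fun j l m => φ' (PowerSeries.C (f j l m))) (w := fun i m => φ' (wt i m)) hdet hx) hinj
  exact good_of_instance hK hgK (le_antisymm hup hlow) fun x hx =>
    nondeg_of_red (O := O) (f := fun j l m => φ' (PowerSeries.C (f j l m)))
      (w := fun i m => φ' (wt i m)) hdet hexO hndO hx

theorem mk_laurentSeries {κ : Type} [Field κ] (hκ : Cardinal.mk κ = Cardinal.continuum) :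
    Cardinal.mk (AlgebraicClosure (LaurentSeries κ)) = Cardinal.continuum := by
  have h1 : Cardinal.mk (LaurentSeries κ) ≤ Cardinal.continuum := by
    refine (Cardinal.mk_le_of_injective (HahnSeries.coeff_injective (R := κ) (Γ := ℤ))).trans ?_
    rw [← Cardinal.power_def, hκ, Cardinal.mk_int, Cardinal.continuum_power_aleph0]
  refine le_antisymm ?_ ?_
  · refine (Algebra.IsAlgebraic.cardinalMk_le_max (LaurentSeries κ) _).trans ?_
    exact max_le h1 Cardinal.aleph0_le_continuum
  · rw [← hκ]
    exact Cardinal.mk_le_of_injective ((algebraMap (LaurentSeries κ) (AlgebraicClosure _)).comp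
      ((HahnSeries.ofPowerSeries ℤ κ).comp PowerSeries.C)).injective

theorem good_option (hs : Adm n k s) (hr : r < k) (hsa : s o r = a + 1) (han : a < n)
    (hcount : ∑ j, ∑ q ∈ Finset.range k, (n - s j q) + (Fintype.card W + 1) =
      k * (n - k) + Fintype.card J * k.choose 2 + r)
    (hA : 0 < r → Good K₀ k s W o (s o (r - 1)) n N₁) (hA0 : r = 0 → N₁ = 0)
    (hB : Good K₀ k (upd s o r a) W o a n N₂) :
    Good K₀ k s (Option W) o (s o r) n (N₁ + N₂) := by
  intro Ω _ _ _ hΩ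
  exact good_option_of_field hΩ (mk_laurentSeries hΩ)
    (φ := (algebraMap (LaurentSeries Ω) (AlgebraicClosure (LaurentSeries Ω))).comp
      (HahnSeries.ofPowerSeries ℤ Ω))
    ((algebraMap (LaurentSeries Ω) (AlgebraicClosure (LaurentSeries Ω))).injective.comp
      HahnSeries.ofPowerSeries_injective) hs hr hsa han hcount hA hA0 hB Ω hΩ

end Degeneration

section Degree

variable (K₀ : Type) [Field K₀] [Countable K₀] (n k : ℕ) {J : Type} [Fintype J]

/-- Every generic instance of the Schubert problem has `N` solutions. -/
def IsDeg (s : J → ℕ → ℕ) (N : ℕ∞) : Prop :=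
  ∀ (Ω : Type) [Field Ω] [Algebra K₀ Ω] [IsAlgClosed Ω], Cardinal.mk Ω = Cardinal.continuum →
    ∀ f : J → Fin n → Fin n → Ω, IsGeneric K₀ f (Empty.elim : Empty → Fin n → Ω) →
      (SchubertSet k f s).encard = N

theorem exists_isDeg (s : J → ℕ → ℕ) : ∃ N, IsDeg K₀ n k s N := by
  by_contra! h
  obtain ⟨Ω, h1, h2, h3, hΩ, f, hg, -⟩ : ∃ (Ω : Type) (_ : Field Ω) (_ : Algebra K₀ Ω)
      (_ : IsAlgClosed Ω) (_ : Cardinal.mk Ω = Cardinal.continuum) (f : J → Fin n → Fin n → Ω)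
      (_ : IsGeneric K₀ f (Empty.elim : Empty → Fin n → Ω)), (SchubertSet k f s).encard ≠ 0 := by
    have := h 0
    unfold IsDeg at this
    push Not at this
    obtain ⟨Ω, h1, h2, h3, hΩ, f, hg, h⟩ := this
    exact ⟨Ω, h1, h2, h3, hΩ, f, hg, h⟩
  refine h (SchubertSet k f s).encard ?_
  intro Ω' _ _ _ hΩ' f' hg'
  obtain ⟨σ, hσ⟩ := exists_ringEquiv hΩ hΩ' hg hg'
  have hf : (fun j l m => σ (f j l m)) = f' := by
    funext j l m; exact hσ (Sum.inl (j, l, m))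
  rw [← hf, encard_push_schubertSet]

/-- The number of solutions of a generic instance of the Schubert problem. -/
noncomputable def deg (s : J → ℕ → ℕ) : ℕ∞ := (exists_isDeg K₀ n k s).choose

variable {K₀ n k} {s : J → ℕ → ℕ} {W : Type} [Fintype W] {o : J} {b : ℕ} {N : ℕ∞}
variable {Ω : Type} [Field Ω] [Algebra K₀ Ω] [IsAlgClosed Ω] {f : J → Fin n → Fin n → Ω}
  {w : W → Fin n → Ω} {r a : ℕ}

theorem IsGeneric.forget (hg : IsGeneric K₀ f w) :
    IsGeneric K₀ f (Empty.elim : Empty → Fin n → Ω) := by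
  convert! hg.comp (e := id) Function.injective_id (e' := (Empty.elim : Empty → W))
    (fun a => a.elim) using 1

theorem encard_schubertSet_eq_deg (hΩ : Cardinal.mk Ω = Cardinal.continuum)
    (hg : IsGeneric K₀ f w) : (SchubertSet k f s).encard = deg K₀ n k s :=
  (exists_isDeg K₀ n k s).choose_spec Ω hΩ f hg.forget

theorem exists_isGeneric (hΩ : Cardinal.mk Ω = Cardinal.continuum) (n : ℕ) (J W : Type) [Finite J]
    [Finite W] : ∃ (f : J → Fin n → Fin n → Ω) (w : W → Fin n → Ω), IsGeneric K₀ f w := by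
  obtain ⟨x, hx⟩ := exists_algebraicIndependent (K₀ := K₀) hΩ ((J × Fin n × Fin n) ⊕ (W × Fin n))
  exact ⟨_, _, IsGeneric.of_algebraicIndependent hx⟩

theorem exists_finrank_one_le {U : Submodule Ω (Fin n → Ω)} (h : 1 ≤ finrank Ω U) :
    ∃ ℓ ≤ U, finrank Ω ↥ℓ = 1 := by
  obtain ⟨z, hz, hz0⟩ := Submodule.exists_mem_ne_zero_of_ne_bot (Submodule.one_le_finrank_iff.1 h)
  exact ⟨Submodule.span Ω {z}, (Submodule.span_singleton_le_iff_mem _ _).2 hz,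
    finrank_span_singleton hz0⟩

theorem exists_mem_markedSet [IsEmpty W] (hk : 0 < k) {V : Submodule Ω (Fin n → Ω)}
    (hV : V ∈ SchubertSet k f s) (o : J) : ∃ ℓ, (ℓ, V) ∈ MarkedSet k f s w o (s o 0) := by
  obtain ⟨ℓ, h1, h2⟩ := exists_finrank_one_le (U := V ⊓ fl (f o) (s o 0))
    ((Nat.le_add_left 1 0).trans (hV.2 o 0 hk))
  exact ⟨ℓ, hV, h2, h1, isEmptyElim⟩

theorem finrank_inf_zero [IsEmpty W] (hk : 0 < k) (hs : Adm n k s)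
    (hcount : ∑ j, ∑ q ∈ Finset.range k, (n - s j q) =
      k * (n - k) + Fintype.card J * k.choose 2) (hg : IsGeneric K₀ f w)
    {V : Submodule Ω (Fin n → Ω)} (hV : V ∈ SchubertSet k f s) (o : J) :
    finrank Ω ↥(V ⊓ fl (f o) (s o 0)) = 1 := by
  obtain ⟨ℓ, hℓ⟩ := exists_mem_markedSet (w := w) hk hV o
  exact finrank_eq_succ hg hs hk (by simpa using hcount) hℓ o 0 hk

theorem good_of_isEmpty_zero [IsEmpty W] (hk : 0 < k) (hs : Adm n k s)
    (hcount : ∑ j, ∑ q ∈ Finset.range k, (n - s j q) =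
      k * (n - k) + Fintype.card J * k.choose 2) :
    Good K₀ k s W o (s o 0) n (deg K₀ n k s) := by
  intro Ω _ _ _ hΩ f w hg
  have hone : ∀ V ∈ SchubertSet k f s, finrank Ω ↥(V ⊓ fl (f o) (s o 0)) = 1 := fun V hV =>
    finrank_inf_zero hk hs hcount hg hV o
  have huniq : ∀ x ∈ MarkedSet k f s w o (s o 0), x.1 = x.2 ⊓ fl (f o) (s o 0) := fun x hx =>
    Submodule.eq_of_le_of_finrank_eq hx.2.2.1 (by rw [hx.2.1, hone _ hx.1])
  constructor
  · rw [← encard_schubertSet_eq_deg hΩ hg]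
    refine Set.encard_congr ⟨fun x => ⟨x.1.2, x.2.1⟩,
      fun V => ⟨(V.1 ⊓ fl (f o) (s o 0), V.1), V.2, hone _ V.2, le_rfl, isEmptyElim⟩,
      fun x => ?_, fun V => rfl⟩
    exact Subtype.ext (Prod.ext (huniq x.1 x.2).symm rfl)
  · intro x hx Φ hΦ u hu hu0 y hy hyu hyw
    have hex := finrank_eq_cnt hg hs hk (by simpa using hcount) hx
    have key : ∀ j i, ∀ z ∈ x.2 ⊓ fl (f j) i, Φ z ∈ fl (f j) i ⊔ x.2 := by
      intro j i z hz
      rcases hc : cnt k (s j) i with _ | q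
      · have h0 := hex j i
        rw [hc, Submodule.finrank_eq_zero] at h0
        rw [h0, Submodule.mem_bot] at hz
        simp [hz]
      · have hqk : q < k := by
          have : cnt k (s j) i ≤ k := (Finset.card_filter_le _ _).trans (Finset.card_range k).le
          omega
        have hsi : s j q ≤ i := by
          by_contra! hlt
          have := hs.cnt_at j hqk
          have h2 : cnt k (s j) i ≤ q := by
            rw [← Finset.card_range q]
            refine Finset.card_le_card fun p hp => ?_
            simp only [Finset.mem_filter, Finset.mem_range] at hp ⊢
            by_contra! hqp
            have := hs.mono j q p hqp hp.1
            omega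
          omega
        have heq : x.2 ⊓ fl (f j) (s j q) = x.2 ⊓ fl (f j) i :=
          Submodule.eq_of_le_of_finrank_eq (inf_le_inf_left _ (fl_mono _ hsi))
            (by rw [hex, hex, hc, hs.cnt_at j hqk])
        rw [← heq] at hz
        exact (sup_le_sup_right (fl_mono (f j) hsi) x.2 :) (hΦ j q hqk z hz)
    have hf : AlgebraicIndependent K₀ fun x : J × Fin n × Fin n => f x.1 x.2.1 x.2.2 :=
      AlgebraicIndependent.comp hg Sum.inl Sum.inl_injective
    have hT := tangent_eq_zero hf (V := x.2) (by
      simp only [hex, sum_cnt]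
      rw [hx.1.1]
      exact hcount) hg.det_ne_zero Φ key
    refine ⟨hT, ?_⟩
    rw [huniq x hx]
    refine ⟨?_, hy⟩
    have h1 := hT u (hx.2.2.1 hu).1
    have := add_mem hyu h1
    rwa [sub_add_cancel] at this

theorem good_of_isEmpty_pos [IsEmpty W] (hk : 0 < k) (hr : 0 < r)
    (hcount : ∑ j, ∑ q ∈ Finset.range k, (n - s j q) =
      k * (n - k) + Fintype.card J * k.choose 2 + r) :
    Good K₀ k s W o b n 0 := by
  intro Ω _ _ _ hΩ f w hg
  have : MarkedSet k f s w o b = ∅ := by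
    rw [Set.eq_empty_iff_forall_notMem]
    intro x hx
    have := sum_le_of_mem_schubertSet hg hk o hx.1
    omega
  simp [this]

theorem good_of_eq (hs : Adm n k s) (hr : r < k) (hsa : s o r = a + 1)
    (hcount : ∑ j, ∑ q ∈ Finset.range k, (n - s j q) + (Fintype.card W + 1) =
      k * (n - k) + Fintype.card J * k.choose 2 + r)
    (ha : if r = 0 then a = 0 else s o (r - 1) = a) :
    Good K₀ k (upd s o r a) W o a n 0 := by
  intro Ω _ _ _ hΩ f w hg
  have : MarkedSet k f (upd s o r a) w o a = ∅ := by
    rw [Set.eq_empty_iff_forall_notMem]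
    intro x hx
    obtain ⟨hx, h⟩ := (mem_markedSet_upd hr (by omega)).1 hx
    split_ifs at ha with hr0
    · have h1 := hx.2.2.1
      have h2 := hx.2.1
      rw [ha, fl_zero (hg.det_ne_zero o), inf_bot_eq, le_bot_iff] at h1
      rw [h1, finrank_bot] at h2
      omega
    · have := special_lt hg hs hr hsa hcount hx (by omega)
        (le_antisymm (special_le hg hs hr hsa hcount hx) h)
      omega
  simp [this]

end Degree

section Strips

variable {n k : ℕ} {J : Type}

/-- The indices of the flag members in the Schubert conditions of the partitions `lam j`. -/
def sOf (n k : ℕ) (lam : J → ℕ → ℕ) : J → ℕ → ℕ := fun j q => n - k + (q + 1) - lam j q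

theorem adm_sOf (hkn : k ≤ n) {lam : J → ℕ → ℕ} (h : ∀ j, IsRectPartition n k (lam j)) :
    Adm n k (sOf n k lam) where
  pos j q _ := by have := (h j).2.1 q; simp only [sOf]; omega
  lt j p q hpq _ := by
    have := (h j).1 hpq.le
    have := (h j).2.1 p
    simp only [sOf]; omega
  le j q hq := by simp only [sOf]; omega

theorem sum_sub_sOf (hkn : k ≤ n) {lam : ℕ → ℕ} (h : IsRectPartition n k lam) :
    ∑ q ∈ Finset.range k, (n - (n - k + (q + 1) - lam q)) =
      ∑ q ∈ Finset.range k, lam q + k.choose 2 := by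
  have h1 : ∀ q ∈ Finset.range k, n - (n - k + (q + 1) - lam q) = lam q + (k - 1 - q) := by
    intro q hq
    have := h.2.1 q
    simp only [Finset.mem_range] at hq
    omega
  rw [Finset.sum_congr rfl h1, Finset.sum_add_distrib, Finset.sum_range_reflect (fun q => q) k,
    Finset.sum_range_id, Nat.choose_two_right]

theorem sum_sum_sub_sOf [Fintype J] (hkn : k ≤ n) {lam : J → ℕ → ℕ}
    (h : ∀ j, IsRectPartition n k (lam j)) :
    ∑ j, ∑ q ∈ Finset.range k, (n - sOf n k lam j q) =
      ∑ j, ∑ q ∈ Finset.range k, lam j q + Fintype.card J * k.choose 2 := by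
  simp only [sOf, fun j => sum_sub_sOf hkn (h j), Finset.sum_add_distrib, Finset.sum_const,
    Finset.card_univ, smul_eq_mul]

theorem finite_isRectPartition (n k : ℕ) : {ν : ℕ → ℕ | IsRectPartition n k ν}.Finite := by
  refine Set.Finite.of_injOn (f := fun ν (i : Fin k) => (⟨min (ν i) (n - k), by omega⟩ :
    Fin (n - k + 1))) (t := Set.univ) (fun _ _ => Set.mem_univ _) ?_ Set.finite_univ
  intro ν hν ν' hν' h
  funext i
  by_cases hi : i < k
  · have := congrFun h ⟨i, hi⟩
    simp only [Fin.mk.injEq] at this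
    rwa [min_eq_left (hν.2.1 i), min_eq_left (hν'.2.1 i)] at this
  · rw [hν.2.2 i (not_lt.1 hi), hν'.2.2 i (not_lt.1 hi)]

/-- The partitions contained in the `k × (n - k)` rectangle. -/
noncomputable def rp (n k : ℕ) : Finset (ℕ → ℕ) := (finite_isRectPartition n k).toFinset

theorem mem_rp {ν : ℕ → ℕ} : ν ∈ rp n k ↔ IsRectPartition n k ν := by simp [rp]

/-- `ν / lam` is a horizontal strip in the rows `0, …, r` with `m - r` cells. -/
def Strip (k r m : ℕ) (lam ν : ℕ → ℕ) : Prop :=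
  (∀ i, lam i ≤ ν i) ∧ (∀ i, ν (i + 1) ≤ lam i) ∧ (∀ i, r < i → ν i = lam i) ∧
    ∑ i ∈ Finset.range k, ν i + r = ∑ i ∈ Finset.range k, lam i + m

variable {lam ν : ℕ → ℕ} {r m : ℕ}

theorem sum_update_succ (hr : r < k) (lam : ℕ → ℕ) :
    ∑ i ∈ Finset.range k, Function.update lam r (lam r + 1) i =
      ∑ i ∈ Finset.range k, lam i + 1 := by
  rw [Finset.sum_update_of_mem (Finset.mem_range.2 hr), ← Finset.add_sum_erase _ lam
    (Finset.mem_range.2 hr), Finset.sdiff_singleton_eq_erase]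
  ring

theorem strip_zero_iff (hlam : IsRectPartition n k lam) :
    IsRectPartition n k ν ∧ Strip k r 0 lam ν ↔ r = 0 ∧ ν = lam := by
  constructor
  · rintro ⟨hν, h1, h2, h3, h4⟩
    have hle : ∑ i ∈ Finset.range k, lam i ≤ ∑ i ∈ Finset.range k, ν i :=
      Finset.sum_le_sum fun i _ => h1 i
    refine ⟨by omega, ?_⟩
    have heq := (Finset.sum_eq_sum_iff_of_le fun i _ => h1 i).1
      (show ∑ i ∈ Finset.range k, lam i = ∑ i ∈ Finset.range k, ν i by omega)
    funext i
    by_cases hi : i < k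
    · exact (heq i (Finset.mem_range.2 hi)).symm
    · rw [hν.2.2 i (not_lt.1 hi), hlam.2.2 i (not_lt.1 hi)]
  · rintro ⟨rfl, rfl⟩
    exact ⟨hlam, fun _ => le_rfl, fun i => hlam.1 (Nat.le_succ i), fun _ _ => rfl, rfl⟩

theorem strip_succ_of_eq (h : ν r = lam r) :
    Strip k r (m + 1) lam ν ↔ 0 < r ∧ Strip k (r - 1) m lam ν ∨
      r = 0 ∧ Strip k r (m + 1) lam ν := by
  rcases Nat.eq_zero_or_pos r with rfl | hr
  · simp
  · simp only [hr, true_and, hr.ne', false_and, or_false, Strip]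
    have : (∀ i, r - 1 < i → ν i = lam i) ↔ ∀ i, r < i → ν i = lam i := by
      refine ⟨fun h' i hi => h' i (by omega), fun h' i hi => ?_⟩
      rcases (show i = r ∨ r < i by omega) with rfl | hi
      · exact h
      · exact h' i hi
    rw [this]
    have : ∑ i ∈ Finset.range k, ν i + r = ∑ i ∈ Finset.range k, lam i + (m + 1) ↔
      ∑ i ∈ Finset.range k, ν i + (r - 1) = ∑ i ∈ Finset.range k, lam i + m := by omega
    rw [this]

theorem not_strip_zero_succ (h : ν 0 = lam 0) : ¬ Strip k 0 (m + 1) lam ν := by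
  rintro ⟨h1, h2, h3, h4⟩
  have : ν = lam := by
    funext i
    rcases i.eq_zero_or_pos with rfl | hi
    · exact h
    · exact h3 i hi
  subst this
  omega

theorem strip_update_iff (hr : r < k) (hlam : IsRectPartition n k lam) :
    Strip k r m (Function.update lam r (lam r + 1)) ν ↔
      Strip k r (m + 1) lam ν ∧ lam r < ν r := by
  have hu : ∀ i, i ≠ r → Function.update lam r (lam r + 1) i = lam i := fun i hi => by simp [hi]
  have hur : Function.update lam r (lam r + 1) r = lam r + 1 := by simp
  unfold Strip
  rw [sum_update_succ hr]
  constructor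
  · rintro ⟨h1, h2, h3, h4⟩
    have hrr := h1 r
    rw [hur] at hrr
    refine ⟨⟨fun i => ?_, fun i => ?_, fun i hi => ?_, by omega⟩, hrr⟩
    · by_cases hi : i = r
      · subst hi; omega
      · rw [← hu i hi]; exact h1 i
    · by_cases hi : i = r
      · subst hi
        rw [h3 _ (Nat.lt_succ_self i), hu _ (by omega)]
        exact hlam.1 (Nat.le_succ i)
      · rw [← hu i hi]; exact h2 i
    · rw [h3 i hi, hu i (by omega)]
  · rintro ⟨⟨h1, h2, h3, h4⟩, h5⟩
    refine ⟨fun i => ?_, fun i => ?_, fun i hi => ?_, by omega⟩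
    · by_cases hi : i = r
      · subst hi; rw [hur]; exact h5
      · rw [hu i hi]; exact h1 i
    · by_cases hi : i = r
      · subst hi; rw [hur]; exact (h2 i).trans (Nat.le_succ _)
      · rw [hu i hi]; exact h2 i
    · rw [hu i (by omega)]; exact h3 i hi

theorem isRectPartition_update (hr : r < k) (hlam : IsRectPartition n k lam)
    (h : if r = 0 then lam 0 < n - k else lam r < lam (r - 1)) :
    IsRectPartition n k (Function.update lam r (lam r + 1)) := by
  have hu : ∀ i, i ≠ r → Function.update lam r (lam r + 1) i = lam i := fun i hi => by simp [hi]
  have hur : Function.update lam r (lam r + 1) r = lam r + 1 := by simp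
  refine ⟨antitone_nat_of_succ_le fun i => ?_, fun i => ?_, fun i hi => ?_⟩
  · have h0 := hlam.1 (Nat.le_succ i)
    by_cases hi : i = r
    · subst hi; rw [hur, hu _ (by omega)]; exact h0.trans (Nat.le_succ _)
    · rw [hu i hi]
      by_cases hi' : i + 1 = r
      · subst hi'
        rw [hur]
        simpa using h
      · rw [hu _ hi']; exact h0
  · by_cases hi : i = r
    · subst hi
      rw [hur]
      split_ifs at h with h0
      · subst h0; omega
      · exact h.trans_le (hlam.2.1 _)
    · rw [hu i hi]; exact hlam.2.1 i
  · rw [hu i (by omega)]; exact hlam.2.2 i hi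

theorem lt_of_strip (hν : IsRectPartition n k ν) (h : Strip k r m lam ν) (hlt : lam r < ν r) :
    if r = 0 then lam 0 < n - k else lam r < lam (r - 1) := by
  split_ifs with h0
  · subst h0; exact hlt.trans_le (hν.2.1 0)
  · have := h.2.1 (r - 1)
    rw [Nat.sub_add_cancel (by omega)] at this
    omega

variable {K₀ : Type} [Field K₀] [Countable K₀] [Fintype J]

theorem upd_sOf (l : J → ℕ → ℕ) (o : J) (r : ℕ) :
    upd (sOf n k l) o r (sOf n k l o r - 1) =
      sOf n k (Function.update l o (Function.update (l o) r (l o r + 1))) := by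
  funext j q
  by_cases hj : j = o
  · subst hj
    by_cases hq : q = r
    · subst hq; rw [upd_self]; simp [sOf]; omega
    · rw [upd_of_ne (by simpa using hq)]; simp [sOf, hq]
  · rw [upd_of_ne (by simp [hj])]; simp [sOf, hj]

theorem sum_update_add (l : J → ℕ → ℕ) (o : J) (ν : ℕ → ℕ) :
    ∑ j, ∑ i ∈ Finset.range k, Function.update l o ν j i + ∑ i ∈ Finset.range k, l o i =
      ∑ j, ∑ i ∈ Finset.range k, l j i + ∑ i ∈ Finset.range k, ν i := by
  rw [← Finset.add_sum_erase _ (fun j => ∑ i ∈ Finset.range k, l j i) (Finset.mem_univ o),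
    ← Finset.add_sum_erase _ (fun j => ∑ i ∈ Finset.range k, Function.update l o ν j i)
      (Finset.mem_univ o)]
  simp only [Function.update_self]
  rw [Finset.sum_congr rfl (g := fun j => ∑ i ∈ Finset.range k, l j i) fun j hj => by
    rw [Function.update_of_ne (Finset.ne_of_mem_erase hj)]]
  ring

theorem good_strip (hkn : k ≤ n) (hk : 0 < k) (o : J) (m : ℕ) : ∀ (r : ℕ) (l : J → ℕ → ℕ),
    (∀ j, IsRectPartition n k (l j)) → r < k →
    ∑ j, ∑ i ∈ Finset.range k, l j i + m = k * (n - k) + r →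
    Good K₀ k (sOf n k l) (Fin m) o (sOf n k l o r) n
      (∑ ν ∈ (rp n k).filter (Strip k r m (l o)),
        deg K₀ n k (sOf n k (Function.update l o ν))) := by
  induction m with
  | zero =>
    intro r l hl hr hsum
    have hS := sum_sum_sub_sOf hkn hl
    rcases Nat.eq_zero_or_pos r with rfl | hr0
    · rw [show (rp n k).filter (Strip k 0 0 (l o)) = {l o} by
        ext ν
        rw [Finset.mem_filter, mem_rp, strip_zero_iff (hl o), Finset.mem_singleton]
        simp, Finset.sum_singleton, Function.update_eq_self]
      exact good_of_isEmpty_zero hk (adm_sOf hkn hl) (by omega)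
    · rw [show (rp n k).filter (Strip k r 0 (l o)) = ∅ by
        ext ν
        rw [Finset.mem_filter, mem_rp, strip_zero_iff (hl o)]
        simp [hr0.ne'], Finset.sum_empty]
      exact good_of_isEmpty_pos hk hr0 (by omega)
  | succ m ih =>
    intro r l hl hr hsum
    have hs := adm_sOf hkn hl
    have hS := sum_sum_sub_sOf hkn hl
    have hpos := hs.pos o r hr
    have hle := hs.le o r hr
    have hsa : sOf n k l o r = (sOf n k l o r - 1) + 1 := by omega
    have hcount : ∑ j, ∑ q ∈ Finset.range k, (n - sOf n k l j q) + (Fintype.card (Fin m) + 1) =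
        k * (n - k) + Fintype.card J * k.choose 2 + r := by
      rw [Fintype.card_fin]; omega
    set c := if r = 0 then l o 0 < n - k else l o r < l o (r - 1) with hc
    have hsplit : ∑ ν ∈ (rp n k).filter (Strip k r (m + 1) (l o)),
        deg K₀ n k (sOf n k (Function.update l o ν)) =
        (if r = 0 then 0 else ∑ ν ∈ (rp n k).filter (Strip k (r - 1) m (l o)),
          deg K₀ n k (sOf n k (Function.update l o ν))) +
        (if c then ∑ ν ∈ (rp n k).filter
            (Strip k r m (Function.update (l o) r (l o r + 1))),
          deg K₀ n k (sOf n k (Function.update l o ν)) else 0) := by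
      rw [← Finset.sum_filter_add_sum_filter_not _ (fun ν => ν r = l o r)]
      congr 1
      · split_ifs with h0
        · subst h0
          refine Finset.sum_eq_zero fun ν hν => ?_
          simp only [Finset.mem_filter, mem_rp] at hν
          exact absurd hν.1.2 (not_strip_zero_succ hν.2)
        · refine Finset.sum_congr ?_ fun _ _ => rfl
          ext ν
          simp only [Finset.mem_filter, and_assoc]
          refine and_congr_right fun _ => ⟨fun h => ?_, fun h => ?_⟩
          · have := (strip_succ_of_eq h.2).1 h.1
            tauto
          · have hν : ν r = l o r := h.2.2.1 r (by omega)
            exact ⟨(strip_succ_of_eq hν).2 (Or.inl ⟨by omega, h⟩), hν⟩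
      · split_ifs with h0
        · refine Finset.sum_congr ?_ fun _ _ => rfl
          ext ν
          simp only [Finset.mem_filter, and_assoc, strip_update_iff hr (hl o)]
          refine and_congr_right fun _ => and_congr_right fun h => ?_
          have := h.1 r
          omega
        · refine Finset.sum_eq_zero fun ν hν => ?_
          simp only [Finset.mem_filter, mem_rp] at hν
          refine absurd (lt_of_strip hν.1.1 hν.1.2 ?_) h0
          have := hν.1.2.1 r
          omega
    rw [hsplit]
    refine Good.reindex ?_ (finSuccEquiv m).symm
    refine good_option hs hr hsa (by omega) hcount (fun h0 => ?_) (fun h0 => by simp [h0]) ?_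
    · rw [if_neg h0.ne']
      exact ih (r - 1) l hl (by omega) (by omega)
    · split_ifs with h0
      · have hl' : ∀ j, IsRectPartition n k
            (Function.update l o (Function.update (l o) r (l o r + 1)) j) := by
          intro j
          by_cases hj : j = o
          · subst hj; rw [Function.update_self]; exact isRectPartition_update hr (hl j) h0
          · rw [Function.update_of_ne hj]; exact hl j
        have hsum' := sum_update_add (k := k) l o (Function.update (l o) r (l o r + 1))
        rw [sum_update_succ hr] at hsum'
        have := ih r _ hl' hr (by omega)
        rw [upd_sOf]
        simp only [Function.update_self, Function.update_idem] at this
        convert! this using 1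
        simp [sOf]; omega
      · refine good_of_eq hs hr hsa hcount ?_
        rw [hc] at h0
        have h1 := (hl o).2.1
        split_ifs at h0 ⊢ with hr0
        · subst hr0; have := h1 0; simp only [sOf]; omega
        · have := (hl o).1 (Nat.sub_le r 1)
          have := h1 r
          have := h1 (r - 1)
          simp only [sOf]; omega

end Strips

section Pieri

variable {K₀ : Type} [Field K₀] [Countable K₀] {n k : ℕ} {J : Type} [Fintype J]
variable {Ω : Type} [Field Ω] [Algebra K₀ Ω] [IsAlgClosed Ω]

theorem le_finrank_inf_fl {g : Fin n → Fin n → Ω} (hdet : (Matrix.of g).det ≠ 0)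
    {V : Submodule Ω (Fin n → Ω)} (hV : finrank Ω V = k) (hkn : k ≤ n) {q : ℕ} (hq : q ≤ k) :
    q ≤ finrank Ω ↥(V ⊓ fl g (n - k + q)) := by
  have h1 := Submodule.finrank_sup_add_finrank_inf_eq V (fl g (n - k + q))
  have h2 := Submodule.finrank_le (V ⊔ fl g (n - k + q))
  rw [finrank_fl hdet (by omega), hV] at h1
  rw [finrank_fin_fun] at h2
  omega

theorem deg_comp (hΩ : Cardinal.mk Ω = Cardinal.continuum) {J' : Type} [Fintype J'] (e : J ≃ J')
    (s : J' → ℕ → ℕ) : deg K₀ n k (fun j => s (e j)) = deg K₀ n k s := by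
  obtain ⟨f, w, hg⟩ := exists_isGeneric (K₀ := K₀) hΩ n J' Empty
  rw [← encard_schubertSet_eq_deg hΩ hg, ← encard_schubertSet_eq_deg hΩ
    (hg.comp (e := e) e.injective (e' := id) Function.injective_id)]
  congr 1
  ext V
  exact and_congr_right fun _ =>
    ⟨fun h j => by obtain ⟨i, rfl⟩ := e.surjective j; exact h i, fun h j => h (e j)⟩

theorem mem_schubertSet_option {f : Option J → Fin n → Fin n → Ω} {l : Option J → ℕ → ℕ}
    {V : Submodule Ω (Fin n → Ω)} :
    V ∈ SchubertSet k f (sOf n k l) ↔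
      V ∈ SchubertSet k (fun j => f (some j)) (sOf n k fun j => l (some j)) ∧
        ∀ q < k, q + 1 ≤ finrank Ω ↥(V ⊓ fl (f none) (sOf n k l none q)) := by
  simp only [SchubertSet, Set.mem_ofPred_eq, Option.forall, sOf]
  tauto

theorem deg_option_zero (hΩ : Cardinal.mk Ω = Cardinal.continuum) (hkn : k ≤ n)
    (l : J → ℕ → ℕ) :
    deg K₀ n k (sOf n k fun j : Option J => j.elim 0 l) = deg K₀ n k (sOf n k l) := by
  obtain ⟨f, w, hg⟩ := exists_isGeneric (K₀ := K₀) hΩ n (Option J) Empty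
  rw [← encard_schubertSet_eq_deg hΩ hg, ← encard_schubertSet_eq_deg hΩ
    (hg.comp (e := some) (Option.some_injective J) (e' := id) Function.injective_id)]
  congr 1
  ext V
  rw [mem_schubertSet_option]
  refine and_iff_left_of_imp fun hV q hq => ?_
  exact le_finrank_inf_fl (hg.det_ne_zero none) hV.1 hkn (by omega)

/-- The partition with the single part `a`. -/
def row (a : ℕ) : ℕ → ℕ := fun i => if i = 0 then a else 0

theorem isRectPartition_row (hk : 0 < k) {a : ℕ} (ha : a ≤ n - k) :
    IsRectPartition n k (row a) := by
  refine ⟨antitone_nat_of_succ_le fun i => by simp [row], fun i => ?_, fun i hi => ?_⟩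
  · simp only [row]; split_ifs <;> omega
  · simp only [row]; split_ifs <;> omega

theorem sum_row (hk : 0 < k) (a : ℕ) : ∑ i ∈ Finset.range k, row a i = a := by
  simp [row]; omega

theorem deg_pieri (hΩ : Cardinal.mk Ω = Cardinal.continuum) (hkn : k ≤ n) (hk : 0 < k) (o : J)
    {a : ℕ} (ha : a ≤ n - k) {l : J → ℕ → ℕ} (hl : ∀ j, IsRectPartition n k (l j))
    (hsum : ∑ j, ∑ i ∈ Finset.range k, l j i + a = k * (n - k)) :
    deg K₀ n k (sOf n k fun j : Option J => j.elim (row a) l) =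
      ∑ ν ∈ (rp n k).filter (Strip k (k - 1) (k - 1 + a) (l o)),
        deg K₀ n k (sOf n k (Function.update l o ν)) := by
  obtain ⟨f, w, hg⟩ := exists_isGeneric (K₀ := K₀) hΩ n (Option J) Empty
  have hgood := good_strip (K₀ := K₀) hkn hk o (k - 1 + a) (k - 1) l hl (by omega) (by omega)
  have hcard : Fintype.card {i : Fin n // n - k + 1 - a ≤ i} = k - 1 + a := by
    rw [Fintype.card_subtype]
    have h1 := Finset.card_filter_add_card_filter_not (s := (Finset.univ : Finset (Fin n)))
      (fun i : Fin n => n - k + 1 - a ≤ (i : ℕ))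
    simp only [not_le] at h1
    rw [Finset.card_univ, Fintype.card_fin] at h1
    have h2 : (Finset.univ.filter fun i : Fin n => (i : ℕ) < n - k + 1 - a).card =
        n - k + 1 - a := by
      rw [Fin.card_filter_val_lt]; omega
    omega
  have hgen : IsGeneric K₀ (fun j => f (some j))
      (fun i : {i : Fin n // n - k + 1 - a ≤ i} => f none i) := by
    unfold IsGeneric at hg ⊢
    convert! AlgebraicIndependent.comp hg (Sum.elim (fun p : J × Fin n × Fin n =>
        Sum.inl (some p.1, p.2)) (fun p : {i : Fin n // n - k + 1 - a ≤ i} × Fin n =>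
        Sum.inl (none, p.1.1, p.2))) (by
      rintro (⟨a, b, c⟩ | ⟨⟨a, ha⟩, b⟩) (⟨a', b', c'⟩ | ⟨⟨a', ha'⟩, b'⟩) h <;> simpa using h) using 1
    funext p
    rcases p with p | p <;> rfl
  have h := ((hgood.reindex (finCongr hcard.symm |>.trans (Fintype.equivFin _).symm))
    Ω hΩ _ _ hgen).1
  rw [← h, ← encard_schubertSet_eq_deg hΩ hg]
  have hl' : ∀ j : Option J, IsRectPartition n k (j.elim (row a) l) := by
    rintro (_ | j)
    · exact isRectPartition_row hk ha
    · exact hl j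
  have hsum' := sum_row hk a
  have he : sOf n k (fun j : Option J => j.elim (row a) l) none 0 = n - k + 1 - a := by
    simp [sOf, row]
  have he' : ∀ q, sOf n k (fun j : Option J => j.elim (row a) l) none (q + 1) =
      n - k + (q + 1 + 1) := by
    simp [sOf, row]
  have hone : ∀ V ∈ SchubertSet k f (sOf n k fun j : Option J => j.elim (row a) l),
      finrank Ω ↥(V ⊓ fl (f none) (n - k + 1 - a)) = 1 := fun V hV => by
    have := finrank_inf_zero hk (adm_sOf hkn hl') (by
      rw [sum_sum_sub_sOf hkn hl', Fintype.sum_option]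
      simp only [Option.elim_none, Option.elim_some]
      omega) hg hV none
    rwa [he] at this
  have hmem : ∀ ℓ V : Submodule Ω (Fin n → Ω), (ℓ, V) ∈ MarkedSet k (fun j => f (some j)) (sOf n k l)
      (fun i : {i : Fin n // n - k + 1 - a ≤ i} => f none i) o (sOf n k l o (k - 1)) ↔
      V ∈ SchubertSet k f (sOf n k fun j : Option J => j.elim (row a) l) ∧
        ℓ ≤ V ⊓ fl (f none) (n - k + 1 - a) ∧ finrank Ω ↥ℓ = 1 := by
    intro ℓ V
    rw [mem_schubertSet_option]
    simp only [MarkedSet, Set.mem_ofPred_eq, Option.elim_some, le_inf_iff]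
    constructor
    · rintro ⟨hV, h1, ⟨h2, h3⟩, h4⟩
      have h5 : ℓ ≤ fl (f none) (n - k + 1 - a) := fun z hz i hi => h4 ⟨i, hi⟩ z hz
      refine ⟨⟨hV, fun q hq => ?_⟩, ⟨h2, h5⟩, h1⟩
      rcases q with _ | q
      · rw [zero_add, ← h1]
        refine Submodule.finrank_mono (le_inf h2 ?_)
        rwa [he]
      · have := le_finrank_inf_fl (hg.det_ne_zero none) hV.1 hkn (q := q + 1 + 1) (by omega)
        rwa [he']
    · rintro ⟨⟨hV, -⟩, ⟨h2, h5⟩, h1⟩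
      refine ⟨hV, h1, ⟨h2, ?_⟩, fun i z hz => h5 hz i.1 i.2⟩
      have hV' : V ⊓ fl (f (some o)) (sOf n k l o (k - 1)) = V := by
        refine Submodule.eq_of_le_of_finrank_le inf_le_left ?_
        have : k - 1 + 1 ≤ finrank Ω ↥(V ⊓ fl (f (some o)) (sOf n k l o (k - 1))) :=
          hV.2 o (k - 1) (by omega)
        rw [hV.1]
        omega
      exact h2.trans (hV'.symm.le.trans inf_le_right)
  symm
  refine Set.encard_congr ⟨fun x => ⟨x.1.2, ((hmem x.1.1 x.1.2).1 x.2).1⟩,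
    fun V => ⟨(V.1 ⊓ fl (f none) (n - k + 1 - a), V.1), (hmem _ _).2 ⟨V.2, le_rfl, hone _ V.2⟩⟩,
    fun x => ?_, fun V => rfl⟩
  obtain ⟨h1, h2, h3⟩ := (hmem x.1.1 x.1.2).1 x.2
  exact Subtype.ext (Prod.ext (Submodule.eq_of_le_of_finrank_eq h2 (by rw [h3, hone _ h1])).symm rfl)

theorem deg_rect [Unique J] (hΩ : Cardinal.mk Ω = Cardinal.continuum) (hkn : k ≤ n) (hk : 0 < k)
    {l : J → ℕ → ℕ} (hl : ∀ j, ∀ q < k, l j q = n - k) : deg K₀ n k (sOf n k l) = 1 := by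
  obtain ⟨f, w, hg⟩ := exists_isGeneric (K₀ := K₀) hΩ n J Empty
  rw [← encard_schubertSet_eq_deg hΩ hg]
  have hs : ∀ j, ∀ q < k, sOf n k l j q = q + 1 := fun j q hq => by
    simp only [sOf, hl j q hq]; omega
  have hF := finrank_fl (hg.det_ne_zero default) hkn
  rw [Set.encard_eq_one]
  refine ⟨fl (f default) k, Set.eq_singleton_iff_unique_mem.2 ⟨⟨hF, fun j q hq => ?_⟩, fun V hV => ?_⟩⟩
  · rw [Unique.eq_default j, hs _ q hq, inf_eq_right.2 (fl_mono _ (by omega)),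
      finrank_fl (hg.det_ne_zero default) (by omega)]
  · have h1 := hV.2 default (k - 1) (by omega)
    rw [hs _ _ (by omega), show k - 1 + 1 = k by omega] at h1
    rw [← Submodule.eq_of_le_of_finrank_le (inf_le_left : V ⊓ fl (f default) k ≤ V) (by
      rw [hV.1]; exact h1)]
    exact Submodule.eq_of_le_of_finrank_le inf_le_right (by rw [hF]; exact h1)

variable (K₀ n k) in
/-- The number of solutions of a generic Schubert problem given by a multiset of partitions. -/
noncomputable def dg (M : Multiset (ℕ → ℕ)) : ℕ∞ := deg K₀ n k (sOf n k fun j : M => j.1)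

theorem dg_cons (hΩ : Cardinal.mk Ω = Cardinal.continuum) (lam : ℕ → ℕ) (M : Multiset (ℕ → ℕ)) :
    dg K₀ n k (lam ::ₘ M) = deg K₀ n k (sOf n k fun j : Option M => j.elim lam fun j => j.1) := by
  rw [dg, ← deg_comp hΩ (Multiset.consEquiv (m := M) (v := lam)).symm]
  congr 1
  funext j
  rcases j with _ | j <;> rfl

end Pieri

section BenderKnuth

/-- The truncated size of a sequence. -/
def mx (k : ℕ) (x : ℕ → ℕ) (j : ℕ) : ℕ := ∑ a ∈ Finset.range k, max (x a) j

theorem mx_zero (k : ℕ) (x : ℕ → ℕ) : mx k x 0 = ∑ a ∈ Finset.range k, x a := by simp [mx]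

theorem sum_min_add_mx (k : ℕ) (x : ℕ → ℕ) (j : ℕ) :
    ∑ a ∈ Finset.range k, min (x a) j + mx k x j = ∑ a ∈ Finset.range k, x a + k * j := by
  rw [mx, ← Finset.sum_add_distrib, Finset.sum_congr rfl fun a _ => min_add_max (x a) j,
    Finset.sum_add_distrib]
  simp

theorem mx_succ (k : ℕ) (x : ℕ → ℕ) (j : ℕ) :
    mx k x (j + 1) = mx k x j + ((Finset.range k).filter (x · ≤ j)).card := by
  rw [mx, mx, Finset.card_filter, ← Finset.sum_add_distrib]
  refine Finset.sum_congr rfl fun a _ => ?_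
  split_ifs <;> omega

/-- The lower end of the movable part of row `a`. -/
def lo (x z : ℕ → ℕ) (a : ℕ) : ℕ := max (x a) (z (a + 1))

/-- The upper end of the movable part of row `a`. -/
def hi (x z : ℕ → ℕ) (a : ℕ) : ℕ := if a = 0 then z 0 else min (z a) (x (a - 1))

/-- The Bender–Knuth move on the columns before `j`. -/
def bk (x y z : ℕ → ℕ) (j a : ℕ) : ℕ :=
  if y a ≤ j then lo x z a + min (hi x z a) j - y a else y a

/-- `y / x` is a horizontal strip. -/
def HStrip (x y : ℕ → ℕ) : Prop := ∀ a, x a ≤ y a ∧ y (a + 1) ≤ x a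

variable {x y z : ℕ → ℕ} {j k : ℕ}

theorem lo_le (h : HStrip x y) (h' : HStrip y z) (a : ℕ) : lo x z a ≤ y a :=
  max_le (h a).1 (h' a).2

theorem le_hi (h : HStrip x y) (h' : HStrip y z) (a : ℕ) : y a ≤ hi x z a := by
  rcases a with _ | a
  · exact (h' 0).1
  · simp only [hi, Nat.add_eq_zero_iff, one_ne_zero, and_false, if_false, Nat.add_sub_cancel]
    exact le_min (h' _).1 (h a).2

theorem lo_le_bk (h : HStrip x y) (h' : HStrip y z) (a : ℕ) : lo x z a ≤ bk x y z j a := by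
  have := lo_le h h' a
  have := le_hi h h' a
  unfold bk
  split_ifs <;> omega

theorem bk_le_hi (h : HStrip x y) (h' : HStrip y z) (a : ℕ) : bk x y z j a ≤ hi x z a := by
  have := lo_le h h' a
  have := le_hi h h' a
  unfold bk
  split_ifs <;> omega

theorem bk_le_iff (h : HStrip x y) (h' : HStrip y z) (a : ℕ) : bk x y z j a ≤ j ↔ y a ≤ j := by
  have := lo_le h h' a
  have := le_hi h h' a
  unfold bk
  split_ifs <;> omega

theorem bk_bk (h : HStrip x y) (h' : HStrip y z) : bk x (bk x y z j) z j = y := by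
  funext a
  have h1 := lo_le h h' a
  have h2 := le_hi h h' a
  conv_lhs => rw [bk]
  simp only [bk_le_iff h h']
  unfold bk
  split_ifs <;> omega

theorem hStrip_bk_left (h : HStrip x y) (h' : HStrip y z) : HStrip x (bk x y z j) := by
  refine fun a => ⟨(le_max_left _ _).trans (lo_le_bk h h' a), (bk_le_hi h h' (a + 1)).trans ?_⟩
  simp [hi]

theorem hStrip_bk_right (h : HStrip x y) (h' : HStrip y z) : HStrip (bk x y z j) z := by
  refine fun a => ⟨(bk_le_hi h h' a).trans ?_, (le_max_right _ _).trans (lo_le_bk h h' a)⟩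
  rcases a with _ | a <;> simp [hi]

theorem mx_bk (h : HStrip x y) (h' : HStrip y z) {j' : ℕ} (hj : j ≤ j') :
    mx k (bk x y z j) j' = mx k y j' := by
  refine Finset.sum_congr rfl fun a _ => ?_
  have := bk_le_iff (j := j) h h' a
  by_cases hy : y a ≤ j
  · have := this.2 hy
    omega
  · simp [bk, hy]

theorem sum_lo_hi (x z : ℕ → ℕ) (j K : ℕ) :
    ∑ a ∈ Finset.range (K + 1), (min (lo x z a) j + min (hi x z a) j) + min (hi x z (K + 1)) j =
      ∑ a ∈ Finset.range (K + 1), min (x a) j + ∑ a ∈ Finset.range (K + 1), min (z a) j +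
        min (z (K + 1)) j := by
  induction K with
  | zero => simp [lo, hi]; omega
  | succ K ih =>
    rw [Finset.sum_range_succ _ (K + 1), Finset.sum_range_succ (fun a => min (x a) j) (K + 1),
      Finset.sum_range_succ (fun a => min (z a) j) (K + 1)]
    have : min (lo x z (K + 1)) j + min (hi x z (K + 1 + 1)) j =
        min (x (K + 1)) j + min (z (K + 1 + 1)) j := by
      simp only [lo, hi, Nat.add_eq_zero_iff, one_ne_zero, and_false, if_false, Nat.add_sub_cancel]
      omega
    omega

theorem sum_bk (h : HStrip x y) (h' : HStrip y z) (hk : 0 < k) (hz : z k = 0)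
    (hno : ∀ a < k, x a ≤ j → y a ≤ j) :
    ∑ a ∈ Finset.range k, bk x y z j a + ∑ a ∈ Finset.range k, y a + (mx k x j + mx k z j) =
      ∑ a ∈ Finset.range k, x a + ∑ a ∈ Finset.range k, z a + 2 * mx k y j := by
  obtain ⟨K, rfl⟩ : ∃ K, k = K + 1 := ⟨k - 1, by omega⟩
  have h1 : ∀ a ∈ Finset.range (K + 1), min (bk x y z j a) j + min (y a) j =
      min (lo x z a) j + min (hi x z a) j := by
    intro a ha
    have h1 := lo_le h h' a
    have h2 := le_hi h h' a
    have h3 := hno a (Finset.mem_range.1 ha)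
    have h4 : x a ≤ lo x z a := le_max_left _ _
    have h5 : lo x z a ≤ max (x a) (y a) := by
      have := (h' a).2
      simp only [lo]; omega
    have h6 : lo x z a = x a ∨ lo x z a = z (a + 1) := by simp only [lo]; omega
    have h7 : y a ≤ j → lo x z a ≤ j := by omega
    by_cases hy : y a ≤ j
    · simp only [bk, hy, if_true]; omega
    · simp only [bk, hy, if_false]
      omega
  have h2 := sum_lo_hi x z j K
  rw [← Finset.sum_congr rfl h1, Finset.sum_add_distrib] at h2
  have h3 : hi x z (K + 1) = 0 := by simp [hi, hz]
  have h4 := sum_min_add_mx (K + 1) x j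
  have h5 := sum_min_add_mx (K + 1) y j
  have h6 := sum_min_add_mx (K + 1) z j
  have h7 := sum_min_add_mx (K + 1) (bk x y z j) j
  have h8 := mx_bk (k := K + 1) h h' (le_refl j)
  rw [h3, hz] at h2
  omega

/-- In the last column violating the lattice condition only the larger letter occurs. -/
theorem bad_column (h : HStrip x y) (h' : HStrip y z) (hz : Antitone z)
    (hbad : 2 * mx k y j < mx k x j + mx k z j)
    (hnext : mx k x (j + 1) + mx k z (j + 1) ≤ 2 * mx k y (j + 1)) :
    mx k x j + mx k z j = 2 * mx k y j + 1 ∧ ∀ a < k, x a ≤ j → y a ≤ j := by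
  simp only [mx_succ] at hnext
  have h1 : (Finset.range k).filter (y · ≤ j) ⊆ (Finset.range k).filter (x · ≤ j) := by
    intro a
    simp only [Finset.mem_filter]
    exact fun ha => ⟨ha.1, (h a).1.trans ha.2⟩
  have h2 : (Finset.range k).filter (z · ≤ j) ⊆ (Finset.range k).filter (y · ≤ j) := by
    intro a
    simp only [Finset.mem_filter]
    exact fun ha => ⟨ha.1, (h' a).1.trans ha.2⟩
  have h3 : ((Finset.range k).filter (y · ≤ j) \ (Finset.range k).filter (z · ≤ j)).card ≤ 1 := by
    have key : ∀ a b, a < b → y a ≤ j → z b ≤ j := fun a b hab hy =>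
      (hz (show a + 1 ≤ b from hab)).trans ((h' a).2.trans hy)
    refine Finset.card_le_one.2 fun a ha b hb => ?_
    simp only [Finset.mem_sdiff, Finset.mem_filter, not_and] at ha hb
    rcases lt_trichotomy a b with hab | hab | hab
    · exact absurd (key a b hab ha.1.2) (hb.2 hb.1.1)
    · exact hab
    · exact absurd (key b a hab hb.1.2) (ha.2 ha.1.1)
  have h4 := Finset.card_le_card h1
  have h5 := Finset.card_sdiff_add_card_eq_card h2
  refine ⟨by omega, fun a ha hx => ?_⟩
  have h6 := Finset.eq_of_subset_of_card_le h1 (by omega)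
  have h7 : a ∈ (Finset.range k).filter (x · ≤ j) :=
    Finset.mem_filter.2 ⟨Finset.mem_range.2 ha, hx⟩
  rw [← h6] at h7
  exact (Finset.mem_filter.1 h7).2

end BenderKnuth

/-- `κ` is a chain of `K` horizontal strips in the `k × (n - k)` rectangle starting at `lam`. -/
structure StripChain (n k K : ℕ) (lam : ℕ → ℕ) (κ : ℕ → ℕ → ℕ) : Prop where
  start : κ 0 = lam
  const : ∀ c, K ≤ c → κ c = κ K
  rect : ∀ c, IsRectPartition n k (κ c)
  strip : ∀ c, HStrip (κ c) (κ (c + 1))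

/-- The number of cells in step `c` of a chain. -/
def cont (k : ℕ) (κ : ℕ → ℕ → ℕ) (c : ℕ) : ℤ :=
  ∑ a ∈ Finset.range k, (κ (c + 1) a : ℤ) - ∑ a ∈ Finset.range k, (κ c a : ℤ)

/-- The lattice condition fails in column `j` between steps `i` and `i + 1`. -/
def BadAt (k K : ℕ) (κ : ℕ → ℕ → ℕ) (j i : ℕ) : Prop :=
  i + 2 ≤ K ∧ 2 * mx k (κ (i + 1)) j < mx k (κ i) j + mx k (κ (i + 2)) j

/-- `(j, i)` is the first failure of the lattice condition. -/
def FirstBad (k K : ℕ) (κ : ℕ → ℕ → ℕ) (j i : ℕ) : Prop :=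
  BadAt k K κ j i ∧ (∀ j' > j, ∀ i', ¬ BadAt k K κ j' i') ∧ ∀ l < i, ¬ BadAt k K κ j l

/-- The Bender–Knuth move applied to a chain. -/
def bkMove (κ : ℕ → ℕ → ℕ) (j i : ℕ) : ℕ → ℕ → ℕ :=
  Function.update κ (i + 1) (bk (κ i) (κ (i + 1)) (κ (i + 2)) j)

variable {n k K : ℕ} {lam : ℕ → ℕ} {κ : ℕ → ℕ → ℕ} {i j : ℕ}

theorem FirstBad.unique {i' j' : ℕ} (h : FirstBad k K κ j i) (h' : FirstBad k K κ j' i') :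
    j = j' ∧ i = i' := by
  have hj : j = j' := by
    rcases lt_trichotomy j j' with hj | hj | hj
    · exact (h.2.1 _ hj _ h'.1).elim
    · exact hj
    · exact (h'.2.1 _ hj _ h.1).elim
  subst hj
  rcases lt_trichotomy i i' with hi | hi | hi
  · exact (h'.2.2 _ hi h.1).elim
  · exact ⟨rfl, hi⟩
  · exact (h.2.2 _ hi h'.1).elim

theorem finite_stripChain (n k K : ℕ) (lam : ℕ → ℕ) : {κ | StripChain n k K lam κ}.Finite := by
  have := (finite_isRectPartition n k).to_subtype
  have hinj : Function.Injective fun (κ : {κ | StripChain n k K lam κ}) (c : Fin (K + 1)) =>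
      (⟨κ.1 c, κ.2.rect c⟩ : {ν | IsRectPartition n k ν}) := fun κ κ' h => by
    have h1 : ∀ c ≤ K, κ.1 c = κ'.1 c := fun c hc =>
      congrArg Subtype.val (congrFun h ⟨c, by omega⟩)
    refine Subtype.ext (funext fun c => ?_)
    rcases le_total c K with hc | hc
    · exact h1 c hc
    · rw [κ.2.const c hc, κ'.2.const c hc, h1 K le_rfl]
  exact Set.finite_coe_iff.1 (Finite.of_injective _ hinj)

theorem StripChain.mx_eq (h : StripChain n k K lam κ) (c : ℕ) (hj : n - k ≤ j) :
    mx k (κ c) j = k * j := by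
  rw [mx, Finset.sum_congr rfl fun a _ => max_eq_right (((h.rect c).2.1 a).trans hj)]
  simp

theorem StripChain.exists_firstBad (h : StripChain n k K lam κ) (hbad : ∃ j i, BadAt k K κ j i) :
    ∃ j i, FirstBad k K κ j i := by
  have hlt : ∀ j i, BadAt k K κ j i → j ≤ n - k := fun j i hji => by
    by_contra hj
    have := hji.2
    rw [h.mx_eq _ (by omega), h.mx_eq _ (by omega), h.mx_eq _ (by omega)] at this
    omega
  obtain ⟨j₀, i₀, h₀⟩ := hbad
  have hs := Nat.findGreatest_spec (P := fun j => ∃ i, BadAt k K κ j i) (hlt _ _ h₀) ⟨i₀, h₀⟩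
  refine ⟨_, Nat.find hs, Nat.find_spec hs, fun j' hj' i' hi' => ?_, fun i' hi' => Nat.find_min hs hi'⟩
  exact Nat.findGreatest_is_greatest hj' (hlt _ _ hi') ⟨i', hi'⟩

theorem bkMove_ne {c : ℕ} (hc : c ≠ i + 1) : bkMove κ j i c = κ c := Function.update_of_ne hc _ _

theorem bkMove_self : bkMove κ j i (i + 1) = bk (κ i) (κ (i + 1)) (κ (i + 2)) j :=
  Function.update_self ..

theorem StripChain.bkMove (h : StripChain n k K lam κ) (hi : i + 2 ≤ K) :
    StripChain n k K lam (bkMove κ j i) where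
  start := by rw [bkMove_ne (by omega), h.start]
  const c hc := by rw [bkMove_ne (by omega), bkMove_ne (by omega), h.const c hc]
  rect c := by
    by_cases hc : c = i + 1
    · subst hc
      rw [bkMove_self]
      have h1 := hStrip_bk_left (j := j) (h.strip i) (h.strip (i + 1))
      have h2 := hStrip_bk_right (j := j) (h.strip i) (h.strip (i + 1))
      refine ⟨antitone_nat_of_succ_le fun a => (h1 a).2.trans (h1 a).1,
        fun a => (h2 a).1.trans ((h.rect _).2.1 a), fun a ha => ?_⟩
      exact Nat.eq_zero_of_le_zero ((h2 a).1.trans ((h.rect _).2.2 a ha).le)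
    · rw [bkMove_ne hc]
      exact h.rect c
  strip c := by
    by_cases hc : c = i
    · subst hc
      rw [bkMove_self, bkMove_ne (by omega)]
      exact hStrip_bk_left (h.strip c) (h.strip (c + 1))
    by_cases hc' : c = i + 1
    · subst hc'
      rw [bkMove_self, bkMove_ne (by omega)]
      exact hStrip_bk_right (h.strip i) (h.strip (i + 1))
    rw [bkMove_ne hc', bkMove_ne (by omega)]
    exact h.strip c

theorem StripChain.bkMove_bkMove (h : StripChain n k K lam κ) :
    SchubertEnum.bkMove (SchubertEnum.bkMove κ j i) j i = κ := by
  funext c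
  by_cases hc : c = i + 1
  · subst hc
    rw [bkMove_self, bkMove_self, bkMove_ne (by omega), bkMove_ne (by omega),
      bk_bk (h.strip i) (h.strip (i + 1))]
  · rw [bkMove_ne hc, bkMove_ne hc]

theorem StripChain.mx_bkMove (h : StripChain n k K lam κ) {j' : ℕ} (hj : j ≤ j') (c : ℕ) :
    mx k (SchubertEnum.bkMove κ j i c) j' = mx k (κ c) j' := by
  by_cases hc : c = i + 1
  · subst hc
    rw [bkMove_self, mx_bk (h.strip i) (h.strip (i + 1)) hj]
  · rw [bkMove_ne hc]

theorem StripChain.badAt_bkMove (h : StripChain n k K lam κ) {j' i' : ℕ} (hj : j ≤ j') :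
    BadAt k K (SchubertEnum.bkMove κ j i) j' i' ↔ BadAt k K κ j' i' := by
  simp only [BadAt, h.mx_bkMove hj]

theorem StripChain.firstBad_bkMove (h : StripChain n k K lam κ) (hb : FirstBad k K κ j i) :
    FirstBad k K (SchubertEnum.bkMove κ j i) j i :=
  ⟨(h.badAt_bkMove le_rfl).2 hb.1, fun _ hj' i' hi' => hb.2.1 _ hj' i' ((h.badAt_bkMove hj'.le).1 hi'),
    fun i' hi' h' => hb.2.2 i' hi' ((h.badAt_bkMove le_rfl).1 h')⟩

theorem StripChain.cont_bkMove (h : StripChain n k K lam κ) (hk : 0 < k) (hb : FirstBad k K κ j i) :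
    cont k (SchubertEnum.bkMove κ j i) i = cont k κ (i + 1) - 1 ∧
      cont k (SchubertEnum.bkMove κ j i) (i + 1) = cont k κ i + 1 ∧
      ∀ c, c ≠ i → c ≠ i + 1 → cont k (SchubertEnum.bkMove κ j i) c = cont k κ c := by
  have hnext : mx k (κ i) (j + 1) + mx k (κ (i + 2)) (j + 1) ≤ 2 * mx k (κ (i + 1)) (j + 1) := by
    have := hb.2.1 (j + 1) (by omega) i
    simp only [BadAt, not_and, not_lt] at this
    exact this hb.1.1
  obtain ⟨h1, h2⟩ := bad_column (h.strip i) (h.strip (i + 1)) (h.rect _).1 hb.1.2 hnext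
  have h3 := sum_bk (h.strip i) (h.strip (i + 1)) hk ((h.rect _).2.2 k le_rfl) h2
  refine ⟨?_, ?_, fun c hc hc' => ?_⟩
  · rw [cont, cont, bkMove_self, bkMove_ne (by omega)]
    zify at h3 h1
    linarith
  · rw [cont, cont, bkMove_self, bkMove_ne (by omega)]
    zify at h3 h1
    linarith
  · rw [cont, cont, bkMove_ne (by omega), bkMove_ne (by omega)]

variable (n k K lam) in
/-- The finite set of chains of horizontal strips. -/
noncomputable def chains : Finset (ℕ → ℕ → ℕ) := (finite_stripChain n k K lam).toFinset

theorem mem_chains : κ ∈ chains n k K lam ↔ StripChain n k K lam κ := by simp [chains]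

/-- The chain `κ` has the content `μ`, permuted by `w` with respect to the dot action. -/
def HasContent (k : ℕ) (μ : ℕ → ℕ) (κ : ℕ → ℕ → ℕ) (w : Equiv.Perm (Fin K)) : Prop :=
  ∀ c : Fin K, cont k κ c - (c : ℤ) = (μ (w c) : ℤ) - (w c : ℤ)

theorem StripChain.hasContent_bkMove (h : StripChain n k K lam κ) (hk : 0 < k)
    (hb : FirstBad k K κ j i) {μ : ℕ → ℕ} {w : Equiv.Perm (Fin K)} (hw : HasContent k μ κ w) :
    HasContent k μ (SchubertEnum.bkMove κ j i)
      (w * Equiv.swap ⟨i, by have := hb.1.1; omega⟩ ⟨i + 1, by have := hb.1.1; omega⟩) := by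
  obtain ⟨h1, h2, h3⟩ := h.cont_bkMove hk hb
  have hi := hb.1.1
  intro c
  rw [Equiv.Perm.mul_apply]
  by_cases hc : (c : ℕ) = i
  · rw [show c = ⟨i, by omega⟩ from Fin.ext hc, Equiv.swap_apply_left, ← hw, h1]
    push_cast
    ring
  by_cases hc' : (c : ℕ) = i + 1
  · rw [show c = ⟨i + 1, by omega⟩ from Fin.ext hc', Equiv.swap_apply_right, ← hw, h2]
    push_cast
    ring
  rw [Equiv.swap_apply_of_ne_of_ne (fun h => hc (by rw [h])) (fun h => hc' (by rw [h])), ← hw,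
    h3 _ hc hc']

theorem StripChain.eq_one_of_hasContent (hlat : ∀ j i, ¬ BadAt k K κ j i) {μ : ℕ → ℕ}
    (hμ : Antitone μ) {w : Equiv.Perm (Fin K)} (hw : HasContent k μ κ w) : w = 1 := by
  have hstep : ∀ c, c + 2 ≤ K → cont k κ (c + 1) ≤ cont k κ c := fun c hc => by
    have := hlat 0 c
    simp only [BadAt, not_and, not_lt, mx_zero] at this
    have := this hc
    zify at this
    simp only [cont]
    linarith
  have hanti : ∀ d c, c + d + 1 ≤ K → cont k κ (c + d) ≤ cont k κ c := fun d => by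
    induction d with
    | zero => simp
    | succ d ih => exact fun c hc => (hstep (c + d) (by omega)).trans (ih c (by omega))
  have hmono : StrictMono w := fun a b hab => by
    by_contra hle
    have hle : w b ≤ w a := not_lt.1 hle
    have h1 := hw a
    have h2 := hw b
    have h3 := hanti (b - a) a (by have := b.2; omega)
    rw [show (a : ℕ) + (b - a) = b by omega] at h3
    have h4 : (μ (w a) : ℤ) ≤ μ (w b) := by exact_mod_cast hμ hle
    have h5 : ((w b : ℕ) : ℤ) ≤ (w a : ℕ) := by exact_mod_cast hle
    have h6 : ((a : ℕ) : ℤ) < (b : ℕ) := by exact_mod_cast hab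
    linarith
  have := Subsingleton.elim (StrictMono.orderIsoOfSurjective w hmono w.surjective)
    (OrderIso.refl (Fin K))
  ext a
  exact congrArg Fin.val (DFunLike.congr_fun this a)

theorem sum_sign_chains (hk : 0 < k) {μ : ℕ → ℕ} (hμ : Antitone μ) (φ : (ℕ → ℕ) → ℤ) :
    ∑ w : Equiv.Perm (Fin K), (Equiv.Perm.sign w : ℤ) *
        ∑ κ ∈ (chains n k K lam).filter (HasContent k μ · w), φ (κ K) =
      ∑ κ ∈ (chains n k K lam).filter fun κ => (∀ j i, ¬ BadAt k K κ j i) ∧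
        HasContent k μ κ (1 : Equiv.Perm (Fin K)), φ (κ K) := by
  have hinv : ∑ p ∈ (Finset.univ ×ˢ chains n k K lam).filter
      fun p : Equiv.Perm (Fin K) × (ℕ → ℕ → ℕ) => HasContent k μ p.2 p.1 ∧ ∃ j i, BadAt k K p.2 j i,
        (Equiv.Perm.sign p.1 : ℤ) * φ (p.2 K) = 0 := by
    have hex : ∀ p : Equiv.Perm (Fin K) × (ℕ → ℕ → ℕ), StripChain n k K lam p.2 →
        (∃ j i, BadAt k K p.2 j i) →
        ∃ p' : Equiv.Perm (Fin K) × (ℕ → ℕ → ℕ), ∃ j i, ∃ hb : FirstBad k K p.2 j i,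
          p' = (p.1 * Equiv.swap ⟨i, by have := hb.1.1; omega⟩ ⟨i + 1, by have := hb.1.1; omega⟩,
            bkMove p.2 j i) := fun p h hbad => by
      obtain ⟨j, i, hb⟩ := h.exists_firstBad hbad
      exact ⟨_, j, i, hb, rfl⟩
    have hex' : ∀ p ∈ (Finset.univ ×ˢ chains n k K lam).filter
      fun p : Equiv.Perm (Fin K) × (ℕ → ℕ → ℕ) => HasContent k μ p.2 p.1 ∧ ∃ j i, BadAt k K p.2 j i,
        ∃ p' : Equiv.Perm (Fin K) × (ℕ → ℕ → ℕ), ∃ j i, ∃ hb : FirstBad k K p.2 j i,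
          p' = (p.1 * Equiv.swap ⟨i, by have := hb.1.1; omega⟩ ⟨i + 1, by have := hb.1.1; omega⟩,
            bkMove p.2 j i) := fun p hp => by
      simp only [Finset.mem_filter, Finset.mem_product, Finset.mem_univ, true_and, mem_chains] at hp
      exact hex p hp.1 hp.2.2
    choose g hg using hex'
    have hsgn : ∀ (w : Equiv.Perm (Fin K)) {a b : Fin K}, a ≠ b →
        (Equiv.Perm.sign (w * Equiv.swap a b) : ℤ) = - Equiv.Perm.sign w := fun w a b hab => by
      rw [Equiv.Perm.sign_mul, Equiv.Perm.sign_swap hab]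
      simp
    have hmem : ∀ p hp, g p hp ∈ (Finset.univ ×ˢ chains n k K lam).filter
      fun p : Equiv.Perm (Fin K) × (ℕ → ℕ → ℕ) =>
        HasContent k μ p.2 p.1 ∧ ∃ j i, BadAt k K p.2 j i := fun p hp => by
      obtain ⟨j, i, hb, he⟩ := hg p hp
      simp only [Finset.mem_filter, Finset.mem_product, Finset.mem_univ, true_and,
        mem_chains] at hp ⊢
      rw [he]
      exact ⟨hp.1.bkMove hb.1.1, hp.1.hasContent_bkMove hk hb hp.2.1, j, i,
        (hp.1.firstBad_bkMove hb).1⟩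
    refine Finset.sum_involution g (fun p hp => ?_) (fun p hp hne heq => ?_) hmem fun p hp => ?_
    · obtain ⟨j, i, hb, he⟩ := hg p hp
      have hi := hb.1.1
      rw [he, hsgn _ (by simp)]
      dsimp only
      rw [bkMove_ne (by omega)]
      ring
    · obtain ⟨j, i, hb, he⟩ := hg p hp
      have := congrArg (fun q => (Equiv.Perm.sign q.1 : ℤ)) (he.symm.trans heq)
      simp only at this
      rw [hsgn _ (by simp)] at this
      rcases Int.units_eq_one_or (Equiv.Perm.sign p.1) with h | h <;> simp [h] at this
    · obtain ⟨j, i, hb, he⟩ := hg p hp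
      obtain ⟨j', i', hb', he'⟩ := hg (g p hp) (hmem p hp)
      have hch : StripChain n k K lam p.2 := by
        simp only [Finset.mem_filter, Finset.mem_product, Finset.mem_univ, true_and,
          mem_chains] at hp
        exact hp.1
      have hb1 : FirstBad k K (g p hp).2 j i := by
        rw [he]
        exact hch.firstBad_bkMove hb
      obtain ⟨rfl, rfl⟩ := hb1.unique hb'
      rw [he']
      refine Prod.ext ?_ ?_
      · simp only [he]
        rw [mul_assoc, Equiv.swap_mul_self, mul_one]
      · simp only [he]
        exact hch.bkMove_bkMove
  have hgood : ∑ p ∈ (Finset.univ ×ˢ chains n k K lam).filter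
      fun p : Equiv.Perm (Fin K) × (ℕ → ℕ → ℕ) =>
        HasContent k μ p.2 p.1 ∧ ¬ ∃ j i, BadAt k K p.2 j i,
        (Equiv.Perm.sign p.1 : ℤ) * φ (p.2 K) =
      ∑ κ ∈ (chains n k K lam).filter fun κ => (∀ j i, ¬ BadAt k K κ j i) ∧
        HasContent k μ κ (1 : Equiv.Perm (Fin K)), φ (κ K) := by
    symm
    refine Finset.sum_bij' (fun κ _ => (1, κ)) (fun p _ => p.2) ?_ ?_ (fun _ _ => rfl) ?_ ?_
    · simp +contextual
    · rintro ⟨w, κ⟩ hp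
      simp only [Finset.mem_filter, Finset.mem_product, Finset.mem_univ, true_and, not_exists] at hp ⊢
      obtain rfl := StripChain.eq_one_of_hasContent hp.2.2 hμ hp.2.1
      exact ⟨hp.1, hp.2.2, hp.2.1⟩
    · rintro ⟨w, κ⟩ hp
      simp only [Finset.mem_filter, Finset.mem_product, Finset.mem_univ, true_and, not_exists] at hp ⊢
      rw [StripChain.eq_one_of_hasContent hp.2.2 hμ hp.2.1]
    · simp
  rw [← hgood, Finset.sum_congr rfl fun w _ => Finset.mul_sum _ _ _,
    Finset.sum_congr rfl fun w _ => Finset.sum_filter _ _, ← Finset.sum_product', ← Finset.sum_filter,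
    ← Finset.sum_filter_add_sum_filter_not _ fun p : Equiv.Perm (Fin K) × (ℕ → ℕ → ℕ) =>
      ∃ j i, BadAt k K p.2 j i, Finset.filter_filter, Finset.filter_filter, hinv, zero_add]

section Lattice

variable {x y z : ℕ → ℕ} {k : ℕ}

theorem mx_le_iff_sum_range_le (h : HStrip x y) (h' : HStrip y z) (hz : Antitone z)
    (hzk : z k = 0) :
    (∀ j, mx k x j + mx k z j ≤ 2 * mx k y j) ↔
      ∀ r, ∑ a ∈ Finset.range (r + 1), z a + ∑ a ∈ Finset.range r, x a ≤
        ∑ a ∈ Finset.range (r + 1), y a + ∑ a ∈ Finset.range r, y a := by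
  have hyx : ∀ a b, a < b → y b ≤ x a := fun a b hab => by
    obtain ⟨d, rfl⟩ := Nat.exists_eq_add_of_lt hab
    clear hab
    induction d with
    | zero => exact (h a).2
    | succ d ih => exact (h _).2.trans ((h _).1.trans ih)
  have hy : Antitone y := antitone_nat_of_succ_le fun a => (h a).2.trans (h a).1
  have hzero : ∀ a, k ≤ a → z a = 0 ∧ y a = 0 ∧ x a = 0 := fun a ha => by
    have h1 := hz ha
    have h2 := (h' a).1
    have h3 := (h a).1
    omega
  have hzy : ∀ a b, a < b → z b ≤ y a := fun a b hab =>
    (hz (show a + 1 ≤ b from hab)).trans (h' a).2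
  constructor
  · intro hcol r
    by_cases hr : r < k
    · have := hcol (y r)
      obtain ⟨d, hd⟩ := Nat.exists_eq_add_of_lt hr
      have hrk : k = (r + 1) + d := by omega
      simp only [mx, hrk, Finset.sum_range_add _ (r + 1)] at this
      have e1 : ∀ w : ℕ → ℕ, w ≤ z → ∑ i ∈ Finset.range d, max (w (r + 1 + i)) (y r) = d * y r :=
        fun w hw => by
          rw [Finset.sum_congr rfl fun a _ => max_eq_right
            ((hw (r + 1 + a)).trans (hzy r (r + 1 + a) (by omega)))]
          simp
      have e2 : ∀ w : ℕ → ℕ, y ≤ w →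
          ∑ i ∈ Finset.range (r + 1), max (w i) (y r) = ∑ i ∈ Finset.range (r + 1), w i :=
        fun w hw => Finset.sum_congr rfl fun a ha => max_eq_left
          ((hy (by rw [Finset.mem_range] at ha; omega)).trans (hw a))
      have e3 : ∑ a ∈ Finset.range r, max (x a) (y r) = ∑ a ∈ Finset.range r, x a :=
        Finset.sum_congr rfl fun a ha => max_eq_left (hyx a r (Finset.mem_range.1 ha))
      rw [e1 x fun a => (h a).1.trans (h' a).1, e1 y fun a => (h' a).1, e1 z le_rfl, e2 y le_rfl,
        e2 z fun a => (h' a).1, Finset.sum_range_succ, max_eq_right (h r).1, e3] at this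
      have := Finset.sum_range_succ y r
      omega
    · have := hcol 0
      simp only [mx_zero] at this
      have e : ∀ w : ℕ → ℕ, (∀ a, k ≤ a → w a = 0) → ∀ r, k ≤ r →
          ∑ a ∈ Finset.range r, w a = ∑ a ∈ Finset.range k, w a := fun w hw r hr =>
        (Finset.sum_subset (Finset.range_mono hr) fun a _ ha =>
          hw a (by simpa using ha)).symm
      rw [e z (fun a ha => (hzero a ha).1) (r + 1) (by omega),
        e x (fun a ha => (hzero a ha).2.2) r (by omega),
        e y (fun a ha => (hzero a ha).2.1) (r + 1) (by omega),
        e y (fun a ha => (hzero a ha).2.1) r (by omega)]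
      omega
  · intro hrow j
    have hex : ∃ a, z a ≤ j := ⟨k, by omega⟩
    obtain ⟨s, hs, hs', hsk⟩ : ∃ s, (∀ a < s, j < z a) ∧ (∀ a, s ≤ a → z a ≤ j) ∧ s ≤ k :=
      ⟨Nat.find hex, fun a ha => not_le.1 (Nat.find_min hex ha),
        fun a ha => (hz ha).trans (Nat.find_spec hex), Nat.find_min' hex (by omega)⟩
    obtain ⟨d, rfl⟩ := Nat.exists_eq_add_of_le hsk
    simp only [mx, Finset.sum_range_add _ s]
    have e1 : ∀ w : ℕ → ℕ, w ≤ z → ∑ i ∈ Finset.range d, max (w (s + i)) j = d * j :=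
      fun w hw => by
        rw [Finset.sum_congr rfl fun a _ => max_eq_right
          ((hw (s + a)).trans (hs' (s + a) (by omega)))]
        simp
    rw [e1 x fun a => (h a).1.trans (h' a).1, e1 y fun a => (h' a).1, e1 z le_rfl]
    suffices hm : ∑ a ∈ Finset.range s, max (x a) j + ∑ a ∈ Finset.range s, max (z a) j ≤
        2 * ∑ a ∈ Finset.range s, max (y a) j by omega
    rcases s with _ | r
    · simp
    have hr0 := hs r (by omega)
    have hr1 := h r
    have hr2 := h' r
    have hrr := hrow r
    rcases r with _ | t
    · simp only [zero_add, Finset.sum_range_one, Finset.sum_range_zero] at hrr ⊢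
      omega
    have f1 : ∀ a ∈ Finset.range t, max (x a) j = x a ∧ max (y a) j = y a ∧ max (z a) j = z a :=
      fun a ha => by
        rw [Finset.mem_range] at ha
        have := hs (a + 2) (by omega)
        have := h a
        have := h (a + 1)
        have := h' a
        have := h' (a + 1)
        simp only [add_assoc, Nat.reduceAdd] at *
        omega
    have ht := hrow t
    have hs1 := hs t (by omega)
    have ht1 := h t
    have ht2 := h' t
    have g1 : ∑ a ∈ Finset.range t, max (x a) j = ∑ a ∈ Finset.range t, x a :=
      Finset.sum_congr rfl fun a ha => (f1 a ha).1
    have g2 : ∑ a ∈ Finset.range t, max (y a) j = ∑ a ∈ Finset.range t, y a :=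
      Finset.sum_congr rfl fun a ha => (f1 a ha).2.1
    have g3 : ∑ a ∈ Finset.range t, max (z a) j = ∑ a ∈ Finset.range t, z a :=
      Finset.sum_congr rfl fun a ha => (f1 a ha).2.2
    simp only [Finset.sum_range_succ, g1, g2, g3] at hrr ht ⊢
    omega

theorem card_rows (N : ℕ) (p q : ℕ → ℕ) {P : ℕ × ℕ → Prop}
    (hP : ∀ a c, P (a, c) ↔ a < N ∧ p a ≤ c ∧ c < q a) :
    Nat.card {x : ℕ × ℕ // P x} = ∑ a ∈ Finset.range N, (q a - p a) := by
  rw [Nat.subtype_card (((Finset.range N).sigma fun a => Finset.Ico (p a) (q a)).map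
    (Equiv.sigmaEquivProd ℕ ℕ).toEmbedding)]
  · simp
  · rintro ⟨a, c⟩
    simp [hP]

end Lattice

section Tableaux

/-- The entries at most `c` of the skew tableau `T` of shape `nu / lam` form `κ c / lam`. -/
structure Compat (lam nu : ℕ → ℕ) (T : ℕ × ℕ → ℕ) (κ : ℕ → ℕ → ℕ) : Prop where
  le : ∀ c i, lam i ≤ κ c i
  le' : ∀ c i, κ c i ≤ nu i
  zero : κ 0 = lam
  iff : ∀ i x, InSkew lam nu (i, x) → ∀ c, T (i, x) ≤ c ↔ x < κ c i
  out : ∀ x, ¬ InSkew lam nu x → T x = 0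

variable {n k : ℕ} {lam mu nu : ℕ → ℕ} {T : ℕ × ℕ → ℕ} {κ : ℕ → ℕ → ℕ}

theorem Compat.ext_tableau {T' : ℕ × ℕ → ℕ} (h : Compat lam nu T κ) (h' : Compat lam nu T' κ) :
    T = T' := by
  funext ⟨i, x⟩
  by_cases hx : InSkew lam nu (i, x)
  · exact le_antisymm ((h.iff i x hx _).2 ((h'.iff i x hx _).1 le_rfl))
      ((h'.iff i x hx _).2 ((h.iff i x hx _).1 le_rfl))
  · rw [h.out _ hx, h'.out _ hx]

theorem Compat.ext_chain {κ' : ℕ → ℕ → ℕ} (h : Compat lam nu T κ) (h' : Compat lam nu T κ') :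
    κ = κ' := by
  have key : ∀ {κ κ'}, Compat lam nu T κ → Compat lam nu T κ' → ∀ c i, κ c i ≤ κ' c i :=
    fun {κ κ'} h h' c i => by
      by_contra hlt
      rw [not_le] at hlt
      have hx : InSkew lam nu (i, κ' c i) := ⟨h'.le c i, hlt.trans_le (h.le' c i)⟩
      exact lt_irrefl _ ((h'.iff _ _ hx c).1 ((h.iff _ _ hx c).2 hlt))
  funext c i
  exact le_antisymm (key h h' c i) (key h' h c i)

theorem Compat.eq_iff (h : Compat lam nu T κ) (m i x : ℕ) :
    InSkew lam nu (i, x) ∧ T (i, x) = m + 1 ↔ κ m i ≤ x ∧ x < κ (m + 1) i := by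
  constructor
  · rintro ⟨hx, hT⟩
    have h1 := h.iff i x hx m
    have h2 := h.iff i x hx (m + 1)
    omega
  · rintro ⟨h1, h2⟩
    have hx : InSkew lam nu (i, x) := ⟨(h.le m i).trans h1, h2.trans_le (h.le' _ i)⟩
    have h3 := h.iff i x hx m
    have h4 := h.iff i x hx (m + 1)
    exact ⟨hx, by omega⟩

theorem Compat.card_eq (h : Compat lam nu T κ) (hnu : ∀ i, k ≤ i → nu i = 0) (m : ℕ) :
    Nat.card {x : ℕ × ℕ // InSkew lam nu x ∧ T x = m + 1} =
      ∑ a ∈ Finset.range k, (κ (m + 1) a - κ m a) := by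
  refine card_rows k _ _ fun a c => ?_
  rw [h.eq_iff, iff_and_self]
  rintro ⟨h1, h2⟩
  by_contra ha
  have := h.le' (m + 1) a
  rw [hnu a (by omega)] at this
  omega

theorem Compat.card_readBefore (h : Compat lam nu T κ) (m r c : ℕ) :
    Nat.card {x : ℕ × ℕ // ReadBefore r c x ∧ InSkew lam nu x ∧ T x = m + 1} =
      ∑ a ∈ Finset.range r, (κ (m + 1) a - κ m a) + (κ (m + 1) r - max (κ m r) c) := by
  rw [card_rows (r + 1) (fun a => if a < r then κ m a else max (κ m a) c) (κ (m + 1)),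
    Finset.sum_range_succ, if_neg (lt_irrefl r),
    Finset.sum_congr rfl fun a ha => by rw [if_pos (Finset.mem_range.1 ha)]]
  intro a x
  rw [h.eq_iff, ReadBefore]
  dsimp only
  split_ifs with ha <;> omega

theorem StripChain.mono {K : ℕ} (h : StripChain n k K lam κ) : Monotone κ :=
  monotone_nat_of_le_succ fun c i => (h.strip c i).1

theorem StripChain.exists_compat {K : ℕ} (h : StripChain n k K lam κ) :
    ∃ T, Compat lam (κ K) T κ := by
  have hex : ∀ x : ℕ × ℕ, InSkew lam (κ K) x → ∃ c, x.2 < κ c x.1 := fun x hx => ⟨K, hx.2⟩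
  refine ⟨fun x => if hx : InSkew lam (κ K) x then Nat.find (hex x hx) else 0, ⟨fun c i => ?_,
    fun c i => ?_, h.start, fun i x hx c => ?_, fun x hx => dif_neg hx⟩⟩
  · rw [← h.start]
    exact h.mono (Nat.zero_le c) i
  · rcases le_total c K with hc | hc
    · exact h.mono hc i
    · rw [h.const c hc]
  · rw [dif_pos hx, Nat.find_le_iff]
    exact ⟨fun ⟨m, hm, hm'⟩ => hm'.trans_le (h.mono hm i), fun hc => ⟨c, le_rfl, hc⟩⟩

theorem lattice_iff {K : ℕ} (h : StripChain n k K lam κ) (hc : Compat lam nu T κ) :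
    (∀ j i, ¬ BadAt k K κ j i) ↔ ∀ m, 0 < m → ∀ r c : ℕ,
      Nat.card {x : ℕ × ℕ // ReadBefore r c x ∧ InSkew lam nu x ∧ T x = m + 1} ≤
      Nat.card {x : ℕ × ℕ // ReadBefore r c x ∧ InSkew lam nu x ∧ T x = m} := by
  have key : ∀ i, (∀ j, mx k (κ i) j + mx k (κ (i + 2)) j ≤ 2 * mx k (κ (i + 1)) j) ↔ ∀ r c : ℕ,
      Nat.card {x : ℕ × ℕ // ReadBefore r c x ∧ InSkew lam nu x ∧ T x = i + 1 + 1} ≤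
      Nat.card {x : ℕ × ℕ // ReadBefore r c x ∧ InSkew lam nu x ∧ T x = i + 1} := fun i => by
    rw [mx_le_iff_sum_range_le (h.strip i) (h.strip (i + 1)) (h.rect _).1 ((h.rect _).2.2 k le_rfl)]
    simp only [hc.card_readBefore]
    refine forall_congr' fun r => ?_
    have hadd : ∀ m, ∑ a ∈ Finset.range r, (κ (m + 1) a - κ m a) + ∑ a ∈ Finset.range r, κ m a =
        ∑ a ∈ Finset.range r, κ (m + 1) a := fun m => by
      rw [← Finset.sum_add_distrib]
      exact Finset.sum_congr rfl fun a _ => Nat.sub_add_cancel (h.strip m a).1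
    have h1 := hadd i
    have h2 := hadd (i + 1)
    have h3 := (h.strip i r).1
    have h4 := (h.strip (i + 1) r).1
    simp only [Finset.sum_range_succ]
    simp only [add_assoc, Nat.reduceAdd] at *
    refine ⟨fun hr c => by omega, fun hr => ?_⟩
    have := hr (κ (i + 1) r)
    omega
  simp only [BadAt, not_and, not_lt]
  constructor
  · rintro hb m hm
    obtain ⟨i, rfl⟩ := Nat.exists_eq_succ_of_ne_zero hm.ne'
    by_cases hi : i + 2 ≤ K
    · exact (key i).1 fun j => hb j i hi
    · intro r c
      rw [Nat.succ_eq_add_one, hc.card_readBefore (i + 1)]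
      rw [h.const (i + 1 + 1) (by omega), h.const (i + 1) (by omega)]
      simp
  · exact fun hr j i _ => (key i).2 (hr (i + 1) (by omega)) j

theorem content_iff {K : ℕ} (h : StripChain n k K lam κ) (hc : Compat lam nu T κ)
    (hnu : ∀ i, k ≤ i → nu i = 0) (hmu : ∀ i, K ≤ i → mu i = 0) :
    HasContent k mu κ (1 : Equiv.Perm (Fin K)) ↔ ∀ m, 0 < m →
      Nat.card {x : ℕ × ℕ // InSkew lam nu x ∧ T x = m} = mu (m - 1) := by
  have key : ∀ c, cont k κ c = (mu c : ℤ) ↔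
      Nat.card {x : ℕ × ℕ // InSkew lam nu x ∧ T x = c + 1} = mu c := fun c => by
    rw [hc.card_eq hnu, cont, ← Finset.sum_sub_distrib,
      Finset.sum_congr rfl fun a _ => (Nat.cast_sub (h.strip c a).1).symm]
    exact_mod_cast Iff.rfl
  constructor
  · intro hw m hm
    obtain ⟨c, rfl⟩ := Nat.exists_eq_succ_of_ne_zero hm.ne'
    rw [Nat.succ_eq_add_one, Nat.add_sub_cancel, ← key]
    by_cases hcK : c < K
    · simpa using hw ⟨c, hcK⟩
    · rw [hmu c (by omega), cont, h.const (c + 1) (by omega), h.const c (by omega)]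
      simp
  · intro hm c
    rw [(key c).2 (hm (c + 1) (by omega))]
    simp

theorem StripChain.isLRSkewTableau {K : ℕ} (h : StripChain n k K lam κ)
    (hc : Compat lam nu T κ) (hnu : IsRectPartition n k nu) (hmu : ∀ i, K ≤ i → mu i = 0)
    (hlat : ∀ j i, ¬ BadAt k K κ j i) (hw : HasContent k mu κ (1 : Equiv.Perm (Fin K))) :
    IsLRSkewTableau lam mu nu T := by
  refine ⟨fun x => ⟨fun hx => ?_, fun hx => ?_⟩, fun i j j' hj hjj hj' => ?_,
    fun i i' j hi hx hx' => ?_, (content_iff h hc hnu.2.2 hmu).1 hw, (lattice_iff h hc).1 hlat⟩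
  · by_contra hx'
    rw [hc.out x hx'] at hx
    exact lt_irrefl _ hx
  · have := hc.iff x.1 x.2 hx 0
    rw [hc.zero] at this
    have := hx.1
    by_contra h0
    simp only [Prod.mk.eta] at *
    omega
  · have h1 : InSkew lam nu (i, j) := ⟨hj, hjj.trans_lt hj'⟩
    have h2 : InSkew lam nu (i, j') := ⟨hj.trans hjj, hj'⟩
    exact (hc.iff i j h1 _).2 (hjj.trans_lt ((hc.iff i j' h2 _).1 le_rfl))
  · have h0 := hc.iff i' j hx' 0
    rw [hc.zero] at h0
    have h0' : lam i' ≤ j := hx'.1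
    obtain ⟨c, hcc⟩ : ∃ c, T (i', j) = c + 1 := ⟨T (i', j) - 1, by omega⟩
    have h1 := (hc.iff i' j hx' (c + 1)).1 hcc.le
    have h2 := (h.rect (c + 1)).1 (show i + 1 ≤ i' from hi)
    have h3 := (h.strip c i).2
    have := (hc.iff i j hx c).2 (by omega)
    omega

theorem exists_stripChain (hlam : IsRectPartition n k lam) (hmu : IsRectPartition n k mu)
    (hnu : IsRectPartition n k nu) (hle : ∀ i, lam i ≤ nu i) (hT : IsLRSkewTableau lam mu nu T) :
    ∃ κ, StripChain n k k lam κ ∧ κ k = nu ∧ Compat lam nu T κ := by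
  obtain ⟨h1, h2, h3, h4, -⟩ := hT
  have hTk : ∀ x, InSkew lam nu x → T x ≤ k := fun x hx => by
    by_contra hlt
    have hc := h4 (T x) (by omega)
    rw [hmu.2.2 _ (by omega)] at hc
    have hfin : Finite {y : ℕ × ℕ // InSkew lam nu y ∧ T y = T x} := by
      refine Set.Finite.subset (Finset.range k ×ˢ Finset.range (n - k)).finite_toSet ?_
      rintro ⟨i, j⟩ ⟨⟨-, hy⟩, -⟩
      have h5 := hnu.2.1 i
      simp only [Finset.coe_product, Finset.coe_range, Set.mem_prod, Set.mem_Iio]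
      refine ⟨?_, hy.trans_le h5⟩
      by_contra hi
      rw [hnu.2.2 i (by omega)] at hy
      omega
    rw [Finite.card_eq_zero_iff] at hc
    exact hc.elim ⟨x, hx, rfl⟩
  have hex : ∀ c i, ∃ x, lam i ≤ x ∧ (nu i ≤ x ∨ c < T (i, x)) := fun c i =>
    ⟨nu i, hle i, Or.inl le_rfl⟩
  set κ : ℕ → ℕ → ℕ := fun c i => Nat.find (hex c i) with hκ
  have hspec : ∀ c i, lam i ≤ κ c i ∧ (nu i ≤ κ c i ∨ c < T (i, κ c i)) := fun c i =>
    Nat.find_spec (hex c i)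
  have hmin : ∀ c i x, lam i ≤ x → x < κ c i → x < nu i ∧ T (i, x) ≤ c := fun c i x hx hlt => by
    have := Nat.find_min (hex c i) hlt
    omega
  have hle' : ∀ c i, κ c i ≤ nu i := fun c i => Nat.find_min' (hex c i) ⟨hle i, Or.inl le_rfl⟩
  have hzero : κ 0 = lam := funext fun i => by
    refine le_antisymm (Nat.find_min' (hex 0 i) ⟨le_rfl, ?_⟩) (hspec 0 i).1
    by_contra hcon
    push Not at hcon
    have := (h1 (i, lam i)).2 ⟨le_rfl, hcon.1⟩
    omega
  have hcompat : Compat lam nu T κ := ⟨fun c i => (hspec c i).1, hle', hzero, fun i x hx c => by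
    refine ⟨fun hTc => ?_, fun hxc => (hmin c i x hx.1 hxc).2⟩
    by_contra hlt
    rw [not_lt] at hlt
    have h5 : x < nu i := hx.2
    have h6 := h2 i (κ c i) x (hspec c i).1 hlt hx.2
    have h7 := (hspec c i).2
    omega, fun x hx => by have := h1 x; by_contra h; exact hx (this.1 (by omega))⟩
  have hstrip : ∀ c, HStrip (κ c) (κ (c + 1)) := fun c i => by
    constructor
    · refine Nat.find_min' (hex c i) ⟨(hspec _ i).1, ?_⟩
      have := (hspec (c + 1) i).2
      omega
    · by_contra hlt
      rw [not_le] at hlt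
      have h5 := hlam.1 (Nat.le_succ i)
      have h6 := hnu.1 (Nat.le_succ i)
      have h7 := (hspec c i).1
      obtain ⟨h8, h9⟩ := hmin (c + 1) (i + 1) (κ c i) (h5.trans h7) hlt
      have h10 := h3 i (i + 1) (κ c i) (by omega) ⟨h7, h8.trans_le h6⟩ ⟨h5.trans h7, h8⟩
      have := (hspec c i).2
      simp only [Nat.succ_eq_add_one] at *
      omega
  have hend : ∀ c, k ≤ c → κ c = nu := fun c hc => funext fun i => by
    refine le_antisymm (hle' c i) ?_
    by_contra hlt
    rw [not_le] at hlt
    have := (hspec c i).2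
    have := hTk (i, κ c i) ⟨(hspec c i).1, hlt⟩
    omega
  refine ⟨κ, ⟨hzero, fun c hc => by rw [hend c hc, hend k le_rfl], fun c => ⟨?_, fun i =>
    (hle' c i).trans (hnu.2.1 i), fun i hi => ?_⟩, hstrip⟩, hend k le_rfl, hcompat⟩
  · rcases c with _ | c
    · rw [hzero]
      exact hlam.1
    · exact antitone_nat_of_succ_le fun i => (hstrip c i).2.trans (hstrip c i).1
  · have := hle' c i
    rw [hnu.2.2 i hi] at this
    omega

/-- Littlewood–Richardson tableaux correspond to lattice chains. -/
theorem nonempty_equiv_isLRSkewTableau (hlam : IsRectPartition n k lam) (hmu : IsRectPartition n k mu)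
    (hnu : IsRectPartition n k nu) :
    Nonempty ({κ // κ ∈ (chains n k k lam).filter fun κ => ((∀ j i, ¬ BadAt k k κ j i) ∧
        HasContent k mu κ (1 : Equiv.Perm (Fin k))) ∧ κ k = nu} ≃
      {T // (∀ i, lam i ≤ nu i) ∧ IsLRSkewTableau lam mu nu T}) := by
  have hfor : ∀ κ : {κ // κ ∈ (chains n k k lam).filter fun κ => ((∀ j i, ¬ BadAt k k κ j i) ∧
      HasContent k mu κ (1 : Equiv.Perm (Fin k))) ∧ κ k = nu},
      ∃ T, Compat lam nu T κ.1 ∧ (∀ i, lam i ≤ nu i) ∧ IsLRSkewTableau lam mu nu T := by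
    rintro ⟨κ, hκ⟩
    simp only [Finset.mem_filter, mem_chains] at hκ
    obtain ⟨h, ⟨h1, h2⟩, rfl⟩ := hκ
    obtain ⟨T, hT⟩ := h.exists_compat
    exact ⟨T, hT, fun i => (hT.le 0 i).trans (hT.le' 0 i), h.isLRSkewTableau hT hnu hmu.2.2 h1 h2⟩
  choose g hg hg' using hfor
  refine ⟨Equiv.ofBijective (fun κ => ⟨g κ, hg' κ⟩) ⟨fun κ κ' h => ?_, fun T => ?_⟩⟩
  · have h := congrArg Subtype.val h
    simp only at h
    exact Subtype.ext ((hg κ).ext_chain (h ▸ hg κ'))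
  · obtain ⟨κ, h1, h2, h3⟩ := exists_stripChain hlam hmu hnu T.2.1 T.2.2
    have hκ : κ ∈ (chains n k k lam).filter fun κ => ((∀ j i, ¬ BadAt k k κ j i) ∧
        HasContent k mu κ (1 : Equiv.Perm (Fin k))) ∧ κ k = nu := by
      simp only [Finset.mem_filter, mem_chains]
      exact ⟨h1, ⟨(lattice_iff h1 h3).2 T.2.2.2.2.2.2,
        (content_iff h1 h3 hnu.2.2 hmu.2.2).2 T.2.2.2.2.2.1⟩, h2⟩
    exact ⟨⟨κ, hκ⟩, Subtype.ext ((hg _).ext_tableau h3)⟩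

theorem finite_isLRSkewTableau (hlam : IsRectPartition n k lam) (hmu : IsRectPartition n k mu)
    (hnu : IsRectPartition n k nu) :
    Finite {T // (∀ i, lam i ≤ nu i) ∧ IsLRSkewTableau lam mu nu T} :=
  (nonempty_equiv_isLRSkewTableau hlam hmu hnu).elim fun e => Finite.of_equiv _ e

/-- The Littlewood–Richardson number counts lattice chains. -/
theorem card_isLRSkewTableau (hlam : IsRectPartition n k lam) (hmu : IsRectPartition n k mu)
    (hnu : IsRectPartition n k nu) :
    Nat.card {T // (∀ i, lam i ≤ nu i) ∧ IsLRSkewTableau lam mu nu T} =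
      ((chains n k k lam).filter fun κ => ((∀ j i, ¬ BadAt k k κ j i) ∧
        HasContent k mu κ (1 : Equiv.Perm (Fin k))) ∧ κ k = nu).card := by
  rw [← Nat.subtype_card _ fun κ => Iff.rfl]
  exact (nonempty_equiv_isLRSkewTableau hlam hmu hnu).elim fun e => Nat.card_congr e.symm

end Tableaux

section Chains

variable {n k K : ℕ} {lam ν μ : ℕ → ℕ} {κ : ℕ → ℕ → ℕ}

/-- The size of a partition with at most `k` parts. -/
def sz (k : ℕ) (lam : ℕ → ℕ) : ℕ := ∑ a ∈ Finset.range k, lam a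

theorem strip_iff {a : ℕ} (hk : 0 < k) (hlam : IsRectPartition n k lam)
    (hν : IsRectPartition n k ν) :
    Strip k (k - 1) (k - 1 + a) lam ν ↔ HStrip lam ν ∧ sz k ν = sz k lam + a := by
  simp only [Strip, HStrip, sz, forall_and]
  constructor
  · rintro ⟨h1, h2, -, h4⟩
    exact ⟨⟨h1, h2⟩, by omega⟩
  · rintro ⟨⟨h1, h2⟩, h3⟩
    refine ⟨h1, h2, fun i hi => ?_, by omega⟩
    rw [hlam.2.2 i (by omega), hν.2.2 i (by omega)]

theorem HStrip.sz_le (h : HStrip lam ν) (k : ℕ) : sz k ν ≤ sz k lam + ν 0 := by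
  rcases k with _ | k
  · simp [sz]
  · rw [sz, sz, Finset.sum_range_succ', Finset.sum_range_succ]
    have := Finset.sum_le_sum fun a (_ : a ∈ Finset.range k) => (h a).2
    omega

theorem cont_eq (k : ℕ) (κ : ℕ → ℕ → ℕ) (c : ℕ) : cont k κ c = (sz k (κ (c + 1)) : ℤ) - sz k (κ c) := by
  simp [cont, sz]

theorem StripChain.cont_nonneg (h : StripChain n k K lam κ) (c : ℕ) : 0 ≤ cont k κ c := by
  rw [cont_eq, sub_nonneg, Nat.cast_le]
  exact Finset.sum_le_sum fun a _ => (h.strip c a).1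

theorem StripChain.cont_le (h : StripChain n k K lam κ) (c : ℕ) : cont k κ c ≤ (n - k : ℕ) := by
  have h1 := (h.strip c).sz_le k
  have h2 := (h.rect (c + 1)).2.1 0
  rw [cont_eq]
  omega

/-- The steps of the chain `κ` have the sizes recorded in the list `l`. -/
def HasCont (k : ℕ) (l : List ℕ) (κ : ℕ → ℕ → ℕ) : Prop :=
  ∀ c : Fin l.length, cont k κ c = (l.get c : ℤ)

theorem hasCont_cons {a : ℕ} {l : List ℕ} :
    HasCont k (a :: l) κ ↔ cont k κ 0 = a ∧ HasCont k l fun c => κ (c + 1) := by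
  exact Fin.forall_fin_succ (n := l.length) (P := fun c => cont k κ c = ((a :: l).get c : ℤ))

theorem chains_zero (hlam : IsRectPartition n k lam) (hs : HStrip lam lam) :
    chains n k 0 lam = {fun _ => lam} := by
  ext κ
  rw [mem_chains, Finset.mem_singleton]
  constructor
  · intro h
    funext c
    rw [h.const c (Nat.zero_le c), h.start]
  · rintro rfl
    exact ⟨rfl, fun _ _ => rfl, fun _ => hlam, fun _ => hs⟩

theorem StripChain.tail (h : StripChain n k (K + 1) lam κ) :
    StripChain n k K (κ 1) fun c => κ (c + 1) :=
  ⟨rfl, fun c hc => h.const (c + 1) (by omega), fun c => h.rect _, fun c => h.strip _⟩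

/-- Prepend a step to a chain. -/
def consChain (lam : ℕ → ℕ) (κ : ℕ → ℕ → ℕ) : ℕ → ℕ → ℕ
  | 0 => lam
  | c + 1 => κ c

theorem StripChain.cons (hlam : IsRectPartition n k lam) (h : StripChain n k K ν κ)
    (hs : HStrip lam ν) : StripChain n k (K + 1) lam (consChain lam κ) where
  start := rfl
  const c hc := by
    obtain ⟨c, rfl⟩ : ∃ d, c = d + 1 := ⟨c - 1, by omega⟩
    exact h.const c (by omega)
  rect c := by
    rcases c with _ | c
    · exact hlam
    · exact h.rect c
  strip c := by
    rcases c with _ | c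
    · simpa only [consChain, h.start] using hs
    · exact h.strip c

theorem sum_chains_succ {A : Type*} [AddCommMonoid A] (hlam : IsRectPartition n k lam) (a : ℕ)
    (l : List ℕ) (φ : (ℕ → ℕ) → A) :
    ∑ κ ∈ (chains n k (a :: l).length lam).filter (HasCont k (a :: l)), φ (κ (a :: l).length) =
      ∑ ν ∈ (rp n k).filter fun ν => HStrip lam ν ∧ sz k ν = sz k lam + a,
        ∑ κ ∈ (chains n k l.length ν).filter (HasCont k l), φ (κ l.length) := by
  rw [Finset.sum_sigma']
  refine Finset.sum_bij' (fun κ _ => ⟨κ 1, fun c => κ (c + 1)⟩) (fun p _ => consChain lam p.2)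
    ?_ ?_ ?_ ?_ ?_
  · intro κ hκ
    simp only [Finset.mem_filter, mem_chains, hasCont_cons, cont_eq, Finset.mem_sigma, mem_rp] at hκ ⊢
    obtain ⟨h, h1, h2⟩ := hκ
    have hs := h.strip 0
    rw [h.start] at h1 hs
    refine ⟨⟨h.rect 1, hs, ?_⟩, h.tail, h2⟩
    simp only [zero_add] at h1 ⊢
    omega
  · rintro ⟨ν, κ⟩ hp
    simp only [Finset.mem_filter, mem_chains, hasCont_cons, Finset.mem_sigma, mem_rp] at hp ⊢
    obtain ⟨⟨h1, h2, h3⟩, h4, h5⟩ := hp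
    refine ⟨h4.cons hlam h2, ?_, h5⟩
    rw [cont_eq]
    simp only [consChain, h4.start, h3]
    push_cast
    ring
  · intro κ hκ
    simp only [Finset.mem_filter, mem_chains] at hκ
    funext c
    rcases c with _ | c
    · exact hκ.1.start.symm
    · rfl
  · rintro ⟨ν, κ⟩ hp
    simp only [Finset.mem_filter, mem_chains, Finset.mem_sigma] at hp
    simp only [consChain, hp.2.1.start]
  · intro κ hκ
    rfl

theorem isRectPartition_zero (n k : ℕ) : IsRectPartition n k 0 :=
  ⟨fun _ _ _ => le_rfl, fun _ => Nat.zero_le _, fun _ _ => rfl⟩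

/-- The chain filling a partition row by row. -/
def rowChain (μ : ℕ → ℕ) : ℕ → ℕ → ℕ := fun c a => if a < c then μ a else 0

theorem stripChain_rowChain (hμ : IsRectPartition n k μ) : StripChain n k k 0 (rowChain μ) where
  start := by funext a; simp [rowChain]
  const c hc := by
    funext a
    simp only [rowChain]
    split_ifs with h1 h2 h2
    · rfl
    · exact hμ.2.2 a (by omega)
    · omega
    · rfl
  rect c := by
    refine ⟨antitone_nat_of_succ_le fun a => ?_, fun a => ?_, fun a ha => ?_⟩
    · have := hμ.1 (Nat.le_succ a)
      simp only [rowChain, Nat.succ_eq_add_one] at *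
      split_ifs <;> omega
    · have := hμ.2.1 a
      simp only [rowChain]
      split_ifs <;> omega
    · simp [rowChain, hμ.2.2 a ha]
  strip c a := by
    have := hμ.1 (Nat.le_succ a)
    simp only [rowChain, Nat.succ_eq_add_one] at *
    constructor <;> split_ifs <;> omega

theorem rowChain_succ (μ : ℕ → ℕ) (c : ℕ) :
    rowChain μ (c + 1) = Function.update (rowChain μ c) c (μ c) := by
  funext a
  rw [Function.update_apply]
  simp only [rowChain]
  split_ifs <;> grind

theorem rowChain_end (hμ : IsRectPartition n k μ) : rowChain μ k = μ := by
  funext a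
  simp only [rowChain]
  split_ifs with h
  · rfl
  · exact (hμ.2.2 a (by omega)).symm

theorem sum_update_eq {M : Type*} [AddCommMonoid M] {c : ℕ} (hc : c < k) (f : ℕ → M) (v : M) :
    ∑ a ∈ Finset.range k, Function.update f c v a + f c = ∑ a ∈ Finset.range k, f a + v := by
  rw [Finset.sum_update_of_mem (Finset.mem_range.2 hc),
    ← Finset.sum_sdiff (Finset.singleton_subset_iff.2 (Finset.mem_range.2 hc)) (f := f),
    Finset.sum_singleton]
  abel

theorem cont_rowChain (μ : ℕ → ℕ) {c : ℕ} (hc : c < k) : cont k (rowChain μ) c = μ c := by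
  have h := sum_update_eq hc (rowChain μ c) (μ c)
  rw [← rowChain_succ, show rowChain μ c c = 0 by simp [rowChain], add_zero] at h
  rw [cont_eq, sz, sz, h]
  push_cast
  ring

theorem not_badAt_rowChain (hμ : IsRectPartition n k μ) (j i : ℕ) : ¬ BadAt k k (rowChain μ) j i := by
  rintro ⟨hi, hlt⟩
  have h : ∀ c < k, mx k (rowChain μ (c + 1)) j + j = mx k (rowChain μ c) j + max (μ c) j :=
    fun c hc => by
      have h := sum_update_eq hc (fun a => max (rowChain μ c a) j) (max (μ c) j)
      simp only [show rowChain μ c c = 0 by simp [rowChain], Nat.zero_max] at h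
      rw [mx, mx, ← h, rowChain_succ]
      congr 1
      refine Finset.sum_congr rfl fun a _ => ?_
      simp only [Function.update_apply]
      split_ifs <;> rfl
  have h1 := h i (by omega)
  have h2 := h (i + 1) (by omega)
  have h3 := hμ.1 (Nat.le_succ i)
  simp only [Nat.succ_eq_add_one, add_assoc, Nat.reduceAdd] at *
  omega

theorem StripChain.eq_rowChain (hμ : IsRectPartition n k μ) (h : StripChain n k k 0 κ)
    (hlat : ∀ j i, ¬ BadAt k k κ j i) (hw : ∀ c < k, cont k κ c = μ c) : κ = rowChain μ := by
  have hzero : ∀ c a, c ≤ a → κ c a = 0 := fun c => by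
    induction c with
    | zero => intro a _; rw [h.start]; rfl
    | succ c ih =>
      intro a ha
      obtain ⟨a, rfl⟩ : ∃ b, a = b + 1 := ⟨a - 1, by omega⟩
      have := (h.strip c a).2
      rw [ih a (by omega)] at this
      omega
  have hkeep : ∀ c, c < k → ∀ a < c, κ (c + 1) a = κ c a := fun c => by
    induction c with
    | zero => intro _ a ha; omega
    | succ c ih =>
      intro hc a ha
      have hle := (mx_le_iff_sum_range_le (h.strip c) (h.strip (c + 1)) (h.rect _).1
        ((h.rect _).2.2 k le_rfl)).1 (fun j => not_lt.1 fun hlt => hlat j c ⟨by omega, hlt⟩) c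
      have he : ∑ a ∈ Finset.range c, κ (c + 1) a = ∑ a ∈ Finset.range c, κ c a :=
        Finset.sum_congr rfl fun a ha => ih (by omega) a (Finset.mem_range.1 ha)
      have hge := Finset.sum_le_sum fun a (_ : a ∈ Finset.range (c + 1)) => (h.strip (c + 1) a).1
      exact ((Finset.sum_eq_sum_iff_of_le fun a _ => (h.strip (c + 1) a).1).1
        (le_antisymm hge (by simp only [add_assoc, Nat.reduceAdd] at *; omega)) a (by simp; omega)).symm
  have hall : ∀ c ≤ k, κ c = rowChain μ c := fun c => by
    induction c with
    | zero => intro _; rw [h.start]; funext a; simp [rowChain]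
    | succ c ih =>
      intro hc
      have hupd : κ (c + 1) = Function.update (κ c) c (κ (c + 1) c) := by
        funext a
        rw [Function.update_apply]
        split_ifs with ha
        · rw [ha]
        · rcases lt_or_gt_of_ne ha with ha | ha
          · exact hkeep c (by omega) a ha
          · rw [hzero (c + 1) a ha, hzero c a ha.le]
      have h1 := sum_update_eq (show c < k by omega) (κ c) (κ (c + 1) c)
      have h2 := hw c (by omega)
      rw [← hupd, hzero c c le_rfl] at h1
      rw [cont_eq, sz, sz] at h2
      rw [hupd, rowChain_succ, ih (by omega)]
      congr 1
      omega
  funext c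
  rcases le_total c k with hc | hc
  · exact hall c hc
  · rw [h.const c hc, hall k le_rfl, (stripChain_rowChain hμ).const c hc]

end Chains

section LittlewoodRichardson

variable {K₀ : Type} [Field K₀] [Countable K₀] {n k : ℕ} {lam ν μ : ℕ → ℕ}
  {M : Multiset (ℕ → ℕ)}
variable {Ω : Type} [Field Ω] [Algebra K₀ Ω] [IsAlgClosed Ω]

/-- The total size of a multiset of partitions. -/
def msz (k : ℕ) (M : Multiset (ℕ → ℕ)) : ℕ := (M.map (sz k)).sum

@[simp] theorem msz_cons : msz k (lam ::ₘ M) = sz k lam + msz k M := by simp [msz]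

@[simp] theorem msz_add (M' : Multiset (ℕ → ℕ)) : msz k (M + M') = msz k M + msz k M' := by
  simp [msz]

theorem sum_coe_sz (k : ℕ) (M : Multiset (ℕ → ℕ)) :
    ∑ j : M, ∑ i ∈ Finset.range k, j.1 i = msz k M := by
  rw [msz, ← Multiset.map_univ M (sz k)]
  rfl

theorem dg_row_cons (hΩ : Cardinal.mk Ω = Cardinal.continuum) (hkn : k ≤ n) (hk : 0 < k) {a : ℕ}
    (ha : a ≤ n - k) (hlam : IsRectPartition n k lam) (hM : ∀ ν ∈ M, IsRectPartition n k ν)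
    (hsum : sz k lam + msz k M + a = k * (n - k)) :
    dg K₀ n k (row a ::ₘ lam ::ₘ M) =
      ∑ ν ∈ (rp n k).filter fun ν => HStrip lam ν ∧ sz k ν = sz k lam + a,
        dg K₀ n k (ν ::ₘ M) := by
  have hl : ∀ j : Option M, IsRectPartition n k (j.elim lam fun j => j.1) := by
    rintro (_ | j)
    · exact hlam
    · exact hM _ (Multiset.coe_mem)
  have h := deg_pieri (K₀ := K₀) hΩ hkn hk none ha hl (by
    rw [Fintype.sum_option]
    simp only [Option.elim_none, Option.elim_some]
    rw [sum_coe_sz]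
    exact hsum)
  rw [dg_cons hΩ, ← deg_comp hΩ (Equiv.optionCongr (Multiset.consEquiv (m := M) (v := lam)).symm)]
  convert h using 1
  · congr 1
    funext j
    rcases j with _ | _ | j <;> rfl
  · refine Finset.sum_congr ?_ fun ν _ => ?_
    · ext ν
      simp only [Finset.mem_filter, mem_rp]
      exact and_congr_right fun hν => (strip_iff hk hlam hν).symm
    · rw [dg_cons hΩ]
      congr 2
      funext j
      rcases j with _ | j
      · simp
      · simp

theorem dg_zero_cons (hΩ : Cardinal.mk Ω = Cardinal.continuum) (hkn : k ≤ n) :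
    dg K₀ n k (0 ::ₘ M) = dg K₀ n k M := by
  rw [dg_cons hΩ, deg_option_zero hΩ hkn, dg]

theorem eq_rectFull (hlam : IsRectPartition n k lam) (hs : sz k lam = k * (n - k)) :
    lam = rectFull n k := by
  have h := (Finset.sum_eq_sum_iff_of_le (s := Finset.range k) (f := lam) (g := fun _ => n - k)
    fun a _ => hlam.2.1 a).1 (by simpa [sz] using hs)
  funext a
  simp only [rectFull]
  split_ifs with ha
  · exact h a (by simpa using ha)
  · exact hlam.2.2 a (by omega)

theorem isRectPartition_rectFull (n k : ℕ) : IsRectPartition n k (rectFull n k) := by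
  refine ⟨antitone_nat_of_succ_le fun a => ?_, fun a => ?_, fun a ha => ?_⟩ <;>
    simp only [rectFull] <;> split_ifs <;> omega

theorem dg_rect (hΩ : Cardinal.mk Ω = Cardinal.continuum) (hkn : k ≤ n) (hk : 0 < k)
    (hlam : IsRectPartition n k lam) (hs : sz k lam = k * (n - k)) : dg K₀ n k {lam} = 1 := by
  rw [← Multiset.cons_zero, dg_cons hΩ]
  have : IsEmpty (0 : Multiset (ℕ → ℕ)) := ⟨fun x => Multiset.notMem_zero _ (Multiset.coe_mem (x := x))⟩
  refine deg_rect hΩ hkn hk fun j q hq => ?_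
  rcases j with _ | j
  · rw [eq_rectFull hlam hs]
    simp [rectFull, hq]
  · exact isEmptyElim j

/-- The multiset of one-row partitions with the parts in `l`. -/
def rows (l : List ℕ) : Multiset (ℕ → ℕ) := l.map row

theorem rows_append (l l' : List ℕ) : rows (l ++ l') = rows l + rows l' := by simp [rows]

theorem msz_rows (hk : 0 < k) (l : List ℕ) : msz k (rows l) = l.sum := by
  induction l with
  | nil => simp [rows, msz]
  | cons a l ih =>
    rw [show rows (a :: l) = row a ::ₘ rows l from rfl, msz_cons, ih, sz, sum_row hk, List.sum_cons]

theorem rows_rect (hk : 0 < k) {l : List ℕ} (hl : ∀ a ∈ l, a ≤ n - k) :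
    ∀ ν ∈ rows l, IsRectPartition n k ν := by
  intro ν hν
  simp only [rows, Multiset.mem_coe, List.mem_map] at hν
  obtain ⟨a, ha, rfl⟩ := hν
  exact isRectPartition_row hk (hl a ha)

theorem dg_rows (hΩ : Cardinal.mk Ω = Cardinal.continuum) (hkn : k ≤ n) (hk : 0 < k)
    (hM : ∀ ν ∈ M, IsRectPartition n k ν) (l : List ℕ) (hl : ∀ a ∈ l, a ≤ n - k) {lam : ℕ → ℕ}
    (hlam : IsRectPartition n k lam) (hsum : sz k lam + l.sum + msz k M = k * (n - k)) :
    dg K₀ n k (lam ::ₘ (rows l + M)) =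
      ∑ κ ∈ (chains n k l.length lam).filter (HasCont k l), dg K₀ n k (κ l.length ::ₘ M) := by
  induction l generalizing lam with
  | nil =>
    rw [List.length_nil, chains_zero hlam fun a => ⟨le_rfl, hlam.1 (Nat.le_succ a)⟩,
      Finset.filter_true_of_mem fun κ _ (c : Fin 0) => c.elim0, Finset.sum_singleton]
    simp [rows]
  | cons a l ih =>
    rw [sum_chains_succ hlam a l fun ν => dg K₀ n k (ν ::ₘ M),
      show rows (a :: l) = row a ::ₘ rows l from rfl, Multiset.cons_add, Multiset.cons_swap]
    rw [List.sum_cons] at hsum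
    rw [dg_row_cons hΩ hkn hk (hl a (by simp)) hlam (fun ν hν => ?_)
      (by rw [msz_add, msz_rows hk]; omega)]
    · refine Finset.sum_congr rfl fun ν hν => ?_
      simp only [Finset.mem_filter, mem_rp] at hν
      exact ih (fun b hb => hl b (by simp [hb])) hν.1 (by omega)
    · rcases Multiset.mem_add.1 hν with hν | hν
      · exact rows_rect hk (fun b hb => hl b (by simp [hb])) ν hν
      · exact hM ν hν

/-- The list of the rows of a partition. -/
def parts (k : ℕ) (lam : ℕ → ℕ) : List ℕ := List.ofFn fun c : Fin k => lam c

theorem sum_parts (k : ℕ) (lam : ℕ → ℕ) : (parts k lam).sum = sz k lam := by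
  rw [parts, List.sum_ofFn, sz, Finset.sum_range]

theorem length_parts (k : ℕ) (lam : ℕ → ℕ) : (parts k lam).length = k := by simp [parts]

theorem mem_parts_le (hlam : IsRectPartition n k lam) : ∀ a ∈ parts k lam, a ≤ n - k := by
  intro a ha
  rw [parts, List.mem_ofFn] at ha
  obtain ⟨c, rfl⟩ := ha
  exact hlam.2.1 _

theorem StripChain.sz_end {l : List ℕ} {κ : ℕ → ℕ → ℕ} (h : StripChain n k l.length lam κ)
    (hl : HasCont k l κ) : sz k (κ l.length) = sz k lam + l.sum := by
  induction l generalizing lam κ with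
  | nil => simp [h.start]
  | cons a l ih =>
    rw [hasCont_cons, cont_eq] at hl
    have := ih h.tail hl.2
    rw [h.start] at hl
    simp only [zero_add, List.length_cons, List.sum_cons] at *
    omega

theorem dg_ne_top (hΩ : Cardinal.mk Ω = Cardinal.continuum) (hkn : k ≤ n) (hk : 0 < k)
    (hM : ∀ ν ∈ M, IsRectPartition n k ν) (l : List ℕ) (hl : ∀ a ∈ l, a ≤ n - k)
    (hsum : l.sum + msz k M = k * (n - k)) : dg K₀ n k (rows l + M) ≠ ⊤ := by
  induction M using Multiset.induction generalizing l with
  | empty =>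
    rw [← dg_zero_cons hΩ hkn, dg_rows hΩ hkn hk hM l hl (isRectPartition_zero n k)
      (by simpa [sz] using hsum)]
    have hone : ∀ κ ∈ (chains n k l.length 0).filter (HasCont k l),
        dg K₀ n k (κ l.length ::ₘ 0) = 1 := fun κ hκ => by
      simp only [Finset.mem_filter, mem_chains] at hκ
      refine dg_rect hΩ hkn hk (hκ.1.rect _) ?_
      rw [hκ.1.sz_end hκ.2, ← hsum]
      simp [sz, msz]
    rw [Finset.sum_congr rfl hone]
    simp
  | cons lam M ih =>
    have hlam := hM lam (by simp)
    have hM' : ∀ ν ∈ M, IsRectPartition n k ν := fun ν hν => hM ν (by simp [hν])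
    have hlM : ∀ ν ∈ rows l + M, IsRectPartition n k ν := fun ν hν => by
      rcases Multiset.mem_add.1 hν with hν | hν
      · exact rows_rect hk hl ν hν
      · exact hM' ν hν
    rw [msz_cons] at hsum
    have h1 := ih hM' (parts k lam ++ l) (fun a ha => by
      rcases List.mem_append.1 ha with ha | ha
      · exact mem_parts_le hlam a ha
      · exact hl a ha) (by rw [List.sum_append, sum_parts]; omega)
    rw [rows_append, add_assoc, ← dg_zero_cons hΩ hkn, dg_rows hΩ hkn hk hlM _ (mem_parts_le hlam)
      (isRectPartition_zero n k) (by
        rw [sum_parts, msz_add, msz_rows hk]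
        simp only [sz, Pi.zero_apply, Finset.sum_const_zero] at *
        omega)] at h1
    rw [Multiset.add_cons]
    refine ne_top_of_le_ne_top h1 ?_
    have hmem : rowChain lam ∈ (chains n k (parts k lam).length 0).filter
        (HasCont k (parts k lam)) := by
      simp only [Finset.mem_filter, mem_chains, length_parts]
      refine ⟨stripChain_rowChain hlam, fun c => ?_⟩
      have hc : (c : ℕ) < k := c.2.trans_eq (length_parts k lam)
      rw [cont_rowChain lam hc]
      exact congrArg _ (List.get_ofFn (fun c : Fin k => lam c) c).symm
    have := Finset.single_le_sum (f := fun κ : ℕ → ℕ → ℕ =>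
      dg K₀ n k (κ (parts k lam).length ::ₘ (rows l + M))) (fun _ _ => zero_le) hmem
    simpa only [length_parts, rowChain_end hlam] using this

end LittlewoodRichardson

section LittlewoodRichardson

variable {K₀ : Type} [Field K₀] [Countable K₀] {n k : ℕ} {lam μ : ℕ → ℕ} {M : Multiset (ℕ → ℕ)}
variable {Ω : Type} [Field Ω] [Algebra K₀ Ω] [IsAlgClosed Ω]

theorem toNat_dg_rows (hΩ : Cardinal.mk Ω = Cardinal.continuum) (hkn : k ≤ n) (hk : 0 < k)
    (hM : ∀ ν ∈ M, IsRectPartition n k ν) (l : List ℕ) (hl : ∀ a ∈ l, a ≤ n - k)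
    (hlam : IsRectPartition n k lam) (hsum : sz k lam + l.sum + msz k M = k * (n - k)) :
    (dg K₀ n k (lam ::ₘ (rows l + M))).toNat =
      ∑ κ ∈ (chains n k l.length lam).filter (HasCont k l),
        (dg K₀ n k (κ l.length ::ₘ M)).toNat := by
  have h := dg_rows (K₀ := K₀) hΩ hkn hk hM l hl hlam hsum
  have htop : dg K₀ n k (lam ::ₘ (rows l + M)) ≠ ⊤ := by
    rw [← Multiset.add_cons]
    refine dg_ne_top hΩ hkn hk (fun ν hν => ?_) l hl (by rw [msz_cons]; omega)
    rcases Multiset.mem_cons.1 hν with rfl | hν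
    · exact hlam
    · exact hM ν hν
  rw [h] at htop ⊢
  refine ENat.toNat_sum fun κ hκ h' => htop ?_
  exact top_unique (h'.symm.le.trans (Finset.single_le_sum (f := fun κ : ℕ → ℕ → ℕ =>
    dg K₀ n k (κ l.length ::ₘ M)) (fun _ _ => zero_le) hκ))

theorem sum_hasContent (hΩ : Cardinal.mk Ω = Cardinal.continuum) (hkn : k ≤ n) (hk : 0 < k)
    (hM : ∀ ν ∈ M, IsRectPartition n k ν) (hlam : IsRectPartition n k lam)
    (hsum : sz k lam + sz k μ + msz k M = k * (n - k)) (w : Equiv.Perm (Fin k)) :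
    ∑ κ ∈ (chains n k k lam).filter (HasContent k μ · w), (dg K₀ n k (κ k ::ₘ M)).toNat =
      ∑ κ ∈ (chains n k k 0).filter (HasContent k μ · w),
        (dg K₀ n k (κ k ::ₘ lam ::ₘ M)).toNat := by
  by_cases hα : ∀ c : Fin k, 0 ≤ (μ (w c) : ℤ) - (w c : ℕ) + (c : ℕ) ∧
      (μ (w c) : ℤ) - (w c : ℕ) + (c : ℕ) ≤ (n - k : ℕ)
  · obtain ⟨a, ha⟩ : ∃ a : Fin k → ℕ, ∀ c, (a c : ℤ) = (μ (w c) : ℤ) - (w c : ℕ) + (c : ℕ) :=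
      ⟨fun c => ((μ (w c) : ℤ) - (w c : ℕ) + (c : ℕ)).toNat, fun c => Int.toNat_of_nonneg (hα c).1⟩
    have hlen : (List.ofFn a).length = k := List.length_ofFn
    have hle : ∀ b ∈ List.ofFn a, b ≤ n - k := by
      intro b hb
      obtain ⟨c, rfl⟩ := List.mem_ofFn.1 hb
      have := ha c
      have := (hα c).2
      omega
    have hs : (List.ofFn a).sum = sz k μ := by
      rw [List.sum_ofFn, sz, Finset.sum_range]
      zify
      rw [Finset.sum_congr rfl fun c _ => ha c, Finset.sum_add_distrib, Finset.sum_sub_distrib,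
        Equiv.sum_comp w fun c => ((μ c : ℕ) : ℤ), Equiv.sum_comp w fun c => ((c : ℕ) : ℤ)]
      ring
    have hf : ∀ lam', (chains n k k lam').filter (HasContent k μ · w) =
        (chains n k (List.ofFn a).length lam').filter (HasCont k (List.ofFn a)) := by
      intro lam'
      ext κ
      rw [Finset.mem_filter, Finset.mem_filter, hlen]
      refine and_congr_right fun _ => ⟨fun h c => ?_, fun h c => ?_⟩
      · have h1 := h ⟨c, c.2.trans_eq hlen⟩
        have h2 := ha ⟨c, c.2.trans_eq hlen⟩
        have h3 : (List.ofFn a).get c = a ⟨c, c.2.trans_eq hlen⟩ := List.get_ofFn a c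
        simp only [h3] at *
        omega
      · have h1 := h ⟨c, c.2.trans_eq hlen.symm⟩
        have h3 : (List.ofFn a).get ⟨c, c.2.trans_eq hlen.symm⟩ = a c := List.get_ofFn a _
        have h2 := ha c
        rw [h3] at h1
        simp only at h1
        omega
    have h1 := toNat_dg_rows (K₀ := K₀) hΩ hkn hk hM (List.ofFn a) hle hlam (by omega)
    have h2 := toNat_dg_rows (K₀ := K₀) hΩ hkn hk (M := lam ::ₘ M) (fun ν hν => by
      rcases Multiset.mem_cons.1 hν with rfl | hν
      · exact hlam
      · exact hM ν hν) (List.ofFn a) hle (isRectPartition_zero n k) (by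
        rw [msz_cons]
        simp only [sz, Pi.zero_apply, Finset.sum_const_zero] at *
        omega)
    rw [dg_zero_cons hΩ hkn, Multiset.add_cons] at h2
    rw [hf, hf]
    rw [hlen] at h1 h2 ⊢
    exact h1.symm.trans h2
  · have hf : ∀ lam', (chains n k k lam').filter (HasContent k μ · w) = ∅ := by
      refine fun lam' => Finset.filter_eq_empty_iff.2 fun κ hκ h => hα fun c => ?_
      have h1 := h c
      have h2 := (mem_chains.1 hκ).cont_nonneg c
      have h3 := (mem_chains.1 hκ).cont_le c
      omega
    rw [hf, hf, Finset.sum_empty, Finset.sum_empty]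

/-- The Littlewood–Richardson rule for degrees of Schubert problems. -/
theorem toNat_dg_cons_cons (hΩ : Cardinal.mk Ω = Cardinal.continuum) (hkn : k ≤ n) (hk : 0 < k)
    (hM : ∀ ν ∈ M, IsRectPartition n k ν) (hlam : IsRectPartition n k lam)
    (hμ : IsRectPartition n k μ) (hsum : sz k lam + sz k μ + msz k M = k * (n - k)) :
    (dg K₀ n k (μ ::ₘ lam ::ₘ M)).toNat = ∑ ν ∈ rp n k,
      Nat.card {T // (∀ i, lam i ≤ ν i) ∧ IsLRSkewTableau lam μ ν T} *
        (dg K₀ n k (ν ::ₘ M)).toNat := by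
  have h1 := sum_sign_chains (n := n) (K := k) (lam := lam) hk hμ.1
    fun ν => ((dg K₀ n k (ν ::ₘ M)).toNat : ℤ)
  have h2 := sum_sign_chains (n := n) (K := k) (lam := 0) hk hμ.1
    fun ν => ((dg K₀ n k (ν ::ₘ lam ::ₘ M)).toNat : ℤ)
  have h3 : ((chains n k k 0).filter fun κ => (∀ j i, ¬ BadAt k k κ j i) ∧
      HasContent k μ κ (1 : Equiv.Perm (Fin k))) = {rowChain μ} := by
    ext κ
    simp only [Finset.mem_filter, mem_chains, Finset.mem_singleton]
    constructor
    · rintro ⟨h, hb, hc⟩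
      refine h.eq_rowChain hμ hb fun c hc' => ?_
      have := hc ⟨c, hc'⟩
      simpa using this
    · rintro rfl
      refine ⟨stripChain_rowChain hμ, not_badAt_rowChain hμ, fun c => ?_⟩
      rw [cont_rowChain μ c.2]
      simp
  have h4 : ∀ w : Equiv.Perm (Fin k),
      ∑ κ ∈ (chains n k k lam).filter (HasContent k μ · w),
        ((dg K₀ n k (κ k ::ₘ M)).toNat : ℤ) =
      ∑ κ ∈ (chains n k k 0).filter (HasContent k μ · w),
        ((dg K₀ n k (κ k ::ₘ lam ::ₘ M)).toNat : ℤ) := fun w => by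
    exact_mod_cast sum_hasContent (K₀ := K₀) hΩ hkn hk hM hlam hsum w
  rw [h3, Finset.sum_singleton, rowChain_end hμ] at h2
  simp only [h4] at h1
  rw [h2] at h1
  have h5 : (dg K₀ n k (μ ::ₘ lam ::ₘ M)).toNat = ∑ κ ∈ (chains n k k lam).filter fun κ =>
      (∀ j i, ¬ BadAt k k κ j i) ∧ HasContent k μ κ (1 : Equiv.Perm (Fin k)),
        (dg K₀ n k (κ k ::ₘ M)).toNat := by exact_mod_cast h1
  rw [h5, ← Finset.sum_fiberwise_of_maps_to (t := rp n k) (g := fun κ => κ k)]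
  · refine Finset.sum_congr rfl fun ν hν => ?_
    rw [card_isLRSkewTableau hlam hμ (mem_rp.1 hν), Finset.filter_filter,
      ← smul_eq_mul, ← Finset.sum_const]
    refine Finset.sum_congr rfl fun κ hκ => ?_
    rw [(Finset.mem_filter.1 hκ).2.2]
  · intro κ hκ
    exact mem_rp.2 ((mem_chains.1 (Finset.mem_filter.1 hκ).1).rect k)

end LittlewoodRichardson

section Iteration

variable {n k m : ℕ} {lams : ℕ → ℕ → ℕ}

/-- The pairs counted by `iteratedLRNumber`. -/
def IsIterated (n k m : ℕ) (lams : ℕ → ℕ → ℕ) (p : (ℕ → ℕ → ℕ) × (ℕ → ℕ × ℕ → ℕ)) : Prop :=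
  p.1 0 = lams 0 ∧
    (∀ j, m - 1 ≤ j → p.1 j = rectFull n k) ∧
    (∀ j, IsRectPartition n k (p.1 j)) ∧
    p.2 0 = (fun _ => 0) ∧
    (∀ j, m ≤ j → p.2 j = fun _ => 0) ∧
    (∀ j, 1 ≤ j → j ≤ m - 1 →
      (∀ i, p.1 (j - 1) i ≤ p.1 j i) ∧
      IsLRSkewTableau (p.1 (j - 1)) (lams j) (p.1 j) (p.2 j))

theorem iteratedLRNumber_eq :
    iteratedLRNumber n k m lams = Nat.card {p // IsIterated n k m lams p} := rfl

/-- Replace the first two members of a sequence of partitions by `ν`. -/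
def mergeSeq (ν : ℕ → ℕ) (lams : ℕ → ℕ → ℕ) : ℕ → ℕ → ℕ
  | 0 => ν
  | j + 1 => lams (j + 2)

/-- Prepend a partition to a chain. -/
def consSeq {α : Type*} (a : α) (c : ℕ → α) : ℕ → α
  | 0 => a
  | j + 1 => c j

theorem consSeq_tail {α : Type*} (c : ℕ → α) : consSeq (c 0) (fun j => c (j + 1)) = c := by
  funext j
  cases j <;> rfl

/-- Splitting off the first step of the chains counted by `iteratedLRNumber`. -/
def iteratedEquiv (t : ℕ) {ν : ℕ → ℕ} (h0 : IsRectPartition n k (lams 0)) :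
    {p : {p // IsIterated n k (t + 2) lams p} // p.1.1 1 = ν} ≃
      {T // (∀ i, lams 0 i ≤ ν i) ∧ IsLRSkewTableau (lams 0) (lams 1) ν T} ×
        {p // IsIterated n k (t + 1) (mergeSeq ν lams) p} where
  toFun p := (⟨p.1.1.2 1, by
      obtain ⟨⟨⟨c, T⟩, h1, h2, h3, h4, h5, h6⟩, rfl⟩ := p
      have h7 : (∀ i, c 0 i ≤ c 1 i) ∧ IsLRSkewTableau (c 0) (lams 1) (c 1) (T 1) :=
        h6 1 le_rfl (by omega)
      rw [show c 0 = lams 0 from h1] at h7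
      exact h7⟩,
    ⟨(fun j => p.1.1.1 (j + 1), consSeq (fun _ => 0) fun j => p.1.1.2 (j + 2)), by
      obtain ⟨⟨⟨c, T⟩, h1, h2, h3, h4, h5, h6⟩, rfl⟩ := p
      refine ⟨rfl, fun j hj => h2 (j + 1) (by omega), fun j => h3 (j + 1), rfl, fun j hj => ?_,
        fun j hj hj' => ?_⟩
      · obtain ⟨j, rfl⟩ := Nat.exists_eq_add_of_le' (show 1 ≤ j by omega)
        exact h5 (j + 2) (by omega)
      · obtain ⟨j, rfl⟩ := Nat.exists_eq_add_of_le' hj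
        exact h6 (j + 2) (by omega) (by omega)⟩)
  invFun q := ⟨⟨(consSeq (lams 0) q.2.1.1,
      consSeq (fun _ => 0) (consSeq q.1.1 fun j => q.2.1.2 (j + 1))), by
      obtain ⟨⟨T, h0', hT⟩, ⟨c, T'⟩, h1, h2, h3, h4, h5, h6⟩ := q
      refine ⟨rfl, fun j hj => ?_, fun j => ?_, rfl, fun j hj => ?_, fun j hj hj' => ?_⟩
      · obtain ⟨j, rfl⟩ := Nat.exists_eq_add_of_le' (show 1 ≤ j by omega)
        exact h2 j (by omega)
      · rcases j with _ | j
        · exact h0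
        · exact h3 j
      · obtain ⟨j, rfl⟩ := Nat.exists_eq_add_of_le' (show 2 ≤ j by omega)
        exact h5 (j + 1) (by omega)
      · obtain ⟨j, rfl⟩ := Nat.exists_eq_add_of_le' hj
        rcases j with _ | j
        · simp only at h1
          simp only [consSeq, zero_add, Nat.sub_self, h1, mergeSeq]
          exact ⟨h0', hT⟩
        · exact h6 (j + 1) (by omega) (by omega)⟩, q.2.2.1⟩
  left_inv p := by
    obtain ⟨⟨⟨c, T⟩, h1, h2, h3, h4, h5, h6⟩, rfl⟩ := p
    refine Subtype.ext (Subtype.ext (Prod.ext ?_ ?_))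
    · simp only at h1
      simp only [← h1]
      exact consSeq_tail c
    · simp only at h4
      simp only [← h4, consSeq]
      funext j
      rcases j with _ | _ | j <;> rfl
  right_inv q := by
    obtain ⟨⟨T, h0', hT⟩, ⟨c, T'⟩, h1, h2, h3, h4, h5, h6⟩ := q
    refine Prod.ext rfl (Subtype.ext (Prod.ext rfl ?_))
    simp only at h4
    simp only [← h4, consSeq]
    exact consSeq_tail T'

theorem sz_eq_of_isLRSkewTableau {lam μ ν : ℕ → ℕ} (hlam : IsRectPartition n k lam)
    (hμ : IsRectPartition n k μ) (hν : IsRectPartition n k ν)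
    (h : Nat.card {T // (∀ i, lam i ≤ ν i) ∧ IsLRSkewTableau lam μ ν T} ≠ 0) :
    sz k ν = sz k lam + sz k μ := by
  rw [card_isLRSkewTableau hlam hμ hν, Finset.card_ne_zero] at h
  obtain ⟨κ, hκ⟩ := h
  simp only [Finset.mem_filter, mem_chains] at hκ
  obtain ⟨h, ⟨-, hc⟩, rfl⟩ := hκ
  have h1 : ∀ c ∈ Finset.range k, (sz k (κ (c + 1)) : ℤ) - sz k (κ c) = μ c := fun c hc' => by
    have := hc ⟨c, Finset.mem_range.1 hc'⟩
    rw [cont_eq] at this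
    simpa using this
  have h2 := Finset.sum_range_sub (fun c => (sz k (κ c) : ℤ)) k
  rw [Finset.sum_congr rfl h1, h.start] at h2
  rw [sz] at h2 ⊢
  zify
  rw [sz, sz] at *
  push_cast at *
  linarith

variable {K₀ : Type} [Field K₀] [Countable K₀] {Ω : Type} [Field Ω] [Algebra K₀ Ω] [IsAlgClosed Ω]

theorem toNat_dg_eq_iteratedLRNumber (hΩ : Cardinal.mk Ω = Cardinal.continuum) (hkn : k ≤ n)
    (hk : 0 < k) (t : ℕ) (hpart : ∀ j, j < t + 1 → IsRectPartition n k (lams j))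
    (hsum : ∑ j ∈ Finset.range (t + 1), sz k (lams j) = k * (n - k)) :
    Finite {p // IsIterated n k (t + 1) lams p} ∧
      (dg K₀ n k (Multiset.ofList ((List.range (t + 1)).map lams))).toNat =
        iteratedLRNumber n k (t + 1) lams := by
  induction t generalizing lams with
  | zero =>
    have hr := eq_rectFull (hpart 0 one_pos) (by simpa using hsum)
    have : Unique {p // IsIterated n k (0 + 1) lams p} :=
      { default := ⟨(fun _ => rectFull n k, fun _ _ => 0), hr.symm, fun _ _ => rfl,
          fun _ => isRectPartition_rectFull n k, rfl, fun _ _ => rfl, fun j hj hj' => by omega⟩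
        uniq := by
          rintro ⟨⟨c, T⟩, h1, h2, h3, h4, h5, h6⟩
          refine Subtype.ext (Prod.ext (funext fun j => h2 j (by omega)) (funext fun j => ?_))
          rcases j with _ | j
          · exact h4
          · exact h5 _ (by omega) }
    refine ⟨inferInstance, ?_⟩
    rw [iteratedLRNumber_eq, Nat.card_unique]
    have := dg_rect (K₀ := K₀) hΩ hkn hk (hpart 0 one_pos) (by simpa using hsum)
    simp only [zero_add, List.range_one, List.map_cons, List.map_nil, Multiset.coe_singleton]
    rw [this]
    rfl
  | succ t ih =>
    have h0 := hpart 0 (by omega)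
    have h1 := hpart 1 (by omega)
    set M : Multiset (ℕ → ℕ) := Multiset.ofList ((List.range t).map fun j => lams (j + 2)) with hMdef
    have hM : ∀ ν ∈ M, IsRectPartition n k ν := by
      intro ν hν
      simp only [hMdef, Multiset.mem_coe, List.mem_map, List.mem_range] at hν
      obtain ⟨j, hj, rfl⟩ := hν
      exact hpart _ (by omega)
    have hmsz : msz k M = ∑ j ∈ Finset.range t, sz k (lams (j + 2)) := by
      simp only [msz, hMdef, Multiset.map_coe, Multiset.sum_coe, List.map_map]
      rfl
    have hl : (Multiset.ofList ((List.range (t + 1 + 1)).map lams)) = lams 1 ::ₘ lams 0 ::ₘ M := by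
      rw [List.range_succ_eq_map, List.range_succ_eq_map, Multiset.cons_swap]
      simp [hMdef, Function.comp_def]
    have hl' : ∀ ν, Multiset.ofList ((List.range (t + 1)).map (mergeSeq ν lams)) = ν ::ₘ M := fun ν => by
      rw [List.range_succ_eq_map]
      simp [hMdef, Function.comp_def, mergeSeq]
    have hs' : sz k (lams 0) + sz k (lams 1) + msz k M = k * (n - k) := by
      rw [hmsz, ← hsum, Finset.sum_range_succ', Finset.sum_range_succ']
      ring
    have hstep : ∀ ν ∈ rp n k,
        Finite {p : {p // IsIterated n k (t + 2) lams p} // p.1.1 1 = ν} ∧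
        Nat.card {T // (∀ i, lams 0 i ≤ ν i) ∧ IsLRSkewTableau (lams 0) (lams 1) ν T} *
          (dg K₀ n k (ν ::ₘ M)).toNat =
          Nat.card {p : {p // IsIterated n k (t + 2) lams p} // p.1.1 1 = ν} := by
      intro ν hν
      rw [mem_rp] at hν
      rw [(iteratedEquiv t h0).finite_iff, Nat.card_congr (iteratedEquiv t h0), Nat.card_prod]
      have hf := finite_isLRSkewTableau h0 h1 hν
      by_cases hc : Nat.card {T // (∀ i, lams 0 i ≤ ν i) ∧
          IsLRSkewTableau (lams 0) (lams 1) ν T} = 0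
      · rw [hc, zero_mul, zero_mul]
        have := (Finite.card_eq_zero_iff).1 hc
        exact ⟨inferInstance, rfl⟩
      · have hsz := sz_eq_of_isLRSkewTableau h0 h1 hν hc
        have := ih (lams := mergeSeq ν lams) (fun j hj => by
          rcases j with _ | j
          · exact hν
          · exact hpart (j + 2) (by omega)) (by
          rw [Finset.sum_range_succ']
          simp only [mergeSeq]
          omega)
        rw [hl', iteratedLRNumber_eq] at this
        obtain ⟨h2, h3⟩ := this
        exact ⟨inferInstance, by rw [h3]⟩
    let g : {p // IsIterated n k (t + 2) lams p} → rp n k := fun p => ⟨p.1.1 1, mem_rp.2 (p.2.2.2.1 1)⟩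
    have hg : ∀ ν : rp n k, {p // g p = ν} ≃ {p : {p // IsIterated n k (t + 2) lams p} // p.1.1 1 = ν} :=
      fun ν => Equiv.subtypeEquivRight fun p => Subtype.ext_iff
    have hfin : ∀ ν : rp n k, Finite {p // g p = ν} := fun ν =>
      (hg ν).finite_iff.2 (hstep ν ν.2).1
    refine ⟨(Equiv.sigmaFiberEquiv g).finite_iff.1 inferInstance, ?_⟩
    rw [hl, toNat_dg_cons_cons hΩ hkn hk hM h0 h1 hs', iteratedLRNumber_eq,
      ← Nat.card_congr (Equiv.sigmaFiberEquiv g), Nat.card_sigma, ← Finset.sum_coe_sort]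
    exact Finset.sum_congr rfl fun ν _ => ((hstep ν ν.2).2.trans (Nat.card_congr (hg ν)).symm)

variable (K₀) in
theorem deg_eq_dg_range (hΩ : Cardinal.mk Ω = Cardinal.continuum) (m : ℕ) (lams : ℕ → ℕ → ℕ) :
    deg K₀ n k (sOf n k fun j : Fin m => lams j) =
      dg K₀ n k (Multiset.ofList ((List.range m).map lams)) := by
  obtain ⟨e, he⟩ : ∃ e : Fin m ≃ (Multiset.ofList ((List.range m).map lams) : Multiset (ℕ → ℕ)),
      ∀ j, (e j).1 = lams j := by
    induction m generalizing lams with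
    | zero => exact ⟨⟨fun j => j.elim0, fun x => (Multiset.notMem_zero _ (Multiset.coe_mem (x := x))).elim,
        fun j => j.elim0, fun x => (Multiset.notMem_zero _ (Multiset.coe_mem (x := x))).elim⟩,
        fun j => j.elim0⟩
    | succ m ih =>
      obtain ⟨e, he⟩ := ih fun j => lams (j + 1)
      have hl : Multiset.ofList ((List.range (m + 1)).map lams) =
          lams 0 ::ₘ Multiset.ofList ((List.range m).map fun j => lams (j + 1)) := by
        rw [List.range_succ_eq_map]
        simp [Function.comp_def]
      rw [hl]
      refine ⟨((finSuccEquiv m).trans (Equiv.optionCongr e)).trans Multiset.consEquiv.symm, fun j => ?_⟩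
      refine Fin.cases ?_ (fun j => ?_) j
      · rfl
      · exact he j
  rw [dg, ← deg_comp hΩ e]
  congr 1
  funext j
  funext q
  show n - k + (q + 1) - lams j q = n - k + (q + 1) - (e j).1 q
  rw [he]

end Iteration

section Transfer

open FirstOrder Language

/-- Two terms over the fields `Ω` and `L` are given by the same integral polynomial. -/
def SameTerm {Ω L : Type*} [Field Ω] [Field L] {ι : Type} (t : (ι → Ω) → Ω) (u : (ι → L) → L) :
    Prop :=
  letI := Ring.compatibleRingOfRing Ω
  letI := Ring.compatibleRingOfRing L
  ∃ τ : Language.ring.Term ι, (∀ v, τ.realize v = t v) ∧ ∀ v, τ.realize v = u v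

/-- Two predicates over the fields `Ω` and `L` are given by the same first order formula. -/
def SameFormula {Ω L : Type*} [Field Ω] [Field L] {ι : Type} (P : (ι → Ω) → Prop)
    (Q : (ι → L) → Prop) : Prop :=
  letI := Ring.compatibleRingOfRing Ω
  letI := Ring.compatibleRingOfRing L
  ∃ φ : Language.ring.Formula ι, (∀ v, φ.Realize v ↔ P v) ∧ ∀ v, φ.Realize v ↔ Q v

variable {Ω L : Type*} [Field Ω] [Field L] {ι κ : Type}

theorem SameTerm.var (i : ι) : SameTerm (fun v : ι → Ω => v i) fun v : ι → L => v i :=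
  ⟨Term.var i, fun _ => rfl, fun _ => rfl⟩

theorem SameTerm.zero : SameTerm (fun _ : ι → Ω => 0) fun _ : ι → L => 0 := by
  let _ := Ring.compatibleRingOfRing Ω
  let _ := Ring.compatibleRingOfRing L
  exact ⟨0, fun _ => by simp, fun _ => by simp⟩

theorem SameTerm.one : SameTerm (fun _ : ι → Ω => 1) fun _ : ι → L => 1 := by
  let _ := Ring.compatibleRingOfRing Ω
  let _ := Ring.compatibleRingOfRing L
  exact ⟨1, fun _ => by simp, fun _ => by simp⟩

theorem SameTerm.add {t t' : (ι → Ω) → Ω} {u u' : (ι → L) → L} (h : SameTerm t u)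
    (h' : SameTerm t' u') : SameTerm (fun v => t v + t' v) fun v => u v + u' v := by
  let _ := Ring.compatibleRingOfRing Ω
  let _ := Ring.compatibleRingOfRing L
  obtain ⟨τ, h1, h2⟩ := h
  obtain ⟨τ', h1', h2'⟩ := h'
  exact ⟨τ + τ', fun v => by simp [h1, h1'], fun v => by simp [h2, h2']⟩

theorem SameTerm.mul {t t' : (ι → Ω) → Ω} {u u' : (ι → L) → L} (h : SameTerm t u)
    (h' : SameTerm t' u') : SameTerm (fun v => t v * t' v) fun v => u v * u' v := by
  let _ := Ring.compatibleRingOfRing Ω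
  let _ := Ring.compatibleRingOfRing L
  obtain ⟨τ, h1, h2⟩ := h
  obtain ⟨τ', h1', h2'⟩ := h'
  exact ⟨τ * τ', fun v => by simp [h1, h1'], fun v => by simp [h2, h2']⟩

theorem SameTerm.sum {α : Type*} (s : Finset α) {t : α → (ι → Ω) → Ω} {u : α → (ι → L) → L}
    (h : ∀ a, SameTerm (t a) (u a)) :
    SameTerm (fun v => ∑ a ∈ s, t a v) fun v => ∑ a ∈ s, u a v := by
  induction s using Finset.induction_on with
  | empty => simpa only [Finset.sum_empty] using SameTerm.zero
  | insert a s ha ih => simpa only [Finset.sum_insert ha] using (h a).add ih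

theorem SameFormula.eq {t t' : (ι → Ω) → Ω} {u u' : (ι → L) → L} (h : SameTerm t u)
    (h' : SameTerm t' u') : SameFormula (fun v => t v = t' v) fun v => u v = u' v := by
  let _ := Ring.compatibleRingOfRing Ω
  let _ := Ring.compatibleRingOfRing L
  obtain ⟨τ, h1, h2⟩ := h
  obtain ⟨τ', h1', h2'⟩ := h'
  exact ⟨τ.equal τ', fun v => by simp [h1, h1'], fun v => by simp [h2, h2']⟩

theorem SameFormula.and {P P' : (ι → Ω) → Prop} {Q Q' : (ι → L) → Prop} (h : SameFormula P Q)
    (h' : SameFormula P' Q') : SameFormula (fun v => P v ∧ P' v) fun v => Q v ∧ Q' v := by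
  let _ := Ring.compatibleRingOfRing Ω
  let _ := Ring.compatibleRingOfRing L
  obtain ⟨φ, h1, h2⟩ := h
  obtain ⟨φ', h1', h2'⟩ := h'
  exact ⟨φ ⊓ φ', fun v => by simp [h1, h1'], fun v => by simp [h2, h2']⟩

theorem SameFormula.imp {P P' : (ι → Ω) → Prop} {Q Q' : (ι → L) → Prop} (h : SameFormula P Q)
    (h' : SameFormula P' Q') : SameFormula (fun v => P v → P' v) fun v => Q v → Q' v := by
  let _ := Ring.compatibleRingOfRing Ω
  let _ := Ring.compatibleRingOfRing L
  obtain ⟨φ, h1, h2⟩ := h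
  obtain ⟨φ', h1', h2'⟩ := h'
  exact ⟨φ.imp φ', fun v => by simp [h1, h1'], fun v => by simp [h2, h2']⟩

theorem SameFormula.not {P : (ι → Ω) → Prop} {Q : (ι → L) → Prop} (h : SameFormula P Q) :
    SameFormula (fun v => ¬ P v) fun v => ¬ Q v := by
  let _ := Ring.compatibleRingOfRing Ω
  let _ := Ring.compatibleRingOfRing L
  obtain ⟨φ, h1, h2⟩ := h
  exact ⟨φ.not, fun v => by simp [h1], fun v => by simp [h2]⟩

theorem SameFormula.forall_mem {α : Type} [Finite α] {P : α → (ι → Ω) → Prop}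
    {Q : α → (ι → L) → Prop} (h : ∀ a, SameFormula (P a) (Q a)) :
    SameFormula (fun v => ∀ a, P a v) fun v => ∀ a, Q a v := by
  let _ := Ring.compatibleRingOfRing Ω
  let _ := Ring.compatibleRingOfRing L
  choose φ h1 h2 using h
  exact ⟨Formula.iInf φ, fun v => by simp [h1], fun v => by simp [h2]⟩

theorem SameFormula.exists_mem {α : Type} [Finite α] {P : α → (ι → Ω) → Prop}
    {Q : α → (ι → L) → Prop} (h : ∀ a, SameFormula (P a) (Q a)) :
    SameFormula (fun v => ∃ a, P a v) fun v => ∃ a, Q a v := by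
  simpa only [not_forall, not_not] using (SameFormula.forall_mem fun a => (h a).not).not

theorem SameFormula.exists [Finite κ] {P : (ι → Ω) → (κ → Ω) → Prop} {Q : (ι → L) → (κ → L) → Prop}
    (h : SameFormula (fun v : ι ⊕ κ → Ω => P (fun i => v (.inl i)) fun i => v (.inr i))
      fun v : ι ⊕ κ → L => Q (fun i => v (.inl i)) fun i => v (.inr i)) :
    SameFormula (fun v => ∃ w, P v w) fun v => ∃ w, Q v w := by
  let _ := Ring.compatibleRingOfRing Ω
  let _ := Ring.compatibleRingOfRing L
  obtain ⟨φ, h1, h2⟩ := h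
  exact ⟨φ.iExs κ, fun v => by simp [h1], fun v => by simp [h2]⟩

theorem SameFormula.forall [Finite κ] {P : (ι → Ω) → (κ → Ω) → Prop} {Q : (ι → L) → (κ → L) → Prop}
    (h : SameFormula (fun v : ι ⊕ κ → Ω => P (fun i => v (.inl i)) fun i => v (.inr i))
      fun v : ι ⊕ κ → L => Q (fun i => v (.inl i)) fun i => v (.inr i)) :
    SameFormula (fun v => ∀ w, P v w) fun v => ∀ w, Q v w := by
  simpa only [not_exists, not_not] using (SameFormula.exists (P := fun v w => ¬ P v w)
    (Q := fun v w => ¬ Q v w) h.not).not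

theorem SameTerm.inl {t : (ι → Ω) → Ω} {u : (ι → L) → L} (h : SameTerm t u) :
    SameTerm (fun v : ι ⊕ κ → Ω => t fun i => v (.inl i)) fun v : ι ⊕ κ → L => u fun i => v (.inl i) := by
  let _ := Ring.compatibleRingOfRing Ω
  let _ := Ring.compatibleRingOfRing L
  obtain ⟨τ, h1, h2⟩ := h
  exact ⟨τ.relabel .inl, fun v => by simp [← h1, Function.comp_def],
    fun v => by simp [← h2, Function.comp_def]⟩

theorem SameTerm.ite (c : Prop) [Decidable c] :
    SameTerm (fun _ : ι → Ω => if c then 1 else 0) fun _ : ι → L => if c then 1 else 0 := by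
  by_cases hc : c
  · simpa only [if_pos hc] using SameTerm.one
  · simpa only [if_neg hc] using SameTerm.zero

theorem SameFormula.prop (c : Prop) : SameFormula (fun _ : ι → Ω => c) fun _ : ι → L => c := by
  by_cases hc : c
  · exact ⟨⊤, fun _ => by simpa, fun _ => by simpa⟩
  · exact ⟨⊥, fun _ => by simpa, fun _ => by simpa⟩

theorem SameFormula.iff [IsAlgClosed Ω] [IsAlgClosed L] (p : ℕ) [CharP Ω p] [CharP L p]
    {P Q : Prop} (h : SameFormula (fun _ : Empty → Ω => P) fun _ : Empty → L => Q) : P ↔ Q := by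
  let _ := Ring.compatibleRingOfRing Ω
  let _ := Ring.compatibleRingOfRing L
  obtain ⟨φ, h1, h2⟩ := h
  have hc := Field.ACF_isComplete (CharP.char_is_prime_or_zero L p)
  exact (h1 default).symm.trans (((hc.realize_sentence_iff φ Ω).trans
    (hc.realize_sentence_iff φ L).symm).trans (h2 default))

end Transfer

section Encoding

variable {F : Type*} [Field F] {n k N : ℕ} {J : Type}

theorem linearIndependent_iff_exists {a b : ℕ} (B : Fin a × Fin b → F) :
    LinearIndependent F (fun r x => B (r, x)) ↔ ∃ C : Fin b × Fin a → F, ∀ r r',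
      ∑ x, B (r, x) * C (x, r') = if r = r' then 1 else 0 := by
  constructor
  · intro h
    obtain ⟨g, hg⟩ := LinearMap.exists_leftInverse_of_injective _
      (LinearMap.ker_eq_bot.2 (linearIndependent_iff_injective_fintypeLinearCombination.1 h))
    refine ⟨fun p => g (Pi.single p.1 1) p.2, fun r r' => ?_⟩
    have h1 := congrFun (LinearMap.congr_fun hg (Pi.single r 1)) r'
    simp only [LinearMap.comp_apply, Fintype.linearCombination_apply_single, one_smul,
      LinearMap.id_apply] at h1
    rw [LinearMap.pi_apply_eq_sum_univ g] at h1
    simp only [Finset.sum_apply, Pi.smul_apply, smul_eq_mul] at h1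
    simp only [Pi.single_apply, eq_comm (a := r')] at h1
    rw [← h1]
    refine Finset.sum_congr rfl fun x _ => ?_
    have e : (Pi.single x 1 : Fin b → F) = fun j => if x = j then 1 else 0 :=
      funext fun y => by simp [Pi.single_apply, eq_comm]
    rw [← e]
  · rintro ⟨C, hC⟩
    refine Fintype.linearIndependent_iff.2 fun g hg r' => ?_
    calc g r' = ∑ r, g r * ∑ x, B (r, x) * C (x, r') := by simp [hC]
      _ = ∑ x, (∑ r, g r • fun x => B (r, x)) x * C (x, r') := by
        simp only [Finset.mul_sum, Finset.sum_apply, Finset.sum_mul, Pi.smul_apply, smul_eq_mul]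
        rw [Finset.sum_comm]
        simp only [mul_assoc]
      _ = 0 := by simp only [hg, Pi.zero_apply, zero_mul, Finset.sum_const_zero]

/-- The subspace spanned by the rows of a matrix. -/
def rowSpan {a b : ℕ} (B : Fin a × Fin b → F) : Submodule F (Fin b → F) :=
  Submodule.span F (Set.range fun r x => B (r, x))

theorem mem_rowSpan {a b : ℕ} {B : Fin a × Fin b → F} {y : Fin b → F} :
    y ∈ rowSpan B ↔ ∃ c : Fin a → F, ∀ x, y x = ∑ r, c r * B (r, x) := by
  rw [rowSpan, Submodule.mem_span_range_iff_exists_fun]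
  refine exists_congr fun c => ⟨?_, fun h => funext fun x => ?_⟩
  · rintro rfl x
    simp
  · rw [h]
    simp

theorem rowSpan_le_iff {a a' b : ℕ} {B : Fin a × Fin b → F} {B' : Fin a' × Fin b → F} :
    rowSpan B ≤ rowSpan B' ↔
      ∃ Q : Fin a × Fin a' → F, ∀ r x, B (r, x) = ∑ c, Q (r, c) * B' (c, x) := by
  rw [rowSpan, Submodule.span_le, Set.range_subset_iff]
  simp only [SetLike.mem_coe, mem_rowSpan]
  constructor
  · intro h
    choose Q hQ using h
    exact ⟨fun p => Q p.1 p.2, hQ⟩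
  · rintro ⟨Q, hQ⟩ r
    exact ⟨fun c => Q (r, c), hQ r⟩

theorem finrank_rowSpan {a b : ℕ} {B : Fin a × Fin b → F}
    (h : LinearIndependent F (fun r x => B (r, x))) : finrank F (rowSpan B) = a :=
  (finrank_span_eq_card h).trans (Fintype.card_fin a)

theorem le_finrank_rowSpan_inf_iff {a k b : ℕ} {B : Fin k × Fin b → F}
    (h : LinearIndependent F (fun r x => B (r, x))) (f : Fin b → Fin b → F) (i : ℕ) :
    a ≤ finrank F ↥(rowSpan B ⊓ fl f i) ↔ ∃ A : Fin a × Fin k → F,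
      (∃ D : Fin k × Fin a → F, ∀ r r', ∑ x, A (r, x) * D (x, r') = if r = r' then 1 else 0) ∧
      ∀ r, ∀ l : Fin b, i ≤ l → ∑ x, f l x * ∑ c, A (r, c) * B (c, x) = 0 := by
  simp only [← linearIndependent_iff_exists]
  constructor
  · intro ha
    obtain ⟨v, hv⟩ := exists_linearIndependent_of_le_finrank ha
    choose A hA using fun r => mem_rowSpan.1 (v r).2.1
    refine ⟨fun p => A p.1 p.2, ?_, fun r l hl => ?_⟩
    · have h1 := (hv.map' (Submodule.subtype _) (Submodule.ker_subtype _))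
      refine LinearIndependent.of_comp (Fintype.linearCombination F fun r x => B (r, x)) ?_
      have e : (Fintype.linearCombination F fun r x => B (r, x)) ∘ (fun r x => A r x) =
          (rowSpan B ⊓ fl f i).subtype ∘ v := by
        funext r x
        simp [hA r x, Fintype.linearCombination_apply]
      exact e ▸ h1
    · have := (v r).2.2 l hl
      simp only [dotProduct, hA] at this
      exact this
  · rintro ⟨A, hA, hf⟩
    have h1 := hA.map' (Fintype.linearCombination F fun r x => B (r, x))
      (LinearMap.ker_eq_bot.2 (linearIndependent_iff_injective_fintypeLinearCombination.1 h))
    have h2 : ∀ r, Fintype.linearCombination F (fun r x => B (r, x)) (fun x => A (r, x)) =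
        fun x => ∑ c, A (r, c) * B (c, x) := fun r => by
      funext x
      simp [Fintype.linearCombination_apply]
    let v : Fin a → ↥(rowSpan B ⊓ fl f i) := fun r => ⟨fun x => ∑ c, A (r, c) * B (c, x),
      mem_rowSpan.2 ⟨_, fun x => rfl⟩, fun l hl => hf r l hl⟩
    have h3 : LinearIndependent F v := by
      refine LinearIndependent.of_comp (Submodule.subtype _) ?_
      have e : (Fintype.linearCombination F fun r x => B (r, x)) ∘ (fun r x => A (r, x)) =
          (rowSpan B ⊓ fl f i).subtype ∘ v := funext h2
      exact e ▸ h1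
    simpa using h3.fintype_card_le_finrank

/-- The rows of `B` are a basis of a solution of the Schubert problem given by `f` and `s`. -/
def IsSolution (s : J → ℕ → ℕ) (f : J × Fin n × Fin n → F) (B : Fin k × Fin n → F) : Prop :=
  (∃ C : Fin n × Fin k → F, ∀ r r', ∑ x, B (r, x) * C (x, r') = if r = r' then 1 else 0) ∧
    ∀ j, ∀ q : Fin k, ∃ A : Fin (q + 1) × Fin k → F,
      (∃ D : Fin k × Fin (q + 1) → F, ∀ r r',
        ∑ x, A (r, x) * D (x, r') = if r = r' then 1 else 0) ∧
      ∀ r, ∀ l : Fin n, s j q ≤ l → ∑ x, f (j, l, x) * ∑ c, A (r, c) * B (c, x) = 0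

theorem isSolution_iff {s : J → ℕ → ℕ} {f : J × Fin n × Fin n → F} {B : Fin k × Fin n → F} :
    IsSolution s f B ↔ LinearIndependent F (fun r x => B (r, x)) ∧
      rowSpan B ∈ SchubertSet k (fun j l x => f (j, l, x)) s := by
  rw [IsSolution, ← linearIndependent_iff_exists]
  refine and_congr_right fun h => ?_
  simp only [SchubertSet, Set.mem_ofPred_eq, finrank_rowSpan h, true_and]
  refine forall_congr' fun j => ⟨fun h' q hq => ?_, fun h' q => ?_⟩
  · exact (le_finrank_rowSpan_inf_iff h _ _).2 (h' ⟨q, hq⟩)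
  · exact (le_finrank_rowSpan_inf_iff h _ _).1 (h' q q.2)

theorem exists_isSolution {s : J → ℕ → ℕ} {f : J × Fin n × Fin n → F}
    {V : Submodule F (Fin n → F)} (hV : V ∈ SchubertSet k (fun j l x => f (j, l, x)) s) :
    ∃ B : Fin k × Fin n → F, IsSolution s f B ∧ rowSpan B = V := by
  let b := finBasisOfFinrankEq F V hV.1
  have h : rowSpan (fun p : Fin k × Fin n => (b p.1 : Fin n → F) p.2) = V := by
    have h1 := congrArg (Submodule.map V.subtype) b.span_eq
    rw [Submodule.map_span, ← Set.range_comp, Submodule.map_top, Submodule.range_subtype] at h1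
    exact h1
  refine ⟨fun p => (b p.1 : Fin n → F) p.2, isSolution_iff.2 ⟨?_, by rwa [h]⟩, h⟩
  exact b.linearIndependent.map' V.subtype V.ker_subtype

/-- There are flags for which the Schubert problem has exactly `N` solutions. -/
def HasSolutions (F : Type*) [Field F] (n k N : ℕ) (s : J → ℕ → ℕ) : Prop :=
  ∃ f : J × Fin n × Fin n → F, (∃ G : J × Fin n × Fin n → F, ∀ j l l',
      ∑ x, f (j, l, x) * G (j, x, l') = if l = l' then 1 else 0) ∧
    ∃ B : Fin N × Fin k × Fin n → F, (∀ i, IsSolution s f fun p => B (i, p.1, p.2)) ∧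
      (∀ i i', i ≠ i' → ¬ ∃ Q : Fin k × Fin k → F, ∀ r x,
        B (i, r, x) = ∑ c, Q (r, c) * B (i', c, x)) ∧
      ∀ B' : Fin k × Fin n → F, IsSolution s f B' → ∃ i, ∃ Q : Fin k × Fin k → F, ∀ r x,
        B' (r, x) = ∑ c, Q (r, c) * B (i, c, x)

theorem rowSpan_eq_iff {B B' : Fin k × Fin n → F} (hB : LinearIndependent F (fun r x => B (r, x)))
    (hB' : LinearIndependent F (fun r x => B' (r, x))) : rowSpan B = rowSpan B' ↔
      ∃ Q : Fin k × Fin k → F, ∀ r x, B (r, x) = ∑ c, Q (r, c) * B' (c, x) := by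
  rw [← rowSpan_le_iff]
  exact ⟨fun h => h.le, fun h => Submodule.eq_of_le_of_finrank_eq h
    ((finrank_rowSpan hB).trans (finrank_rowSpan hB').symm)⟩

theorem hasSolutions_iff {s : J → ℕ → ℕ} : HasSolutions F n k N s ↔
    ∃ f : J → Fin n → Fin n → F, (∀ j, (Matrix.of (f j)).det ≠ 0) ∧
      (SchubertSet k f s).encard = N := by
  constructor
  · rintro ⟨f, ⟨G, hG⟩, B, h1, h2, h3⟩
    refine ⟨fun j l x => f (j, l, x), fun j => ?_, ?_⟩
    · have : Matrix.of (fun l x => f (j, l, x)) * Matrix.of (fun l x => G (j, l, x)) = 1 := by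
        ext l l'
        simp only [Matrix.mul_apply, Matrix.of_apply, hG, Matrix.one_apply]
      exact ((Matrix.isUnit_iff_isUnit_det _).1 (IsUnit.of_mul_eq_one _ this)).ne_zero
    · let B'' : Fin N → Fin k × Fin n → F := fun i p => B (i, p.1, p.2)
      have h4 : ∀ i, LinearIndependent F (fun r x => B'' i (r, x)) ∧
          rowSpan (B'' i) ∈ SchubertSet k (fun j l x => f (j, l, x)) s :=
        fun i => isSolution_iff.1 (h1 i)
      have h5 : SchubertSet k (fun j l x => f (j, l, x)) s =
          (fun i => rowSpan (B'' i)) '' Set.univ := by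
        ext V
        simp only [Set.image_univ, Set.mem_range]
        constructor
        · intro hV
          obtain ⟨B', hB', rfl⟩ := exists_isSolution hV
          obtain ⟨i, hi⟩ := h3 B' hB'
          exact ⟨i, ((rowSpan_eq_iff (B' := B'' i) (isSolution_iff.1 hB').1 (h4 i).1).2 hi).symm⟩
        · rintro ⟨i, rfl⟩
          exact (h4 i).2
      have h6 : Function.Injective fun i => rowSpan (B'' i) := by
        intro i i' h
        by_contra hne
        exact h2 i i' hne
          ((rowSpan_eq_iff (B := B'' i) (B' := B'' i') (h4 i).1 (h4 i').1).1 h)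
      rw [h5, h6.encard_image, Set.encard_univ]
      simp
  · rintro ⟨f, hf, hN⟩
    have hfin := Set.finite_of_encard_eq_coe hN
    have := hfin.to_subtype
    obtain ⟨e⟩ : Nonempty (Fin N ≃ SchubertSet k f s) := by
      refine ⟨(Finite.equivFinOfCardEq ?_).symm⟩
      rw [Nat.card_coe_set_eq, Set.ncard, hN]
      rfl
    choose B hB hBV using fun i =>
      exists_isSolution (f := fun p : J × Fin n × Fin n => f p.1 p.2.1 p.2.2) (e i).2
    refine ⟨fun p => f p.1 p.2.1 p.2.2, ⟨fun p => (Matrix.of (f p.1))⁻¹ p.2.1 p.2.2, fun j l l' => ?_⟩,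
      fun p => B p.1 p.2, hB, fun i i' hne h => hne ?_, fun B' hB' => ?_⟩
    · have := congrFun (congrFun (Matrix.mul_nonsing_inv (Matrix.of (f j)) (Ne.isUnit (hf j))) l) l'
      rw [Matrix.mul_apply, Matrix.one_apply] at this
      exact this
    · have h1 := (rowSpan_eq_iff (isSolution_iff.1 (hB i)).1 (isSolution_iff.1 (hB i')).1).2 h
      rw [hBV, hBV] at h1
      exact e.injective (Subtype.ext h1)
    · have h1 := isSolution_iff.1 hB'
      refine ⟨e.symm ⟨_, h1.2⟩, (rowSpan_eq_iff h1.1 (isSolution_iff.1 (hB _)).1).1 ?_⟩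
      exact ((hBV _).trans (congrArg Subtype.val (e.apply_symm_apply ⟨_, h1.2⟩))).symm

end Encoding

section Main

variable {Ω L : Type*} [Field Ω] [Field L] {ι : Type} {n k N : ℕ} {J : Type} [Finite J]

theorem SameFormula.exists_rightInverse {a b : ℕ} {A : (ι → Ω) → Fin a × Fin b → Ω}
    {A' : (ι → L) → Fin a × Fin b → L} (h : ∀ p, SameTerm (fun v => A v p) fun v => A' v p) :
    SameFormula
      (fun v => ∃ D : Fin b × Fin a → Ω, ∀ r r', ∑ x, A v (r, x) * D (x, r') = if r = r' then 1 else 0)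
      fun v => ∃ D : Fin b × Fin a → L, ∀ r r',
        ∑ x, A' v (r, x) * D (x, r') = if r = r' then 1 else 0 :=
  .exists (.forall_mem fun r => .forall_mem fun r' =>
    .eq (.sum _ fun x => .mul (.inl (h (r, x))) (.var (Sum.inr (x, r')))) (.ite _))

theorem SameFormula.isSolution {s : J → ℕ → ℕ} {f : (ι → Ω) → J × Fin n × Fin n → Ω}
    {f' : (ι → L) → J × Fin n × Fin n → L} {B : (ι → Ω) → Fin k × Fin n → Ω}
    {B' : (ι → L) → Fin k × Fin n → L} (hf : ∀ p, SameTerm (fun v => f v p) fun v => f' v p)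
    (hB : ∀ p, SameTerm (fun v => B v p) fun v => B' v p) :
    SameFormula (fun v => IsSolution s (f v) (B v)) fun v => IsSolution s (f' v) (B' v) :=
  .and (.exists_rightInverse hB) (.forall_mem fun j => .forall_mem fun _ =>
    .exists (.and (.exists_rightInverse fun p => .var (Sum.inr p))
      (.forall_mem fun r => .forall_mem fun l => .imp (.prop _)
        (.eq (.sum _ fun x => .mul (.inl (hf (j, l, x)))
          (.sum _ fun c => .mul (.var (Sum.inr (r, c))) (.inl (hB (c, x))))) .zero))))

theorem SameFormula.exists_combination {a b : ℕ} {B : (ι → Ω) → Fin a × Fin b → Ω}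
    {B' : (ι → L) → Fin a × Fin b → L} {C : (ι → Ω) → Fin a × Fin b → Ω}
    {C' : (ι → L) → Fin a × Fin b → L} (hB : ∀ p, SameTerm (fun v => B v p) fun v => B' v p)
    (hC : ∀ p, SameTerm (fun v => C v p) fun v => C' v p) :
    SameFormula
      (fun v => ∃ Q : Fin a × Fin a → Ω, ∀ r x, B v (r, x) = ∑ c, Q (r, c) * C v (c, x))
      fun v => ∃ Q : Fin a × Fin a → L, ∀ r x, B' v (r, x) = ∑ c, Q (r, c) * C' v (c, x) :=
  .exists (.forall_mem fun r => .forall_mem fun x =>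
    .eq (.inl (hB (r, x))) (.sum _ fun c => .mul (.var (Sum.inr (r, c))) (.inl (hC (c, x)))))

theorem hasSolutions_transfer [IsAlgClosed Ω] [IsAlgClosed L] (p : ℕ) [CharP Ω p] [CharP L p]
    (s : J → ℕ → ℕ) : HasSolutions Ω n k N s ↔ HasSolutions L n k N s := by
  refine SameFormula.iff p (.exists (.and ?_ (.exists (.and ?_ (.and ?_ (.forall (.imp ?_ ?_)))))))
  · exact .exists (.forall_mem fun j => .forall_mem fun l => .forall_mem fun l' =>
      .eq (.sum _ fun x => .mul (.var (Sum.inl (Sum.inr (j, l, x)))) (.var (Sum.inr (j, x, l')))) (.ite _))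
  · exact .forall_mem fun i => .isSolution (fun p => .var (Sum.inl (Sum.inr p)))
      fun p => .var (Sum.inr (i, p.1, p.2))
  · exact .forall_mem fun i => .forall_mem fun i' => .imp (.prop _)
      (.not (.exists_combination (fun p => .var (Sum.inr (i, p.1, p.2)))
        fun p => .var (Sum.inr (i', p.1, p.2))))
  · exact .isSolution (fun p => .var (Sum.inl (Sum.inl (Sum.inr p)))) fun p => .var (Sum.inr p)
  · exact .exists_mem fun i => .exists_combination (fun p => .var (Sum.inr p))
      fun p => .var (Sum.inl (Sum.inr (i, p.1, p.2)))

theorem exists_isAlgClosed_continuum (K₀ : Type) [Field K₀] [Countable K₀] :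
    ∃ (Ω : Type) (_ : Field Ω) (_ : Algebra K₀ Ω), IsAlgClosed Ω ∧
      Cardinal.mk Ω = Cardinal.continuum := by
  refine ⟨AlgebraicClosure (FractionRing (MvPolynomial ℝ K₀)), inferInstance, inferInstance,
    inferInstance, le_antisymm ?_ ?_⟩
  · refine (Algebra.IsAlgebraic.cardinalMk_le_max (FractionRing (MvPolynomial ℝ K₀)) _).trans ?_
    refine max_le ?_ Cardinal.aleph0_le_continuum
    rw [IsFractionRing.cardinalMk (MvPolynomial ℝ K₀) (FractionRing (MvPolynomial ℝ K₀)),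
      MvPolynomial.cardinalMk_eq_max, Cardinal.mk_real]
    exact max_le (max_le ((Cardinal.mk_le_aleph0 (α := K₀)).trans Cardinal.aleph0_le_continuum) le_rfl)
      Cardinal.aleph0_le_continuum
  · rw [← Cardinal.mk_real]
    exact Cardinal.mk_le_of_injective (((algebraMap (FractionRing (MvPolynomial ℝ K₀))
      (AlgebraicClosure _)).injective.comp (IsFractionRing.injective (MvPolynomial ℝ K₀)
        (FractionRing (MvPolynomial ℝ K₀)))).comp (MvPolynomial.X_injective (R := K₀)))

theorem exists_countable_charP (p : ℕ) (hp : p.Prime ∨ p = 0) :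
    ∃ (K₀ : Type) (_ : Field K₀), Countable K₀ ∧ CharP K₀ p := by
  rcases hp with hp | rfl
  · have : Fact p.Prime := ⟨hp⟩
    exact ⟨ZMod p, inferInstance, Finite.to_countable, inferInstance⟩
  · exact ⟨ℚ, inferInstance, inferInstance, inferInstance⟩

theorem hasSolutions_iteratedLRNumber (L : Type*) [Field L] [IsAlgClosed L] {m : ℕ} (hk : 0 < k)
    (hkn : k ≤ n) (hm : 1 ≤ m) {lams : ℕ → ℕ → ℕ} (hpart : ∀ j < m, IsRectPartition n k (lams j))
    (hsum : ∑ j ∈ Finset.range m, sz k (lams j) = k * (n - k)) :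
    HasSolutions L n k (iteratedLRNumber n k m lams) (sOf n k fun j : Fin m => lams j) := by
  obtain ⟨p, hp⟩ := CharP.exists L
  obtain ⟨K₀, _, _, _⟩ := exists_countable_charP p (CharP.char_is_prime_or_zero L p)
  obtain ⟨Ω, _, _, _, hΩ⟩ := exists_isAlgClosed_continuum K₀
  have : CharP Ω p := charP_of_injective_algebraMap (algebraMap K₀ Ω).injective p
  rw [← hasSolutions_transfer (Ω := Ω) p, hasSolutions_iff]
  obtain ⟨f, w, hf⟩ := exists_isGeneric (K₀ := K₀) hΩ n (Fin m) Empty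
  refine ⟨f, hf.det_ne_zero, ?_⟩
  obtain ⟨t, rfl⟩ : ∃ t, m = t + 1 := ⟨m - 1, by omega⟩
  rw [encard_schubertSet_eq_deg hΩ hf, deg_eq_dg_range K₀ hΩ,
    ← (toNat_dg_eq_iteratedLRNumber (K₀ := K₀) hΩ hkn hk t hpart hsum).2]
  refine (ENat.natCast_toNat ?_).symm
  have h := dg_ne_top (K₀ := K₀) hΩ hkn hk
    (M := Multiset.ofList ((List.range (t + 1)).map lams)) ?_ [] (by simp) ?_
  · simpa [rows] using h
  · simpa using hpart
  · rw [← hsum]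
    simp only [msz, Multiset.map_coe, Multiset.sum_coe, List.map_map, List.sum_nil, zero_add]
    rfl

theorem exists_flags {L : Type*} [Field L] {m N : ℕ} {lams : ℕ → ℕ → ℕ}
    (h : HasSolutions L n k N (sOf n k fun j : Fin m => lams j)) :
    ∃ F : ℕ → ℕ → Submodule L (Fin n → L),
      (∀ j, j < m → (F j 0 = ⊥ ∧ F j n = ⊤ ∧ Monotone (F j) ∧
          ∀ d, d ≤ n → finrank L ↥(F j d) = d)) ∧
      {V : Submodule L (Fin n → L) | finrank L ↥V = k ∧
          ∀ j, j < m → ∀ i, i < k →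
            i + 1 ≤ finrank L ↥(V ⊓ F j (n - k + (i + 1) - lams j i))}.encard = N := by
  obtain ⟨f, hf, hN⟩ := hasSolutions_iff.1 h
  obtain ⟨F, hF⟩ : ∃ F : ℕ → ℕ → Submodule L (Fin n → L), ∀ j (hj : j < m), F j = fl (f ⟨j, hj⟩) :=
    ⟨fun j => if h : j < m then fl (f ⟨j, h⟩) else ⊥, fun j hj => dif_pos hj⟩
  refine ⟨F, fun j hj => ?_, ?_⟩
  · rw [hF j hj]
    exact ⟨fl_zero (hf _), fl_of_le _ le_rfl, fl_mono _, fun d hd => finrank_fl (hf _) hd⟩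
  · rw [← hN]
    congr 1
    ext V
    refine and_congr_right fun _ => ⟨fun h j q hq => ?_, fun h j hj q hq => ?_⟩
    · have := h j j.2 q hq
      rwa [hF j j.2] at this
    · rw [hF j hj]
      exact h ⟨j, hj⟩ q hq

end Main

end SchubertEnum

/-- **Schubert problems are enumerative over algebraically closed fields.**  Given partitions
`λ¹, …, λᵐ` in the `k × (n-k)` rectangle with `Σ_j |λʲ| = k(n-k)`, there are
complete flags `F¹_•, …, Fᵐ_•` of `Lⁿ` for which the set of `k`-planes
satisfying all the Schubert conditions is finite of cardinality exactly the
iterated Littlewood–Richardson number. -/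
theorem schubert_enumerative_algClosed
    (L : Type*) [Field L] [IsAlgClosed L]
    (n k m : ℕ) (hk1 : 1 ≤ k) (hkn : k ≤ n) (hm : 1 ≤ m)
    (lams : ℕ → ℕ → ℕ)
    (hpart : ∀ j, j < m → IsRectPartition n k (lams j))
    (hsum : (∑ j ∈ Finset.range m, ∑ i ∈ Finset.range k, lams j i) = k * (n - k)) :
    ∃ F : ℕ → ℕ → Submodule L (Fin n → L),
      (∀ j, j < m → (F j 0 = ⊥ ∧ F j n = ⊤ ∧ Monotone (F j) ∧
          ∀ d, d ≤ n → finrank L ↥(F j d) = d)) ∧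
      {V : Submodule L (Fin n → L) | finrank L ↥V = k ∧
          ∀ j, j < m → ∀ i, i < k →
            i + 1 ≤ finrank L ↥(V ⊓ F j (n - k + (i + 1) - lams j i))}.Finite ∧
      Nat.card {V : Submodule L (Fin n → L) | finrank L ↥V = k ∧
          ∀ j, j < m → ∀ i, i < k →
            i + 1 ≤ finrank L ↥(V ⊓ F j (n - k + (i + 1) - lams j i))} =
        iteratedLRNumber n k m lams := by

  obtain ⟨F, hF, hN⟩ := SchubertEnum.exists_flags
    (SchubertEnum.hasSolutions_iteratedLRNumber L hk1 hkn hm hpart hsum)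
  refine ⟨F, hF, Set.finite_of_encard_eq_coe hN, ?_⟩
  rw [Nat.card_coe_set_eq, Set.ncard, hN, ENat.toNat_natCast]
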